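/- For every first-order formula φ in the language of rings with k free variables there exists B ∈ ℕ such that for every prime p the following holds: letting c_m(p) be the number of k-tuples over GaloisField p m at which φ is satisfied in GaloisField p m, there exist polynomials a, b ∈ ℚ[t] with b ≠ 0, natDegree a ≤ B and natDegree b ≤ B, such that b·(Σ_{m≥1} c_m(p) t^m) = a in ℚ[[t]]. That is, the Poincaré series of φ at p is rational with numerator and denominator degrees bounded independently of p. -/

import Mathlib

section
open FirstOrder PowerSeries

/-- The number of `k`-tuples of a (finite) ring `K` satisfying the ring-language formula `φ`,
where `K` is viewed as a structure for the language of rings via `compatibleRingOfRing`. -/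
noncomputable def ringFormulaCount {k : ℕ} (φ : Language.ring.Formula (Fin k))
    (K : Type*) [Add K] [Mul K] [Neg K] [One K] [Zero K] : ℕ :=
  letI := Ring.compatibleRingOfRing K
  Nat.card {x : Fin k → K // φ.Realize x}

end

section

section
open Polynomial

namespace PRU

/-- `s` is the coefficient sequence of a rational function of degrees at most `B`. -/
def Rec (B : ℕ) (s : ℕ → ℚ) : Prop :=
  ∃ a b : ℚ[X], b ≠ 0 ∧ a.natDegree ≤ B ∧ b.natDegree ≤ B ∧
    (b : PowerSeries ℚ) * PowerSeries.mk s = (a : PowerSeries ℚ)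

theorem Rec.mono {B C : ℕ} {s : ℕ → ℚ} (h : Rec B s) (hBC : B ≤ C) : Rec C s := by
  obtain ⟨a, b, h1, h2, h3, h4⟩ := h
  exact ⟨a, b, h1, h2.trans hBC, h3.trans hBC, h4⟩

theorem Rec.add {B C : ℕ} {s t : ℕ → ℚ} (hs : Rec B s) (ht : Rec C t) :
    Rec (B + C) (fun m => s m + t m) := by
  obtain ⟨a, b, h1, h2, h3, h4⟩ := hs
  obtain ⟨a', b', h1', h2', h3', h4'⟩ := ht
  refine ⟨a * b' + b * a', b * b', mul_ne_zero h1 h1', ?_, ?_, ?_⟩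
  · refine (natDegree_add_le _ _).trans (max_le ?_ ?_) <;>
    exact natDegree_mul_le.trans (by omega)
  · exact natDegree_mul_le.trans (by omega)
  · have : PowerSeries.mk (fun m => s m + t m) = PowerSeries.mk s + PowerSeries.mk t := by
      ext; simp
    rw [this]
    simp only [Polynomial.coe_mul, Polynomial.coe_add]
    linear_combination (b' : PowerSeries ℚ) * h4 + (b : PowerSeries ℚ) * h4'

theorem Rec.smul {B : ℕ} {s : ℕ → ℚ} (hs : Rec B s) (c : ℚ) :
    Rec B (fun m => c * s m) := by
  obtain ⟨a, b, h1, h2, h3, h4⟩ := hs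
  refine ⟨C c * a, b, h1, (natDegree_C_mul_le _ _).trans h2, h3, ?_⟩
  have : PowerSeries.mk (fun m => c * s m) = PowerSeries.C c * PowerSeries.mk s := by
    ext; simp
  rw [this]
  simp only [Polynomial.coe_mul, Polynomial.coe_C]
  linear_combination (PowerSeries.C c) * h4

theorem Rec.zero : Rec 0 (fun _ => 0) :=
  ⟨0, 1, one_ne_zero, by simp, by simp, by ext; simp⟩

theorem Rec.sum {ι : Type*} (I : Finset ι) (B : ι → ℕ) (s : ι → ℕ → ℚ)
    (h : ∀ i ∈ I, Rec (B i) (s i)) : Rec (∑ i ∈ I, B i) (fun m => ∑ i ∈ I, s i m) := by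
  classical
  induction I using Finset.induction_on with
  | empty => simpa using Rec.zero
  | insert i I hi ih =>
    simp only [Finset.sum_insert hi]
    exact (h i (by simp)).add (ih fun j hj => h j (by simp [hj]))

/-- changing finitely many terms -/
theorem Rec.congr_of_lt {B N : ℕ} {s t : ℕ → ℚ} (hs : Rec B s) (hst : ∀ m, N ≤ m → s m = t m) :
    Rec (B + N) t := by
  have h0 : Rec N (fun m => if m < N then t m - s m else 0) := by
    refine ⟨∑ m ∈ Finset.range N, Polynomial.monomial m (t m - s m), 1, one_ne_zero, ?_, by simp, ?_⟩
    · refine natDegree_sum_le_of_forall_le _ _ fun i hi => (natDegree_monomial_le _).trans ?_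
      exact (Finset.mem_range.1 hi).le
    · ext n
      simp only [Polynomial.coe_one, one_mul, PowerSeries.coeff_mk, Polynomial.coeff_coe,
        finsetSum_coeff, coeff_monomial, Finset.sum_ite_eq', Finset.mem_range]
  have := hs.add h0
  convert this using 2 with m
  split_ifs with h
  · ring
  · rw [hst m (not_lt.1 h)]; ring

theorem Rec.twist {B : ℕ} {s : ℕ → ℚ} (hs : Rec B s) (c : ℚ) (hc : c ≠ 0) :
    Rec B (fun m => c ^ m * s m) := by
  obtain ⟨a, b, h1, h2, h3, h4⟩ := hs
  have key : ∀ f : ℚ[X], ((f.comp (C c * X) : ℚ[X]) : PowerSeries ℚ) =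
      PowerSeries.rescale c (f : PowerSeries ℚ) := by
    intro f
    ext n
    rw [Polynomial.coeff_coe, Polynomial.comp_C_mul_X_coeff, PowerSeries.coeff_rescale,
      Polynomial.coeff_coe, mul_comm]
  have hd : (C c * X : ℚ[X]).natDegree = 1 := natDegree_C_mul_X c hc
  refine ⟨a.comp (C c * X), b.comp (C c * X), ?_, ?_, ?_, ?_⟩
  · intro h
    apply h1
    rw [Polynomial.comp_eq_zero_iff] at h
    rcases h with h | ⟨_, h⟩
    · exact h
    · rw [h] at hd; simp at hd
  · rw [natDegree_comp, hd]; omega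
  · rw [natDegree_comp, hd]; omega
  · have : PowerSeries.mk (fun m => c ^ m * s m) = PowerSeries.rescale c (PowerSeries.mk s) := by
      ext; simp
    rw [this, key, key, ← map_mul, h4]

/-- from a linear recurrence to `Rec` -/
theorem Rec.of_recurrence {B N : ℕ} {s : ℕ → ℚ} (c : Fin (B + 1) → ℚ) (hc : c ≠ 0)
    (h : ∀ m, N ≤ m → ∑ j, c j * s (m + j) = 0) : Rec (B + N) s := by
  refine ⟨∑ n ∈ Finset.range (B + N), monomial n
      (∑ j : Fin (B + 1), if B - (j : ℕ) ≤ n then c j * s (n - (B - j)) else 0),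
    ∑ j : Fin (B + 1), monomial (B - j) (c j), ?_, ?_, ?_, ?_⟩
  · intro h0
    apply hc
    funext j
    have := congrArg (fun f => Polynomial.coeff f (B - j)) h0
    simp only [finsetSum_coeff, coeff_monomial, coeff_zero] at this
    rw [Finset.sum_eq_single j] at this
    · simpa using this
    · intro b _ hb
      rw [if_neg]
      intro h; apply hb; ext; omega
    · simp
  · exact natDegree_sum_le_of_forall_le _ _ fun i hi => (natDegree_monomial_le _).trans
      (Finset.mem_range.1 hi).le
  · exact natDegree_sum_le_of_forall_le _ _ fun i hi => (natDegree_monomial_le _).trans (by omega)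
  · have e1 : ((∑ j : Fin (B + 1), monomial (B - j) (c j) : ℚ[X]) : PowerSeries ℚ)
        = ∑ j : Fin (B + 1), PowerSeries.C (c j) * PowerSeries.X ^ (B - (j : ℕ)) := by
      ext n
      simp only [Polynomial.coeff_coe, finsetSum_coeff, coeff_monomial, map_sum]
      refine Finset.sum_congr rfl fun j _ => ?_
      simp [PowerSeries.coeff_X_pow, eq_comm]
    rw [e1]
    ext n
    rw [Finset.sum_mul, map_sum, Polynomial.coeff_coe, finsetSum_coeff]
    simp only [coeff_monomial]
    have e2 : ∀ j : Fin (B + 1), (PowerSeries.coeff n) (PowerSeries.C (c j) *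
        PowerSeries.X ^ (B - (j : ℕ)) * PowerSeries.mk s) =
        if B - (j : ℕ) ≤ n then c j * s (n - (B - j)) else 0 := by
      intro j
      rw [mul_assoc, PowerSeries.coeff_C_mul, PowerSeries.coeff_X_pow_mul']
      split_ifs <;> simp
    simp only [e2, Finset.sum_ite_eq', Finset.mem_range]
    split_ifs with hn
    · rfl
    · rw [← h (n - B) (by omega)]
      refine Finset.sum_congr rfl fun j _ => ?_
      rw [if_pos (by omega)]
      congr 2
      omega

section Hankel
variable {K : Type*} [Field K] (S : ℕ → K)

def hankel (B s : ℕ) : Matrix (Fin B) (Fin B) K := Matrix.of fun i j => S (s + i + j)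

def hrow {B : ℕ} (c : Fin B → K) (s : ℕ) : K := ∑ j, c j * S (s + j)

theorem hankel_ker {B s : ℕ} (h : (hankel S B s).det = 0) :
    ∃ c : Fin B → K, c ≠ 0 ∧ ∀ i < B, hrow S c (s + i) = 0 := by
  obtain ⟨c, hc, h⟩ := Matrix.exists_mulVec_eq_zero_iff.2 h
  refine ⟨c, hc, fun i hi => ?_⟩
  have := congrFun h ⟨i, hi⟩
  simp only [Matrix.mulVec, dotProduct, hankel, Matrix.of_apply, Pi.zero_apply] at this
  rw [← this]
  exact Finset.sum_congr rfl fun j _ => mul_comm _ _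

theorem hankel_inj {B s : ℕ} (h : (hankel S B s).det ≠ 0) (c : Fin B → K)
    (hc : ∀ i < B, hrow S c (s + i) = 0) : c = 0 := by
  by_contra h0
  apply h
  apply Matrix.exists_mulVec_eq_zero_iff.1
  refine ⟨c, h0, ?_⟩
  funext i
  have := hc i i.2
  simp only [Matrix.mulVec, dotProduct, hankel, Matrix.of_apply, Pi.zero_apply]
  rw [← this]
  exact Finset.sum_congr rfl fun j _ => mul_comm _ _

theorem hrow_succ {B : ℕ} (c : Fin (B + 1) → K) (h : c 0 = 0) (s : ℕ) :
    hrow S c s = hrow S (fun j : Fin B => c j.succ) (s + 1) := by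
  simp only [hrow, Fin.sum_univ_succ, h, zero_mul, zero_add, Fin.val_succ]
  exact Finset.sum_congr rfl fun j _ => by rw [show s + (j + 1) = s + 1 + j by ring]

theorem hrow_cast {B : ℕ} (c : Fin (B + 1) → K) (h : c (Fin.last B) = 0) (s : ℕ) :
    hrow S c s = hrow S (fun j : Fin B => c j.castSucc) s := by
  simp only [hrow, Fin.sum_univ_castSucc, h, zero_mul, add_zero, Fin.val_castSucc]

theorem hrow_comb {B : ℕ} (a b : K) (c d : Fin B → K) (s : ℕ) :
    hrow S (fun j => a * c j - b * d j) s = a * hrow S c s - b * hrow S d s := by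
  simp only [hrow, Finset.mul_sum, ← Finset.sum_sub_distrib]
  exact Finset.sum_congr rfl fun j _ => by ring

theorem vanish_first {B s : ℕ} (h : (hankel S B (s + 1)).det ≠ 0) (c : Fin (B + 1) → K)
    (hc : ∀ i < B, hrow S c (s + i) = 0) (h0 : c 0 = 0) : c = 0 := by
  have := hankel_inj S h (fun j : Fin B => c j.succ) fun i hi => by
    rw [← hc i hi, hrow_succ S c h0, show s + 1 + i = s + i + 1 by ring]
  funext j
  refine Fin.cases h0 (fun i => ?_) j
  exact congrFun this i

theorem vanish_last {B s : ℕ} (h : (hankel S B s).det ≠ 0) (c : Fin (B + 1) → K)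
    (hc : ∀ i < B, hrow S c (s + i) = 0) (h0 : c (Fin.last B) = 0) : c = 0 := by
  have := hankel_inj S h (fun j : Fin B => c j.castSucc) fun i hi => by
    rw [← hc i hi, hrow_cast S c h0]
  funext j
  refine Fin.lastCases h0 (fun i => ?_) j
  exact congrFun this i

theorem hankel_down {B s : ℕ} (h : (hankel S B (s + 1)).det ≠ 0)
    (h' : (hankel S (B + 1) s).det = 0) : (hankel S B s).det ≠ 0 := by
  obtain ⟨c, hc, hk⟩ := hankel_ker S h'
  intro h2
  obtain ⟨d, hd, hdk⟩ := hankel_ker S h2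
  have c0 : c 0 ≠ 0 := fun h0 => hc (vanish_first S h c (fun i hi => hk i (by omega)) h0)
  have cB : c (Fin.last B) ≠ 0 := fun h0 => hc (vanish_last S h c (fun i hi => by
    rw [show s + 1 + i = s + (i + 1) by ring]; exact hk _ (by omega)) h0)
  let D : Fin (B + 1) → K := Fin.snoc d 0
  have hD : ∀ i < B, hrow S D (s + i) = 0 := fun i hi => by
    rw [hrow_cast S D (by simp [D])]
    simpa [D] using hdk i hi
  have := vanish_first S h (fun j => c 0 * D j - D 0 * c j) (fun i hi => by
    rw [hrow_comb, hD i hi, hk i (by omega)]; ring) (by ring)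
  have e := congrFun this (Fin.last B)
  have hD0 : D 0 = 0 := by simpa [D, cB] using e
  apply hd
  funext j
  have e := congrFun this j.castSucc
  simpa [D, c0, hD0] using e

theorem hankel_up {B s : ℕ} (h : (hankel S B (s + 1)).det ≠ 0)
    (h' : (hankel S (B + 1) s).det = 0) : (hankel S B (s + 2)).det ≠ 0 := by
  obtain ⟨c, hc, hk⟩ := hankel_ker S h'
  intro h2
  obtain ⟨d, hd, hdk⟩ := hankel_ker S h2
  have c0 : c 0 ≠ 0 := fun h0 => hc (vanish_first S h c (fun i hi => hk i (by omega)) h0)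
  have cB : c (Fin.last B) ≠ 0 := fun h0 => hc (vanish_last S h c (fun i hi => by
    rw [show s + 1 + i = s + (i + 1) by ring]; exact hk _ (by omega)) h0)
  let D : Fin (B + 1) → K := Fin.cons 0 d
  have hD : ∀ i < B, hrow S D (s + 1 + i) = 0 := fun i hi => by
    rw [hrow_succ S D (by simp [D]), show s + 1 + i + 1 = s + 2 + i by ring]
    simpa [D] using hdk i hi
  have := vanish_last S h (fun j => c (Fin.last B) * D j - D (Fin.last B) * c j) (fun i hi => by
    rw [hrow_comb, hD i hi, show s + 1 + i = s + (i + 1) by ring, hk (i + 1) (by omega)]; ring)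
    (by ring)
  have e := congrFun this 0
  have hD0 : D (Fin.last B) = 0 := by simpa [D, c0] using e
  apply hd
  funext j
  have e := congrFun this j.succ
  simpa [D, cB, hD0] using e

theorem hankel_recurrence (B s0 : ℕ) (h : ∀ s, s0 ≤ s → (hankel S (B + 1) s).det = 0) :
    ∃ c : Fin (B + 1) → K, c ≠ 0 ∧ ∀ s, s0 + B ≤ s → hrow S c s = 0 := by
  induction B generalizing s0 with
  | zero =>
    refine ⟨fun _ => 1, fun h => one_ne_zero (congrFun h 0), fun s hs => ?_⟩
    have := h s (by omega)
    simpa [hankel, hrow] using this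
  | succ B ih =>
    by_cases h1 : ∀ s, s0 + 1 ≤ s → (hankel S (B + 1) s).det = 0
    · obtain ⟨c, hc, hr⟩ := ih (s0 + 1) h1
      refine ⟨Fin.snoc c 0, fun h => hc ?_, fun s hs => ?_⟩
      · funext j
        simpa using congrFun h j.castSucc
      · rw [hrow_cast _ _ (by simp)]
        simpa using hr s (by omega)
    · push Not at h1
      obtain ⟨s1, hs1, hne⟩ := h1
      have dn : ∀ k s, s + k = s1 → s0 ≤ s → (hankel S (B + 1) s).det ≠ 0 := by
        intro k
        induction k with
        | zero => rintro s rfl _; simpa using hne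
        | succ k ihk =>
          intro s hs hs0
          exact hankel_down S (ihk (s + 1) (by omega) (by omega)) (h s hs0)
      have all : ∀ s, s0 ≤ s → (hankel S (B + 1) s).det ≠ 0 := by
        intro s hs
        by_cases hle : s ≤ s1
        · exact dn (s1 - s) s (by omega) hs
        · obtain ⟨k, rfl⟩ : ∃ k, s = s1 + k := ⟨s - s1, by omega⟩
          clear hs hle
          induction k with
          | zero => simpa using hne
          | succ k ihk =>
            obtain ⟨r, hr⟩ : ∃ r, s1 + k = r + 1 := ⟨s1 + k - 1, by omega⟩
            rw [hr] at ihk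
            have := hankel_up S ihk (h r (by omega))
            rwa [show s1 + (k + 1) = r + 2 by omega]
      obtain ⟨c, hc, hk⟩ := hankel_ker S (h s0 le_rfl)
      refine ⟨c, hc, ?_⟩
      have main : ∀ k, ∀ i < B + 1 + 1, hrow S c (s0 + k + i) = 0 := by
        intro k
        induction k with
        | zero => simpa using hk
        | succ k ihk =>
          obtain ⟨c', hc', hk'⟩ := hankel_ker S (h (s0 + k + 1) (by omega))
          have hdet := all (s0 + k + 1) (by omega)
          have cB : c (Fin.last _) ≠ 0 := fun h0 => hc (vanish_last S hdet c (fun i hi => by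
            rw [show s0 + k + 1 + i = s0 + k + (i + 1) by ring]; exact ihk _ (by omega)) h0)
          have cB' : c' (Fin.last _) ≠ 0 := fun h0 => hc' (vanish_last S hdet c' (fun i hi =>
            hk' _ (by omega)) h0)
          have := vanish_last S hdet (fun j => c' (Fin.last _) * c j - c (Fin.last _) * c' j)
            (fun i hi => by
              rw [hrow_comb, hk' i (by omega), show s0 + k + 1 + i = s0 + k + (i + 1) by ring,
                ihk _ (by omega)]; ring) (by ring)
          intro i hi
          have e := hrow_comb S (c' (Fin.last _)) (c (Fin.last _)) c c' (s0 + (k + 1) + i)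
          rw [this, show s0 + (k + 1) + i = s0 + k + 1 + i by ring, hk' i hi] at e
          have : c' (Fin.last _) * hrow S c (s0 + k + 1 + i) = 0 := by
            rw [mul_zero, sub_zero] at e
            rw [← e]; simp [hrow]
          rw [show s0 + (k + 1) + i = s0 + k + 1 + i by ring]
          exact (mul_eq_zero.1 this).resolve_left cB'
      intro s hs
      have := main (s - s0) 0 (by omega)
      rwa [show s0 + (s - s0) + 0 = s by omega] at this

end Hankel

theorem Rec.of_hankel {B s0 : ℕ} {S : ℕ → ℚ} (h : ∀ s, s0 ≤ s → (hankel S (B + 1) s).det = 0) :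
    Rec (B + (s0 + B)) S := by
  obtain ⟨c, hc, hr⟩ := hankel_recurrence S B s0 h
  exact Rec.of_recurrence c hc hr

open Matrix in
theorem trace_pow_eq {K : Type*} [Field K] [IsAlgClosed K] {n : Type*} [Fintype n] [DecidableEq n]
    (A : Matrix n n K) (m : ℕ) : (A ^ m).trace = (A.charpoly.roots.map (· ^ m)).sum := by
  rcases Nat.eq_zero_or_pos m with rfl | hm
  · have := IsAlgClosed.card_roots_eq_natDegree (p := A.charpoly)
    simp [this, Matrix.charpoly_natDegree_eq_dim]
  have key : (A ^ m).charpoly = (A.charpoly.roots.map (fun l => X - C (l ^ m))).prod := by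
    apply Polynomial.funext
    intro x
    have hs := IsAlgClosed.splits (X ^ m - C x : K[X])
    have hmon : (X ^ m - C x : K[X]).Monic := monic_X_pow_sub_C x hm.ne'
    have hp := hs.eq_prod_roots_of_monic hmon
    have evA : A ^ m - algebraMap K _ x = ((X ^ m - C x : K[X]).roots.toList.map
        (fun r => A - algebraMap K _ r)).prod := by
      have : A ^ m - algebraMap K _ x = aeval A (X ^ m - C x : K[X]) := by simp
      rw [this]
      conv_lhs => rw [hp, ← Multiset.coe_toList (X ^ m - C x : K[X]).roots, Multiset.map_coe,
        Multiset.prod_coe, map_list_prod, List.map_map]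
      simp [Function.comp_def]
    have cp : ∀ (M : Matrix n n K) (r : K), M.charpoly.eval r = (-1) ^ Fintype.card n *
        (M - algebraMap K _ r).det := by
      intro M r
      rw [eval_charpoly, ← Matrix.det_neg]
      congr 1
      simp [Matrix.algebraMap_eq_diagonal, Matrix.scalar_apply, Pi.algebraMap_def]
    have detr : ∀ r, (A - algebraMap K _ r).det = (A.charpoly.roots.map (fun l => l - r)).prod := by
      intro r
      have h1 := cp A r
      have h2 := (IsAlgClosed.splits A.charpoly).eq_prod_roots_of_monic A.charpoly_monic
      have h3 : A.charpoly.eval r = (-1) ^ Fintype.card n *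
          (A.charpoly.roots.map (fun l => l - r)).prod := by
        conv_lhs => rw [h2]
        rw [eval_multiset_prod, Multiset.map_map]
        have h4 : Fintype.card n = Multiset.card A.charpoly.roots := by
          rw [IsAlgClosed.card_roots_eq_natDegree, Matrix.charpoly_natDegree_eq_dim]
        rw [h4, ← Multiset.card_map (fun l => l - r) A.charpoly.roots, ← Multiset.prod_map_neg,
          Multiset.map_map]
        simp [Function.comp_def]
      exact mul_left_cancel₀ (pow_ne_zero _ (neg_ne_zero.2 one_ne_zero)) (h1.symm.trans h3)
    rw [cp, evA]
    have e1 : ((X ^ m - C x : K[X]).roots.toList.map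
        (fun r => A - algebraMap K _ r)).prod.det = ((X ^ m - C x : K[X]).roots.map
          fun r => (A.charpoly.roots.map (fun l => l - r)).prod).prod := by
      rw [← Matrix.coe_detMonoidHom, map_list_prod, List.map_map]
      conv_rhs => rw [← Multiset.coe_toList (X ^ m - C x : K[X]).roots, Multiset.map_coe,
        Multiset.prod_coe]
      congr 1
      apply List.map_congr_left
      intro r _
      simp [detr]
    have h4 : Fintype.card n = Multiset.card A.charpoly.roots := by
          rw [IsAlgClosed.card_roots_eq_natDegree, Matrix.charpoly_natDegree_eq_dim]
    rw [e1, Multiset.prod_map_prod_map, eval_multiset_prod, Multiset.map_map, h4,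
      ← Multiset.card_map (fun l => l ^ m - x) A.charpoly.roots]
    have e2 : ∀ l, ((X ^ m - C x : K[X]).roots.map fun r => l - r).prod = l ^ m - x := by
      intro l
      have := congrArg (eval l) hp
      rw [eval_multiset_prod, Multiset.map_map] at this
      simpa [Function.comp_def] using this.symm
    simp only [e2]
    rw [← Multiset.prod_map_neg, Multiset.map_map]
    simp [Function.comp_def]
  rw [Matrix.trace_eq_sum_roots_charpoly, key]
  congr 1
  have : (A.charpoly.roots.map (fun l => X - C (l ^ m))) =
    ((A.charpoly.roots.map (fun l => l ^ m)).map fun l => X - C l) := by simp [Multiset.map_map]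
  rw [this, roots_multiset_prod_X_sub_C]

end PRU
end

section
open Polynomial

namespace PRU

section Ultra
variable {L : Type*} [NormedField L]

theorem exists_norm_avoid [IsAlgClosed L] (x : L) (hx : 1 < ‖x‖) (w : ℕ) (F : Set ℝ)
    (hF : F.Finite) : ∃ t : L, ‖x‖ ^ w ≤ ‖t‖ ∧ ‖t‖ ≤ ‖x‖ ^ (w + 1) ∧ ‖t‖ ∉ F := by
  have hr : ∀ N : ℕ, ∃ r : L, r ^ (N + 1) = x := fun N => by
    simpa using IsAlgClosed.exists_pow_nat_eq x (Nat.succ_pos N)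
  choose r hr using hr
  have hn : ∀ N, ‖r N‖ ^ (N + 1) = ‖x‖ := fun N => by rw [← norm_pow, hr]
  have h1 : ∀ N, 1 < ‖r N‖ := fun N => by
    by_contra hle
    have := pow_le_one₀ (n := N + 1) (norm_nonneg _) (not_lt.1 hle)
    rw [hn] at this
    linarith
  have hx0 : 0 < ‖x‖ := by linarith
  have inj : Function.Injective fun N => ‖x ^ w * r N‖ := by
    intro a b hab
    simp only [norm_mul, norm_pow] at hab
    have hab := mul_left_cancel₀ (pow_ne_zero _ hx0.ne') hab
    have := (hn a).trans (hn b).symm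
    rw [hab] at this
    have := pow_right_injective₀ (by linarith [h1 b]) (h1 b).ne' this
    omega
  obtain ⟨N, hN⟩ : ∃ N, ‖x ^ w * r N‖ ∉ F := by
    by_contra hall
    push Not at hall
    exact Set.infinite_univ (Set.Finite.of_finite_image
      (hF.subset (by rintro _ ⟨N, _, rfl⟩; exact hall N)) inj.injOn)
  refine ⟨_, ?_, ?_, hN⟩
  · rw [norm_mul, norm_pow]
    exact le_mul_of_one_le_right (by positivity) (h1 N).le
  · rw [norm_mul, norm_pow, pow_succ]
    refine mul_le_mul_of_nonneg_left ?_ (by positivity)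
    rw [← hn N]
    exact le_self_pow₀ (h1 N).le (by omega)

variable [IsUltrametricDist L]

theorem norm_det_le_prod {ι : Type*} [Fintype ι] [DecidableEq ι] (A : Matrix ι ι L)
    (R Q : ι → ℝ) (hR : ∀ u, 0 < R u) (hQ : ∀ u, 0 ≤ Q u)
    (h : ∀ u w, ‖A u w‖ * R w ≤ R u * Q u) : ‖A.det‖ ≤ ∏ u, Q u := by
  rw [← Matrix.det_transpose, Matrix.det_apply]
  refine IsUltrametricDist.norm_sum_le_of_forall_le_of_nonneg
    (Finset.prod_nonneg fun u _ => hQ u) fun σ _ => ?_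
  have hs : ‖Equiv.Perm.sign σ • ∏ i, A.transpose (σ i) i‖ = ∏ i, ‖A i (σ i)‖ := by
    rw [← norm_prod]
    rcases Int.units_eq_one_or (Equiv.Perm.sign σ) with h | h <;> simp [h]
  rw [hs]
  have h1 : ∏ i, (‖A i (σ i)‖ * R (σ i)) ≤ ∏ i, (R i * Q i) :=
    Finset.prod_le_prod (fun i _ => mul_nonneg (norm_nonneg _) (hR _).le) fun i _ => h i _
  rw [Finset.prod_mul_distrib, Finset.prod_mul_distrib, Equiv.prod_comp σ R, mul_comm] at h1
  exact le_of_mul_le_mul_left h1 (Finset.prod_pos fun i _ => hR i)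

theorem norm_one_sub_of_ne {x : L} (hx : ‖x‖ ≠ 1) : ‖1 - x‖ = max 1 ‖x‖ := by
  have := IsUltrametricDist.norm_add_eq_max_of_norm_ne_norm (x := (1 : L)) (y := -x)
    (by simpa using hx.symm)
  simpa [sub_eq_add_neg] using this

theorem eig_bound [IsAlgClosed L] {ι : Type*} [Fintype ι] [DecidableEq ι] (A : Matrix ι ι L)
    (R Q : ι → ℝ) (hR : ∀ u, 0 < R u) (hQ : ∀ u, 0 ≤ Q u)
    (h : ∀ u w, ‖A u w‖ * R w ≤ R u * Q u) (t : L) (ht : t ≠ 0)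
    (hne : ∀ l ∈ A.charpoly.roots, ‖t‖ * ‖l‖ ≠ 1) :
    (A.charpoly.roots.map fun l => max 1 (‖t‖ * ‖l‖)).prod ≤ ∏ u, max 1 (‖t‖ * Q u) := by
  have h1 : (1 - t • A).det = (A.charpoly.roots.map fun l => 1 - t * l).prod := by
    have e1 : A.charpoly.eval t⁻¹ = (A.charpoly.roots.map fun l => t⁻¹ - l).prod := by
      conv_lhs => rw [(IsAlgClosed.splits A.charpoly).eq_prod_roots_of_monic A.charpoly_monic]
      rw [eval_multiset_prod, Multiset.map_map]
      simp
    rw [Matrix.eval_charpoly] at e1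
    have e2 : (1 - t • A) = t • (Matrix.scalar ι t⁻¹ - A) := by
      rw [smul_sub]
      congr 1
      ext i j
      simp [Matrix.one_apply, Matrix.diagonal_apply, ht]
    rw [e2, Matrix.det_smul, e1, ← Matrix.charpoly_natDegree_eq_dim A,
      ← IsAlgClosed.card_roots_eq_natDegree, ← Multiset.prod_replicate, ← Multiset.map_const,
      ← Multiset.prod_map_mul]
    congr 1
    apply Multiset.map_congr rfl
    intro l _
    rw [Function.const_apply, mul_sub, mul_inv_cancel₀ ht]
  have h2 : ‖(1 - t • A).det‖ ≤ ∏ u, max 1 (‖t‖ * Q u) := by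
    refine norm_det_le_prod _ R _ hR (fun u => le_max_of_le_left zero_le_one) fun u w => ?_
    have hb : ‖(1 - t • A) u w‖ ≤ max ‖(1 : Matrix ι ι L) u w‖ ‖t * A u w‖ := by
      simpa [sub_eq_add_neg] using
        IsUltrametricDist.norm_add_le_max ((1 : Matrix ι ι L) u w) (-(t * A u w))
    rcases le_max_iff.1 hb with hb | hb
    · by_cases huw : u = w
      · subst huw
        simp only [Matrix.one_apply_eq, norm_one] at hb
        rw [mul_comm]
        exact mul_le_mul_of_nonneg_left (hb.trans (le_max_left _ _)) (hR u).le
      · rw [Matrix.one_apply_ne huw, norm_zero] at hb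
        rw [le_antisymm hb (norm_nonneg _), zero_mul]
        exact mul_nonneg (hR u).le (le_max_of_le_left zero_le_one)
    · calc _ ≤ ‖t * A u w‖ * R w := mul_le_mul_of_nonneg_right hb (hR w).le
        _ = ‖t‖ * (‖A u w‖ * R w) := by rw [norm_mul]; ring
        _ ≤ ‖t‖ * (R u * Q u) := mul_le_mul_of_nonneg_left (h u w) (norm_nonneg _)
        _ = R u * (‖t‖ * Q u) := by ring
        _ ≤ _ := mul_le_mul_of_nonneg_left (le_max_right _ _) (hR u).le
  refine le_trans (le_of_eq ?_) h2
  rw [h1]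
  change _ = normHom (α := L) _
  rw [map_multiset_prod, Multiset.map_map]
  congr 1
  apply Multiset.map_congr rfl
  intro l hl
  change _ = ‖1 - t * l‖
  rw [norm_one_sub_of_ne (by rw [norm_mul]; exact hne l hl), norm_mul]

open Classical in
/-- number of large eigenvalues -/
theorem eig_count [IsAlgClosed L] {ι : Type*} [Fintype ι] [DecidableEq ι] (A : Matrix ι ι L)
    (R Q : ι → ℝ) (hR : ∀ u, 0 < R u) (hQ : ∀ u, 0 ≤ Q u) (hQ1 : ∀ u, Q u ≤ 1)
    (h : ∀ u w, ‖A u w‖ * R w ≤ R u * Q u) (x : L) (hx : 1 < ‖x‖) (w : ℕ) (hw : 0 < w) :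
    (A.charpoly.roots.filter fun l => 1 ≤ ‖l‖ * ‖x‖ ^ w).card ≤
      3 * (Finset.univ.filter fun u => 1 < Q u * ‖x‖ ^ (2 * w + 1)).card := by
  obtain ⟨t, ht1, ht2, ht3⟩ := exists_norm_avoid x hx (2 * w)
    (Set.image (fun l => ‖l‖⁻¹) {l | l ∈ A.charpoly.roots})
    (Set.Finite.image _ (by
      have : {l | l ∈ A.charpoly.roots} = (A.charpoly.roots.toFinset : Set L) := by ext; simp
      rw [this]; exact Finset.finite_toSet _))
  have hxw : 1 < ‖x‖ ^ w := one_lt_pow₀ hx hw.ne'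
  have htpos : 1 < ‖t‖ := (one_lt_pow₀ hx (by omega)).trans_le ht1
  have ht0 : t ≠ 0 := norm_pos_iff.1 (by linarith)
  have key := eig_bound A R Q hR hQ h t ht0 (fun l hl he => ht3 ⟨l, hl, by
    rw [eq_comm]; exact eq_inv_of_mul_eq_one_left he⟩)
  set k := (A.charpoly.roots.filter fun l => 1 ≤ ‖l‖ * ‖x‖ ^ w).card with hk
  set N := (Finset.univ.filter fun u => 1 < Q u * ‖x‖ ^ (2 * w + 1)).card with hN
  have up : ∏ u, max 1 (‖t‖ * Q u) ≤ ‖t‖ ^ N := by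
    rw [hN, ← Finset.prod_const, Finset.prod_filter]
    refine Finset.prod_le_prod (fun u _ => le_max_of_le_left zero_le_one) fun u _ => ?_
    split_ifs with hu
    · exact max_le htpos.le (mul_le_of_le_one_right (norm_nonneg _) (hQ1 u))
    · refine max_le le_rfl ?_
      rw [mul_comm]
      exact (mul_le_mul_of_nonneg_left ht2 (hQ u)).trans (not_lt.1 hu)
  have low : (‖x‖ ^ w) ^ k ≤ (A.charpoly.roots.map fun l => max 1 (‖t‖ * ‖l‖)).prod := by
    rw [← Multiset.filter_add_not (fun l => 1 ≤ ‖l‖ * ‖x‖ ^ w) A.charpoly.roots,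
      Multiset.map_add, Multiset.prod_add]
    have a1 : (‖x‖ ^ w) ^ k ≤ ((A.charpoly.roots.filter fun l => 1 ≤ ‖l‖ * ‖x‖ ^ w).map
        fun l => max 1 (‖t‖ * ‖l‖)).prod := by
      rw [hk, ← Multiset.prod_replicate, ← Multiset.map_const']
      refine Multiset.prod_map_le_prod_map₀ _ _ (fun _ _ => by positivity) fun l hl => ?_
      refine le_max_of_le_right ?_
      have := (Multiset.mem_filter.1 hl).2
      calc ‖x‖ ^ w ≤ ‖x‖ ^ w * (‖l‖ * ‖x‖ ^ w) := le_mul_of_one_le_right (by positivity) this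
        _ = ‖x‖ ^ (2 * w) * ‖l‖ := by ring
        _ ≤ _ := mul_le_mul_of_nonneg_right ht1 (norm_nonneg _)
    refine a1.trans (le_mul_of_one_le_right ?_ ?_)
    · exact le_trans (by positivity) a1
    · refine Multiset.prod_induction (fun r : ℝ => 1 ≤ r) _
        (fun a b ha hb => one_le_mul_of_one_le_of_one_le ha hb) le_rfl ?_
      intro a ha
      obtain ⟨l, _, rfl⟩ := Multiset.mem_map.1 ha
      exact le_max_left _ _
  have fin : ‖x‖ ^ (w * k) ≤ ‖x‖ ^ ((2 * w + 1) * N) := by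
    rw [pow_mul, pow_mul]
    exact low.trans (key.trans (up.trans (pow_le_pow_left₀ (norm_nonneg _) ht2 _)))
  have := (pow_le_pow_iff_right₀ hx).1 fin
  by_contra hcon
  push Not at hcon
  have h3 : w * (3 * N + 1) ≤ w * k := Nat.mul_le_mul_left _ hcon
  have h4 : N ≤ w * N := Nat.le_mul_of_pos_left _ hw
  nlinarith

theorem norm_multiset_sum_le {α : Type*} (M : Multiset α) (f : α → L) {C : ℝ} (hC : 0 ≤ C)
    (h : ∀ a ∈ M, ‖f a‖ ≤ C) : ‖(M.map f).sum‖ ≤ C := by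
  induction M using Multiset.induction_on with
  | empty => simpa using hC
  | cons a M ih =>
    rw [Multiset.map_cons, Multiset.sum_cons]
    exact (IsUltrametricDist.norm_add_le_max _ _).trans (max_le (h a (by simp))
      (ih fun b hb => h b (by simp [hb])))

/-- product of `X - l` has coefficients of norm at most one -/
theorem norm_coeff_prod_le (M : Multiset L) (hM : ∀ l ∈ M, ‖l‖ ≤ 1) (i : ℕ) :
    ‖((M.map fun l => X - C l).prod).coeff i‖ ≤ 1 := by
  induction M using Multiset.induction_on generalizing i with
  | empty =>
    simp only [Multiset.map_zero, Multiset.prod_zero, coeff_one]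
    split_ifs <;> simp
  | cons a M ih =>
    have ih' := ih fun b hb => hM b (by simp [hb])
    rw [Multiset.map_cons, Multiset.prod_cons, sub_mul, coeff_sub, coeff_C_mul, sub_eq_add_neg]
    refine (IsUltrametricDist.norm_add_le_max _ _).trans (max_le ?_ ?_)
    · cases i with
      | zero => simp
      | succ i => rw [coeff_X_mul]; exact ih' i
    · rw [norm_neg, norm_mul]
      exact mul_le_one₀ (hM a (by simp)) (norm_nonneg _) (ih' i)

open Classical in
theorem norm_hankel_le (S : ℕ → L) (hS : ∀ m, ‖S m‖ ≤ 1) (ρ : ℝ) (hρ : 0 ≤ ρ)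
    (K B s : ℕ)
    (M : Multiset (L × L)) (h1 : ∀ x ∈ M, ‖x.1‖ ≤ 1) (h2 : ∀ x ∈ M, ‖x.2‖ ≤ 1)
    (hM : (M.filter fun x => ρ ≤ ‖x.2‖).card ≤ K)
    (happ : ∀ m, s ≤ m → m ≤ s + 2 * B → ‖S m - (M.map fun x => x.1 * x.2 ^ m).sum‖ ≤ ρ ^ s) :
    ‖(hankel S (B + 1) s).det‖ ≤ (ρ ^ s) ^ (B + 1 - K) := by
  set big := (M.filter fun x => ρ ≤ ‖x.2‖).map Prod.snd with hbig
  set P : L[X] := X ^ (K - big.card) * (big.map fun l => X - C l).prod with hP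
  have hcard : big.card ≤ K := by simpa [hbig] using hM
  have hmon0 : (big.map fun l => X - C l).prod.Monic := monic_multisetProd_X_sub_C _
  have hmon : P.Monic := (monic_X_pow _).mul hmon0
  have hdeg : P.natDegree = K := by
    rw [hP, (monic_X_pow _).natDegree_mul hmon0, natDegree_X_pow,
      natDegree_multiset_prod_X_sub_C_eq_card]
    omega
  have hcoef : ∀ i, ‖P.coeff i‖ ≤ 1 := by
    intro i
    rw [hP, coeff_X_pow_mul']
    split_ifs
    · refine norm_coeff_prod_le _ (fun l hl => ?_) _
      obtain ⟨x, hx, rfl⟩ := Multiset.mem_map.1 hl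
      exact h2 x (Multiset.mem_of_mem_filter hx)
    · simp
  have hroot : ∀ x ∈ M, ρ ≤ ‖x.2‖ → P.eval x.2 = 0 := by
    intro x hx hxρ
    rw [hP, eval_mul, eval_multiset_prod, Multiset.prod_eq_zero, mul_zero]
    rw [Multiset.map_map]
    refine Multiset.mem_map.2 ⟨x.2, ?_, by simp⟩
    exact Multiset.mem_map.2 ⟨x, Multiset.mem_filter.2 ⟨hx, hxρ⟩, rfl⟩
  have hev : ∀ x ∈ M, ‖P.eval x.2‖ ≤ 1 := by
    intro x hx
    rw [eval_eq_sum_range]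
    refine IsUltrametricDist.norm_sum_le_of_forall_le_of_nonneg zero_le_one fun i _ => ?_
    rw [norm_mul, norm_pow]
    exact mul_le_one₀ (hcoef i) (by positivity) (pow_le_one₀ (norm_nonneg _) (h2 x hx))
  let U : Matrix (Fin (B + 1)) (Fin (B + 1)) L := Matrix.of fun a j =>
    if (j : ℕ) < K then (if a = j then 1 else 0)
    else if (j : ℕ) - K ≤ a then P.coeff (a - (j - K)) else 0
  have hU : U.det = 1 := by
    rw [Matrix.det_of_isUpperTriangular]
    · refine Finset.prod_eq_one fun j _ => ?_
      simp only [U, Matrix.of_apply]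
      split_ifs with h h h
      · rfl
      · rw [show (j : ℕ) - (j - K) = K by omega, ← hdeg]; exact hmon
      · omega
    · intro a j haj
      have haj : (j : ℕ) < a := haj
      simp only [U, Matrix.of_apply]
      split_ifs with h h h
      · rw [h] at haj; omega
      · rfl
      · exact coeff_eq_zero_of_natDegree_lt (by omega)
      · rfl
  have hprod : ∀ i j : Fin (B + 1), ‖(hankel S (B + 1) s * U) i j‖ ≤
      if (j : ℕ) < K then 1 else ρ ^ s := by
    intro i j
    rw [Matrix.mul_apply]
    split_ifs with hj
    · rw [Finset.sum_eq_single j]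
      · simp [U, hj, hankel, hS]
      · intro b _ hb
        simp [U, hj, hb]
      · simp
    · have e : ∑ a, hankel S (B + 1) s i a * U a j =
          ∑ l ∈ Finset.range (K + 1), P.coeff l * S (s + i + (j - K) + l) := by
        set r := (j : ℕ) - K with hr
        let g : ℕ → L := fun a => P.coeff (a - r) * S (s + i + a)
        have e1 : ∑ a, hankel S (B + 1) s i a * U a j =
            ∑ a ∈ Finset.range (B + 1), if r ≤ a then g a else 0 := by
          rw [← Fin.sum_univ_eq_sum_range (fun a => if r ≤ a then g a else 0) (B + 1)]
          refine Finset.sum_congr rfl fun a _ => ?_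
          simp only [hankel, U, Matrix.of_apply, if_neg hj, g, ← hr]
          split_ifs
          · ring
          · ring
        have e2 : ∑ l ∈ Finset.range (K + 1), P.coeff l * S (s + i + r + l) =
            ∑ a ∈ Finset.Ico r (r + (K + 1)), g a := by
          rw [Finset.sum_Ico_eq_sum_range, Nat.add_sub_cancel_left]
          refine Finset.sum_congr rfl fun l _ => ?_
          simp [g, add_assoc]
        rw [e1, e2, ← Finset.sum_filter]
        symm
        refine Finset.sum_subset ?_ ?_
        · intro a ha
          simp only [Finset.mem_Ico, Finset.mem_filter, Finset.mem_range] at ha ⊢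
          omega
        · intro a ha ha'
          simp only [Finset.mem_Ico, Finset.mem_filter, Finset.mem_range] at ha ha'
          simp only [g]
          rw [coeff_eq_zero_of_natDegree_lt (by omega), zero_mul]
      rw [e]
      set b := s + i + (j - K) with hb
      have e3 : ∑ l ∈ Finset.range (K + 1), P.coeff l * S (b + l) =
          ∑ l ∈ Finset.range (K + 1), P.coeff l *
            (S (b + l) - (M.map fun x => x.1 * x.2 ^ (b + l)).sum) +
          (M.map fun x => x.1 * x.2 ^ b * P.eval x.2).sum := by
        have : (M.map fun x => x.1 * x.2 ^ b * P.eval x.2).sum =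
            ∑ l ∈ Finset.range (K + 1), P.coeff l * (M.map fun x => x.1 * x.2 ^ (b + l)).sum := by
          simp only [← Multiset.sum_map_mul_left]
          rw [Finset.sum_eq_multiset_sum, Multiset.sum_map_sum_map]
          congr 1
          apply Multiset.map_congr rfl
          intro x _
          rw [eval_eq_sum_range, hdeg, Finset.mul_sum, Finset.sum_eq_multiset_sum]
          congr 1
          apply Multiset.map_congr rfl
          intro l _
          ring
        rw [this, ← Finset.sum_add_distrib]
        exact Finset.sum_congr rfl fun l _ => by ring
      rw [e3]
      refine (IsUltrametricDist.norm_add_le_max _ _).trans (max_le ?_ ?_)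
      · refine IsUltrametricDist.norm_sum_le_of_forall_le_of_nonneg (by positivity) fun l hl => ?_
        have := Finset.mem_range.1 hl
        rw [norm_mul]
        exact (mul_le_of_le_one_left (norm_nonneg _) (hcoef l)).trans
          (happ _ (by omega) (by omega))
      · refine norm_multiset_sum_le _ _ (by positivity) fun x hx => ?_
        by_cases hxρ : ρ ≤ ‖x.2‖
        · rw [hroot x hx hxρ, mul_zero, norm_zero]; positivity
        · rw [norm_mul, norm_mul, norm_pow]
          have hle : ‖x.2‖ ^ b ≤ ρ ^ s :=
            (pow_le_pow_of_le_one (norm_nonneg _) (h2 x hx) (by omega : s ≤ b)).trans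
              (pow_le_pow_left₀ (norm_nonneg _) (not_le.1 hxρ).le _)
          calc ‖x.1‖ * ‖x.2‖ ^ b * ‖P.eval x.2‖ ≤ 1 * ‖x.2‖ ^ b * 1 := by
                gcongr
                · exact h1 x hx
                · exact hev x hx
            _ ≤ ρ ^ s := by simpa using hle
  have : (hankel S (B + 1) s).det = (hankel S (B + 1) s * U).det := by
    rw [Matrix.det_mul, hU, mul_one]
  rw [this, ← Matrix.det_transpose]
  refine (norm_det_le_prod _ (fun _ => 1) (fun j : Fin (B + 1) => if (j : ℕ) < K then 1 else ρ ^ s)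
    (fun _ => one_pos) (fun _ => by split_ifs <;> positivity) (fun j i => ?_)).trans ?_
  · simpa using hprod i j
  · rw [Fin.prod_univ_eq_prod_range (fun j => if j < K then (1 : ℝ) else ρ ^ s) (B + 1),
      Finset.prod_ite, Finset.prod_const_one, one_mul, Finset.prod_const]
    have : (Finset.range (B + 1)).filter (fun j => ¬ j < K) = Finset.Ico K (B + 1) := by
      ext j; simp; omega
    rw [this, Nat.card_Ico]

theorem hankel_cast (F : Type*) [Field F] (S : ℕ → ℤ) (B s : ℕ) :
    (hankel (fun m => (S m : F)) B s).det =
      ((Matrix.det (Matrix.of fun i j : Fin B => S (s + i + j)) : ℤ) : F) := by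
  rw [← eq_intCast (Int.castRingHom F), RingHom.map_det]
  rfl

open Classical in
theorem hankel_int_eq_zero (p : ℕ) (hp : 2 ≤ p) (hinteg : ∀ z : ℤ, z ≠ 0 → 1 ≤ |(z : ℝ)| * ‖(z : L)‖)
    (hle : ∀ z : ℤ, ‖(z : L)‖ ≤ 1) (n K s : ℕ) (hK : 0 < K) (S : ℕ → ℤ)
    (hS : ∀ m, 1 ≤ m → |S m| ≤ (p : ℤ) ^ (n * m)) (hs : 2 * K ≤ s)
    (happ : ∃ M : Multiset (L × L), (∀ x ∈ M, ‖x.1‖ ≤ 1) ∧ (∀ x ∈ M, ‖x.2‖ ≤ 1) ∧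
      (M.filter fun x => ((p : ℝ) ^ (6 * n + 3))⁻¹ ≤ ‖x.2‖).card ≤ K ∧
      ∀ m, 1 ≤ m → m ≤ s + 4 * K → ‖(S m : L) - (M.map fun x => x.1 * x.2 ^ m).sum‖ ≤
        (((p : ℝ) ^ (6 * n + 3))⁻¹) ^ s) :
    (hankel (fun m => (S m : ℚ)) (2 * K) s).det = 0 := by
  obtain ⟨M, h1, h2, h3, h4⟩ := happ
  obtain ⟨B, hB⟩ : ∃ B, 2 * K = B + 1 := ⟨2 * K - 1, by omega⟩
  have hp1 : (1 : ℝ) < p := by exact_mod_cast hp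
  rw [hB]
  set D := Matrix.det (Matrix.of fun i j : Fin (B + 1) => S (s + i + j)) with hD
  rw [hankel_cast]
  by_contra hne
  have hD0 : D ≠ 0 := fun h => hne (by rw [← hD, h]; simp)
  have low := hinteg D hD0
  have up1 : ‖(D : L)‖ ≤ ((((p : ℝ) ^ (6 * n + 3))⁻¹) ^ s) ^ (B + 1 - K) := by
    rw [hD, ← hankel_cast L]
    exact norm_hankel_le (fun m => (S m : L)) (fun m => hle _) _ (by positivity) K B s M h1 h2 h3
      fun m hm hm' => h4 m (by omega) (by omega)
  have up2 : |(D : ℝ)| ≤ (B + 1).factorial * ((p : ℝ) ^ (n * (s + 2 * B))) ^ (B + 1) := by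
    have := Matrix.det_le (abv := AbsoluteValue.abs (S := ℤ)) (A := Matrix.of fun i j : Fin (B + 1) =>
      S (s + i + j)) (x := (p : ℤ) ^ (n * (s + 2 * B))) (fun i j => by
        simp only [Matrix.of_apply, AbsoluteValue.abs_apply]
        refine (hS _ (by omega)).trans (pow_le_pow_right₀ (by exact_mod_cast (by omega : 1 ≤ p)) ?_)
        exact Nat.mul_le_mul_left _ (by omega))
    simp only [AbsoluteValue.abs_apply, Fintype.card_fin, nsmul_eq_mul] at this
    rw [← hD] at this
    exact_mod_cast this
  have fac : ((B + 1).factorial : ℝ) ≤ (p : ℝ) ^ ((B + 1) * (B + 1)) := by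
    have a1 : (B + 1).factorial ≤ (B + 1) ^ (B + 1) := Nat.factorial_le_pow _
    have a2 : B + 1 ≤ p ^ (B + 1) := (Nat.lt_pow_self (by omega)).le
    have : (B + 1).factorial ≤ p ^ ((B + 1) * (B + 1)) := by
      rw [pow_mul]
      exact a1.trans (Nat.pow_le_pow_left a2 _)
    exact_mod_cast this
  have hBK : B + 1 - K = K := by omega
  rw [hBK] at up1
  have tot : (1 : ℝ) ≤ (p : ℝ) ^ ((B + 1) * (B + 1)) * ((p : ℝ) ^ (n * (s + 2 * B))) ^ (B + 1) *
      ((((p : ℝ) ^ (6 * n + 3))⁻¹) ^ s) ^ K := by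
    refine low.trans (mul_le_mul (up2.trans ?_) up1 (norm_nonneg _) (by positivity))
    exact mul_le_mul_of_nonneg_right fac (by positivity)
  rw [inv_pow, inv_pow, ← pow_mul, ← pow_mul, ← pow_mul, ← pow_add,
    ← div_eq_mul_inv, one_le_div (by positivity), pow_le_pow_iff_right₀ hp1, ← hB] at tot
  have q1 : 2 * K * (2 * K) ≤ s * (2 * K) := Nat.mul_le_mul_right _ hs
  have q2 : n * (s + 2 * B) * (2 * K) ≤ n * (3 * s) * (2 * K) :=
    Nat.mul_le_mul_right _ (Nat.mul_le_mul_left _ (by omega))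
  have q3 : 0 < s * K := Nat.mul_pos (by omega) hK
  nlinarith

end Ultra
end PRU
end

section
open Polynomial
namespace PRU
open PowerSeries in
/-- multiplicative series with prescribed logarithmic derivative -/
def LD {K : Type*} [Field K] (F H : PowerSeries K) : Prop :=
  PowerSeries.coeff 0 F = 1 ∧ ∀ n : ℕ, (n : K) * PowerSeries.coeff n F = PowerSeries.coeff n (F * H)

section LD
variable {K : Type*} [Field K]

theorem ld_aux (F : PowerSeries K) (n : ℕ) :
    PowerSeries.coeff n (PowerSeries.X * PowerSeries.derivative K F) = n * PowerSeries.coeff n F := by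
  cases n with
  | zero => simp
  | succ n =>
    rw [PowerSeries.coeff_succ_X_mul, PowerSeries.coeff_derivative]; push_cast; ring

theorem LD.iff {F H : PowerSeries K} : LD F H ↔ PowerSeries.coeff 0 F = 1 ∧
    PowerSeries.X * PowerSeries.derivative K F = F * H := by
  unfold LD
  refine and_congr_right fun _ => ?_
  rw [PowerSeries.ext_iff]
  simp only [ld_aux]

theorem LD.one : LD (1 : PowerSeries K) 0 := by
  refine ⟨by simp, fun n => ?_⟩
  rw [PowerSeries.coeff_one]; split_ifs with h <;> simp [h]

theorem LD.mul {F G H J : PowerSeries K} (h : LD F H) (h2 : LD G J) : LD (F * G) (H + J) := by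
  rw [LD.iff] at *
  refine ⟨by simp_all, ?_⟩
  rw [Derivation.leibniz, smul_eq_mul, smul_eq_mul]
  linear_combination F * h2.2 + G * h.2

theorem LD.pow {F H : PowerSeries K} (h : LD F H) (N : ℕ) : LD (F ^ N) ((N : PowerSeries K) * H) := by
  induction N with
  | zero => simpa using LD.one
  | succ N ih =>
    have := ih.mul h
    rw [pow_succ]; convert this using 1; push_cast; ring

theorem LD.prod {F H : ℕ → PowerSeries K} (m : ℕ) (h : ∀ i, LD (F i) (H i)) :
    LD (∏ i ∈ Finset.range m, F i) (∑ i ∈ Finset.range m, H i) := by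
  induction m with
  | zero => simpa using LD.one
  | succ N ih =>
    rw [Finset.prod_range_succ, Finset.sum_range_succ]
    exact ih.mul (h N)

theorem LD.unique [CharZero K] {F G H : PowerSeries K} (h : LD F H) (h2 : LD G H)
    (hH : PowerSeries.coeff 0 H = 0) : F = G := by
  ext n
  induction n using Nat.strong_induction_on with
  | _ n ih =>
    rcases Nat.eq_zero_or_pos n with rfl | hn
    · rw [h.1, h2.1]
    have hn' : (n : K) ≠ 0 := by exact_mod_cast hn.ne'
    apply mul_left_cancel₀ hn'
    rw [h.2, h2.2, PowerSeries.coeff_mul, PowerSeries.coeff_mul]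
    refine Finset.sum_congr rfl fun x hx => ?_
    rw [Finset.HasAntidiagonal.mem_antidiagonal] at hx
    rcases Nat.eq_zero_or_pos x.2 with h0 | h0
    · rw [h0, hH]; simp
    · rw [ih x.1 (by omega)]

theorem LD.rescale {F H : PowerSeries K} (h : LD F H) (c : K) :
    LD (PowerSeries.rescale c F) (PowerSeries.rescale c H) := by
  refine ⟨by simpa using h.1, fun n => ?_⟩
  rw [← map_mul, PowerSeries.coeff_rescale, PowerSeries.coeff_rescale, ← h.2]; ring

theorem LD.expand {F H : PowerSeries K} (h : LD F H) (p : ℕ) (hp : p ≠ 0) :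
    LD (PowerSeries.expand p hp F) ((p : PowerSeries K) * PowerSeries.expand p hp H) := by
  refine ⟨by simpa using h.1, fun n => ?_⟩
  rw [mul_left_comm, ← map_mul, ← map_natCast (PowerSeries.C), PowerSeries.coeff_C_mul]
  by_cases hn : p ∣ n
  · obtain ⟨k, rfl⟩ := hn
    rw [PowerSeries.coeff_expand_mul, PowerSeries.coeff_expand_mul, ← h.2]; push_cast; ring
  · rw [PowerSeries.coeff_expand_of_not_dvd _ _ _ hn, PowerSeries.coeff_expand_of_not_dvd _ _ _ hn]; simp

theorem LD.exp [Algebra ℚ K] : LD (PowerSeries.exp K) PowerSeries.X := by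
  rw [LD.iff]
  refine ⟨by simp, ?_⟩
  rw [PowerSeries.derivative_exp, mul_comm]

theorem LD.map {K' : Type*} [Field K'] (f : K →+* K') {F H : PowerSeries K} (h : LD F H) :
    LD (PowerSeries.map f F) (PowerSeries.map f H) := by
  refine ⟨by rw [PowerSeries.coeff_map, h.1, map_one], fun n => ?_⟩
  rw [← map_mul, PowerSeries.coeff_map, PowerSeries.coeff_map, ← h.2]; simp
end LD

open Classical in
/-- the series `∑ X^(p^j)` -/
noncomputable def lam (K : Type*) [Field K] (p : ℕ) : PowerSeries K :=
  PowerSeries.mk fun n => if ∃ j, n = p ^ j then 1 else 0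

open Classical in
/-- coefficients of the Artin-Hasse type series with logarithmic derivative `a * lam` -/
noncomputable def ah {K : Type*} [Field K] (p : ℕ) (a : K) : ℕ → K
  | 0 => 1
  | n + 1 => a / ((n + 1 : ℕ) : K) * ∑ j : Fin (n + 1), if ∃ i, n + 1 - j.1 = p ^ i then ah p a j.1 else 0

section AH
variable {K : Type*} [Field K]

theorem coeff_zero_lam (p : ℕ) (hp : p ≠ 0) : PowerSeries.coeff 0 (lam K p) = 0 := by
  rw [lam, PowerSeries.coeff_mk, if_neg]
  rintro ⟨j, hj⟩
  exact pow_ne_zero j hp hj.symm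

theorem lam_eq (p : ℕ) (hp : p ≠ 0) (hp1 : 1 < p) :
    lam K p = PowerSeries.X + PowerSeries.expand p hp (lam K p) := by
  ext n
  rw [map_add, PowerSeries.coeff_X]
  by_cases hn : p ∣ n
  · obtain ⟨k, rfl⟩ := hn
    rw [PowerSeries.coeff_expand_mul, lam, PowerSeries.coeff_mk, PowerSeries.coeff_mk]
    by_cases h1 : p * k = 1
    · have : p = 1 := Nat.dvd_one.mp ⟨k, h1.symm⟩
      omega
    · rw [if_neg h1, zero_add]
      congr 1
      apply propext
      constructor
      · rintro ⟨j, hj⟩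
        cases j with
        | zero => simp at hj; exact absurd (by simp [hj]) h1
        | succ j => exact ⟨j, by rw [pow_succ'] at hj; exact Nat.eq_of_mul_eq_mul_left (by omega) hj⟩
      · rintro ⟨j, hj⟩
        exact ⟨j + 1, by rw [hj, pow_succ']⟩
  · rw [PowerSeries.coeff_expand_of_not_dvd _ _ _ hn, lam, PowerSeries.coeff_mk, add_zero]
    congr 1
    apply propext
    constructor
    · rintro ⟨j, hj⟩
      cases j with
      | zero => simpa using hj
      | succ j => exact absurd ⟨_, by rw [hj, pow_succ']⟩ hn
    · rintro rfl; exact ⟨0, by simp⟩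

theorem ld_ah [CharZero K] (p : ℕ) (hp : p ≠ 0) (a : K) :
    LD (PowerSeries.mk (ah p a)) (PowerSeries.C a * lam K p) := by
  refine ⟨by simp [ah], fun n => ?_⟩
  rw [mul_left_comm, PowerSeries.coeff_C_mul]
  cases n with
  | zero => simp [PowerSeries.coeff_mul, coeff_zero_lam p hp]
  | succ n =>
    have hn : ((n + 1 : ℕ) : K) ≠ 0 := by exact_mod_cast Nat.succ_ne_zero n
    rw [PowerSeries.coeff_mk, ah, ← mul_assoc, mul_div_cancel₀ _ hn, PowerSeries.coeff_mul,
      Finset.Nat.sum_antidiagonal_eq_sum_range_succ_mk, Finset.sum_range_succ,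
      Nat.sub_self, coeff_zero_lam p hp, mul_zero, add_zero, Finset.sum_range]
    congr 1
    refine Finset.sum_congr rfl fun j _ => ?_
    rw [PowerSeries.coeff_mk, lam, PowerSeries.coeff_mk]
    split_ifs <;> simp

theorem ah_continuous [TopologicalSpace K] [IsTopologicalRing K] (p n : ℕ) :
    Continuous fun a : K => ah p a n := by
  induction n using Nat.strong_induction_on with
  | _ n ih =>
    cases n with
    | zero => simpa [ah] using continuous_const
    | succ n =>
      simp only [ah]
      simp only [div_eq_mul_inv]
      refine (continuous_id.mul continuous_const).mul (continuous_finsetSum _ fun j _ => ?_)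
      split_ifs
      · exact ih _ (by omega)
      · exact continuous_const

theorem ah_natCast [CharZero K] (p : ℕ) (hp : p ≠ 0) (N : ℕ) :
    PowerSeries.mk (ah p (N : K)) = PowerSeries.mk (ah p (1 : K)) ^ N := by
  refine LD.unique (ld_ah p hp _) (H := PowerSeries.C (N : K) * lam K p) ?_ ?_
  · have := (ld_ah p hp (1 : K)).pow N
    simpa using this
  · rw [PowerSeries.coeff_C_mul, coeff_zero_lam p hp, mul_zero]

theorem ah_prod [CharZero K] (p : ℕ) (hp : 1 < p) (m : ℕ) (t : K) (ht : t ^ p ^ m = t) :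
    ∏ i ∈ Finset.range m, PowerSeries.rescale (t ^ p ^ i) (PowerSeries.mk (ah p (1 : K))) =
      PowerSeries.mk (ah p (∑ i ∈ Finset.range m, t ^ p ^ i)) := by
  refine LD.unique (LD.prod m fun i => (ld_ah p (by omega) (1 : K)).rescale (t ^ p ^ i)) (H := _) ?_ ?_
  · convert ld_ah p (by omega) (∑ i ∈ Finset.range m, t ^ p ^ i) using 1
    ext n
    rw [map_sum, PowerSeries.coeff_C_mul, lam, PowerSeries.coeff_mk]
    simp only [map_one, one_mul, PowerSeries.coeff_rescale, PowerSeries.coeff_mk]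
    split_ifs with h
    · obtain ⟨j, rfl⟩ := h
      simp only [mul_one]
      have : ∀ j, ∑ i ∈ Finset.range m, (t ^ p ^ i) ^ p ^ j = ∑ i ∈ Finset.range m, t ^ p ^ i := by
        intro j
        induction j with
        | zero => simp
        | succ j ih =>
          rw [← ih]
          have h1 := Finset.sum_range_succ (fun i => (t ^ p ^ i) ^ p ^ j) m
          have h2 := Finset.sum_range_succ' (fun i => (t ^ p ^ i) ^ p ^ j) m
          rw [h1] at h2
          simp only [pow_zero, pow_one, ht] at h2
          have h3 := add_right_cancel h2
          rw [h3]
          refine Finset.sum_congr rfl fun i _ => ?_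
          rw [← pow_mul, ← pow_mul]; congr 1; ring
      exact this j
    · simp
  · rw [map_sum]
    refine Finset.sum_eq_zero fun i _ => ?_
    simp [coeff_zero_lam p (by omega : p ≠ 0)]

theorem ah_map {K' : Type*} [Field K'] (f : K →+* K') (p : ℕ) (n : ℕ) (a : K) :
    f (ah p a n) = ah p (f a) n := by
  induction n using Nat.strong_induction_on with
  | _ n ih =>
    cases n with
    | zero => simp [ah]
    | succ n =>
      simp only [ah, map_mul, map_div₀, map_natCast, map_sum]
      congr 1
      refine Finset.sum_congr rfl fun j _ => ?_
      split_ifs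
      · exact ih _ (by omega)
      · simp

theorem ah_pow_p [CharZero K] [Algebra ℚ K] (p : ℕ) (hp : 1 < p) :
    (PowerSeries.mk (ah p (1 : K))) ^ p = PowerSeries.expand p (by omega) (PowerSeries.mk (ah p (1 : K))) *
      PowerSeries.rescale (p : K) (PowerSeries.exp K) := by
  have hp0 : p ≠ 0 := by omega
  have hE := ld_ah p hp0 (1 : K)
  simp only [map_one, one_mul] at hE
  refine LD.unique (hE.pow p) (H := _) ?_ ?_
  · convert (hE.expand p hp0).mul (LD.exp.rescale (p : K)) using 1
    conv_lhs => rw [lam_eq p hp0 hp]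
    rw [PowerSeries.rescale_X]
    simp only [map_natCast]; ring
  · rw [← map_natCast (PowerSeries.C), PowerSeries.coeff_C_mul, coeff_zero_lam p hp0, mul_zero]

theorem ah_one [CharZero K] (p : ℕ)  : ah p (1 : K) 1 = 1 := by
  rw [ah, Finset.sum_eq_single 0]
  · rw [if_pos ⟨0, by simp⟩]
    simp [ah]
  · intro b _ hb; omega
  · simp
end AH
end PRU
end

section
open Polynomial
namespace PRU
section integrality
variable (p : ℕ) [hp : Fact p.Prime]

theorem norm_pow_div_factorial (j : ℕ) (hj : j ≠ 0) : ‖((p : ℚ_[p]) ^ j / (j.factorial : ℚ_[p]))‖ ≤ (p : ℝ)⁻¹ := by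
  have h1 := sub_one_mul_padicValNat_factorial_lt_of_ne_zero p hj
  have h2 : padicValNat p j.factorial + 1 ≤ j := by
    have := hp.out.two_le
    have : 1 * padicValNat p j.factorial ≤ (p - 1) * padicValNat p j.factorial := Nat.mul_le_mul_right _ (by omega)
    omega
  have hf : (j.factorial : ℚ_[p]) ≠ 0 := by exact_mod_cast j.factorial_ne_zero
  have hp1 : (1 : ℝ) < p := by exact_mod_cast hp.out.one_lt
  rw [norm_div, norm_pow, Padic.norm_p, Padic.norm_eq_zpow_neg_valuation hf, Padic.valuation_natCast,
    zpow_neg, div_inv_eq_mul, zpow_natCast, inv_pow]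
  rw [inv_mul_le_iff₀ (by positivity), ← div_eq_mul_inv, le_div_iff₀ (by positivity), ← pow_succ]
  exact pow_le_pow_right₀ hp1.le h2

theorem expand_sub_pow_norm (T : ℤ_[p][X]) (n : ℕ) :
    ‖(expand ℤ_[p] p T - T ^ p).coeff n‖ ≤ (p : ℝ)⁻¹ := by
  have : (expand ℤ_[p] p T - T ^ p).coeff n ∈ RingHom.ker (PadicInt.toZMod (p := p)) := by
    rw [RingHom.mem_ker, ← coeff_map, Polynomial.map_sub, Polynomial.map_pow, map_expand, ZMod.expand_card,
      sub_self, coeff_zero]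
  rw [PadicInt.ker_toZMod, PadicInt.maximalIdeal_eq_span_p, Ideal.mem_span_singleton] at this
  obtain ⟨c, hc⟩ := this
  rw [hc, norm_mul, PadicInt.norm_p]
  have := PadicInt.norm_le_one c
  have h0 : (0 : ℝ) ≤ (p : ℝ)⁻¹ := by positivity
  nlinarith

theorem ah_norm_le_one (n : ℕ) : ‖ah p (1 : ℚ_[p]) n‖ ≤ 1 := by
  induction n using Nat.strong_induction_on with
  | _ n ih =>
    rcases Nat.eq_zero_or_pos n with rfl | hn
    · simp [ah]
    set e := ah p (1 : ℚ_[p]) with he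
    set E := PowerSeries.mk e with hE
    have hp0 : p ≠ 0 := hp.out.ne_zero
    have hp1 := hp.out.one_lt
    have hpr : (0 : ℝ) < (p : ℝ)⁻¹ := inv_pos.mpr (by exact_mod_cast hp.out.pos)
    let ι : ℤ_[p] →+* ℚ_[p] := PadicInt.Coe.ringHom
    have hex : ∀ k, ∃ y : ℤ_[p], k < n → ι y = e k := by
      intro k
      by_cases hk : k < n
      · exact ⟨⟨e k, ih k hk⟩, fun _ => rfl⟩
      · exact ⟨0, fun h => absurd h hk⟩
    choose e' he' using hex
    let T : ℤ_[p][X] := ∑ k ∈ Finset.range n, monomial k (e' k)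
    have hTc : ∀ k, k < n → ι (T.coeff k) = e k := by
      intro k hk
      simp only [T, finsetSum_coeff, coeff_monomial]
      rw [Finset.sum_ite_eq', if_pos (Finset.mem_range.mpr hk), he' k hk]
    have hTc2 : ∀ k, n ≤ k → T.coeff k = 0 := by
      intro k hk
      simp only [T, finsetSum_coeff, coeff_monomial]
      rw [Finset.sum_ite_eq', if_neg (by simpa using hk)]
    let T' : PowerSeries ℚ_[p] := ((T.map ι : ℚ_[p][X]) : PowerSeries ℚ_[p])
    have hT'c : ∀ k, PowerSeries.coeff k T' = ι (T.coeff k) := by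
      intro k; simp [T', coeff_coe]
    let R : PowerSeries ℚ_[p] := PowerSeries.mk fun k => e (k + n)
    have hER : E = T' + PowerSeries.X ^ n * R := by
      ext k
      rw [map_add, hT'c, PowerSeries.coeff_X_pow_mul', hE, PowerSeries.coeff_mk]
      split_ifs with h
      · rw [hTc2 k h, map_zero, zero_add, PowerSeries.coeff_mk, Nat.sub_add_cancel h]
      · rw [hTc k (by omega), add_zero]
    obtain ⟨z, hz⟩ := Polynomial.powAddExpansion T' (PowerSeries.X ^ n * R) p
    have hL : PowerSeries.coeff n (E ^ p) = ι ((T ^ p).coeff n) + p * e n := by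
      rw [hER, hz]
      have e1 : (T' ^ p + (p : PowerSeries ℚ_[p]) * T' ^ (p - 1) * (PowerSeries.X ^ n * R) + z * (PowerSeries.X ^ n * R) ^ 2)
        = T' ^ p + PowerSeries.X ^ n * (PowerSeries.C (p : ℚ_[p]) * (T' ^ (p - 1) * R)) + PowerSeries.X ^ n * (PowerSeries.X ^ n * (z * R ^ 2)) := by
        simp only [map_natCast]; ring
      rw [e1, map_add, map_add]
      have h3 : ∀ Q : PowerSeries ℚ_[p], PowerSeries.coeff n (PowerSeries.X ^ n * Q) = PowerSeries.coeff 0 Q := by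
        intro Q; simpa using PowerSeries.coeff_X_pow_mul Q n 0
      rw [h3, h3, PowerSeries.coeff_C_mul]
      have h4 : PowerSeries.constantCoeff T' = 1 := by
        rw [← PowerSeries.coeff_zero_eq_constantCoeff_apply, hT'c, hTc 0 hn]; simp [he, ah]
      have h5 : PowerSeries.constantCoeff R = e n := by
        rw [← PowerSeries.coeff_zero_eq_constantCoeff_apply]; simp [R]
      have h6 : PowerSeries.coeff n (T' ^ p) = ι ((T ^ p).coeff n) := by
        simp only [T', ← Polynomial.coe_pow, coeff_coe, ← Polynomial.map_pow, coeff_map]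
      rw [h6]
      simp only [PowerSeries.coeff_zero_eq_constantCoeff_apply, map_mul, map_pow, h4, h5]
      have : PowerSeries.constantCoeff (PowerSeries.X : PowerSeries ℚ_[p]) = 0 := by simp
      rw [this, zero_pow hn.ne']; simp
    have hxp : ∀ k, k ≤ n → PowerSeries.coeff k (PowerSeries.expand p hp0 E) = ι ((expand ℤ_[p] p T).coeff k) := by
      intro k hk
      rw [PowerSeries.coeff_expand, coeff_expand hp.out.pos]
      split_ifs with h
      · rw [hTc, hE, PowerSeries.coeff_mk]
        obtain ⟨c, rfl⟩ := h
        rw [Nat.mul_div_cancel_left _ hp.out.pos]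
        rcases Nat.eq_zero_or_pos c with rfl | hc
        · exact hn
        · nlinarith
      · simp
    have hιn : ∀ x, ‖ι x‖ = ‖x‖ := fun x => rfl
    have hRr : PowerSeries.coeff n (E ^ p) = PowerSeries.coeff n (PowerSeries.expand p hp0 E) +
       ∑ k ∈ Finset.range n, PowerSeries.coeff k (PowerSeries.expand p hp0 E) * ((p : ℚ_[p]) ^ (n - k) / ((n - k).factorial : ℚ_[p])) := by
      rw [ah_pow_p p hp1, PowerSeries.coeff_mul, Finset.Nat.sum_antidiagonal_eq_sum_range_succ_mk, Finset.sum_range_succ, add_comm]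
      congr 1
      · simp [hE, he]
      · refine Finset.sum_congr rfl fun k _ => ?_
        simp only [PowerSeries.coeff_rescale, PowerSeries.coeff_exp]
        congr 1
        simp [div_eq_mul_inv]
    have key : (p : ℚ_[p]) * e n = ι ((expand ℤ_[p] p T - T ^ p).coeff n) +
       ∑ k ∈ Finset.range n, PowerSeries.coeff k (PowerSeries.expand p hp0 E) * ((p : ℚ_[p]) ^ (n - k) / ((n - k).factorial : ℚ_[p])) := by
      rw [coeff_sub, map_sub, ← hxp n le_rfl]
      rw [hL] at hRr
      linear_combination hRr
    have hb : ‖(p : ℚ_[p]) * e n‖ ≤ (p : ℝ)⁻¹ := by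
      rw [key]
      refine (IsUltrametricDist.norm_add_le_max _ _).trans (max_le ?_ ?_)
      · rw [hιn]; exact expand_sub_pow_norm p T n
      · refine IsUltrametricDist.norm_sum_le_of_forall_le_of_nonneg hpr.le fun k hk => ?_
        rw [Finset.mem_range] at hk
        rw [hxp k hk.le, norm_mul, hιn]
        have h1 := PadicInt.norm_le_one ((expand ℤ_[p] p T).coeff k)
        have h2 := norm_pow_div_factorial p (n - k) (by omega)
        exact (mul_le_mul h1 h2 (norm_nonneg _) zero_le_one).trans (by rw [one_mul])
    rw [norm_mul, Padic.norm_p] at hb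
    exact (mul_le_iff_le_one_right hpr).mp hb
end integrality
end PRU
end

section
open Polynomial
namespace PRU

theorem sum_pow_shift {K : Type*} [CommRing K] (p m : ℕ) (t : K) (ht : t ^ p ^ m = t) (j : ℕ) :
    ∑ i ∈ Finset.range m, (t ^ p ^ i) ^ p ^ j = ∑ i ∈ Finset.range m, t ^ p ^ i := by
  induction j with
  | zero => simp
  | succ j ih =>
    rw [← ih]
    have h1 := Finset.sum_range_succ (fun i => (t ^ p ^ i) ^ p ^ j) m
    have h2 := Finset.sum_range_succ' (fun i => (t ^ p ^ i) ^ p ^ j) m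
    rw [h1] at h2
    simp only [pow_zero, pow_one, ht] at h2
    have h3 := add_right_cancel h2
    rw [h3]
    refine Finset.sum_congr rfl fun i _ => ?_
    rw [← pow_mul, ← pow_mul]; congr 1; ring

theorem one_le_norm_multiset_prod {K : Type*} [NormedField K] (M : Multiset K)
    (h : ∀ x ∈ M, 1 ≤ ‖x‖) : 1 ≤ ‖M.prod‖ := by
  induction M using Multiset.induction with
  | empty => simp
  | cons a M ih =>
    rw [Multiset.prod_cons, norm_mul]
    exact one_le_mul_of_one_le_of_one_le (h a (by simp)) (ih fun x hx => h x (by simp [hx]))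

section teich
variable (p : ℕ) [hp : Fact p.Prime]

/-- ring of integers of the algebraic closure of `ℚ_p` -/
noncomputable abbrev OL : ValuationSubring (PadicAlgCl p) := (NormedField.valuation (K := PadicAlgCl p)).valuationSubring
/-- residue field -/
noncomputable abbrev KL : Type := IsLocalRing.ResidueField (OL p)

theorem mem_OL {x : PadicAlgCl p} : x ∈ OL p ↔ ‖x‖ ≤ 1 := by
  rw [Valuation.mem_valuationSubring_iff]
  rfl

theorem norm_OL (x : OL p) : ‖(x : PadicAlgCl p)‖ ≤ 1 := (mem_OL p).mp x.2

theorem res_eq_zero_iff (x : OL p) : IsLocalRing.residue (OL p) x = 0 ↔ ‖(x : PadicAlgCl p)‖ < 1 := by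
  rw [IsLocalRing.residue_eq_zero_iff, ValuationSubring.valuation_lt_one_iff,
    ← (Valuation.isEquiv_valuation_valuationSubring (NormedField.valuation (K := PadicAlgCl p))).lt_one_iff_lt_one]
  rfl

theorem norm_p_L : ‖(p : PadicAlgCl p)‖ = (p : ℝ)⁻¹ := by
  have := PadicAlgCl.norm_extends p (p : ℚ_[p])
  rw [Padic.norm_p] at this
  simpa using this

instance : CharP (KL p) p := by
  rw [CharP.charP_iff_prime_eq_zero hp.out]
  rw [← map_natCast (IsLocalRing.residue (OL p)), res_eq_zero_iff]
  have : ((p : OL p) : PadicAlgCl p) = p := by simp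
  rw [this, norm_p_L]
  exact inv_lt_one_of_one_lt₀ (by exact_mod_cast hp.out.one_lt)

instance : IsAlgClosed (KL p) := by
  apply IsAlgClosed.of_exists_root
  intro f hf hirr
  have hl : f ∈ Polynomial.lifts (IsLocalRing.residue (OL p)) := by
    rw [Polynomial.lifts_iff_coeff_lifts]
    intro n; exact IsLocalRing.residue_surjective _
  obtain ⟨F, hF, hdeg, hmon⟩ := Polynomial.lifts_and_natDegree_eq_and_monic hl hf
  have hdF : (F.map (algebraMap (OL p) (PadicAlgCl p))).degree ≠ 0 := by
    rw [hmon.degree_map]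
    rw [Polynomial.degree_eq_natDegree hmon.ne_zero, hdeg]
    have := hirr.natDegree_pos
    exact_mod_cast this.ne'
  obtain ⟨r, hr⟩ := IsAlgClosed.exists_root _ hdF
  have hinteg : IsIntegral (OL p) r := ⟨F, hmon, by rw [IsRoot, eval_map] at hr; exact hr⟩
  obtain ⟨y, hy⟩ := IsIntegrallyClosed.isIntegral_iff.mp hinteg
  refine ⟨IsLocalRing.residue _ y, ?_⟩
  rw [← hF, eval_map, eval₂_at_apply]
  have : F.eval y = 0 := by
    apply FaithfulSMul.algebraMap_injective (OL p) (PadicAlgCl p)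
    rw [map_zero, ← eval₂_at_apply, hy, ← eval_map]; exact hr
  rw [this, map_zero]

theorem tei_norm {m : ℕ} {t : PadicAlgCl p} (ht : t ^ p ^ m = t) (hm : m ≠ 0) : ‖t‖ ≤ 1 := by
  by_contra h
  push Not at h
  have h1 : ‖t‖ ^ p ^ m = ‖t‖ := by rw [← norm_pow, ht]
  have h2 : 1 < p ^ m := Nat.one_lt_pow hm hp.out.one_lt
  have := pow_lt_pow_right₀ h h2
  rw [pow_one, h1] at this
  exact lt_irrefl _ this

theorem tei_inj {m : ℕ} (hm : m ≠ 0) {s t : PadicAlgCl p} (hs : s ^ p ^ m = s) (ht : t ^ p ^ m = t)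
    (h : ‖s - t‖ < 1) : s = t := by
  let s' : OL p := ⟨s, (mem_OL p).mpr (tei_norm p hs hm)⟩
  let t' : OL p := ⟨t, (mem_OL p).mpr (tei_norm p ht hm)⟩
  have hst : IsLocalRing.residue (OL p) s' = IsLocalRing.residue (OL p) t' := by
    rw [← sub_eq_zero, ← map_sub, res_eq_zero_iff]; exact h
  by_contra hne
  have h1 : (s - t) * 1 = (s - t) * ∑ i ∈ Finset.range (p ^ m), s ^ i * t ^ (p ^ m - 1 - i) := by
    rw [mul_comm (s - t) (∑ i ∈ _, _), (Commute.all s t).geom_sum₂_mul, hs, ht, mul_one]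
  have h2 := mul_left_cancel₀ (sub_ne_zero.mpr hne) h1
  have h3 : (1 : OL p) = ∑ i ∈ Finset.range (p ^ m), s' ^ i * t' ^ (p ^ m - 1 - i) := by
    apply Subtype.ext
    push_cast
    exact h2
  have h4 := congrArg (IsLocalRing.residue (OL p)) h3
  simp only [map_one, map_sum, map_mul, map_pow, hst] at h4
  rw [Finset.sum_congr rfl (g := fun _ => IsLocalRing.residue (OL p) t' ^ (p ^ m - 1))] at h4
  · rw [Finset.sum_const, Finset.card_range, nsmul_eq_mul] at h4
    push_cast at h4
    rw [CharP.cast_eq_zero (KL p) p, zero_pow hm, zero_mul] at h4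
    exact one_ne_zero h4
  · intro i hi
    rw [Finset.mem_range] at hi
    rw [← pow_add]; congr 1; omega

theorem tei_exists {m : ℕ} (hm : m ≠ 0) (y : PadicAlgCl p)
    (h : ‖y ^ p ^ m - y‖ < 1) : ∃ t : PadicAlgCl p, t ^ p ^ m = t ∧ ‖t - y‖ < 1 := by
  have h2 : 1 < p ^ m := Nat.one_lt_pow hm hp.out.one_lt
  let f : (PadicAlgCl p)[X] := X ^ p ^ m - X
  have hmon : f.Monic := by
    apply monic_X_pow_sub (n := p ^ m)
    rw [degree_X]; exact_mod_cast h2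
  have hf := (IsAlgClosed.splits f).eq_prod_roots_of_monic hmon
  have he : y ^ p ^ m - y = (f.roots.map fun a => y - a).prod := by
    have := congrArg (eval y) hf
    rw [eval_multiset_prod, Multiset.map_map] at this
    simpa [f] using this
  by_contra hcon
  push Not at hcon
  have : 1 ≤ ‖(f.roots.map fun a => y - a).prod‖ := by
    apply one_le_norm_multiset_prod
    intro x hx
    simp only [Multiset.mem_map] at hx
    obtain ⟨a, ha, rfl⟩ := hx
    rw [mem_roots hmon.ne_zero] at ha
    have := hcon a (by simpa [f, sub_eq_zero] using ha)
    rw [norm_sub_rev]; exact this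
  rw [← he] at this
  exact absurd h (not_lt.mpr this)
end teich
end PRU
end

section
open Polynomial
namespace PRU
section teich2
variable (p : ℕ) [hp : Fact p.Prime]

theorem exists_teich {m : ℕ} (hm : m ≠ 0) : ∃ (ι : GaloisField p m →+* KL p) (τ : GaloisField p m →*₀ PadicAlgCl p)
    (hτ : ∀ x, τ x ∈ OL p), Function.Injective τ ∧ (∀ x, τ x ^ p ^ m = τ x) ∧
    (∀ x, IsLocalRing.residue (OL p) ⟨τ x, hτ x⟩ = ι x) ∧ (∀ t, t ^ p ^ m = t → ∃ x, τ x = t) := by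
  have := Fintype.ofFinite (GaloisField p m)
  let : Algebra (ZMod p) (KL p) := ZMod.algebra _ p
  let ι : GaloisField p m →+* KL p := (IsAlgClosed.lift (R := ZMod p) : GaloisField p m →ₐ[ZMod p] KL p).toRingHom
  have hcard : Fintype.card (GaloisField p m) = p ^ m := by
    rw [← Nat.card_eq_fintype_card, GaloisField.card p m hm]
  have hq : ∀ x : GaloisField p m, x ^ p ^ m = x := fun x => by rw [← hcard, FiniteField.pow_card]
  have hqm : p ^ m ≠ 0 := pow_ne_zero _ hp.out.ne_zero
  have hex : ∀ x : GaloisField p m, ∃ t : PadicAlgCl p, t ^ p ^ m = t ∧ ∃ ht : t ∈ OL p,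
      IsLocalRing.residue (OL p) ⟨t, ht⟩ = ι x := by
    intro x
    obtain ⟨y, hy⟩ := IsLocalRing.residue_surjective (R := OL p) (ι x)
    have h1 : IsLocalRing.residue (OL p) (y ^ p ^ m - y) = 0 := by
      rw [map_sub, map_pow, hy, ← map_pow, hq, sub_self]
    rw [res_eq_zero_iff] at h1
    obtain ⟨t, ht, hty⟩ := tei_exists p hm (y : PadicAlgCl p) (by simpa using h1)
    refine ⟨t, ht, (mem_OL p).mpr (tei_norm p ht hm), ?_⟩
    rw [← hy, ← sub_eq_zero, ← map_sub, res_eq_zero_iff]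
    simpa using hty
  choose t ht htO htr using hex
  have huniq : ∀ (s : PadicAlgCl p) (hs : s ∈ OL p) (x : GaloisField p m), s ^ p ^ m = s →
      IsLocalRing.residue (OL p) ⟨s, hs⟩ = ι x → s = t x := by
    intro s hs x h1 h2
    apply tei_inj p hm h1 (ht x)
    have : IsLocalRing.residue (OL p) (⟨s, hs⟩ - ⟨t x, htO x⟩) = 0 := by
      rw [map_sub, h2, htr, sub_self]
    rw [res_eq_zero_iff] at this
    simpa using this
  let τ : GaloisField p m →*₀ PadicAlgCl p :=
    { toFun := t
      map_zero' := by
        symm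
        apply huniq 0 (ValuationSubring.zero_mem _) 0 (zero_pow hqm)
        rw [map_zero]; exact map_zero _
      map_one' := by
        symm
        apply huniq 1 (ValuationSubring.one_mem _) 1 (one_pow _)
        rw [map_one]; exact map_one _
      map_mul' := by
        intro x y
        symm
        apply huniq (t x * t y) (ValuationSubring.mul_mem _ _ _ (htO x) (htO y)) (x * y)
        · rw [mul_pow, ht, ht]
        · rw [map_mul, ← htr, ← htr, ← map_mul]; rfl }
  have hinj : Function.Injective t := by
    intro x y hxy
    apply ι.injective
    rw [← htr, ← htr]
    congr 1
    exact Subtype.ext hxy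
  refine ⟨ι, τ, htO, hinj, ht, htr, ?_⟩
  intro s hs
  have hsO := (mem_OL p).mpr (tei_norm p hs hm)
  have hroot : IsLocalRing.residue (OL p) ⟨s, hsO⟩ ^ p ^ m = IsLocalRing.residue (OL p) ⟨s, hsO⟩ := by
    rw [← map_pow]; congr 1; exact Subtype.ext hs
  have h2 : 1 < p ^ m := Nat.one_lt_pow hm hp.out.one_lt
  let f : (KL p)[X] := X ^ p ^ m - X
  have hdf : f.natDegree = p ^ m := FiniteField.X_pow_card_sub_X_natDegree_eq _ h2
  have hf0 : f ≠ 0 := FiniteField.X_pow_card_sub_X_ne_zero _ h2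
  classical
  have hsub : Finset.univ.image ι ⊆ f.roots.toFinset := by
    intro z hz
    rw [Finset.mem_image] at hz
    obtain ⟨x, _, rfl⟩ := hz
    rw [Multiset.mem_toFinset, mem_roots hf0]
    simp [f, ← map_pow, hq]
  have heq := Finset.eq_of_subset_of_card_le hsub (by
    rw [Finset.card_image_of_injective _ ι.injective, Finset.card_univ, hcard, ← hdf]
    exact (Multiset.toFinset_card_le _).trans (card_roots' f))
  have hmem : IsLocalRing.residue (OL p) ⟨s, hsO⟩ ∈ f.roots.toFinset := by
    rw [Multiset.mem_toFinset, mem_roots hf0]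
    simp [f, hroot]
  rw [← heq, Finset.mem_image] at hmem
  obtain ⟨x, _, hx⟩ := hmem
  exact ⟨x, (huniq s hsO x hs hx.symm).symm⟩

/-- The trace of a Teichmüller element lies in `ℤ_p`. -/
theorem teich_trace {m : ℕ} (ι : GaloisField p m →+* KL p) (τ : GaloisField p m →*₀ PadicAlgCl p)
    (hτ : ∀ x, τ x ∈ OL p) (hq : ∀ x, τ x ^ p ^ m = τ x)
    (hres : ∀ x, IsLocalRing.residue (OL p) ⟨τ x, hτ x⟩ = ι x)
    (hsurj : ∀ t, t ^ p ^ m = t → ∃ x, τ x = t) (x : GaloisField p m) :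
    ∃ α : ℚ_[p], algebraMap ℚ_[p] (PadicAlgCl p) α = ∑ i ∈ Finset.range m, τ x ^ p ^ i := by
  have := (InfiniteGalois.mem_range_algebraMap_iff_fixed (k := ℚ_[p]) (∑ i ∈ Finset.range m, τ x ^ p ^ i)).mpr ?_
  · exact this
  intro s
  have hsn : ∀ y : PadicAlgCl p, ‖s y‖ = ‖y‖ := fun y =>
    (spectralNorm_eq_of_equiv (K := ℚ_[p]) (L := PadicAlgCl p) s y).symm
  obtain ⟨x', hx'⟩ := hsurj (s (τ x)) (by rw [← map_pow, hq])
  have hxi : IsIntegral (ZMod p) x := Algebra.IsIntegral.isIntegral x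
  -- lift of the minimal polynomial
  obtain ⟨F, hF⟩ := Polynomial.map_surjective (Int.castRingHom (ZMod p)) (ZMod.intCast_surjective) (minpoly (ZMod p) x)
  let : Algebra (ZMod p) (KL p) := ZMod.algebra _ p
  have key : ∀ y : GaloisField p m, ‖F.aeval (τ y)‖ < 1 ↔ aeval y (minpoly (ZMod p) x) = 0 := by
    intro y
    have h1 : F.aeval (τ y) = ((F.aeval (⟨τ y, hτ y⟩ : OL p) : OL p) : PadicAlgCl p) := by
      have := Polynomial.hom_eval₂ F (algebraMap ℤ (OL p)) (OL p).subtype ⟨τ y, hτ y⟩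
      rw [aeval_def, aeval_def]
      refine Eq.trans ?_ this.symm
      exact congrArg (fun g => eval₂ g (τ y) F) (RingHom.ext_int _ _)
    rw [h1, ← res_eq_zero_iff, ← hF, aeval_def, aeval_def, Polynomial.hom_eval₂, hres, eval₂_map]
    have h2 : Polynomial.eval₂ ((IsLocalRing.residue (OL p)).comp (algebraMap ℤ (OL p))) (ι y) F
      = ι (eval₂ ((algebraMap (ZMod p) (GaloisField p m)).comp (Int.castRingHom (ZMod p))) y F) := by
      rw [Polynomial.hom_eval₂]
      congr 1
      exact RingHom.ext_int _ _
    rw [h2]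
    exact map_eq_zero_iff ι ι.injective
  have h0 : ‖F.aeval (τ x)‖ < 1 := (key x).mpr (minpoly.aeval _ _)
  have h1 : ‖F.aeval (τ x')‖ < 1 := by
    rw [hx']
    have : F.aeval (s (τ x)) = s (F.aeval (τ x)) := by
      have := Polynomial.hom_eval₂ F (algebraMap ℤ (PadicAlgCl p)) (s : PadicAlgCl p →+* PadicAlgCl p) (τ x)
      rw [aeval_def, aeval_def]
      refine Eq.trans ?_ this.symm
      exact congrArg (fun g => eval₂ g (s (τ x)) F) (RingHom.ext_int _ _)
    rw [this, hsn]; exact h0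
  obtain ⟨σ, hσ⟩ := minpoly.exists_algEquiv_of_root hxi.isAlgebraic ((key x').mp h1)
  have hσ' : σ.symm x = x' := by rw [← hσ]; simp
  obtain ⟨j, hj⟩ := (FiniteField.bijective_frobeniusAlgEquivOfAlgebraic_pow (ZMod p) (GaloisField p m)).2 σ.symm
  have hj' : x' = x ^ p ^ (j : ℕ) := by
    rw [← hσ', ← hj]
    simp only [AlgEquiv.coe_pow]
    rw [FiniteField.coe_frobeniusAlgEquivOfAlgebraic_iterate, ZMod.card]
  rw [map_sum]
  simp only [map_pow]
  rw [← hx', hj', map_pow, ← sum_pow_shift p m (τ x) (hq x) j]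
  refine Finset.sum_congr rfl fun i _ => ?_
  rw [← pow_mul, ← pow_mul, mul_comm]
end teich2
end PRU
end

section
open Polynomial
namespace PRU

section polybounds
variable {L : Type*} [NormedField L] [IsUltrametricDist L]

theorem coeff_mul_bound (r : ℝ) (hr : 0 ≤ r) {P Q : L[X]} (hP : ∀ n, ‖P.coeff n‖ ≤ r ^ n) (hQ : ∀ n, ‖Q.coeff n‖ ≤ r ^ n)
    (n : ℕ) : ‖(P * Q).coeff n‖ ≤ r ^ n := by
  rw [coeff_mul]
  refine IsUltrametricDist.norm_sum_le_of_forall_le_of_nonneg (by positivity) fun x hx => ?_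
  rw [Finset.HasAntidiagonal.mem_antidiagonal] at hx
  rw [norm_mul, ← hx, pow_add]
  exact mul_le_mul (hP _) (hQ _) (norm_nonneg _) (by positivity)

theorem coeff_prod_bound (r : ℝ) (hr : 0 ≤ r) (P : ℕ → L[X]) (hP : ∀ i n, ‖(P i).coeff n‖ ≤ r ^ n) (m n : ℕ) :
    ‖(∏ i ∈ Finset.range m, P i).coeff n‖ ≤ r ^ n := by
  induction m generalizing n with
  | zero =>
    rw [Finset.range_zero, Finset.prod_empty, coeff_one]
    split_ifs with h
    · subst h; simp
    · simp; positivity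
  | succ m ih =>
    rw [Finset.prod_range_succ]
    exact coeff_mul_bound r hr ih (hP m) n

theorem eval_sub_bound {P Q : L[X]} (hP : ∀ n, ‖P.coeff n‖ ≤ 1) (hQ : ∀ n, ‖Q.coeff n‖ ≤ 1) (N : ℕ) (g : L) (hg : ‖g‖ ≤ 1)
    (h : ∀ n < N, ‖P.coeff n - Q.coeff n‖ ≤ ‖g‖ ^ N) : ‖P.eval g - Q.eval g‖ ≤ ‖g‖ ^ N := by
  rw [← eval_sub, eval_eq_sum_range]
  refine IsUltrametricDist.norm_sum_le_of_forall_le_of_nonneg (by positivity) fun n _ => ?_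
  rw [norm_mul, norm_pow, coeff_sub]
  rcases lt_or_ge n N with hn | hn
  · calc _ ≤ ‖g‖ ^ N * 1 := mul_le_mul (h n hn) (pow_le_one₀ (norm_nonneg _) hg) (by positivity) (by positivity)
      _ = _ := mul_one _
  · have h1 : ‖P.coeff n - Q.coeff n‖ ≤ 1 := by
      rw [sub_eq_add_neg]
      refine (IsUltrametricDist.norm_add_le_max _ _).trans (max_le (hP n) ?_)
      rw [norm_neg]; exact hQ n
    calc _ ≤ 1 * ‖g‖ ^ N := mul_le_mul h1 (pow_le_pow_of_le_one (norm_nonneg _) hg hn) (by positivity) zero_le_one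
      _ = _ := one_mul _
end polybounds

/-- congruence of power series below degree `N` -/
def Cong {K : Type*} [Field K] (N : ℕ) (A B : PowerSeries K) : Prop :=
  ∀ n < N, PowerSeries.coeff n A = PowerSeries.coeff n B

theorem Cong.mul {K : Type*} [Field K] {N : ℕ} {A B C D : PowerSeries K} (h : Cong N A B) (h2 : Cong N C D) :
    Cong N (A * C) (B * D) := by
  intro n hn
  rw [PowerSeries.coeff_mul, PowerSeries.coeff_mul]
  refine Finset.sum_congr rfl fun x hx => ?_
  rw [Finset.HasAntidiagonal.mem_antidiagonal] at hx
  rw [h _ (by omega), h2 _ (by omega)]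

theorem Cong.prod {K : Type*} [Field K] {N : ℕ} {A B : ℕ → PowerSeries K} (h : ∀ i, Cong N (A i) (B i)) (m : ℕ) :
    Cong N (∏ i ∈ Finset.range m, A i) (∏ i ∈ Finset.range m, B i) := by
  induction m with
  | zero => intro n _; simp
  | succ m ih => rw [Finset.prod_range_succ, Finset.prod_range_succ]; exact ih.mul (h m)

section splitting
variable (p : ℕ) [hp : Fact p.Prime]

theorem ah_norm_L (n : ℕ) : ‖ah p (1 : PadicAlgCl p) n‖ ≤ 1 := by
  have := ah_map (algebraMap ℚ_[p] (PadicAlgCl p)) p n 1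
  rw [map_one] at this
  rw [← this]
  have h := PadicAlgCl.norm_extends p (ah p (1 : ℚ_[p]) n)
  rw [h]
  exact ah_norm_le_one p n

/-- truncated Artin–Hasse polynomial -/
noncomputable def ahT (N : ℕ) : (PadicAlgCl p)[X] := ∑ k ∈ Finset.range N, monomial k (ah p 1 k)

theorem ahT_coeff (N n : ℕ) : (ahT p N).coeff n = if n < N then ah p 1 n else 0 := by
  simp only [ahT, finsetSum_coeff, coeff_monomial]
  rw [Finset.sum_ite_eq']
  simp

theorem zeta_norm {ζ : PadicAlgCl p} (hζ : IsPrimitiveRoot ζ p) : ‖ζ - 1‖ ^ (p - 1) ≤ (p : ℝ)⁻¹ := by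
  obtain ⟨n, hn⟩ : ∃ n, p = n + 1 := ⟨p - 1, by have := hp.out.pos; omega⟩
  have hζ1 : ‖ζ‖ = 1 := by
    have : ‖ζ‖ ^ p = 1 := by rw [← norm_pow, hζ.pow_eq_one, norm_one]
    exact (pow_eq_one_iff_of_nonneg (norm_nonneg _) hp.out.ne_zero).mp this
  have h1 : ∏ k ∈ Finset.range n, (1 - ζ ^ (k + 1)) = (p : PadicAlgCl p) := by
    have h := IsPrimitiveRoot.prod_one_sub_pow_eq_order (n := n) (μ := ζ) (by rw [← hn]; exact hζ)
    rw [h]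
    have e : (p : PadicAlgCl p) = ((n + 1 : ℕ) : PadicAlgCl p) := congrArg Nat.cast hn
    rw [e]
    push_cast; ring
  have h2 := congrArg norm h1
  rw [norm_p_L, norm_prod] at h2
  rw [← h2]
  have h3 : ‖ζ - 1‖ ^ (p - 1) = ∏ k ∈ Finset.range n, ‖ζ - 1‖ := by
    have e : p - 1 = n := by omega
    rw [Finset.prod_const, Finset.card_range, e]
  rw [h3]
  refine Finset.prod_le_prod (fun _ _ => norm_nonneg _) fun k hk => ?_
  rw [Finset.mem_range] at hk
  have hcop : Nat.Coprime (k + 1) p := by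
    rw [Nat.coprime_comm, hp.out.coprime_iff_not_dvd]
    intro hd; have := Nat.le_of_dvd (by omega) hd; omega
  have hpr := hζ.pow_of_coprime (k + 1) hcop
  obtain ⟨i, _, hi⟩ := hpr.eq_pow_of_pow_eq_one hζ.pow_eq_one
  have hg : ζ - 1 = (ζ ^ (k + 1) - 1) * ∑ j ∈ Finset.range i, (ζ ^ (k + 1)) ^ j := by
    rw [mul_comm, geom_sum_mul, hi]
  calc ‖ζ - 1‖ = ‖ζ ^ (k + 1) - 1‖ * ‖∑ j ∈ Finset.range i, (ζ ^ (k + 1)) ^ j‖ := by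
        conv_lhs => rw [hg, norm_mul]
    _ ≤ ‖ζ ^ (k + 1) - 1‖ * 1 := by
        refine mul_le_mul_of_nonneg_left ?_ (norm_nonneg _)
        refine IsUltrametricDist.norm_sum_le_of_forall_le_of_nonneg zero_le_one fun j _ => ?_
        rw [norm_pow, norm_pow, hζ1]; simp
    _ = ‖1 - ζ ^ (k + 1)‖ := by rw [mul_one, norm_sub_rev]

theorem zeta_norm_lt {ζ : PadicAlgCl p} (hζ : IsPrimitiveRoot ζ p) : ‖ζ - 1‖ < 1 := by
  by_contra h
  push Not at h
  have h1 := zeta_norm p hζ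
  have h2 := one_le_pow₀ h (n := p - 1)
  have : (p : ℝ)⁻¹ < 1 := inv_lt_one_of_one_lt₀ (by exact_mod_cast hp.out.one_lt)
  linarith

theorem exists_gamma {ζ : PadicAlgCl p} (hζ : IsPrimitiveRoot ζ p) (N : ℕ) (hN : 2 ≤ N) :
    ∃ g : PadicAlgCl p, (ahT p N).eval g = ζ ∧ ‖g‖ ≤ ‖ζ - 1‖ := by
  have hne : ζ - 1 ≠ 0 := sub_ne_zero.mpr (hζ.ne_one hp.out.one_lt)
  let f := ahT p N - C ζ
  have h0 : f.eval 0 = 1 - ζ := by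
    rw [← coeff_zero_eq_eval_zero]
    simp only [f, coeff_sub, ahT_coeff, coeff_C_zero]
    rw [if_pos (by omega)]; simp [ah]
  have h1 : f.derivative.eval 0 = 1 := by
    rw [← coeff_zero_eq_eval_zero, coeff_derivative]
    simp only [f, coeff_sub, ahT_coeff, zero_add]
    rw [if_pos (by omega), ah_one, coeff_C_of_ne_zero (by omega)]; simp
  have hne' : f.eval 0 ≠ 0 := by rw [h0, ← neg_sub]; exact neg_ne_zero.mpr hne
  have hf0 : f ≠ 0 := by rintro h; rw [h] at hne'; simp at hne'
  have h := (IsAlgClosed.splits f).eval_derivative_div_eval_of_ne_zero hne'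
  rw [h0, h1] at h
  by_contra hcon
  push Not at hcon
  have hb : ∀ z ∈ f.roots, ‖(1 : PadicAlgCl p) / (0 - z)‖ < ‖ζ - 1‖⁻¹ := by
    intro z hz
    rw [mem_roots hf0] at hz
    have := hcon z (by simpa [f, sub_eq_zero] using hz)
    rw [zero_sub, norm_div, norm_neg, norm_one, one_div]
    exact inv_strictAnti₀ (norm_pos_iff.mpr hne) this
  have hs : ∀ M : Multiset (PadicAlgCl p), (∀ z ∈ M, ‖(1 : PadicAlgCl p) / (0 - z)‖ < ‖ζ - 1‖⁻¹) →
      ‖(M.map fun z => 1 / (0 - z)).sum‖ < ‖ζ - 1‖⁻¹ := by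
    intro M
    induction M using Multiset.induction with
    | empty => intro _; simpa using hne
    | cons a M ih =>
      intro hM
      rw [Multiset.map_cons, Multiset.sum_cons]
      exact (IsUltrametricDist.norm_add_le_max _ _).trans_lt
        (max_lt (hM a (by simp)) (ih fun z hz => hM z (by simp [hz])))
  have := hs _ hb
  rw [← h, norm_div, norm_one, norm_sub_rev, one_div] at this
  exact lt_irrefl _ this

theorem splitting : ∃ ζ : PadicAlgCl p, IsPrimitiveRoot ζ p ∧ ∀ N, 2 ≤ N → ∃ θ : (PadicAlgCl p)[X],
    (∀ n, ‖θ.coeff n‖ ≤ ‖ζ - 1‖ ^ n) ∧ ∀ m ≠ 0, ∃ τ : GaloisField p m →*₀ PadicAlgCl p,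
      Function.Injective τ ∧ (∀ x, τ x ^ p ^ m = τ x) ∧
      ∀ x, ‖∏ i ∈ Finset.range m, θ.eval (τ x ^ p ^ i) -
        ζ ^ (Algebra.trace (ZMod p) (GaloisField p m) x).val‖ ≤ ‖ζ - 1‖ ^ N := by
  obtain ⟨ζ, hζ⟩ := HasEnoughRootsOfUnity.exists_primitiveRoot (PadicAlgCl p) p
  refine ⟨ζ, hζ, fun N hN => ?_⟩
  obtain ⟨g, hg, hgn⟩ := exists_gamma p hζ N hN
  have hz1 := zeta_norm_lt p hζ
  have hg1 : ‖g‖ ≤ 1 := hgn.trans hz1.le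
  have hTn : ∀ n, ‖(ahT p N).coeff n‖ ≤ 1 := by
    intro n
    rw [ahT_coeff]
    split_ifs
    · exact ah_norm_L p n
    · simp
  refine ⟨(ahT p N).comp (C g * X), fun n => ?_, fun m hm => ?_⟩
  · rw [comp_C_mul_X_coeff, norm_mul, norm_pow]
    calc _ ≤ 1 * ‖ζ - 1‖ ^ n := mul_le_mul (hTn n) (pow_le_pow_left₀ (norm_nonneg _) hgn n) (by positivity) zero_le_one
      _ = _ := one_mul _
  obtain ⟨ι, τ, hτO, hinj, hq, hres, hsurj⟩ := exists_teich p hm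
  refine ⟨τ, hinj, hq, fun x => ?_⟩
  obtain ⟨α, hα⟩ := teich_trace p ι τ hτO hq hres hsurj x
  set t := τ x with ht
  set a := ∑ i ∈ Finset.range m, t ^ p ^ i with ha
  have htn : ‖t‖ ≤ 1 := tei_norm p (hq x) hm
  have han : ‖a‖ ≤ 1 := by
    refine IsUltrametricDist.norm_sum_le_of_forall_le_of_nonneg zero_le_one fun i _ => ?_
    rw [norm_pow]; exact pow_le_one₀ (norm_nonneg _) htn
  have hαn : ‖α‖ ≤ 1 := by
    have h := PadicAlgCl.norm_extends p α
    rw [← h]; rw [← hα] at han; exact han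
  have hg0 : 0 < ‖g‖ ^ N := by
    apply pow_pos
    rw [norm_pos_iff]
    rintro rfl
    rw [← coeff_zero_eq_eval_zero, ahT_coeff, if_pos (by omega)] at hg
    simp [ah] at hg
    exact hζ.ne_one hp.out.one_lt hg.symm
  -- approximate
  obtain ⟨M, hM1, hM2⟩ : ∃ M : ℕ, ‖a - M‖ < 1 ∧ ∀ n < N, ‖ah p a n - ah p (M : PadicAlgCl p) n‖ ≤ ‖g‖ ^ N := by
    have hcont : Continuous fun y : ℤ_[p] => (algebraMap ℚ_[p] (PadicAlgCl p) (y : ℚ_[p])) :=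
      (algebraMapCLM ℚ_[p] (PadicAlgCl p)).continuous.comp continuous_subtype_val
    let α' : ℤ_[p] := ⟨α, hαn⟩
    have hα' : algebraMap ℚ_[p] (PadicAlgCl p) (α' : ℚ_[p]) = a := hα
    have hU : IsOpen {y : ℤ_[p] | ‖a - algebraMap ℚ_[p] (PadicAlgCl p) (y : ℚ_[p])‖ < 1 ∧
        ∀ n ∈ Finset.range N, ‖ah p a n - ah p (algebraMap ℚ_[p] (PadicAlgCl p) (y : ℚ_[p])) n‖ < ‖g‖ ^ N} := by
      rw [Set.ofPred_and]
      refine IsOpen.inter ?_ ?_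
      · exact isOpen_lt (continuous_const.sub hcont).norm continuous_const
      · simp only [Set.ofPred_forall]
        refine isOpen_biInter_finset fun n _ => ?_
        exact isOpen_lt (continuous_const.sub ((ah_continuous p n).comp hcont)).norm continuous_const
    obtain ⟨M, hM⟩ := PadicInt.denseRange_natCast.exists_mem_open hU ⟨α', by
      simp only [Set.mem_ofPred_eq, hα', sub_self, norm_zero]
      exact ⟨one_pos, fun n _ => hg0⟩⟩
    simp only [Set.mem_ofPred_eq, PadicInt.coe_natCast, map_natCast] at hM
    exact ⟨M, hM.1, fun n hn => (hM.2 n (Finset.mem_range.mpr hn)).le⟩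
  -- the trace
  have htr : ((Algebra.trace (ZMod p) (GaloisField p m) x).val : ZMod p) = (M : ZMod p) := by
    rw [ZMod.natCast_val, ZMod.cast_id']
    have h1 : IsLocalRing.residue (OL p) (∑ i ∈ Finset.range m, (⟨t, hτO x⟩ : OL p) ^ p ^ i - (M : OL p)) = 0 := by
      rw [res_eq_zero_iff]
      push_cast
      exact hM1
    rw [map_sub, map_sum] at h1
    simp only [map_pow, map_natCast] at h1
    rw [hres x] at h1
    have h2 := FiniteField.algebraMap_trace_eq_sum_pow (ZMod p) (GaloisField p m) x
    rw [GaloisField.finrank p hm, Nat.card_zmod] at h2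
    have h3 : ι (algebraMap (ZMod p) (GaloisField p m) (Algebra.trace (ZMod p) (GaloisField p m) x - M)) = 0 := by
      rw [map_sub, h2, map_sub, map_sum]
      simp only [map_pow, map_natCast]
      exact h1
    have h4 := (map_eq_zero_iff ι ι.injective).mp h3
    have h5 := (map_eq_zero_iff _ (algebraMap (ZMod p) (GaloisField p m)).injective).mp h4
    exact sub_eq_zero.mp h5
  have hzM : ζ ^ (Algebra.trace (ZMod p) (GaloisField p m) x).val = ζ ^ M := by
    rw [ZMod.natCast_eq_natCast_iff] at htr
    rw [pow_eq_pow_mod _ hζ.pow_eq_one, pow_eq_pow_mod M hζ.pow_eq_one]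
    exact congrArg _ htr
  rw [hzM]
  -- the two polynomials
  let F1 : (PadicAlgCl p)[X] := ∏ i ∈ Finset.range m, (ahT p N).comp (C (t ^ p ^ i) * X)
  let F2 : (PadicAlgCl p)[X] := ∏ _i ∈ Finset.range M, ahT p N
  have hF1 : F1.eval g = ∏ i ∈ Finset.range m, ((ahT p N).comp (C g * X)).eval (t ^ p ^ i) := by
    simp only [F1, eval_prod, eval_comp, eval_mul, eval_C, eval_X]
    exact Finset.prod_congr rfl fun i _ => by rw [mul_comm]
  have hF2 : F2.eval g = ζ ^ M := by
    simp only [F2, Finset.prod_const, Finset.card_range, eval_pow, hg]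
  rw [← hF1, ← hF2]
  refine le_trans (eval_sub_bound ?_ ?_ N g hg1 ?_) (pow_le_pow_left₀ (norm_nonneg _) hgn N)
  · intro n
    have := coeff_prod_bound 1 zero_le_one (fun i => (ahT p N).comp (C (t ^ p ^ i) * X)) (fun i n => by
      rw [comp_C_mul_X_coeff, norm_mul, one_pow, norm_pow, norm_pow]
      exact mul_le_one₀ (hTn n) (by positivity) (pow_le_one₀ (by positivity) (pow_le_one₀ (norm_nonneg _) htn))) m n
    simpa only [one_pow] using this
  · intro n
    have := coeff_prod_bound 1 zero_le_one (fun i => ahT p N) (fun i n => by simpa using hTn n) M n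
    simpa only [one_pow] using this
  · intro n hn
    have hc : ∀ c : PadicAlgCl p, Cong N (((ahT p N).comp (C c * X) : (PadicAlgCl p)[X]) : PowerSeries (PadicAlgCl p))
        (PowerSeries.rescale c (PowerSeries.mk (ah p 1))) := by
      intro c k hk
      rw [coeff_coe, comp_C_mul_X_coeff, ahT_coeff, if_pos hk, PowerSeries.coeff_rescale, PowerSeries.coeff_mk, mul_comm]
    have e1 : F1.coeff n = ah p a n := by
      have h1 := Cong.prod (fun i => hc (t ^ p ^ i)) m n hn
      rw [ah_prod p hp.out.one_lt m t (hq x), PowerSeries.coeff_mk] at h1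
      rw [← h1, ← Polynomial.coeff_coe]
      congr 1
      exact map_prod (Polynomial.coeToPowerSeries.ringHom (R := PadicAlgCl p)) (fun i => (ahT p N).comp (C (t ^ p ^ i) * X)) (Finset.range m)
    have e2 : F2.coeff n = ah p (M : PadicAlgCl p) n := by
      have h1 := Cong.prod (fun _ => hc 1) M n hn
      rw [Finset.prod_const, Finset.prod_const, Finset.card_range, PowerSeries.rescale_one, RingHom.id_apply,
        ← ah_natCast p hp.out.ne_zero, PowerSeries.coeff_mk] at h1
      rw [← h1, ← Polynomial.coeff_coe]
      simp [F2]
    rw [e1, e2]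
    exact hM2 n hn
end splitting
end PRU
end

section
open Polynomial

set_option linter.unusedSectionVars false
namespace PRU

section charsum
variable {K L : Type*} [Field K] [Fintype K] [Field L] [CharZero L]

theorem tau_sum (τ : K →*₀ L) (hτ : Function.Injective τ) (k : ℕ) :
    ∑ x, τ x ^ k = (if k = 0 then 1 else 0) + (if Fintype.card K - 1 ∣ k then ((Fintype.card K : L) - 1) else 0) := by
  classical
  have h0 : ∑ x, τ x ^ k = (if k = 0 then 1 else 0) + ∑ u : Kˣ, τ u ^ k := by
    rw [← Finset.add_sum_erase _ _ (Finset.mem_univ (0 : K))]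
    congr 1
    · rw [map_zero]; split_ifs with h
      · rw [h, pow_zero]
      · rw [zero_pow h]
    · symm
      refine Finset.sum_bij (fun u _ => (u : K)) (by simp) (fun a _ b _ h => Units.ext h) ?_ (by simp)
      intro b hb
      exact ⟨Units.mk0 b (Finset.ne_of_mem_erase hb), by simp, rfl⟩
  rw [h0]
  congr 1
  let f : Kˣ →* L := ((τ : K →* L).comp (Units.coeHom K)) ^ k
  have hf : ∀ u, f u = τ u ^ k := fun u => rfl
  have hiff : f = 1 ↔ Fintype.card K - 1 ∣ k := by
    rw [← FiniteField.forall_pow_eq_one_iff]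
    constructor
    · intro h u
      have := DFunLike.congr_fun h u
      rw [hf, ← map_pow, MonoidHom.one_apply, ← map_one τ] at this
      exact Units.ext (by simpa using hτ this)
    · intro h; ext u
      rw [hf, ← map_pow, MonoidHom.one_apply, ← Units.val_pow_eq_pow_val, h u]; simp
  have h1 := sum_hom_units f
  simp only [hf] at h1
  rw [h1]
  simp only [hiff]
  split_ifs
  · rw [Fintype.card_units, Nat.cast_sub Fintype.card_pos, Nat.cast_one]
  · simp

end charsum

section trace
variable {ι L : Type*} [Fintype ι] [DecidableEq ι] [Field L] (p : ℕ)

/-- iterated product of Frobenius twists -/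
noncomputable def Gm (G : MvPolynomial ι L) (m : ℕ) : MvPolynomial ι L :=
  ∏ i ∈ Finset.range m, MvPolynomial.expand (p ^ i) G


theorem coeff_expand_mul (P : ℕ) (G H : MvPolynomial ι L) (k : ι →₀ ℕ) :
    (MvPolynomial.expand P G * H).coeff k =
      ∑ a ∈ G.support, if P • a ≤ k then G.coeff a * H.coeff (k - P • a) else 0 := by
  conv_lhs => rw [G.as_sum, map_sum, Finset.sum_mul, MvPolynomial.coeff_sum]
  refine Finset.sum_congr rfl fun a _ => ?_
  rw [MvPolynomial.expand_monomial, MvPolynomial.coeff_monomial_mul']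

theorem Gm_succ (G : MvPolynomial ι L) (m : ℕ) : Gm p G (m + 1) = MvPolynomial.expand (p ^ m) G * Gm p G m := by
  rw [Gm, Finset.prod_range_succ, mul_comm]; rfl

theorem coeff_Gm_bound (hp : 2 ≤ p) (G : MvPolynomial ι L) (D : ℕ) (hD : ∀ k, G.coeff k ≠ 0 → ∀ i, k i ≤ D) (m : ℕ)
    (k : ι →₀ ℕ) (hk : (Gm p G m).coeff k ≠ 0) (i : ι) : k i + D ≤ p ^ m * D := by
  induction m generalizing k with
  | zero =>
    simp only [Gm, Finset.range_zero, Finset.prod_empty, MvPolynomial.coeff_one] at hk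
    split_ifs at hk with h
    · subst h; simp
    · simp at hk
  | succ m ih =>
    rw [Gm_succ, coeff_expand_mul] at hk
    obtain ⟨a, ha, hne⟩ := Finset.exists_ne_zero_of_sum_ne_zero hk
    split_ifs at hne with hle
    · have h1 := ih _ (right_ne_zero_of_mul hne)
      have h2 := hD a (MvPolynomial.mem_support_iff.mp ha) i
      have h3 := hle i
      simp only [Finsupp.coe_tsub, Finsupp.coe_smul, Pi.sub_apply, Pi.smul_apply, smul_eq_mul] at h1 h3
      have h4 : p ^ m * a i ≤ p ^ m * D := Nat.mul_le_mul_left _ h2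
      have h5 : 2 * (p ^ m * D) ≤ p * (p ^ m * D) := Nat.mul_le_mul_right _ hp
      rw [pow_succ, mul_comm (p ^ m), mul_assoc]
      omega
    · exact absurd rfl hne

/-- The Dwork matrix on the box `Iic B`. -/
noncomputable def dw (G : MvPolynomial ι L) (B : ι →₀ ℕ) : Matrix (Finset.Iic B) (Finset.Iic B) L :=
  Matrix.of fun u w => if w.1 ≤ p • u.1 then G.coeff (p • u.1 - w.1) else 0

theorem dw_pow (hp : 2 ≤ p) (G : MvPolynomial ι L) (D : ℕ) (hD : ∀ k, G.coeff k ≠ 0 → ∀ i, k i ≤ D)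
    (B : ι →₀ ℕ) (hB : ∀ i, B i = 0 ∨ B i = D) (m : ℕ) (u w : Finset.Iic B) :
    ((dw p G B) ^ m) u w = if w.1 ≤ p ^ m • u.1 then (Gm p G m).coeff (p ^ m • u.1 - w.1) else 0 := by
  induction m generalizing u w with
  | zero =>
    rw [pow_zero, Matrix.one_apply, pow_zero, one_smul]
    simp only [Gm, Finset.range_zero, Finset.prod_empty, MvPolynomial.coeff_one]
    by_cases h : u = w
    · subst h; simp
    · rw [if_neg h]
      split_ifs with h1 h2
      · exfalso; apply h
        apply Subtype.ext
        refine le_antisymm ?_ h1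
        exact tsub_eq_zero_iff_le.mp h2.symm
      · rfl
      · rfl
  | succ m ih =>
    rw [pow_succ', Matrix.mul_apply]
    simp only [ih]
    rw [Gm_succ, coeff_expand_mul]
    have hp0 : 0 < p ^ m := pow_pos (by omega) m
    by_cases hw : w.1 ≤ p ^ (m + 1) • u.1
    swap
    · rw [if_neg hw]
      refine Finset.sum_eq_zero fun s _ => ?_
      simp only [dw, Matrix.of_apply]
      split_ifs with h1 h2
      · exfalso; apply hw
        intro i
        have h1i := h1 i; have h2i := h2 i
        simp only [Finsupp.coe_smul, Pi.smul_apply, smul_eq_mul] at h1i h2i ⊢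
        have := Nat.mul_le_mul_left (p ^ m) h1i
        rw [pow_succ, mul_assoc]; omega
      · simp
      · simp
      · simp
    rw [if_pos hw]
    have key : ∀ s a : ι →₀ ℕ, s + a = p • u.1 → (w.1 ≤ p ^ m • s ↔ p ^ m • a ≤ p ^ (m + 1) • u.1 - w.1) ∧
        (w.1 ≤ p ^ m • s → p ^ m • s - w.1 = p ^ (m + 1) • u.1 - w.1 - p ^ m • a) := by
      intro s a h
      have h' : ∀ i, p ^ m * s i + p ^ m * a i = p ^ (m + 1) * u.1 i := fun i => by
        have := DFunLike.congr_fun h i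
        simp only [Finsupp.coe_add, Pi.add_apply, Finsupp.coe_smul, Pi.smul_apply, smul_eq_mul] at this
        rw [← mul_add, this, pow_succ, mul_assoc]
      refine ⟨⟨fun h1 i => ?_, fun h1 i => ?_⟩, fun h1 => ?_⟩
      · have := h1 i; have := h' i; have := hw i
        simp only [Finsupp.coe_tsub, Finsupp.coe_smul, Pi.sub_apply, Pi.smul_apply, smul_eq_mul] at *
        omega
      · have := h1 i; have := h' i; have := hw i
        simp only [Finsupp.coe_tsub, Finsupp.coe_smul, Pi.sub_apply, Pi.smul_apply, smul_eq_mul] at *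
        omega
      · ext i
        have := h1 i; have := h' i; have := hw i
        simp only [Finsupp.coe_tsub, Finsupp.coe_smul, Pi.sub_apply, Pi.smul_apply, smul_eq_mul] at *
        omega
    refine Finset.sum_bij_ne_zero (fun s _ _ => p • u.1 - s.1) ?_ ?_ ?_ ?_
    · intro s _ hs
      have h1 := left_ne_zero_of_mul hs
      simp only [dw, Matrix.of_apply] at h1
      split_ifs at h1 with h2
      · exact MvPolynomial.mem_support_iff.mpr h1
      · exact absurd rfl h1
    · intro s _ hs s' _ hs' he
      have h1 := left_ne_zero_of_mul hs
      have h1' := left_ne_zero_of_mul hs'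
      simp only [dw, Matrix.of_apply, ne_eq, ite_eq_right_iff, not_forall] at h1 h1'
      obtain ⟨h1, _⟩ := h1
      obtain ⟨h1', _⟩ := h1'
      apply Subtype.ext
      exact (tsub_right_inj h1 h1').mp he
    · intro a ha hne
      split_ifs at hne with hle
      swap
      · exact absurd rfl hne
      have hapu : a ≤ p • u.1 := by
        intro i
        have h1 := hle i
        simp only [Finsupp.coe_tsub, Finsupp.coe_smul, Pi.sub_apply, Pi.smul_apply, smul_eq_mul] at h1 ⊢
        have : p ^ m * a i ≤ p ^ m * (p * u.1 i) := by rw [← mul_assoc, ← pow_succ]; omega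
        exact Nat.le_of_mul_le_mul_left this hp0
      have hsum : (p • u.1 - a) + a = p • u.1 := tsub_add_cancel_of_le hapu
      obtain ⟨k1, k2⟩ := key _ _ hsum
      have hws := k1.mpr hle
      have hsB : p • u.1 - a ≤ B := by
        intro i
        rcases hB i with h0 | h0
        · have hu := Finset.mem_Iic.mp u.2 i
          rw [h0] at hu
          have : u.1 i = 0 := by omega
          simp [this]
        · have h2 := coeff_Gm_bound p hp G D hD m _ (right_ne_zero_of_mul hne) i
          rw [← k2 hws] at h2
          have hwi := Finset.mem_Iic.mp w.2 i
          have := hws i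
          rw [h0] at hwi ⊢
          simp only [Finsupp.coe_tsub, Finsupp.coe_smul, Pi.sub_apply, Pi.smul_apply, smul_eq_mul] at h2 this ⊢
          refine Nat.le_of_mul_le_mul_left (c := p ^ m) ?_ hp0
          omega
      refine ⟨⟨p • u.1 - a, Finset.mem_Iic.mpr hsB⟩, Finset.mem_univ _, ?_, ?_⟩
      · simp only [dw, Matrix.of_apply]
        rw [if_pos tsub_le_self, if_pos hws, tsub_tsub_cancel_of_le hapu, k2 hws]
        exact hne
      · exact tsub_tsub_cancel_of_le hapu
    · intro s _ hs
      have h1 := left_ne_zero_of_mul hs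
      simp only [dw, Matrix.of_apply, ne_eq, ite_eq_right_iff, not_forall] at h1
      obtain ⟨h1, _⟩ := h1
      obtain ⟨k1, k2⟩ := key s.1 (p • u.1 - s.1) (add_tsub_cancel_of_le h1)
      simp only [dw, Matrix.of_apply]
      rw [if_pos h1]
      by_cases hws : w.1 ≤ p ^ m • s.1
      · rw [if_pos hws, if_pos (k1.mp hws), k2 hws]
      · rw [if_neg hws, if_neg (fun h => hws (k1.mpr h)), mul_zero]

end trace
end PRU
end

section
open Polynomial

set_option linter.unusedSectionVars false
namespace PRU
section trace2
variable {ι L : Type*} [Fintype ι] [DecidableEq ι] [Field L] (p : ℕ)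

/-- corner of the box -/
noncomputable def boxB (D : ℕ) (I : Finset ι) : ι →₀ ℕ :=
  Finsupp.equivFunOnFinite.symm fun i => if i ∈ I then D else 0

theorem boxB_apply (D : ℕ) (I : Finset ι) (i : ι) : boxB D I i = if i ∈ I then D else 0 := rfl

theorem sum_Gm [CharZero L] {K : Type*} [Field K] [Fintype K] (τ : K →*₀ L) (hτ : Function.Injective τ)
    (hp : 2 ≤ p) (G : MvPolynomial ι L) (D : ℕ) (hD : ∀ k, G.coeff k ≠ 0 → ∀ i, k i ≤ D) (m : ℕ) (hm : m ≠ 0)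
    (hK : Fintype.card K = p ^ m) :
    ∑ x : ι → K, MvPolynomial.eval (fun i => τ (x i)) (Gm p G m) =
      ∑ I ∈ (Finset.univ : Finset ι).powerset, ((p : L) ^ m - 1) ^ I.card * ((dw p G (boxB D I)) ^ m).trace := by
  classical
  set H := Gm p G m with hH
  have hq1 : 2 ≤ p ^ m := hp.trans (Nat.le_self_pow hm p)
  have h1 : ∀ k : ι →₀ ℕ, ∑ x : ι → K, ∏ i, τ (x i) ^ k i =
      ∑ I ∈ (Finset.univ : Finset ι).powerset, (∏ i ∈ I, if p ^ m - 1 ∣ k i then ((p : L) ^ m - 1) else 0) *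
        ∏ i ∈ Finset.univ \ I, if k i = 0 then (1 : L) else 0 := by
    intro k
    rw [← Fintype.piFinset_univ, ← Finset.prod_univ_sum (fun _ => Finset.univ) (fun i (y : K) => τ y ^ k i)]
    simp only [tau_sum τ hτ, hK]
    rw [← Finset.prod_add]
    refine Finset.prod_congr rfl fun i _ => ?_
    push_cast
    exact add_comm _ _
  simp only [MvPolynomial.eval_eq']
  rw [Finset.sum_comm]
  simp only [← Finset.mul_sum, h1]
  simp only [Finset.mul_sum]
  rw [Finset.sum_comm]
  refine Finset.sum_congr rfl fun I _ => ?_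
  rw [Matrix.trace, Finset.mul_sum]
  symm
  have hB : ∀ i, boxB D I i = 0 ∨ boxB D I i = D := by
    intro i; rw [boxB_apply]; split_ifs <;> simp
  have hle : ∀ u : ι →₀ ℕ, u ≤ p ^ m • u := fun u i => by
    simp only [Finsupp.coe_smul, Pi.smul_apply, smul_eq_mul]
    exact Nat.le_mul_of_pos_left _ (by omega)
  have hsub : ∀ (u : ι →₀ ℕ) i, (p ^ m • u - u) i = (p ^ m - 1) * u i := fun u i => by
    simp only [Finsupp.coe_tsub, Finsupp.coe_smul, Pi.sub_apply, Pi.smul_apply, smul_eq_mul]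
    rw [Nat.sub_mul, one_mul]
  have hterm : ∀ u : Finset.Iic (boxB D I), (((dw p G (boxB D I)) ^ m).diag u) = H.coeff (p ^ m • u.1 - u.1) := by
    intro u
    rw [Matrix.diag_apply, dw_pow p hp G D hD _ hB, if_pos (hle _)]
  have hprod : ∀ u : ι →₀ ℕ, u ≤ boxB D I → (∏ i ∈ I, if p ^ m - 1 ∣ (p ^ m • u - u) i then ((p : L) ^ m - 1) else 0) *
        (∏ i ∈ Finset.univ \ I, if (p ^ m • u - u) i = 0 then (1 : L) else 0) = ((p : L) ^ m - 1) ^ I.card := by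
    intro u hu
    rw [Finset.prod_congr rfl (g := fun _ => ((p : L) ^ m - 1)), Finset.prod_const,
      Finset.prod_congr rfl (s₁ := Finset.univ \ I) (g := fun _ => (1 : L)), Finset.prod_const_one, mul_one]
    · intro i hi
      have h2 := hu i
      rw [boxB_apply, if_neg (Finset.mem_sdiff.mp hi).2] at h2
      have h3 : u i = 0 := by omega
      rw [hsub, h3, mul_zero, if_pos rfl]
    · intro i _
      rw [hsub, if_pos (Dvd.intro _ rfl)]
  refine Finset.sum_bij_ne_zero (fun u _ _ => p ^ m • u.1 - u.1) ?_ ?_ ?_ ?_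
  · intro u _ hu
    have := right_ne_zero_of_mul hu
    rw [hterm] at this
    exact MvPolynomial.mem_support_iff.mpr this
  · intro u _ _ w _ _ he
    apply Subtype.ext
    ext i
    have := DFunLike.congr_fun he i
    rw [hsub, hsub] at this
    exact Nat.eq_of_mul_eq_mul_left (by omega) this
  · intro k hk hne
    have hdiv : ∀ i ∈ I, p ^ m - 1 ∣ k i := by
      intro i hi
      have h2 := left_ne_zero_of_mul (right_ne_zero_of_mul hne)
      have := Finset.prod_ne_zero_iff.mp h2 i hi
      by_contra h; rw [if_neg h] at this; exact this rfl
    have hz : ∀ i, i ∉ I → k i = 0 := by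
      intro i hi
      have h2 := right_ne_zero_of_mul (right_ne_zero_of_mul hne)
      have := Finset.prod_ne_zero_iff.mp h2 i (by simp [hi])
      by_contra h; rw [if_neg h] at this; exact this rfl
    have hdiv' : ∀ i, p ^ m - 1 ∣ k i := fun i => by
      by_cases hi : i ∈ I
      · exact hdiv i hi
      · rw [hz i hi]; exact dvd_zero _
    choose f hf using hdiv'
    let u : ι →₀ ℕ := Finsupp.equivFunOnFinite.symm f
    have hui : ∀ i, u i = f i := fun i => rfl
    have hku : p ^ m • u - u = k := by
      ext i; rw [hsub, hui, ← hf]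
    have huB : u ≤ boxB D I := by
      intro i
      rw [boxB_apply]
      split_ifs with hi
      · have h2 := coeff_Gm_bound p hp G D hD m k (MvPolynomial.mem_support_iff.mp hk) i
        rw [hf, ← hui] at h2
        have h3 : (p ^ m - 1) * u i ≤ (p ^ m - 1) * D := by rw [Nat.sub_mul _ _ D, one_mul]; omega
        exact Nat.le_of_mul_le_mul_left h3 (by omega)
      · have h2 := hz i hi
        rw [hf, ← hui] at h2
        rcases Nat.mul_eq_zero.mp h2 with h | h <;> omega
    refine ⟨⟨u, Finset.mem_Iic.mpr huB⟩, Finset.mem_univ _, ?_, hku⟩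
    rw [hterm, ← hprod u huB]
    rw [mul_comm, hku]; exact hne
  · intro u _ _
    rw [hterm, hprod u.1 (Finset.mem_Iic.mp u.2), mul_comm]
end trace2
end PRU
end

section
open Polynomial

set_option linter.unusedSectionVars false
namespace PRU
section bd
variable {ι L : Type*} [Fintype ι] [DecidableEq ι] [NormedField L] [IsUltrametricDist L]

/-- geometric decay of coefficients -/
def Bd (r : ℝ) (G : MvPolynomial ι L) : Prop := ∀ u, ‖G.coeff u‖ ≤ r ^ u.degree

theorem Bd.one (r : ℝ) (hr : 0 ≤ r) : Bd r (1 : MvPolynomial ι L) := by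
  intro u
  rw [MvPolynomial.coeff_one]
  split_ifs with h
  · subst h; simp
  · simpa using pow_nonneg hr _

theorem Bd.mul {r : ℝ} (hr : 0 ≤ r) {G H : MvPolynomial ι L} (hG : Bd r G) (hH : Bd r H) : Bd r (G * H) := by
  intro u
  rw [MvPolynomial.coeff_mul]
  refine IsUltrametricDist.norm_sum_le_of_forall_le_of_nonneg (pow_nonneg hr _) fun x hx => ?_
  rw [Finset.HasAntidiagonal.mem_antidiagonal] at hx
  rw [norm_mul, ← hx, map_add, pow_add]
  exact mul_le_mul (hG _) (hH _) (norm_nonneg _) (pow_nonneg hr _)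

theorem Bd.pow {r : ℝ} (hr : 0 ≤ r) {G : MvPolynomial ι L} (hG : Bd r G) (n : ℕ) : Bd r (G ^ n) := by
  induction n with
  | zero => rw [pow_zero]; exact Bd.one r hr
  | succ n ih => rw [pow_succ]; exact ih.mul hr hG

theorem Bd.prod {κ : Type*} {r : ℝ} (hr : 0 ≤ r) (s : Finset κ) (G : κ → MvPolynomial ι L)
    (hG : ∀ i ∈ s, Bd r (G i)) : Bd r (∏ i ∈ s, G i) := by
  classical
  induction s using Finset.induction_on with
  | empty => rw [Finset.prod_empty]; exact Bd.one r hr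
  | insert a s ha ih =>
    rw [Finset.prod_insert ha]
    exact (hG a (by simp)).mul hr (ih fun i hi => hG i (by simp [hi]))

theorem Bd.aeval_monomial {r : ℝ} (hr : 0 ≤ r) (hr1 : r ≤ 1) (d : ℕ) (θ : L[X]) (hθ : ∀ n, ‖θ.coeff n‖ ≤ (r ^ d) ^ n)
    (I : ι →₀ ℕ) (hI : I.degree ≤ d) : Bd r (Polynomial.aeval (MvPolynomial.monomial I (1 : L)) θ) := by
  intro u
  rw [Polynomial.aeval_eq_sum_range, MvPolynomial.coeff_sum]
  refine IsUltrametricDist.norm_sum_le_of_forall_le_of_nonneg (pow_nonneg hr _) fun j _ => ?_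
  rw [MvPolynomial.monomial_pow, one_pow, MvPolynomial.coeff_smul, MvPolynomial.coeff_monomial]
  split_ifs with h
  · rw [smul_eq_mul, mul_one]
    refine (hθ j).trans ?_
    rw [← pow_mul]
    refine pow_le_pow_of_le_one hr hr1 ?_
    rw [← h, map_nsmul, smul_eq_mul, mul_comm]
    exact Nat.mul_le_mul_right _ hI
  · simpa using pow_nonneg hr _

theorem norm_prod_sub_prod {κ : Type*} (s : Finset κ) (a b : κ → L) (ε : ℝ) (hε : 0 ≤ ε) (ha : ∀ i ∈ s, ‖a i‖ ≤ 1)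
    (hb : ∀ i ∈ s, ‖b i‖ ≤ 1) (h : ∀ i ∈ s, ‖a i - b i‖ ≤ ε) : ‖∏ i ∈ s, a i - ∏ i ∈ s, b i‖ ≤ ε := by
  classical
  induction s using Finset.induction_on with
  | empty => simpa using hε
  | insert i s hi ih =>
    rw [Finset.prod_insert hi, Finset.prod_insert hi]
    have e : a i * ∏ j ∈ s, a j - b i * ∏ j ∈ s, b j =
        a i * (∏ j ∈ s, a j - ∏ j ∈ s, b j) + (a i - b i) * ∏ j ∈ s, b j := by ring
    rw [e]
    refine (IsUltrametricDist.norm_add_le_max _ _).trans (max_le ?_ ?_)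
    · rw [norm_mul]
      have h1 := ih (fun j hj => ha j (by simp [hj])) (fun j hj => hb j (by simp [hj])) (fun j hj => h j (by simp [hj]))
      have h2 := ha i (by simp)
      calc _ ≤ 1 * ε := mul_le_mul h2 h1 (norm_nonneg _) zero_le_one
        _ = ε := one_mul _
    · rw [norm_mul, norm_prod]
      have h1 : ∏ j ∈ s, ‖b j‖ ≤ 1 := Finset.prod_le_one (fun _ _ => norm_nonneg _) fun j hj => hb j (by simp [hj])
      calc _ ≤ ε * 1 := mul_le_mul (h i (by simp)) h1 (Finset.prod_nonneg fun _ _ => norm_nonneg _) hε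
        _ = ε := mul_one _

theorem norm_pow_sub_pow (a b : L) (ε : ℝ) (hε : 0 ≤ ε) (ha : ‖a‖ ≤ 1) (hb : ‖b‖ ≤ 1) (h : ‖a - b‖ ≤ ε) (n : ℕ) :
    ‖a ^ n - b ^ n‖ ≤ ε := by
  have := norm_prod_sub_prod (Finset.range n) (fun _ => a) (fun _ => b) ε hε (fun _ _ => ha) (fun _ _ => hb) fun _ _ => h
  simpa using this

open Classical in
theorem eig_dw [IsAlgClosed L] (p : ℕ) (hp : 2 ≤ p) (hpn : ‖(p : L)‖ = (p : ℝ)⁻¹) (d : ℕ) (r : ℝ) (hr : 0 < r)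
    (hr1 : r ≤ 1) (hd : (r ^ d) ^ (p - 1) ≤ (p : ℝ)⁻¹) (G : MvPolynomial ι L) (hG : Bd r G) (B : ι →₀ ℕ) (W : ℕ) (hW : 0 < W) :
    ((dw p G B).charpoly.roots.filter fun l => ((p : ℝ) ^ W)⁻¹ ≤ ‖l‖).card ≤ 3 * (d * (2 * W + 1)) ^ Fintype.card ι := by
  have hp1 : (1 : ℝ) < p := by exact_mod_cast hp
  have hp0 : (0 : ℝ) < p := by linarith
  have hx : ‖(p : L)⁻¹‖ = p := by rw [norm_inv, hpn, inv_inv]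
  have h := eig_count (dw p G B) (fun u => r ^ u.1.degree) (fun u => (r ^ u.1.degree) ^ (p - 1))
    (fun u => pow_pos hr _) (fun u => by positivity) (fun u => pow_le_one₀ (by positivity) (pow_le_one₀ hr.le hr1))
    (by
      intro u w
      rw [← pow_succ', Nat.sub_add_cancel (by omega)]
      simp only [dw, Matrix.of_apply]
      split_ifs with hle
      · calc _ ≤ r ^ (p • u.1 - w.1).degree * r ^ w.1.degree := mul_le_mul_of_nonneg_right (hG _) (by positivity)
          _ = _ := by
            rw [← pow_add, ← map_add, tsub_add_cancel_of_le hle, map_nsmul, smul_eq_mul, mul_comm p, pow_mul]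
      · rw [norm_zero, zero_mul]; positivity) (p : L)⁻¹ (by rw [hx]; exact hp1) W hW
  rw [hx] at h
  have e : ((dw p G B).charpoly.roots.filter fun l => ((p : ℝ) ^ W)⁻¹ ≤ ‖l‖) =
      ((dw p G B).charpoly.roots.filter fun l => 1 ≤ ‖l‖ * (p : ℝ) ^ W) := by
    refine Multiset.filter_congr fun l _ => ?_
    rw [inv_le_iff_one_le_mul₀ (by positivity)]
  rw [e]
  refine h.trans (Nat.mul_le_mul_left _ ?_)
  have hlt : ∀ u ∈ (Finset.univ.filter fun u : Finset.Iic B => 1 < (r ^ u.1.degree) ^ (p - 1) * (p : ℝ) ^ (2 * W + 1)),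
      u.1.degree < d * (2 * W + 1) := by
    intro u hu
    rw [Finset.mem_filter] at hu
    by_contra hge
    push Not at hge
    have h2 : (1 : ℝ) < ((r ^ u.1.degree) ^ (p - 1) * (p : ℝ) ^ (2 * W + 1)) ^ d ∨ d = 0 := by
      rcases Nat.eq_zero_or_pos d with h0 | h0
      · exact Or.inr h0
      · exact Or.inl (one_lt_pow₀ hu.2 h0.ne')
    rcases h2 with h2 | h2
    · have h3 : ((r ^ u.1.degree) ^ (p - 1) * (p : ℝ) ^ (2 * W + 1)) ^ d =
          ((r ^ d) ^ (p - 1)) ^ u.1.degree * (p : ℝ) ^ (d * (2 * W + 1)) := by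
        rw [mul_pow]; simp only [← pow_mul]; congr 2 <;> ring
      rw [h3] at h2
      have h4 : ((r ^ d) ^ (p - 1)) ^ u.1.degree ≤ ((p : ℝ)⁻¹) ^ (d * (2 * W + 1)) :=
        (pow_le_pow_left₀ (by positivity) hd _).trans
          (pow_le_pow_of_le_one (by positivity) (inv_le_one_of_one_le₀ hp1.le) hge)
      have h5 : ((p : ℝ)⁻¹) ^ (d * (2 * W + 1)) * (p : ℝ) ^ (d * (2 * W + 1)) = 1 := by
        rw [← mul_pow, inv_mul_cancel₀ hp0.ne', one_pow]
      have := mul_le_mul_of_nonneg_right h4 (by positivity : (0 : ℝ) ≤ (p : ℝ) ^ (d * (2 * W + 1)))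
      linarith
    · subst h2
      rw [pow_zero, one_pow] at hd
      have := inv_lt_one_of_one_lt₀ hp1
      linarith
  calc _ ≤ (Finset.univ : Finset (ι → Fin (d * (2 * W + 1)))).card := by
        rcases Nat.eq_zero_or_pos (d * (2 * W + 1)) with h0 | h0
        · rw [Finset.card_eq_zero.mpr]
          · exact Nat.zero_le _
          · rw [Finset.eq_empty_iff_forall_notMem]
            intro u hu
            have := hlt u hu
            omega
        · refine Finset.card_le_card_of_injOn (fun u i => ⟨u.1 i % (d * (2 * W + 1)), Nat.mod_lt _ h0⟩) (by simp) ?_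
          intro u hu w hw he
          apply Subtype.ext
          ext i
          have h1 := congrArg Fin.val (congrFun he i)
          have hu' := (Finsupp.le_degree i u.1).trans_lt (hlt u (by simpa using hu))
          have hw' := (Finsupp.le_degree i w.1).trans_lt (hlt w (by simpa using hw))
          simp only [Nat.mod_eq_of_lt hu', Nat.mod_eq_of_lt hw'] at h1
          exact h1
    _ = _ := by simp

theorem eig_le_one (n : Type*) [Fintype n] [DecidableEq n] (A : Matrix n n L) (hA : ∀ i j, ‖A i j‖ ≤ 1)
    (l : L) (hl : l ∈ A.charpoly.roots) : ‖l‖ ≤ 1 := by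
  have h1 := (Polynomial.mem_roots'.mp hl).2
  rw [Polynomial.IsRoot.def, Matrix.eval_charpoly] at h1
  obtain ⟨v, hv, hv0⟩ := Matrix.exists_mulVec_eq_zero_iff.mpr h1
  obtain ⟨i0, hi0⟩ := Function.ne_iff.mp hv
  obtain ⟨i, -, hi⟩ := Finset.exists_max_image Finset.univ (fun i => ‖v i‖) ⟨i0, Finset.mem_univ _⟩
  have hvi : 0 < ‖v i‖ := (norm_pos_iff.mpr hi0).trans_le (hi i0 (Finset.mem_univ _))
  have h2 := congrFun hv0 i
  rw [Matrix.sub_mulVec, Pi.sub_apply, Matrix.scalar_apply, Matrix.mulVec_diagonal, Pi.zero_apply, sub_eq_zero] at h2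
  have h3 : ‖l‖ * ‖v i‖ ≤ ‖v i‖ := by
    rw [← norm_mul, h2, Matrix.mulVec, dotProduct]
    refine IsUltrametricDist.norm_sum_le_of_forall_le_of_nonneg (norm_nonneg _) fun j _ => ?_
    rw [norm_mul]
    calc _ ≤ 1 * ‖v i‖ := mul_le_mul (hA _ _) (hi j (Finset.mem_univ _)) (norm_nonneg _) zero_le_one
      _ = _ := one_mul _
  by_contra h
  push Not at h
  have := (lt_mul_iff_one_lt_left hvi).mpr h
  linarith

/-- The trace formula sum written as a multiset of weighted eigenvalue powers. -/
noncomputable def evM [IsAlgClosed L] (p : ℕ) (G : MvPolynomial ι L) (D : ℕ) : Multiset (L × L) :=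
  ∑ I ∈ (Finset.univ : Finset ι).powerset, ∑ j ∈ Finset.range (I.card + 1),
    (dw p G (boxB D I)).charpoly.roots.map fun l =>
      (((-1) ^ (I.card - j) * (I.card.choose j : L)), (p : L) ^ j * l)

theorem evM_sum [IsAlgClosed L] (p : ℕ) (G : MvPolynomial ι L) (D : ℕ) (m : ℕ) :
    ((evM p G D).map fun x => x.1 * x.2 ^ m).sum =
      ∑ I ∈ (Finset.univ : Finset ι).powerset, ((p : L) ^ m - 1) ^ I.card * ((dw p G (boxB D I)) ^ m).trace := by
  have hom : ∀ M : Multiset (L × L), (M.map fun x => x.1 * x.2 ^ m).sum =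
    (Multiset.sumAddMonoidHom.comp (Multiset.mapAddMonoidHom fun x : L × L => x.1 * x.2 ^ m)) M := fun M => rfl
  rw [hom, evM, map_sum]
  refine Finset.sum_congr rfl fun I _ => ?_
  rw [map_sum, trace_pow_eq, sub_eq_add_neg, add_pow, Finset.sum_mul]
  refine Finset.sum_congr rfl fun j _ => ?_
  rw [← hom, Multiset.map_map, ← Multiset.sum_map_mul_left]
  refine congrArg _ (Multiset.map_congr rfl fun l _ => ?_)
  simp only [Function.comp_apply]
  rw [mul_pow, ← pow_mul, ← pow_mul, mul_comm j m]
  ring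

theorem mem_evM [IsAlgClosed L] (p : ℕ) (G : MvPolynomial ι L) (D : ℕ) (x : L × L) (hx : x ∈ evM p G D) :
    ∃ I : Finset ι, ∃ j, ∃ l ∈ (dw p G (boxB D I)).charpoly.roots,
      x = (((-1) ^ (I.card - j) * (I.card.choose j : L)), (p : L) ^ j * l) := by
  rw [evM] at hx
  obtain ⟨I, _, hx⟩ := Multiset.mem_sum.mp hx
  obtain ⟨j, _, hx⟩ := Multiset.mem_sum.mp hx
  obtain ⟨l, hl, rfl⟩ := Multiset.mem_map.mp hx
  exact ⟨I, j, l, hl, rfl⟩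

open Classical in
theorem evM_card [IsAlgClosed L] (p : ℕ) (hpn : ‖(p : L)‖ ≤ 1) (G : MvPolynomial ι L) (D : ℕ) (ρ : ℝ) (K : ℕ)
    (hK : ∀ B, ((dw p G B).charpoly.roots.filter fun l => ρ ≤ ‖l‖).card ≤ K) :
    ((evM p G D).filter fun x => ρ ≤ ‖x.2‖).card ≤ 2 ^ Fintype.card ι * ((Fintype.card ι + 1) * K) := by
  have hom : ∀ M : Multiset (L × L), (M.filter fun x => ρ ≤ ‖x.2‖).card =
      (Multiset.countPAddMonoidHom fun x : L × L => ρ ≤ ‖x.2‖) M :=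
    fun M => (Multiset.countP_eq_card_filter _ _).symm
  rw [hom, evM, map_sum]
  calc _ ≤ ∑ I ∈ (Finset.univ : Finset ι).powerset, ((Fintype.card ι + 1) * K) := by
        refine Finset.sum_le_sum fun I _ => ?_
        rw [map_sum]
        calc _ ≤ ∑ j ∈ Finset.range (I.card + 1), K := by
              refine Finset.sum_le_sum fun j _ => ?_
              refine le_trans ?_ (hK (boxB D I))
              rw [← hom, Multiset.filter_map, Multiset.card_map]
              refine Multiset.card_le_card (Multiset.monotone_filter_right _ fun l hl => ?_)
              simp only [Function.comp_apply] at hl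
              refine hl.trans ?_
              rw [norm_mul, norm_pow]
              exact mul_le_of_le_one_left (norm_nonneg _) (pow_le_one₀ (norm_nonneg _) hpn)
          _ ≤ _ := by
              rw [Finset.sum_const, Finset.card_range, smul_eq_mul]
              exact Nat.mul_le_mul_right _ (Nat.succ_le_succ (Finset.card_le_univ I))
    _ = _ := by simp
end bd
end PRU
end

section
open Polynomial

set_option linter.unusedSectionVars false
namespace PRU
section dwork
variable {ι : Type*} [Fintype ι] [DecidableEq ι] (p : ℕ) [hp : Fact p.Prime]

noncomputable instance gfFintype (m : ℕ) : Fintype (GaloisField p m) := Fintype.ofFinite _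

/-- the splitting polynomial attached to `F` -/
noncomputable def GF' (θ : (PadicAlgCl p)[X]) (F : MvPolynomial ι ℤ) : MvPolynomial ι (PadicAlgCl p) :=
  ∏ I ∈ F.support, (Polynomial.aeval (MvPolynomial.monomial I (1 : PadicAlgCl p)) θ) ^ (((F.coeff I : ℤ) : ZMod p)).val

theorem eval_GF' (θ : (PadicAlgCl p)[X]) (F : MvPolynomial ι ℤ) (v : ι → PadicAlgCl p) :
    MvPolynomial.eval v (GF' p θ F) =
      ∏ I ∈ F.support, (θ.eval (∏ i, v i ^ I i)) ^ (((F.coeff I : ℤ) : ZMod p)).val := by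
  rw [GF', map_prod]
  refine Finset.prod_congr rfl fun I _ => ?_
  rw [map_pow]
  congr 1
  rw [← MvPolynomial.coe_aeval_eq_eval, RingHom.coe_coe, ← Polynomial.aeval_algHom_apply, MvPolynomial.aeval_monomial, map_one, one_mul, Polynomial.coe_aeval_eq_eval, Finsupp.prod_fintype]
  intro i; simp

theorem trace_char {ζ : PadicAlgCl p} (hζ : IsPrimitiveRoot ζ p) {m : ℕ} (F : MvPolynomial ι ℤ) (x : ι → GaloisField p m) :
    ζ ^ (Algebra.trace (ZMod p) (GaloisField p m) (MvPolynomial.aeval x F)).val =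
      ∏ I ∈ F.support, (ζ ^ (Algebra.trace (ZMod p) (GaloisField p m) (∏ i, x i ^ I i)).val) ^ (((F.coeff I : ℤ) : ZMod p)).val := by
  have : NeZero p := ⟨hp.out.ne_zero⟩
  let ψ := AddChar.zmodChar p hζ.pow_eq_one
  have hψ : ∀ a, ζ ^ (ZMod.val a) = ψ a := fun a => rfl
  simp only [hψ]
  simp only [← AddChar.map_nsmul_eq_pow]
  have hsum : ∀ (s : Finset (ι →₀ ℕ)) (f : (ι →₀ ℕ) → ZMod p), ψ (∑ i ∈ s, f i) = ∏ i ∈ s, ψ (f i) := by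
    intro s f
    exact map_prod ψ.toMonoidHom (fun i => Multiplicative.ofAdd (f i)) s
  rw [← hsum]
  congr 1
  rw [MvPolynomial.aeval_def, MvPolynomial.eval₂_eq', map_sum]
  refine Finset.sum_congr rfl fun I _ => ?_
  have e : (algebraMap ℤ (GaloisField p m)) (F.coeff I) * ∏ i, x i ^ I i = (((F.coeff I : ℤ) : ZMod p)) • ∏ i, x i ^ I i := by
    rw [Algebra.smul_def]; simp
  rw [e, map_smul, nsmul_eq_mul, smul_eq_mul, ZMod.natCast_val, ZMod.cast_id', id]

theorem approx {ζ : PadicAlgCl p} (hζ : IsPrimitiveRoot ζ p) (θ : (PadicAlgCl p)[X]) (N m : ℕ)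
    (τ : GaloisField p m →*₀ PadicAlgCl p)
    (hτ : ∀ x, ‖∏ i ∈ Finset.range m, θ.eval (τ x ^ p ^ i) -
        ζ ^ (Algebra.trace (ZMod p) (GaloisField p m) x).val‖ ≤ ‖ζ - 1‖ ^ N)
    (F : MvPolynomial ι ℤ) (x : ι → GaloisField p m) :
    ‖ζ ^ (Algebra.trace (ZMod p) (GaloisField p m) (MvPolynomial.aeval x F)).val -
      MvPolynomial.eval (fun i => τ (x i)) (Gm p (GF' p θ F) m)‖ ≤ ‖ζ - 1‖ ^ N := by
  have hζ1 : ∀ k : ℕ, ‖ζ ^ k‖ = 1 := by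
    intro k
    have : ‖ζ‖ ^ p = 1 := by rw [← norm_pow, hζ.pow_eq_one, norm_one]
    rw [norm_pow, (pow_eq_one_iff_of_nonneg (norm_nonneg _) hp.out.ne_zero).mp this, one_pow]
  have hε1 : ‖ζ - 1‖ ^ N ≤ 1 := pow_le_one₀ (norm_nonneg _) (zeta_norm_lt p hζ).le
  have e : MvPolynomial.eval (fun i => τ (x i)) (Gm p (GF' p θ F) m) =
      ∏ I ∈ F.support, (∏ i ∈ Finset.range m, θ.eval (τ (∏ j, x j ^ I j) ^ p ^ i)) ^ (((F.coeff I : ℤ) : ZMod p)).val := by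
    rw [Gm, map_prod]
    simp only [MvPolynomial.eval_expand, eval_GF']
    rw [Finset.prod_comm]
    refine Finset.prod_congr rfl fun I _ => ?_
    rw [← Finset.prod_pow]
    refine Finset.prod_congr rfl fun i _ => ?_
    congr 2
    rw [map_prod, ← Finset.prod_pow]
    refine Finset.prod_congr rfl fun j _ => ?_
    rw [map_pow, Pi.pow_apply, ← pow_mul, ← pow_mul, mul_comm]
  rw [e, trace_char p hζ, norm_sub_rev]
  have ha : ∀ y, ‖∏ i ∈ Finset.range m, θ.eval (τ y ^ p ^ i)‖ ≤ 1 := by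
    intro y
    rw [← sub_add_cancel (∏ i ∈ Finset.range m, θ.eval (τ y ^ p ^ i)) (ζ ^ (Algebra.trace (ZMod p) (GaloisField p m) y).val)]
    refine (IsUltrametricDist.norm_add_le_max _ _).trans (max_le ((hτ y).trans hε1) (hζ1 _).le)
  refine norm_prod_sub_prod _ _ _ _ (by positivity) ?_ ?_ ?_
  · intro I _
    rw [norm_pow]; exact pow_le_one₀ (norm_nonneg _) (ha _)
  · intro I _
    rw [norm_pow, hζ1, one_pow]
  · intro I _
    exact norm_pow_sub_pow _ _ _ (by positivity) (ha _) (hζ1 _).le (hτ _) _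

theorem intcast_norm (z : ℤ) : ‖(z : PadicAlgCl p)‖ = ‖(z : ℚ_[p])‖ := by
  have := PadicAlgCl.norm_extends p (z : ℚ_[p])
  rw [← this]; simp

theorem int_norm_low (z : ℤ) (hz : z ≠ 0) : 1 ≤ |(z : ℝ)| * ‖(z : PadicAlgCl p)‖ := by
  rw [intcast_norm]
  have h1 : ‖(z : ℚ_[p])‖ = (p : ℝ) ^ (-(padicValInt p z : ℤ)) := by
    rw [← Rat.cast_intCast, Padic.eq_padicNorm, padicNorm.eq_zpow_of_nonzero (by exact_mod_cast hz), padicValRat.of_int]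
    push_cast; rfl
  have hp0 : (0 : ℝ) < p := by exact_mod_cast hp.out.pos
  rw [h1, zpow_neg, zpow_natCast, ← div_eq_mul_inv, one_le_div (by positivity)]
  have h2 : (p : ℤ) ^ padicValInt p z ∣ z := padicValInt_dvd z
  have h3 := Int.le_of_dvd (abs_pos.mpr hz) ((dvd_abs _ _).mpr h2)
  exact_mod_cast h3

theorem dwork_rec (n d : ℕ) : ∃ B, ∀ (ι : Type) [Fintype ι] [DecidableEq ι] (_ : Fintype.card ι = n) (p : ℕ) [Fact p.Prime] (F : MvPolynomial ι ℤ),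
    (∀ I ∈ F.support, I.degree ≤ d) → ∀ S : ℕ → ℤ, (∀ m, 1 ≤ m → |S m| ≤ (p : ℤ) ^ (n * m)) →
    (∀ ζ : PadicAlgCl p, IsPrimitiveRoot ζ p → ∀ m, m ≠ 0 → (S m : PadicAlgCl p) =
      ∑ x : ι → GaloisField p m, ζ ^ (Algebra.trace (ZMod p) (GaloisField p m) (MvPolynomial.aeval x F)).val) →
    Rec B (fun m => (S m : ℚ)) := by
  classical
  set W := 6 * n + 3 with hW
  set d' := d + 1 with hd'
  set K := 2 ^ n * ((n + 1) * (3 * (d' * (2 * W + 1)) ^ n)) with hK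
  have hK0 : 0 < K := by positivity
  refine ⟨2 * K - 1 + (2 * K + (2 * K - 1)), fun ι _ _ hn p hp F hF S hS hS2 => ?_⟩
  subst hn
  refine Rec.of_hankel fun s hs => ?_
  rw [Nat.sub_add_cancel (by omega)]
  have hp2 : 2 ≤ p := hp.out.two_le
  have hp1 : (1 : ℝ) < p := by exact_mod_cast hp2
  refine hankel_int_eq_zero (L := PadicAlgCl p) p hp2 (int_norm_low p) (fun z => by
    rw [intcast_norm]; exact Padic.norm_int_le_one z) (Fintype.card ι) K s hK0 S hS hs ?_
  obtain ⟨ζ, hζ, hspl⟩ := splitting p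
  have hz1 := zeta_norm_lt p hζ
  have hz0 : 0 < ‖ζ - 1‖ := by
    rw [norm_pos_iff, sub_ne_zero]; exact hζ.ne_one hp.out.one_lt
  obtain ⟨N0, hN0⟩ := exists_pow_lt_of_lt_one (show 0 < (((p : ℝ) ^ W)⁻¹) ^ s by positivity) hz1
  obtain ⟨θ, hθ, hθ2⟩ := hspl (N0 + 2) (by omega)
  obtain ⟨r, hr0, hr⟩ : ∃ r : ℝ, 0 < r ∧ r ^ d' = ‖ζ - 1‖ :=
    ⟨‖ζ - 1‖ ^ ((d' : ℝ)⁻¹), Real.rpow_pos_of_pos hz0 _, Real.rpow_inv_natCast_pow hz0.le (by omega)⟩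
  have hr1 : r ≤ 1 := by
    by_contra h
    push Not at h
    have := one_lt_pow₀ h (show d' ≠ 0 by omega)
    linarith
  set G := GF' p θ F with hG
  have hGB : Bd r G := by
    refine Bd.prod hr0.le _ _ fun I hI => Bd.pow hr0.le ?_ _
    refine Bd.aeval_monomial hr0.le hr1 d' θ (fun n => by rw [hr]; exact hθ n) I ((hF I hI).trans (by omega))
  set D := ∑ i, G.degreeOf i with hDdef
  have hD : ∀ k, G.coeff k ≠ 0 → ∀ i, k i ≤ D := by
    intro k hk i
    exact (MvPolynomial.monomial_le_degreeOf i (MvPolynomial.mem_support_iff.mpr hk)).trans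
      (Finset.single_le_sum (f := fun i => G.degreeOf i) (fun _ _ => Nat.zero_le _) (Finset.mem_univ i))
  have hdw : ∀ B u w, ‖dw p G B u w‖ ≤ 1 := by
    intro B u w
    simp only [dw, Matrix.of_apply]
    split_ifs
    · exact (hGB _).trans (pow_le_one₀ hr0.le hr1)
    · simp
  have hpn : ‖(p : PadicAlgCl p)‖ ≤ 1 := by rw [norm_p_L]; exact inv_le_one_of_one_le₀ hp1.le
  refine ⟨evM p G D, ?_, ?_, ?_, ?_⟩
  · intro x hx
    obtain ⟨I, j, l, hl, rfl⟩ := mem_evM p G D x hx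
    have : ((-1) ^ (I.card - j) * (I.card.choose j : PadicAlgCl p)) = (((-1) ^ (I.card - j) * (I.card.choose j : ℤ) : ℤ) : PadicAlgCl p) := by
      push_cast; rfl
    simp only [this]
    rw [intcast_norm]; exact Padic.norm_int_le_one _
  · intro x hx
    obtain ⟨I, j, l, hl, rfl⟩ := mem_evM p G D x hx
    simp only [norm_mul, norm_pow]
    exact mul_le_one₀ (pow_le_one₀ (norm_nonneg _) hpn) (norm_nonneg _) (eig_le_one _ _ (hdw _) l hl)
  · refine evM_card p hpn G D _ _ fun B => ?_
    exact eig_dw p hp2 (norm_p_L p) d' r hr0 hr1 (by rw [hr]; exact zeta_norm p hζ) G hGB B W (by omega)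
  · intro m hm _
    have hm0 : m ≠ 0 := by omega
    obtain ⟨τ, hinj, -, hτ⟩ := hθ2 m hm0
    have hcard : Fintype.card (GaloisField p m) = p ^ m := by
      rw [← Nat.card_eq_fintype_card]; exact GaloisField.card p m hm0
    rw [evM_sum, ← sum_Gm p τ hinj hp2 G D hD m hm0 hcard, hS2 ζ hζ m hm0, ← Finset.sum_sub_distrib]
    refine IsUltrametricDist.norm_sum_le_of_forall_le_of_nonneg (by positivity) fun x _ => ?_
    refine (approx p hζ θ (N0 + 2) m τ hτ F x).trans ?_
    refine le_trans ?_ hN0.le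
    exact pow_le_pow_of_le_one hz0.le hz1.le (by omega)
end dwork
end PRU
end

section
open Polynomial

set_option linter.unusedSectionVars false
namespace PRU
section sys

theorem char_sum_system {p : ℕ} [hp : Fact p.Prime] {C : Type*} [Field C] {ζ : C} (hζ : IsPrimitiveRoot ζ p)
    {K : Type} [Field K] [Fintype K] [DecidableEq K] [Algebra (ZMod p) K] (b : K) :
    ∑ y : K, ζ ^ (Algebra.trace (ZMod p) K (y * b)).val = if b = 0 then (Fintype.card K : C) else 0 := by
  classical
  have : NeZero p := ⟨hp.out.ne_zero⟩
  let ψ0 := AddChar.zmodChar p hζ.pow_eq_one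
  let ψ : AddChar K C := ψ0.compAddMonoidHom (Algebra.trace (ZMod p) K).toAddMonoidHom
  have hψ : ∀ x, ζ ^ (Algebra.trace (ZMod p) K x).val = ψ x := fun x => rfl
  simp only [hψ]
  have hne : ψ ≠ 1 := by
    intro h
    obtain ⟨x, hx⟩ := Algebra.trace_surjective (ZMod p) K 1
    have h1 : ψ x = 1 := by rw [h]; rfl
    rw [← hψ, hx, ZMod.val_one, pow_one] at h1
    exact hζ.ne_one hp.out.one_lt h1
  have := AddChar.sum_mulShift b (AddChar.IsPrimitive.of_ne_one hne)
  push_cast at this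
  exact this

/-- number of solutions of a system of integer polynomial equations -/
noncomputable def sysCount {σ : Type} {κ : Type} (P : κ → MvPolynomial σ ℤ) (K : Type) [Field K] : ℕ :=
  Nat.card {x : σ → K // ∀ j, MvPolynomial.aeval x (P j) = 0}

theorem sys_rec {σ κ : Type} [Fintype σ] [Fintype κ] (P : κ → MvPolynomial σ ℤ) :
    ∃ B, ∀ (p : ℕ) [Fact p.Prime], Rec B (fun m => (sysCount P (GaloisField p m) : ℚ)) := by
  classical
  let F : MvPolynomial (σ ⊕ κ) ℤ := ∑ j, MvPolynomial.X (Sum.inr j) * MvPolynomial.rename Sum.inl (P j)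
  obtain ⟨B, hB⟩ := dwork_rec (Fintype.card (σ ⊕ κ)) F.totalDegree
  refine ⟨B, fun p hp => ?_⟩
  have hp0 : (p : ℚ) ≠ 0 := by exact_mod_cast hp.out.ne_zero
  set r := Fintype.card κ with hr
  have hcard : ∀ m, m ≠ 0 → Fintype.card (GaloisField p m) = p ^ m := fun m hm => by
    rw [← Nat.card_eq_fintype_card]; exact GaloisField.card p m hm
  have h := hB (σ ⊕ κ) rfl p F (fun I hI => ?_) (fun m => (p : ℤ) ^ (r * m) * sysCount P (GaloisField p m)) ?_ ?_
  · have h2 := h.twist (((p : ℚ) ^ r)⁻¹) (inv_ne_zero (pow_ne_zero _ hp0))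
    convert h2 using 2 with m
    push_cast
    rw [inv_pow, ← pow_mul, ← mul_assoc, inv_mul_cancel₀ (pow_ne_zero _ hp0), one_mul]
  · have := MvPolynomial.le_totalDegree hI
    rwa [Finsupp.degree_eq_sum, ← Finsupp.sum_fintype _ (fun _ e => e) (by simp)]
  · intro m hm
    rw [abs_of_nonneg (by positivity), Fintype.card_sum, add_comm, add_mul, pow_add]
    refine mul_le_mul_of_nonneg_left ?_ (by positivity)
    have h1 : sysCount P (GaloisField p m) ≤ Nat.card (σ → GaloisField p m) :=
      Nat.card_le_card_of_injective _ Subtype.val_injective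
    rw [Nat.card_eq_fintype_card, Fintype.card_fun, hcard m (by omega), ← pow_mul, mul_comm m] at h1
    exact_mod_cast h1
  · intro ζ hζ m hm
    push_cast
    rw [← (Equiv.sumArrowEquivProdArrow σ κ (GaloisField p m)).symm.sum_comp, Fintype.sum_prod_type]
    have h1 : ∀ x : σ → GaloisField p m, ∑ y : κ → GaloisField p m,
        ζ ^ (Algebra.trace (ZMod p) (GaloisField p m) (MvPolynomial.aeval
          ((Equiv.sumArrowEquivProdArrow σ κ (GaloisField p m)).symm (x, y)) F)).val =
        if (∀ j, MvPolynomial.aeval x (P j) = 0) then (p : PadicAlgCl p) ^ (r * m) else 0 := by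
      intro x
      have e : ∀ y : κ → GaloisField p m, ζ ^ (Algebra.trace (ZMod p) (GaloisField p m) (MvPolynomial.aeval
          ((Equiv.sumArrowEquivProdArrow σ κ (GaloisField p m)).symm (x, y)) F)).val =
          ∏ j, ζ ^ (Algebra.trace (ZMod p) (GaloisField p m) (y j * MvPolynomial.aeval x (P j))).val := by
        intro y
        have hF : MvPolynomial.aeval ((Equiv.sumArrowEquivProdArrow σ κ (GaloisField p m)).symm (x, y)) F =
            ∑ j, y j * MvPolynomial.aeval x (P j) := by
          simp only [F, map_sum, map_mul, MvPolynomial.aeval_X, MvPolynomial.aeval_rename]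
          rfl
        have : NeZero p := ⟨hp.out.ne_zero⟩
        let ψ := AddChar.zmodChar p hζ.pow_eq_one
        have hψ : ∀ a, ζ ^ (ZMod.val a) = ψ a := fun a => rfl
        rw [hF, map_sum]
        simp only [hψ]
        exact map_prod ψ.toMonoidHom (fun i => Multiplicative.ofAdd _) _
      simp only [e]
      rw [← Fintype.piFinset_univ, ← Finset.prod_univ_sum (fun _ => Finset.univ)
        (fun j (y : GaloisField p m) => ζ ^ (Algebra.trace (ZMod p) (GaloisField p m) (y * MvPolynomial.aeval x (P j))).val)]
      simp only [char_sum_system hζ, hcard m hm]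
      split_ifs with h
      · rw [Finset.prod_congr rfl (g := fun _ => (p : PadicAlgCl p) ^ m)]
        · rw [Finset.prod_const, Finset.card_univ, ← pow_mul, mul_comm m]
        · intro j _; rw [if_pos (h j)]; push_cast; rfl
      · push Not at h
        obtain ⟨j, hj⟩ := h
        exact Finset.prod_eq_zero (Finset.mem_univ j) (if_neg hj)
    simp only [h1]
    rw [← Finset.sum_filter, Finset.sum_const, nsmul_eq_mul, mul_comm]
    congr 2
    rw [sysCount, Nat.card_eq_fintype_card, Fintype.card_subtype]
end sys
end PRU
end

section
open Polynomial

set_option linter.unusedSectionVars false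
namespace PRU

/-- bundled finite fields -/
structure FF where
  carrier : Type
  [fld : Field carrier]
  [fin : Fintype carrier]

attribute [instance] FF.fld FF.fin

instance : CoeSort FF Type := ⟨FF.carrier⟩

section fiber
variable {σ : Type}

/-- functions on points over finite fields -/
abbrev FFun (σ : Type) := (F : FF) → (σ → F) → ℚ

/-- fiber counting functions -/
def IsFib (h : FFun σ) : Prop :=
  ∃ (κ l : Type) (_ : Fintype κ) (_ : Fintype l) (P : l → MvPolynomial (σ ⊕ κ) ℤ), ∀ F x,
    h F x = Nat.card {z : κ → F // ∀ j, MvPolynomial.aeval (Sum.elim x z) (P j) = 0}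

theorem IsFib.one : IsFib (1 : FFun σ) := by
  refine ⟨Empty, Empty, inferInstance, inferInstance, Empty.elim, fun F x => ?_⟩
  have : Unique {z : Empty → F // ∀ j : Empty, MvPolynomial.aeval (Sum.elim x z) (Empty.elim j : MvPolynomial (σ ⊕ Empty) ℤ) = 0} :=
    ⟨⟨⟨Empty.elim, fun j => j.elim⟩⟩, fun z => Subtype.ext (Subsingleton.elim _ _)⟩
  rw [Nat.card_unique]; simp

theorem IsFib.mul {h h' : FFun σ} (H : IsFib h) (H' : IsFib h') : IsFib (h * h') := by
  obtain ⟨κ, l, _, _, P, hP⟩ := H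
  obtain ⟨κ', l', _, _, P', hP'⟩ := H'
  refine ⟨κ ⊕ κ', l ⊕ l', inferInstance, inferInstance,
    Sum.elim (fun j => MvPolynomial.rename (Sum.map id Sum.inl) (P j))
      (fun j => MvPolynomial.rename (Sum.map id Sum.inr) (P' j)), fun F x => ?_⟩
  simp only [Pi.mul_apply]
  rw [hP, hP', ← Nat.cast_mul, ← Nat.card_prod]
  congr 1
  refine Nat.card_congr
    { toFun := fun z => ⟨Sum.elim z.1.1 z.2.1, ?_⟩
      invFun := fun z => ⟨⟨fun i => z.1 (Sum.inl i), ?_⟩, ⟨fun i => z.1 (Sum.inr i), ?_⟩⟩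
      left_inv := fun z => by ext <;> rfl
      right_inv := fun z => by
        apply Subtype.ext; funext i; rcases i with i | i <;> rfl }
  · rintro (j | j)
    · simp only [Sum.elim_inl, MvPolynomial.aeval_rename]
      convert z.1.2 j using 3
      funext i; rcases i with i | i <;> rfl
    · simp only [Sum.elim_inr, MvPolynomial.aeval_rename]
      convert z.2.2 j using 3
      funext i; rcases i with i | i <;> rfl
  · intro j
    have := z.2 (Sum.inl j)
    simp only [Sum.elim_inl, MvPolynomial.aeval_rename] at this
    convert this using 3
    funext i; rcases i with i | i <;> rfl
  · intro j
    have := z.2 (Sum.inr j)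
    simp only [Sum.elim_inr, MvPolynomial.aeval_rename] at this
    convert this using 3
    funext i; rcases i with i | i <;> rfl

/-- the algebra of motivic functions -/
def fibMonoid (σ : Type) : Submonoid (FFun σ) where
  carrier := {h | IsFib h}
  one_mem' := IsFib.one
  mul_mem' := IsFib.mul

/-- the algebra generated by fibre counts -/
def motAlg (σ : Type) : Subalgebra ℚ (FFun σ) := Algebra.adjoin ℚ (fibMonoid σ : Set (FFun σ))

theorem motAlg_of_fib {h : FFun σ} (H : IsFib h) : h ∈ motAlg σ := Algebra.subset_adjoin H

open Classical in
theorem motAlg_rec [Fintype σ] {h : FFun σ} (H : h ∈ motAlg σ) :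
    ∃ B, ∀ (p : ℕ) [Fact p.Prime], Rec B (fun m => ∑ x, h ⟨GaloisField p m⟩ x) := by
  have H' : h ∈ Submodule.span ℚ {h : FFun σ | IsFib h} := by
    have := Algebra.adjoin_eq_span ℚ (fibMonoid σ : Set (FFun σ))
    rw [Submonoid.closure_eq] at this
    rw [← Subalgebra.mem_toSubmodule, motAlg, this] at H
    exact H
  induction H' using Submodule.span_induction with
  | mem h hh =>
    obtain ⟨κ, l, _, _, P, hP⟩ := hh
    obtain ⟨B, hB⟩ := sys_rec P
    refine ⟨B, fun p _ => ?_⟩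
    convert hB p using 2 with m
    simp only [hP]
    rw [sysCount, ← Nat.cast_sum]
    congr 1
    rw [← Nat.card_sigma]
    refine Nat.card_congr
      { toFun := fun z => ⟨Sum.elim z.1 z.2.1, z.2.2⟩
        invFun := fun z => ⟨fun i => z.1 (Sum.inl i), ⟨fun i => z.1 (Sum.inr i), ?_⟩⟩
        left_inv := fun z => rfl
        right_inv := fun z => by
          apply Subtype.ext; funext i; rcases i with i | i <;> rfl }
    intro j
    convert z.2 j using 3
    funext i; rcases i with i | i <;> rfl
  | zero => exact ⟨0, fun p _ => by simpa using Rec.zero⟩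
  | add a b ha hb iha ihb =>
    have hm : ∀ h ∈ Submodule.span ℚ {h : FFun σ | IsFib h}, h ∈ motAlg σ := fun h hh => by
      have : Submodule.span ℚ {h : FFun σ | IsFib h} ≤ (motAlg σ).toSubmodule :=
        Submodule.span_le.mpr fun h hh => motAlg_of_fib hh
      exact this hh
    obtain ⟨B, hB⟩ := iha (hm a ha)
    obtain ⟨B', hB'⟩ := ihb (hm b hb)
    refine ⟨B + B', fun p _ => ?_⟩
    convert (hB p).add (hB' p) using 2 with m
    simp only [Pi.add_apply, Finset.sum_add_distrib]
  | smul c a ha iha =>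
    have hm : ∀ h ∈ Submodule.span ℚ {h : FFun σ | IsFib h}, h ∈ motAlg σ := fun h hh => by
      have : Submodule.span ℚ {h : FFun σ | IsFib h} ≤ (motAlg σ).toSubmodule :=
        Submodule.span_le.mpr fun h hh => motAlg_of_fib hh
      exact this hh
    obtain ⟨B, hB⟩ := iha (hm a ha)
    refine ⟨B, fun p _ => ?_⟩
    convert (hB p).smul c using 2 with m
    simp only [Pi.smul_apply, smul_eq_mul, Finset.mul_sum]

/-- `f(x, ·)` has a root in `K`. -/
def HasRt {K : Type*} [Field K] (x : σ → K) (f : (MvPolynomial σ ℤ)[X]) : Prop :=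
  ∃ z : K, f.eval₂ (MvPolynomial.aeval x).toRingHom z = 0

/-- definability by finitely many root predicates over large finite fields -/
def DeltaDef (X : (F : FF) → (σ → F) → Prop) : Prop :=
  ∃ (q0 : ℕ) (S : Finset (MvPolynomial σ ℤ)[X]), ∀ (F F' : FF) (x : σ → F) (x' : σ → F'),
    q0 ≤ Fintype.card F → q0 ≤ Fintype.card F' → (∀ f ∈ S, HasRt x f ↔ HasRt x' f) → (X F x ↔ X F' x')

open Classical in
theorem root_mot (f : (MvPolynomial σ ℤ)[X]) : (fun F x => if HasRt x f then 1 else 0 : FFun σ) ∈ motAlg σ := by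
  -- vanishing of all coefficients
  let V : FFun σ := fun F x => if (∀ i, MvPolynomial.aeval x (f.coeff i) = 0) then 1 else 0
  have hV : V ∈ motAlg σ := by
    apply motAlg_of_fib
    refine ⟨Empty, Fin (f.natDegree + 1), inferInstance, inferInstance, fun i => MvPolynomial.rename Sum.inl (f.coeff i), fun F x => ?_⟩
    have e : ∀ (z : Empty → F) i, MvPolynomial.aeval (Sum.elim x z) (MvPolynomial.rename Sum.inl (f.coeff i)) =
        MvPolynomial.aeval x (f.coeff i) := fun z i => by
      rw [MvPolynomial.aeval_rename]; rfl
    simp only [e, V]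
    split_ifs with h
    · have : Unique {z : Empty → F // ∀ i : Fin (f.natDegree + 1), MvPolynomial.aeval x (f.coeff i) = 0} :=
        ⟨⟨⟨Empty.elim, fun j => h j⟩⟩, fun z => Subtype.ext (Subsingleton.elim _ _)⟩
      rw [Nat.card_unique]; simp
    · have : IsEmpty {z : Empty → F // ∀ i : Fin (f.natDegree + 1), MvPolynomial.aeval x (f.coeff i) = 0} := by
        refine ⟨fun z => h fun i => ?_⟩
        by_cases hi : i < f.natDegree + 1
        · exact z.2 ⟨i, hi⟩
        · rw [Polynomial.coeff_eq_zero_of_natDegree_lt (by omega), map_zero]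
      rw [Nat.card_of_isEmpty]; simp
  let N : FFun σ := fun F x => Nat.card {z : F // f.eval₂ (MvPolynomial.aeval x).toRingHom z = 0}
  have hN : N ∈ motAlg σ := by
    apply motAlg_of_fib
    refine ⟨Unit, Unit, inferInstance, inferInstance, fun _ =>
      f.eval₂ (MvPolynomial.rename Sum.inl).toRingHom (MvPolynomial.X (Sum.inr ())), fun F x => ?_⟩
    have e : ∀ z : Unit → F, MvPolynomial.aeval (Sum.elim x z)
        (f.eval₂ (MvPolynomial.rename Sum.inl).toRingHom (MvPolynomial.X (Sum.inr ()))) =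
        f.eval₂ (MvPolynomial.aeval x).toRingHom (z ()) := by
      intro z
      have := Polynomial.hom_eval₂ f (MvPolynomial.rename Sum.inl : MvPolynomial σ ℤ →ₐ[ℤ] MvPolynomial (σ ⊕ Unit) ℤ).toRingHom
        (MvPolynomial.aeval (Sum.elim x z) : MvPolynomial (σ ⊕ Unit) ℤ →ₐ[ℤ] F).toRingHom (MvPolynomial.X (Sum.inr ()))
      refine Eq.trans this ?_
      congr 1
      · apply MvPolynomial.ringHom_ext
        · intro r; simp
        · intro i; simp
      · simp
    simp only [e, N]
    congr 1
    refine Nat.card_congr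
      { toFun := fun z => ⟨fun _ => z.1, fun _ => z.2⟩
        invFun := fun z => ⟨z.1 (), z.2 ()⟩
        left_inv := fun z => rfl
        right_inv := fun z => rfl }
  let Lg : ℚ[X] := Lagrange.interpolate (Finset.range (f.natDegree + 1)) (fun i => (i : ℚ)) (fun i => if i = 0 then 0 else 1)
  have key : (fun F x => if HasRt x f then 1 else 0 : FFun σ) = V + (1 - V) * Polynomial.aeval N Lg := by
    funext F x
    have ea : (Polynomial.aeval N Lg) F x = Lg.eval (N F x) := by
      rw [Polynomial.aeval_eq_sum_range, Finset.sum_apply, Finset.sum_apply, Polynomial.eval_eq_sum_range]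
      simp
    rw [Pi.add_apply, Pi.add_apply, Pi.mul_apply, Pi.mul_apply, ea, Pi.sub_apply, Pi.sub_apply, Pi.one_apply, Pi.one_apply]
    by_cases hv : ∀ i, MvPolynomial.aeval x (f.coeff i) = 0
    · have hr : HasRt x f := ⟨0, by
        rw [Polynomial.eval₂_eq_sum_range]
        exact Finset.sum_eq_zero fun i _ => by
          have := hv i
          change MvPolynomial.aeval x (f.coeff i) * _ = 0
          rw [this, zero_mul]⟩
      simp only [V, if_pos hv, if_pos hr]; ring
    · simp only [V, if_neg hv]
      rw [sub_zero, one_mul, zero_add]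
      have hle : Nat.card {z : F // f.eval₂ (MvPolynomial.aeval x).toRingHom z = 0} ≤ f.natDegree := by
        set g := f.map (MvPolynomial.aeval x).toRingHom with hg
        have hg0 : g ≠ 0 := by
          intro h0
          apply hv
          intro i
          have := congrArg (fun t => t.coeff i) h0
          simpa [hg, Polynomial.coeff_map] using this
        have hsub : ∀ z, f.eval₂ (MvPolynomial.aeval x).toRingHom z = 0 → z ∈ g.roots.toFinset := by
          intro z hz
          rw [Multiset.mem_toFinset, Polynomial.mem_roots hg0, Polynomial.IsRoot.def, hg, Polynomial.eval_map]; exact hz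
        rw [Nat.card_eq_fintype_card, Fintype.card_subtype]
        calc _ ≤ g.roots.toFinset.card := Finset.card_le_card fun z hz => hsub z (Finset.mem_filter.mp hz).2
          _ ≤ g.roots.card := Multiset.toFinset_card_le _
          _ ≤ g.natDegree := Polynomial.card_roots' g
          _ ≤ _ := Polynomial.natDegree_map_le
      have hev := Lagrange.eval_interpolate_at_node (s := Finset.range (f.natDegree + 1)) (v := fun i : ℕ => (i : ℚ))
        (i := Nat.card {z : F // f.eval₂ (MvPolynomial.aeval x).toRingHom z = 0}) (fun i => if i = 0 then (0 : ℚ) else 1)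
        (fun a _ b _ h => Nat.cast_injective h) (Finset.mem_range.mpr (by omega))
      change _ = Polynomial.eval ((Nat.card {z : F // f.eval₂ (MvPolynomial.aeval x).toRingHom z = 0} : ℕ) : ℚ) Lg
      rw [hev]
      by_cases hr : HasRt x f
      · rw [if_pos hr, if_neg]
        obtain ⟨z, hz⟩ := hr
        have : Nonempty {z : F // f.eval₂ (MvPolynomial.aeval x).toRingHom z = 0} := ⟨⟨z, hz⟩⟩
        exact Nat.card_pos.ne'
      · rw [if_neg hr, if_pos]
        have : IsEmpty {z : F // f.eval₂ (MvPolynomial.aeval x).toRingHom z = 0} := ⟨fun z => hr ⟨z.1, z.2⟩⟩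
        exact Nat.card_of_isEmpty
  rw [key]
  refine add_mem hV (mul_mem (sub_mem (one_mem _) hV) ?_)
  rw [Polynomial.aeval_eq_sum_range]
  exact sum_mem fun i _ => Subalgebra.smul_mem _ (pow_mem hN i) _


open Classical in
theorem deltaDef_mot {X : (F : FF) → (σ → F) → Prop} (hX : DeltaDef X) : ∃ q0 : ℕ, ∃ h ∈ motAlg σ,
    ∀ (F : FF) (x : σ → F), q0 ≤ Fintype.card F → h F x = if X F x then 1 else 0 := by
  obtain ⟨q0, S, hS⟩ := hX
  let rt : (MvPolynomial σ ℤ)[X] → FFun σ := fun f F x => if HasRt x f then 1 else 0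
  let vec : (F : FF) → (σ → F) → Finset (MvPolynomial σ ℤ)[X] := fun F x => S.filter fun f => HasRt x f
  let T := S.powerset.filter fun t => ∃ (F : FF) (x : σ → F), q0 ≤ Fintype.card F ∧ vec F x = t ∧ X F x
  let h : FFun σ := ∑ t ∈ T, (∏ f ∈ t, rt f) * ∏ f ∈ S \ t, (1 - rt f)
  refine ⟨q0, h, ?_, ?_⟩
  · refine sum_mem fun t _ => mul_mem (prod_mem fun f _ => root_mot f) (prod_mem fun f _ => sub_mem (one_mem _) (root_mot f))
  · intro F x hF
    have hterm : ∀ t ∈ T, ((∏ f ∈ t, rt f) * ∏ f ∈ S \ t, (1 - rt f) : FFun σ) F x = if vec F x = t then 1 else 0 := by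
      intro t ht
      have htS : t ⊆ S := Finset.mem_powerset.mp (Finset.mem_filter.mp ht).1
      simp only [Pi.mul_apply, Finset.prod_apply, Pi.sub_apply, Pi.one_apply, rt]
      split_ifs with hv
      · rw [Finset.prod_eq_one, Finset.prod_eq_one, one_mul]
        · intro f hf
          rw [if_neg, sub_zero]
          intro hr
          apply (Finset.mem_sdiff.mp hf).2
          rw [← hv]; exact Finset.mem_filter.mpr ⟨(Finset.mem_sdiff.mp hf).1, hr⟩
        · intro f hf
          rw [← hv] at hf
          rw [if_pos (Finset.mem_filter.mp hf).2]
      · by_contra hne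
        apply hv
        have h1 := left_ne_zero_of_mul hne
        have h2 := right_ne_zero_of_mul hne
        rw [Finset.prod_ne_zero_iff] at h1 h2
        ext f
        simp only [vec, Finset.mem_filter]
        constructor
        · rintro ⟨hf, hr⟩
          by_contra hft
          have := h2 f (Finset.mem_sdiff.mpr ⟨hf, hft⟩)
          rw [if_pos hr] at this
          simp at this
        · intro hf
          refine ⟨htS hf, ?_⟩
          by_contra hr
          exact h1 f hf (if_neg hr)
    have : h F x = ∑ t ∈ T, if vec F x = t then 1 else 0 := by
      simp only [h, Finset.sum_apply]
      exact Finset.sum_congr rfl hterm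
    rw [this, Finset.sum_ite_eq]
    congr 1
    apply propext
    constructor
    · intro hm
      obtain ⟨F', x', hF', hv, hX'⟩ := (Finset.mem_filter.mp hm).2
      refine (hS F' F x' x hF' hF fun f hf => ?_).mp hX'
      have := Finset.ext_iff.mp hv f
      simp only [vec, Finset.mem_filter, hf, true_and] at this
      exact this
    · intro hx
      exact Finset.mem_filter.mpr ⟨Finset.mem_powerset.mpr (Finset.filter_subset _ _), F, x, hF, rfl, hx⟩

theorem delta_rec [Fintype σ] {X : (F : FF) → (σ → F) → Prop} (hX : DeltaDef X) : ∃ B, ∀ (p : ℕ) [Fact p.Prime],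
    Rec B (fun m => (Nat.card {x : σ → GaloisField p m // X ⟨GaloisField p m⟩ x} : ℚ)) := by
  classical
  obtain ⟨q0, h, hm, hh⟩ := deltaDef_mot hX
  obtain ⟨B, hB⟩ := motAlg_rec hm
  refine ⟨B + (q0 + 1), fun p hp => ?_⟩
  refine Rec.congr_of_lt (hB p) fun m hm => ?_
  have hc : q0 ≤ Fintype.card (GaloisField p m) := by
    rw [← Nat.card_eq_fintype_card, GaloisField.card p m (by omega)]
    have : m < p ^ m := Nat.lt_pow_self hp.out.one_lt
    omega
  have e : ∀ x : σ → GaloisField p m, h ⟨GaloisField p m⟩ x = if X ⟨GaloisField p m⟩ x then 1 else 0 := fun x =>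
    (hh ⟨GaloisField p m⟩ x hc).trans (by congr)
  refine (Finset.sum_congr rfl fun x _ => e x).trans ?_
  rw [Finset.sum_boole, Nat.card_eq_fintype_card, Fintype.card_subtype]
end fiber
end PRU
end

section
open Polynomial
set_option linter.unusedSectionVars false
namespace PRU

/-! ### Weighted spaces -/

/-- The weight function: `y` has weight one, the `z_j` weight `D`. -/
def wtf (d D : ℕ) : Option (Fin d) → ℕ := fun o => o.elim 1 (fun _ => D)

/-- Polynomials of weight at most `m`. -/
noncomputable def Wp (k : Type*) [Field k] (d D m : ℕ) :
    Submodule k (MvPolynomial (Option (Fin d)) k) :=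
  MvPolynomial.restrictSupport k {s | Finsupp.weight (wtf d D) s ≤ m}

section Wp
variable {k : Type*} [Field k] {d D : ℕ}

lemma Wp_mono {m m' : ℕ} (h : m ≤ m') : Wp k d D m ≤ Wp k d D m' :=
  MvPolynomial.restrictSupport_mono _ fun _ hs => le_trans hs h

lemma monomial_mem_Wp {m : ℕ} {s : Option (Fin d) →₀ ℕ} (hs : Finsupp.weight (wtf d D) s ≤ m)
    (c : k) : MvPolynomial.monomial s c ∈ Wp k d D m := by
  unfold Wp
  rw [MvPolynomial.monomial_mem_restrictSupport]
  exact Or.inl hs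

lemma mem_Wp_iff {m : ℕ} {P : MvPolynomial (Option (Fin d)) k} :
    P ∈ Wp k d D m ↔ ∀ s ∈ P.support, Finsupp.weight (wtf d D) s ≤ m := by
  unfold Wp
  rw [MvPolynomial.mem_restrictSupport_iff]
  exact Iff.rfl

lemma exists_mem_Wp (P : MvPolynomial (Option (Fin d)) k) : ∃ m, P ∈ Wp k d D m := by
  refine ⟨P.support.sup (fun s => Finsupp.weight (wtf d D) s), mem_Wp_iff.2 fun s hs => ?_⟩
  exact Finset.le_sup (f := fun s => Finsupp.weight (wtf d D) s) hs

/-- Induction principle: additive maps are controlled on monomials. -/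
lemma Wp_map {M : Type*} [AddCommMonoid M] (T : MvPolynomial (Option (Fin d)) k →+ M)
    (S : AddSubmonoid M) {m : ℕ}
    (h : ∀ s c, Finsupp.weight (wtf d D) s ≤ m → T (MvPolynomial.monomial s c) ∈ S)
    {P : MvPolynomial (Option (Fin d)) k} (hP : P ∈ Wp k d D m) : T P ∈ S := by
  rw [P.as_sum, map_sum]
  exact S.sum_mem fun s hs => h _ _ (mem_Wp_iff.1 hP s hs)

lemma mul_mem_Wp {m m' : ℕ} {P Q : MvPolynomial (Option (Fin d)) k} (hP : P ∈ Wp k d D m)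
    (hQ : Q ∈ Wp k d D m') : P * Q ∈ Wp k d D (m + m') := by
  refine Wp_map (AddMonoidHom.mulRight Q) (Wp k d D (m + m')).toAddSubmonoid (fun s c hs => ?_) hP
  refine Wp_map (AddMonoidHom.mulLeft _) (Wp k d D (m + m')).toAddSubmonoid (fun t c' ht => ?_) hQ
  simp only [AddMonoidHom.coe_mulLeft, MvPolynomial.monomial_mul]
  refine monomial_mem_Wp ?_ _
  rw [map_add]
  omega

lemma C_mem_Wp (c : k) (m : ℕ) : MvPolynomial.C c ∈ Wp k d D m :=
  monomial_mem_Wp (by simp) c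

lemma one_mem_Wp (m : ℕ) : (1 : MvPolynomial (Option (Fin d)) k) ∈ Wp k d D m :=
  C_mem_Wp (1 : k) m

lemma pow_mem_Wp {m : ℕ} {P : MvPolynomial (Option (Fin d)) k} (hP : P ∈ Wp k d D m) (e : ℕ) :
    P ^ e ∈ Wp k d D (e * m) := by
  induction e with
  | zero => simpa using one_mem_Wp 0
  | succ e ih =>
    rw [pow_succ, Nat.succ_mul]
    exact mul_mem_Wp ih hP

lemma Xnone_mem_Wp : (MvPolynomial.X none : MvPolynomial (Option (Fin d)) k) ∈ Wp k d D 1 :=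
  monomial_mem_Wp (by simp [Finsupp.weight_single, wtf]) 1

lemma Xsome_mem_Wp (j : Fin d) :
    (MvPolynomial.X (some j) : MvPolynomial (Option (Fin d)) k) ∈ Wp k d D D :=
  monomial_mem_Wp (by simp [Finsupp.weight_single, wtf]) 1

lemma Wp_fd (hD : D ≠ 0) (m : ℕ) : FiniteDimensional k (Wp k d D m) := by
  have : {s : Option (Fin d) →₀ ℕ | Finsupp.weight (wtf d D) s ≤ m}.Finite := by
    apply Finsupp.finite_of_nat_weight_le
    rintro (_ | _) <;> simp [wtf, hD]
  have := this.to_subtype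
  exact Module.Finite.of_basis (MvPolynomial.basisRestrictSupport k _)

end Wp

section W
variable {k : Type*} [Field k] {Ω : Type*} [Field Ω] [Algebra k Ω] [Algebra k[X] Ω]
  [IsScalarTower k k[X] Ω] {d : ℕ}

variable (k) in
/-- The evaluation at `(y, z)`. -/
noncomputable def evz (z : Fin d → Ω) : MvPolynomial (Option (Fin d)) k →ₐ[k] Ω :=
  MvPolynomial.aeval (fun o => o.elim (algebraMap k[X] Ω X) z)

variable (k) in
/-- Elements of weight at most `m`. -/
noncomputable def W (z : Fin d → Ω) (D m : ℕ) : Submodule k Ω :=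
  (Wp k d D m).map (evz k z).toLinearMap

variable {z : Fin d → Ω} {D : ℕ}

lemma mem_W {m : ℕ} {r : Ω} : r ∈ W k z D m ↔ ∃ P ∈ Wp k d D m, evz k z P = r := by
  simp [W, Submodule.mem_map]

lemma W_mono {m m' : ℕ} (h : m ≤ m') : W k z D m ≤ W k z D m' := Submodule.map_mono (Wp_mono h)

lemma mul_mem_W {m m' : ℕ} {r s : Ω} (hr : r ∈ W k z D m) (hs : s ∈ W k z D m') :
    r * s ∈ W k z D (m + m') := by
  obtain ⟨P, hP, rfl⟩ := mem_W.1 hr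
  obtain ⟨Q, hQ, rfl⟩ := mem_W.1 hs
  exact mem_W.2 ⟨P * Q, mul_mem_Wp hP hQ, map_mul _ _ _⟩

lemma one_mem_W (m : ℕ) : (1 : Ω) ∈ W k z D m := mem_W.2 ⟨1, one_mem_Wp m, map_one _⟩

lemma pow_mem_W {m : ℕ} {r : Ω} (hr : r ∈ W k z D m) (e : ℕ) : r ^ e ∈ W k z D (e * m) := by
  obtain ⟨P, hP, rfl⟩ := mem_W.1 hr
  exact mem_W.2 ⟨P ^ e, pow_mem_Wp hP e, map_pow _ _ _⟩

lemma prod_mem_W {ι : Type*} (S : Finset ι) {m : ℕ} {r : ι → Ω} (hr : ∀ i ∈ S, r i ∈ W k z D m) :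
    ∏ i ∈ S, r i ∈ W k z D (S.card * m) := by
  classical
  induction S using Finset.induction_on with
  | empty => simpa using one_mem_W 0
  | insert a S ha ih =>
    rw [Finset.prod_insert ha, Finset.card_insert_of_notMem ha, Nat.succ_mul, add_comm]
    exact mul_mem_W (hr _ (Finset.mem_insert_self _ _))
      (ih fun i hi => hr i (Finset.mem_insert_of_mem hi))

lemma W_fd (hD : D ≠ 0) (m : ℕ) : FiniteDimensional k (W k z D m) := by
  have := Wp_fd (k := k) (d := d) hD m
  unfold W
  infer_instance

/-- Semilinear ring homs fixing `y` and permuting the `z`. -/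
lemma map_mem_W (T : Ω →+* Ω) (F : k →+* k) (hF : ∀ c, T (algebraMap k Ω c) = algebraMap k Ω (F c))
    (hy : T (algebraMap k[X] Ω X) = algebraMap k[X] Ω X) (π : Fin d → Fin d)
    (hz : ∀ j, T (z j) = z (π j)) {m : ℕ} {r : Ω} (hr : r ∈ W k z D m) : T r ∈ W k z D m := by
  obtain ⟨P, hP, rfl⟩ := mem_W.1 hr
  refine Wp_map (T.comp (evz k z).toRingHom).toAddMonoidHom (W k z D m).toAddSubmonoid
    (fun s c hs => ?_) hP
  refine mem_W.2 ⟨MvPolynomial.rename (Option.map π) (MvPolynomial.monomial s (F c)), ?_, ?_⟩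
  · rw [MvPolynomial.rename_monomial]
    refine monomial_mem_Wp (le_trans (le_of_eq ?_) hs) _
    clear hs hP hr
    induction s using Finsupp.induction_linear with
    | zero => simp
    | add a b ha hb => rw [Finsupp.mapDomain_add, map_add, map_add, ha, hb]
    | single o n =>
      rw [Finsupp.mapDomain_single, Finsupp.weight_single, Finsupp.weight_single]
      cases o <;> rfl
  · simp only [evz, MvPolynomial.aeval_rename, RingHom.toAddMonoidHom_eq_coe, AddMonoidHom.coe_coe,
      RingHom.comp_apply, AlgHom.toRingHom_eq_coe, RingHom.coe_coe, MvPolynomial.aeval_monomial,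
      map_mul, hF, Finsupp.prod, map_prod, map_pow]
    congr 1
    refine Finset.prod_congr rfl fun o _ => ?_
    congr 1
    cases o
    · simp [hy]
    · simp [hz]

end W

section Linfty
variable {k : Type*} [Field k] {Ω : Type*} [Field Ω] [Algebra k Ω] [Algebra k[X] Ω]
  [Algebra (RatFunc k) Ω] [IsScalarTower k k[X] Ω] [IsScalarTower k[X] (RatFunc k) Ω] {d : ℕ}
  {z : Fin d → Ω} {D : ℕ}

lemma evz_integral {f : k[X][X]} (hf : f.Monic)
    (hz : ∀ j, f.eval₂ (algebraMap k[X] Ω) (z j) = 0) (P : MvPolynomial (Option (Fin d)) k) :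
    IsIntegral k[X] (evz k z P) := by
  induction P using MvPolynomial.induction_on with
  | C c =>
    have : evz k z (MvPolynomial.C c) = algebraMap k[X] Ω (C c) := by
      simp only [evz, MvPolynomial.aeval_C]
      rw [IsScalarTower.algebraMap_apply k k[X] Ω]; rfl
    rw [this]
    exact isIntegral_algebraMap
  | add p q hp hq =>
    rw [map_add]
    exact hp.add hq
  | mul_X p o hp =>
    rw [map_mul]
    refine hp.mul ?_
    simp only [evz, MvPolynomial.aeval_X]
    cases o with
    | none => exact isIntegral_algebraMap
    | some j => exact ⟨f, hf, hz j⟩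

lemma W_infty {f : k[X][X]} (hf : f.Monic) (hfd : ∀ i, i < f.natDegree → (f.coeff i).natDegree ≤ D)
    (hz : ∀ j, f.eval₂ (algebraMap k[X] Ω) (z j) = 0) {m : ℕ} {r : Ω} (hr : r ∈ W k z D m)
    (P : k[X]) (hP : algebraMap k[X] Ω P = r) : P.natDegree ≤ m := by
  classical
  by_cases hP0 : P = 0
  · simp [hP0]
  set v := RatFunc.inftyValuation k with hv
  let A : ValuationSubring (RatFunc k) := v.valuationSubring
  set y : Ω := algebraMap k[X] Ω X with hy
  have hyR : algebraMap (RatFunc k) Ω RatFunc.X = y := by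
    rw [hy, IsScalarTower.algebraMap_apply k[X] (RatFunc k) Ω, RatFunc.algebraMap_X]
  have hy0 : y ≠ 0 := by
    rw [← hyR]; exact (_root_.map_ne_zero _).2 RatFunc.X_ne_zero
  have hA : ∀ x : RatFunc k, v x ≤ 1 → IsIntegral A (algebraMap (RatFunc k) Ω x) := by
    intro x hx
    exact isIntegral_algebraMap (R := A) (x := ⟨x, hx⟩)
  have hvp : ∀ Q : k[X], Q ≠ 0 → v (algebraMap k[X] (RatFunc k) Q) = WithZero.exp (Q.natDegree : ℤ) :=
    fun Q hQ => RatFunc.inftyValuation.polynomial k hQ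
  have hpol : ∀ (Q : k[X]) (e : ℕ), Q.natDegree ≤ e →
      IsIntegral A (algebraMap k[X] Ω Q * (y⁻¹) ^ e) := by
    intro Q e hQ
    have : algebraMap k[X] Ω Q * (y⁻¹) ^ e
        = algebraMap (RatFunc k) Ω (algebraMap k[X] (RatFunc k) Q * (RatFunc.X⁻¹) ^ e) := by
      rw [map_mul, map_pow, map_inv₀, hyR, ← IsScalarTower.algebraMap_apply]
    rw [this]
    apply hA
    by_cases hQ0 : Q = 0
    · simp [hQ0]
    rw [map_mul, map_pow, map_inv₀, RatFunc.inftyValuation.X, hvp _ hQ0,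
      ← WithZero.exp_neg, ← WithZero.exp_nsmul, ← WithZero.exp_add, ← WithZero.exp_zero,
      WithZero.exp_le_exp]
    simp
    exact_mod_cast hQ
  have hyi : IsIntegral A y⁻¹ := by
    simpa using hpol 1 1 (by simp)
  have hzi : ∀ j, IsIntegral A (z j * (y⁻¹) ^ D) := by
    intro j
    set w := z j * (y⁻¹) ^ D with hw
    -- a monic polynomial over integral elements
    set d' := f.natDegree
    let g : Polynomial Ω := X ^ d' + ∑ i ∈ Finset.range d',
      C (algebraMap k[X] Ω (f.coeff i) * (y⁻¹) ^ (D * (d' - i))) * X ^ i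
    have hgm : g.Monic := by
      apply monic_X_pow_add
      refine lt_of_le_of_lt (degree_sum_le _ _) ?_
      refine (Finset.sup_lt_iff (WithBot.bot_lt_coe d')).2 ?_
      intro i hi
      exact lt_of_le_of_lt (degree_C_mul_X_pow_le _ _) (WithBot.coe_lt_coe.2 (Finset.mem_range.1 hi))
    have hgw : g.eval w = 0 := by
      have h1 := hz j
      rw [eval₂_eq_sum_range, Finset.sum_range_succ, hf.coeff_natDegree, map_one, one_mul] at h1
      have : g.eval w = (y⁻¹) ^ (D * d') * (∑ i ∈ Finset.range d',
          algebraMap k[X] Ω (f.coeff i) * z j ^ i + z j ^ d') := by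
        simp only [g, eval_add, eval_pow, eval_X, eval_finsetSum, eval_mul, eval_C]
        rw [mul_add, add_comm, Finset.mul_sum]
        congr 1
        · refine Finset.sum_congr rfl fun i hi => ?_
          have : D * d' = D * (d' - i) + D * i := by
            rw [← mul_add]; congr 1; have := Finset.mem_range.1 hi; omega
          rw [this, hw, mul_pow, ← pow_mul, pow_add]
          ring
        · rw [hw, mul_pow, ← pow_mul]; ring
      rw [this, h1, mul_zero]
    have hgi : ∀ i, IsIntegral A (g.coeff i) := by
      intro i
      simp only [g, coeff_add, finsetSum_coeff, coeff_C_mul, coeff_X_pow]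
      refine IsIntegral.add ?_ (IsIntegral.sum _ fun a ha => ?_)
      · split_ifs
        · exact isIntegral_one
        · exact isIntegral_zero
      · refine IsIntegral.mul (hpol _ _ ?_) ?_
        · have := Finset.mem_range.1 ha
          calc _ ≤ D * 1 := by simpa using hfd a this
            _ ≤ _ := Nat.mul_le_mul_left _ (by omega)
        · split_ifs
          · exact isIntegral_one
          · exact isIntegral_zero
    let I := integralClosure A Ω
    have hl : g ∈ Polynomial.lifts (algebraMap I Ω) := by
      rw [Polynomial.lifts_iff_coeff_lifts]
      intro i
      exact ⟨⟨_, hgi i⟩, rfl⟩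
    obtain ⟨g', hg', -, hg'm⟩ := Polynomial.lifts_and_natDegree_eq_and_monic hl hgm
    have : IsIntegral I w := ⟨g', hg'm, by rw [← eval_map, hg', hgw]⟩
    exact isIntegral_trans (R := A) (A := I) w this
  have key : IsIntegral A (r * (y⁻¹) ^ m) := by
    obtain ⟨Q, hQ, rfl⟩ := mem_W.1 hr
    refine Wp_map ((AddMonoidHom.mulRight ((y⁻¹) ^ m)).comp (evz k z).toRingHom.toAddMonoidHom)
      (integralClosure A Ω).toSubring.toAddSubgroup.toAddSubmonoid (fun s c hs => ?_) hQ
    change IsIntegral A (evz k z (MvPolynomial.monomial s c) * (y⁻¹) ^ m)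
    simp only [evz, MvPolynomial.aeval_monomial]
    rw [Finsupp.prod_fintype _ _ (by simp), Fintype.prod_option]
    simp only [Option.elim_none, Option.elim_some]
    rw [Finsupp.weight_eq_sum, Fintype.sum_option] at hs
    simp only [wtf, Option.elim_none, Option.elim_some, smul_eq_mul, mul_one, ← Finset.sum_mul]
      at hs
    obtain ⟨e, rfl⟩ := Nat.exists_eq_add_of_le hs
    have h1 : (algebraMap k Ω c) * (y ^ s none * ∏ j, z j ^ s (some j)) *
        (y⁻¹) ^ (s none + (∑ j, s (some j)) * D + e) =
        (algebraMap k[X] Ω (C c) * (y⁻¹) ^ 0) *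
          ((∏ j, (z j * (y⁻¹) ^ D) ^ s (some j)) * (y⁻¹) ^ e) := by
      have h2 : ∏ j, (z j * (y⁻¹) ^ D) ^ s (some j)
          = (∏ j, z j ^ s (some j)) * (y⁻¹) ^ ((∑ j, s (some j)) * D) := by
        simp only [mul_pow, Finset.prod_mul_distrib, ← pow_mul, Finset.prod_pow_eq_pow_sum,
          Finset.sum_mul, mul_comm D]
      have h3 : y ^ s none * (y⁻¹) ^ s none = 1 := by
        rw [← mul_pow, mul_inv_cancel₀ hy0, one_pow]
      rw [h2, IsScalarTower.algebraMap_apply k k[X] Ω, pow_add, pow_add]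
      change algebraMap k[X] Ω (C c) * _ * _ = _
      linear_combination (algebraMap k[X] Ω (C c)) * (∏ j, z j ^ s (some j)) *
        (y⁻¹) ^ ((∑ j, s (some j)) * D) * (y⁻¹) ^ e * h3
    rw [h1]
    refine (hpol _ _ (by simp)).mul (IsIntegral.mul ?_ (hyi.pow _))
    exact IsIntegral.prod _ fun j _ => (hzi j).pow _
  have h2 : r * (y⁻¹) ^ m
      = algebraMap (RatFunc k) Ω (algebraMap k[X] (RatFunc k) P * (RatFunc.X⁻¹) ^ m) := by
    rw [map_mul, map_pow, map_inv₀, hyR, ← IsScalarTower.algebraMap_apply, hP]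
  rw [h2] at key
  have key2 : IsIntegral A (algebraMap k[X] (RatFunc k) P * (RatFunc.X⁻¹) ^ m) :=
    (isIntegral_algebraMap_iff (algebraMap (RatFunc k) Ω).injective).1 key
  have h3 : v (algebraMap k[X] (RatFunc k) P * (RatFunc.X⁻¹) ^ m) ≤ 1 := by
    obtain ⟨a, ha⟩ := IsIntegrallyClosed.isIntegral_iff.1 key2
    rw [← ha]
    exact a.2
  rw [map_mul, map_pow, map_inv₀, RatFunc.inftyValuation.X, hvp _ hP0,
      ← WithZero.exp_neg, ← WithZero.exp_nsmul, ← WithZero.exp_add, ← WithZero.exp_zero,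
      WithZero.exp_le_exp] at h3
  simp at h3
  exact_mod_cast h3

/-- `L∞`: a rational function in `W m` is a polynomial of degree at most `m`. -/
lemma Linfty {f : k[X][X]} (hf : f.Monic) (hfd : ∀ i, i < f.natDegree → (f.coeff i).natDegree ≤ D)
    (hz : ∀ j, f.eval₂ (algebraMap k[X] Ω) (z j) = 0) {m : ℕ} {r : Ω} (hr : r ∈ W k z D m)
    (x : RatFunc k) (hx : algebraMap (RatFunc k) Ω x = r) :
    ∃ P : k[X], algebraMap k[X] Ω P = r ∧ P.natDegree ≤ m := by
  have hi : IsIntegral k[X] r := by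
    obtain ⟨P, -, rfl⟩ := mem_W.1 hr
    exact evz_integral hf hz P
  rw [← hx, isIntegral_algebraMap_iff (algebraMap (RatFunc k) Ω).injective,
    IsIntegrallyClosed.isIntegral_iff] at hi
  obtain ⟨P, rfl⟩ := hi
  rw [← IsScalarTower.algebraMap_apply] at hx
  exact ⟨P, hx, W_infty hf hfd hz hr P hx⟩

end Linfty
end PRU
end

section
open Polynomial
set_option linter.unusedSectionVars false
namespace PRU

section Cov
variable {k : Type*} [Field k] {N : Type*} [Field N] [Algebra k N] [Algebra k[X] N]
  [Algebra (RatFunc k) N] [IsScalarTower k k[X] N] [IsScalarTower k[X] (RatFunc k) N] {d : ℕ}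

/-- The data of a Galois cover of the line with explicit generators. -/
structure Cov (z : Fin d → N) (D : ℕ) where
  f : k[X][X]
  a : k[X][X]
  b : k[X][X]
  δ : k[X]
  monic : f.Monic
  hfd : ∀ i, (f.coeff i).natDegree ≤ D
  hbd : ∀ i, (b.coeff i).natDegree ≤ D
  hbn : b.natDegree ≤ D
  hδd : δ.natDegree ≤ D
  hz : f.map (algebraMap k[X] N) = ∏ j, (X - C (z j))
  bez : a * f + b * derivative f = C δ
  hδ : δ ≠ 0
  gen : IntermediateField.adjoin (RatFunc k) (Set.range z) = ⊤

variable {z : Fin d → N} {D : ℕ}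

lemma Cov.natDegree (c : Cov (k := k) z D) : c.f.natDegree = d := by
  have h := congrArg Polynomial.natDegree c.hz
  rw [c.monic.natDegree_map, natDegree_prod_of_monic _ _ (fun j _ => monic_X_sub_C _)] at h
  simpa using h

lemma Cov.root_iff (c : Cov (k := k) z D) (x : N) : c.f.eval₂ (algebraMap k[X] N) x = 0 ↔ ∃ j, z j = x := by
  rw [← eval_map, c.hz, eval_prod, Finset.prod_eq_zero_iff]
  simp only [Finset.mem_univ, true_and, eval_sub, eval_X, eval_C, sub_eq_zero]
  exact exists_congr fun j => eq_comm

lemma Cov.eval_z (c : Cov (k := k) z D) (j : Fin d) : c.f.eval₂ (algebraMap k[X] N) (z j) = 0 :=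
  (c.root_iff _).2 ⟨j, rfl⟩

lemma Cov.gal_z (c : Cov (k := k) z D) (g : N ≃ₐ[RatFunc k] N) : ∃ π : Fin d → Fin d, ∀ j, g (z j) = z (π j) := by
  have : ∀ j, ∃ i, z i = g (z j) := by
    intro j
    rw [← c.root_iff]
    have h := congrArg g (c.eval_z j)
    rw [map_zero, ← RingHom.coe_coe g, hom_eval₂] at h
    have h2 : (g : N →+* N).comp (algebraMap k[X] N) = algebraMap k[X] N := by
      refine RingHom.ext fun x => ?_
      rw [IsScalarTower.algebraMap_eq k[X] (RatFunc k) N]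
      simp
    rw [h2] at h
    exact h
  choose π hπ using this
  exact ⟨π, fun j => (hπ j).symm⟩

lemma Cov.gal_mem_W (c : Cov (k := k) z D) (g : N ≃ₐ[RatFunc k] N) {m : ℕ} {r : N} (hr : r ∈ W k z D m) :
    g r ∈ W k z D m := by
  obtain ⟨π, hπ⟩ := c.gal_z g
  have hx : ∀ Q : k[X], g (algebraMap k[X] N Q) = algebraMap k[X] N Q := by
    intro Q
    rw [IsScalarTower.algebraMap_apply k[X] (RatFunc k) N, AlgEquiv.commutes]
  refine map_mem_W (g : N →+* N) (RingHom.id k) (fun a => ?_) (hx _) π hπ hr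
  rw [RingHom.id_apply, IsScalarTower.algebraMap_apply k k[X] N]
  exact hx _

/-- Norms of elements of `W m`. -/
lemma Cov.norm_W (c : Cov (k := k) z D) [FiniteDimensional (RatFunc k) N] [IsGalois (RatFunc k) N] {m : ℕ} {r : N}
    (hr : r ∈ W k z D m) (h0 : r ≠ 0) :
    ∃ P : k[X], algebraMap k[X] N P = ∏ g : N ≃ₐ[RatFunc k] N, g r ∧ P ≠ 0 ∧
      P.natDegree ≤ Module.finrank (RatFunc k) N * m := by
  have h1 : ∏ g : N ≃ₐ[RatFunc k] N, g r ∈ W k z D (Module.finrank (RatFunc k) N * m) := by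
    rw [← IsGalois.card_aut_eq_finrank, Nat.card_eq_fintype_card, ← Finset.card_univ]
    exact prod_mem_W _ fun g _ => c.gal_mem_W g hr
  obtain ⟨P, hP, hd⟩ := Linfty c.monic (fun i _ => c.hfd i) c.eval_z h1 _
    (Algebra.norm_eq_prod_automorphisms (RatFunc k) r)
  refine ⟨P, hP, ?_, hd⟩
  rintro rfl
  rw [map_zero] at hP
  obtain ⟨g, -, hg⟩ := Finset.prod_eq_zero_iff.1 hP.symm
  exact h0 (by simpa using hg)

lemma Cov.pow_z (c : Cov (k := k) z D) (j : Fin d) (e : ℕ) : ∃ u : Fin d → RatFunc k,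
    z j ^ e = ∑ i : Fin d, algebraMap (RatFunc k) N (u i) * z j ^ (i : ℕ) := by
  have hd := c.natDegree
  set R : k[X][X] := X ^ e %ₘ c.f
  have hR : R.natDegree < d := by
    rw [← hd]
    refine natDegree_modByMonic_lt _ c.monic ?_
    intro h
    rw [h, natDegree_one] at hd
    exact absurd j.2 (by omega)
  have h1 : z j ^ e = R.eval₂ (algebraMap k[X] N) (z j) := by
    have := congrArg (eval₂ (algebraMap k[X] N) (z j)) (modByMonic_add_div (X ^ e) c.f)
    rw [eval₂_add, eval₂_mul, c.eval_z, zero_mul, add_zero] at this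
    rw [this]; simp
  refine ⟨fun i => algebraMap k[X] (RatFunc k) (R.coeff i), ?_⟩
  rw [h1, eval₂_eq_sum_range' _ hR, Finset.sum_range]
  refine Finset.sum_congr rfl fun i _ => ?_
  rw [← IsScalarTower.algebraMap_apply]

lemma Cov.span_mon (c : Cov (k := k) z D) [FiniteDimensional (RatFunc k) N] :
    Submodule.span (RatFunc k) (Set.range fun α : Fin d → Fin d => ∏ j, z j ^ (α j : ℕ)) = ⊤ := by
  classical
  rw [eq_top_iff]
  intro x _
  have hx : x ∈ Algebra.adjoin (RatFunc k) (Set.range z) := by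
    rw [← IntermediateField.adjoin_toSubalgebra, c.gen]; trivial
  rw [Algebra.adjoin_range_eq_range_aeval] at hx
  obtain ⟨P, rfl⟩ := hx
  change MvPolynomial.aeval z P ∈ _
  rw [P.as_sum, map_sum]
  refine Submodule.sum_mem _ fun s _ => ?_
  rw [MvPolynomial.aeval_monomial, ← Algebra.smul_def]
  refine Submodule.smul_mem _ _ ?_
  rw [Finsupp.prod_fintype _ _ (by simp)]
  choose u hu using fun j => c.pow_z j (s j)
  simp only [hu]
  rw [Finset.prod_univ_sum]
  refine Submodule.sum_mem _ fun α _ => ?_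
  rw [Finset.prod_mul_distrib, ← map_prod, ← Algebra.smul_def]
  exact Submodule.smul_mem _ _ (Submodule.subset_span ⟨α, rfl⟩)

lemma ratFunc_X_pow_li {k : Type*} [Field k] : LinearIndependent k (fun n : ℕ => (RatFunc.X : RatFunc k) ^ n) := by
  rw [linearIndependent_iff]
  intro l hl
  have h1 : algebraMap k[X] (RatFunc k) (l.sum fun n a => monomial n a) = 0 := by
    rw [← hl, Finsupp.linearCombination_apply, Finsupp.sum, map_sum, Finsupp.sum]
    refine Finset.sum_congr rfl fun n _ => ?_
    rw [← C_mul_X_pow_eq_monomial, map_mul, map_pow, RatFunc.algebraMap_X, Algebra.smul_def]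
    rfl
  rw [map_eq_zero_iff _ (RatFunc.algebraMap_injective k)] at h1
  ext n
  have := congrArg (fun p => coeff p n) h1
  simp only [Finsupp.sum, finsetSum_coeff, coeff_monomial, coeff_zero] at this
  rw [Finset.sum_ite_eq'] at this
  by_cases h : l n = 0
  · simpa using h
  · simp [h] at this

/-- Lower bound for the dimension of `W m`. -/
lemma Cov.dim_lower (c : Cov (k := k) z D) [FiniteDimensional (RatFunc k) N] (hD : D ≠ 0) (m : ℕ) :
    Module.finrank (RatFunc k) N * (m - D * d * d) ≤ Module.finrank k (W k z D m) := by
  classical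
  obtain ⟨B, hB, hspan, hli⟩ := exists_linearIndependent (RatFunc k)
    (Set.range fun α : Fin d → Fin d => ∏ j, z j ^ (α j : ℕ))
  rw [c.span_mon] at hspan
  have hBf : B.Finite := (Set.finite_range _).subset hB
  have := hBf.fintype
  have hcard : Module.finrank (RatFunc k) N = Fintype.card B :=
    Module.finrank_eq_card_basis (Module.Basis.mk hli (by rw [Subtype.range_coe, hspan]))
  have : IsScalarTower k (RatFunc k) N := IsScalarTower.of_algebraMap_eq fun x => by
    rw [IsScalarTower.algebraMap_apply k k[X] N, IsScalarTower.algebraMap_apply k[X] (RatFunc k) N,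
      ← IsScalarTower.algebraMap_apply k k[X] (RatFunc k)]
  have h1 : LinearIndependent k (fun n : Fin (m - D * d * d) => (RatFunc.X : RatFunc k) ^ (n : ℕ)) :=
    LinearIndependent.comp ratFunc_X_pow_li _ Fin.val_injective
  have h2 := linearIndependent_smul h1 hli
  have hz : ∀ j, z j ∈ W k z D D := fun j =>
    mem_W.2 ⟨_, Xsome_mem_Wp j, by simp [evz]⟩
  have hyW : algebraMap (RatFunc k) N RatFunc.X ∈ W k z D 1 := by
    refine mem_W.2 ⟨_, Xnone_mem_Wp, ?_⟩
    simp only [evz, MvPolynomial.aeval_X, Option.elim_none]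
    rw [IsScalarTower.algebraMap_apply k[X] (RatFunc k) N, RatFunc.algebraMap_X]
  have hmem : ∀ p : Fin (m - D * d * d) × B, (RatFunc.X : RatFunc k) ^ (p.1 : ℕ) • (p.2 : N) ∈
      W k z D m := by
    rintro ⟨i, v, hv⟩
    obtain ⟨α, rfl⟩ := hB hv
    rw [Algebra.smul_def, map_pow]
    have h3 : ∏ j, z j ^ (α j : ℕ) ∈ W k z D (d * (d * D)) := by
      have := prod_mem_W (k := k) (z := z) (D := D) Finset.univ (m := d * D)
        (r := fun j => z j ^ (α j : ℕ))
        (fun j _ => W_mono (Nat.mul_le_mul_right _ (α j).2.le) (pow_mem_W (hz j) _))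
      simpa using this
    refine W_mono ?_ (mul_mem_W (pow_mem_W hyW i) h3)
    have := i.2
    have e : d * (d * D) = D * d * d := by ring
    omega
  have h4 : LinearIndependent k (fun p : Fin (m - D * d * d) × B =>
      (⟨_, hmem p⟩ : W k z D m)) :=
    LinearIndependent.of_comp (W k z D m).subtype h2
  have := W_fd (k := k) (z := z) hD m
  have h5 := h4.fintype_card_le_finrank
  rw [Fintype.card_prod, Fintype.card_fin] at h5
  rw [hcard, mul_comm]
  exact h5

end Cov
end PRU
end

section
open Polynomial
set_option linter.unusedSectionVars false
namespace PRU

section Eps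
variable {k : Type*} [Field k] {N : Type*} [Field N] [Algebra k N] [Algebra k[X] N]
  [Algebra (RatFunc k) N] [IsScalarTower k k[X] N] [IsScalarTower k[X] (RatFunc k) N] {d : ℕ}
  {z : Fin d → N} {D : ℕ}

/-- Expansion of a polynomial at `y0`. -/
noncomputable def expd (y0 : k) : k[X] →+* PowerSeries k :=
  eval₂RingHom (PowerSeries.C (R := k)) (PowerSeries.C y0 + PowerSeries.X)

lemma expd_C (y0 : k) (a : k) : expd y0 (C a) = PowerSeries.C a := by simp [expd]

lemma expd_X (y0 : k) : expd y0 X = PowerSeries.C y0 + PowerSeries.X := by simp [expd]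

lemma expd_eq (y0 : k) (P : k[X]) : expd y0 P = ((taylor y0 P : k[X]) : PowerSeries k) := by
  have : expd y0 = (Polynomial.coeToPowerSeries.ringHom).comp (taylorAlgHom y0 : k[X] →+* k[X]) := by
    ext1
    · ext1 a; simp [expd_C]
    · simp [expd_X, add_comm]
  rw [this]; simp

lemma expd_const (y0 : k) (P : k[X]) :
    PowerSeries.constantCoeff (expd y0 P) = P.eval y0 := by
  rw [expd_eq, ← PowerSeries.coeff_zero_eq_constantCoeff_apply, Polynomial.coeff_coe,
    taylor_coeff_zero]

lemma expd_inj (y0 : k) : Function.Injective (expd y0) := by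
  intro P Q h
  rw [expd_eq, expd_eq, Polynomial.coe_inj] at h
  exact taylor_injective y0 h

lemma expd_dvd (y0 : k) {P : k[X]} (hP : P ≠ 0) {e : ℕ} (h : PowerSeries.X ^ e ∣ expd y0 P) :
    e ≤ P.rootMultiplicity y0 := by
  rw [Polynomial.le_rootMultiplicity_iff hP]
  rw [PowerSeries.X_pow_dvd_iff] at h
  have h1 : X ^ e ∣ taylor y0 P := by
    rw [Polynomial.X_pow_dvd_iff]
    intro m hm
    have := h m hm
    rwa [expd_eq, Polynomial.coeff_coe] at this
  obtain ⟨Q, hQ⟩ := h1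
  have h2 := congrArg (taylor (-y0)) hQ
  rw [taylor_taylor, neg_add_cancel, taylor_zero, taylor_mul, taylor_pow, taylor_X] at h2
  exact ⟨_, by rw [h2, C_neg, sub_eq_add_neg]⟩

lemma Cov.exists_eps [IsAlgClosed k] (c : Cov (k := k) z D) (y0 : k) (h0 : c.δ.eval y0 ≠ 0) :
    ∃ ε : N →+* LaurentSeries k,
      (∀ Q : k[X], ε (algebraMap k[X] N Q) = algebraMap (PowerSeries k) _ (expd y0 Q)) ∧
      ∀ j, ∃ u : PowerSeries k, ε (z j) = algebraMap (PowerSeries k) _ u := by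
  classical
  set L := LaurentSeries k
  set i0 : k[X] →+* L := (algebraMap (PowerSeries k) L).comp (expd y0) with hi0
  have hinj : Function.Injective (algebraMap (PowerSeries k) L) := IsFractionRing.injective _ _
  have hi0i : Function.Injective i0 := hinj.comp (expd_inj y0)
  set F1 : (PowerSeries k)[X] := c.f.map (expd y0) with hF1
  have hF1m : F1.Monic := c.monic.map _
  set F0 : k[X] := c.f.map (evalRingHom y0) with hF0
  have hF0m : F0.Monic := c.monic.map _
  have hd0 : F0.natDegree = d := by rw [hF0, c.monic.natDegree_map, c.natDegree]
  have hred : F1.map (PowerSeries.constantCoeff (R := k)) = F0 := by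
    rw [hF1, hF0, map_map]
    congr 1
    refine RingHom.ext fun P => ?_
    simp [expd_const]
  have hsep : F0.Separable := by
    have h1 := congrArg (Polynomial.map (evalRingHom y0)) c.bez
    rw [Polynomial.map_add, Polynomial.map_mul, Polynomial.map_mul, ← derivative_map,
      Polynomial.map_C] at h1
    refine ⟨C (c.δ.eval y0)⁻¹ * c.a.map (evalRingHom y0),
      C (c.δ.eval y0)⁻¹ * c.b.map (evalRingHom y0), ?_⟩
    rw [mul_assoc, mul_assoc, ← mul_add, h1, ← C_mul, coe_evalRingHom, inv_mul_cancel₀ h0, C_1]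
  have hcard : F0.roots.toFinset.card = d := by
    rw [Multiset.toFinset_card_of_nodup (nodup_roots hsep), ← hd0]
    exact splits_iff_card_roots.1 (IsAlgClosed.splits F0)
  have hlift : ∀ ρ : k, ρ ∈ F0.roots.toFinset →
      ∃ u : PowerSeries k, F1.eval u = 0 ∧ PowerSeries.constantCoeff u = ρ := by
    intro ρ hρ
    have hρ0 : F0.eval ρ = 0 := by
      rw [Multiset.mem_toFinset, mem_roots hF0m.ne_zero] at hρ; exact hρ
    have hmem : ∀ v : PowerSeries k, PowerSeries.constantCoeff v = 0 →
        v ∈ Ideal.span {(PowerSeries.X : PowerSeries k)} := by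
      intro v hv
      rw [Ideal.mem_span_singleton]
      exact PowerSeries.X_dvd_iff.2 hv
    have hev : ∀ G : (PowerSeries k)[X], PowerSeries.constantCoeff (G.eval (PowerSeries.C ρ))
        = (G.map (PowerSeries.constantCoeff (R := k))).eval ρ := by
      intro G
      have := eval₂_at_apply (p := G) (PowerSeries.constantCoeff (R := k)) (PowerSeries.C ρ)
      rw [eval_map, ← this, PowerSeries.constantCoeff_C]
    obtain ⟨u, hu, hu2⟩ := HenselianRing.is_henselian
      (I := Ideal.span {(PowerSeries.X : PowerSeries k)}) F1 hF1m (PowerSeries.C ρ) (by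
        apply hmem
        rw [hev, hred, hρ0]) (by
        apply IsUnit.map
        rw [PowerSeries.isUnit_iff_constantCoeff, hev, ← derivative_map, hred]
        exact isUnit_iff_ne_zero.2 (hsep.eval₂_derivative_ne_zero (RingHom.id k) hρ0))
    refine ⟨u, hu, ?_⟩
    rw [Ideal.mem_span_singleton, PowerSeries.X_dvd_iff, map_sub, sub_eq_zero] at hu2
    rw [hu2]; simp
  choose u hu using hlift
  set FL : L[X] := c.f.map i0 with hFL
  have hFLm : FL.Monic := c.monic.map _
  have hFL1 : FL = F1.map (algebraMap _ L) := by rw [hFL, hF1, map_map]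
  -- all roots
  set U : Finset L := F0.roots.toFinset.attach.image (fun ρ => algebraMap _ L (u ρ.1 ρ.2)) with hU
  have hUcard : U.card = d := by
    rw [hU, Finset.card_image_of_injective, Finset.card_attach, hcard]
    intro ρ ρ' h
    have h2 := hinj h
    ext
    rw [← (hu ρ.1 ρ.2).2, h2, (hu ρ'.1 ρ'.2).2]
  have hUr : U ⊆ FL.roots.toFinset := by
    intro x hx
    obtain ⟨ρ, -, rfl⟩ := Finset.mem_image.1 hx
    rw [Multiset.mem_toFinset, mem_roots hFLm.ne_zero, hFL1, IsRoot.def, eval_map,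
      eval₂_at_apply, (hu _ _).1, map_zero]
  have hnd : FL.natDegree = d := by rw [hFL, c.monic.natDegree_map, c.natDegree]
  have h1 : FL.roots.toFinset.card ≤ FL.roots.card := Multiset.toFinset_card_le _
  have h2 : FL.roots.card ≤ d := hnd ▸ card_roots' FL
  have h3 := Finset.card_le_card hUr
  have hsplit : FL.Splits := splits_iff_card_roots.2 (by omega)
  have hUeq : U = FL.roots.toFinset := Finset.eq_of_subset_of_card_le hUr (by omega)
  let algL : Algebra (RatFunc k) L := (IsFractionRing.lift (K := RatFunc k) hi0i).toAlgebra
  have halg : ∀ Q : k[X], algebraMap (RatFunc k) L (algebraMap k[X] (RatFunc k) Q) = i0 Q :=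
    fun Q => IsFractionRing.lift_algebraMap hi0i Q
  set FK : (RatFunc k)[X] := c.f.map (algebraMap k[X] (RatFunc k)) with hFK
  have hFKm : FK.Monic := c.monic.map _
  have hFKL : FK.map (algebraMap (RatFunc k) L) = FL := by
    rw [hFK, map_map, hFL]
    congr 1
    exact RingHom.ext halg
  have hFKz : ∀ j, aeval (z j) FK = 0 := by
    intro j
    rw [aeval_def, hFK, eval₂_map, ← IsScalarTower.algebraMap_eq]
    exact c.eval_z j
  obtain ⟨ε⟩ := IntermediateField.nonempty_algHom_of_adjoin_splits (F := RatFunc k) (E := N) (K := L)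
    (S := Set.range z) (by
      rintro _ ⟨j, rfl⟩
      refine ⟨⟨FK, hFKm, hFKz j⟩, ?_⟩
      refine Splits.of_dvd hsplit hFLm.ne_zero ?_
      rw [← hFKL]
      exact Polynomial.map_dvd _ (minpoly.dvd _ _ (hFKz j))) c.gen
  refine ⟨ε, fun Q => ?_, fun j => ?_⟩
  · rw [IsScalarTower.algebraMap_apply k[X] (RatFunc k) N, RingHom.coe_coe, AlgHom.commutes, halg]
    rfl
  · have : ε (z j) ∈ FL.roots.toFinset := by
      rw [Multiset.mem_toFinset, mem_roots hFLm.ne_zero, IsRoot.def, ← hFKL, eval_map, ← aeval_def,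
        aeval_algHom_apply, hFKz, map_zero]
    rw [← hUeq] at this
    obtain ⟨ρ, -, hρ⟩ := Finset.mem_image.1 this
    exact ⟨_, hρ.symm⟩

variable (k z) in
/-- A place of `N` over the point `y0`, with its Galois conjugates. -/
structure Place (y0 : k) where
  ε : N →+* LaurentSeries k
  hε : ∀ Q : k[X], ε (algebraMap k[X] N Q) = algebraMap (PowerSeries k) _ (expd y0 Q)
  E : (N ≃ₐ[RatFunc k] N) → MvPolynomial (Option (Fin d)) k →ₐ[k] PowerSeries k
  hE : ∀ g P, ε (g (evz k z P)) = algebraMap (PowerSeries k) _ (E g P)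

lemma Cov.exists_place [IsAlgClosed k] (c : Cov (k := k) z D) (y0 : k) (h0 : c.δ.eval y0 ≠ 0) :
    Nonempty (Place k z y0) := by
  obtain ⟨ε, hε, hu⟩ := c.exists_eps y0 h0
  choose u hu using hu
  choose π hπ using c.gal_z
  refine ⟨⟨ε, hε, fun g => MvPolynomial.aeval (fun o => o.elim (expd y0 X) (fun j => u (π g j))),
    fun g P => ?_⟩⟩
  have hx : ∀ Q : k[X], g (algebraMap k[X] N Q) = algebraMap k[X] N Q := by
    intro Q
    rw [IsScalarTower.algebraMap_apply k[X] (RatFunc k) N, AlgEquiv.commutes]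
  induction P using MvPolynomial.induction_on with
  | C a =>
    rw [MvPolynomial.aeval_C, evz, MvPolynomial.aeval_C, IsScalarTower.algebraMap_apply k k[X] N,
      hx, hε]
    congr 1
    exact expd_C y0 a
  | add P Q hP hQ => simp only [map_add, hP, hQ]
  | mul_X P o hP =>
    simp only [map_mul, hP]
    congr 1
    simp only [evz, MvPolynomial.aeval_X]
    cases o with
    | none => simp only [Option.elim_none, hx, hε]
    | some j => simp only [Option.elim_some, hπ, hu]

namespace Place
variable {y0 : k} (pl : Place k z y0)

lemma E_zero_iff (g) (P) : pl.E g P = 0 ↔ evz k z P = 0 := by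
  rw [← map_eq_zero_iff (algebraMap (PowerSeries k) (LaurentSeries k)) (IsFractionRing.injective _ _),
    ← pl.hE, map_eq_zero, EmbeddingLike.map_eq_zero_iff]

lemma E_poly (g) (P) (Q : k[X]) (h : evz k z P = algebraMap k[X] N Q) : pl.E g P = expd y0 Q := by
  apply IsFractionRing.injective (PowerSeries k) (LaurentSeries k)
  rw [← pl.hE, h, IsScalarTower.algebraMap_apply k[X] (RatFunc k) N, AlgEquiv.commutes,
    ← IsScalarTower.algebraMap_apply, pl.hε]

lemma E_congr (g) {P Q} (h : evz k z P = evz k z Q) : pl.E g P = pl.E g Q := by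
  apply IsFractionRing.injective (PowerSeries k) (LaurentSeries k)
  rw [← pl.hE, h, pl.hE]

lemma E_X (g) : pl.E g (MvPolynomial.X none) = expd y0 X :=
  pl.E_poly g _ _ (by simp [evz])

lemma prod_E [FiniteDimensional (RatFunc k) N] (P) (Q : k[X])
    (h : algebraMap k[X] N Q = ∏ g : N ≃ₐ[RatFunc k] N, g (evz k z P)) :
    ∏ g, pl.E g P = expd y0 Q := by
  apply IsFractionRing.injective (PowerSeries k) (LaurentSeries k)
  rw [map_prod, ← pl.hε, h, map_prod]
  exact Finset.prod_congr rfl fun g _ => (pl.hE g P).symm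

end Place

lemma sum_count_le {α : Type*} [DecidableEq α] (Y : Finset α) (s : Multiset α) :
    ∑ y ∈ Y, s.count y ≤ s.card := by
  induction s using Multiset.induction_on with
  | empty => simp
  | cons a s ih =>
    simp only [Multiset.count_cons, Finset.sum_add_distrib, Multiset.card_cons]
    have : ∑ y ∈ Y, (if y = a then 1 else 0) ≤ 1 := by
      rw [Finset.sum_ite_eq']; split_ifs <;> simp
    omega

/-- Counting zeros with multiplicity. -/
lemma Cov.zeros [FiniteDimensional (RatFunc k) N] [IsGalois (RatFunc k) N]
    (c : Cov (k := k) z D) (Y : Finset k) (pl : ∀ y ∈ Y, Place k z y)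
    (S : k → Finset (N ≃ₐ[RatFunc k] N)) {m M : ℕ} {P : MvPolynomial (Option (Fin d)) k}
    (hP : P ∈ Wp k d D m) (hP0 : evz k z P ≠ 0)
    (hS : ∀ y (hy : y ∈ Y), ∀ g ∈ S y, PowerSeries.X ^ M ∣ (pl y hy).E g P) :
    M * ∑ y ∈ Y, (S y).card ≤ Module.finrank (RatFunc k) N * m := by
  classical
  obtain ⟨Q, hQ, hQ0, hQd⟩ := c.norm_W (mem_W.2 ⟨P, hP, rfl⟩) hP0
  calc M * ∑ y ∈ Y, (S y).card = ∑ y ∈ Y, M * (S y).card := Finset.mul_sum _ _ _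
    _ ≤ ∑ y ∈ Y, Q.roots.count y := by
        refine Finset.sum_le_sum fun y hy => ?_
        rw [count_roots]
        apply expd_dvd y hQ0
        rw [← (pl y hy).prod_E P Q hQ, pow_mul]
        refine dvd_trans ?_ (Finset.prod_dvd_prod_of_subset (S y) Finset.univ _
          (Finset.subset_univ _))
        rw [← Finset.prod_const]
        exact Finset.prod_dvd_prod_of_dvd _ _ fun g hg => hS y hy g hg
    _ ≤ Q.roots.card := sum_count_le _ _
    _ ≤ Q.natDegree := card_roots' Q
    _ ≤ _ := hQd

lemma Cov.order_le [FiniteDimensional (RatFunc k) N] [IsGalois (RatFunc k) N]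
    (c : Cov (k := k) z D) {y : k} (pl : Place k z y) {m M : ℕ} {P : MvPolynomial (Option (Fin d)) k}
    (hP : P ∈ Wp k d D m) (hP0 : evz k z P ≠ 0) (h : PowerSeries.X ^ M ∣ pl.E 1 P) :
    M ≤ Module.finrank (RatFunc k) N * m := by
  have := c.zeros {y} (fun y' hy' => (Finset.mem_singleton.1 hy') ▸ pl) (fun _ => {1}) hP hP0
    (M := M) (by
      intro y' hy' g hg
      obtain rfl := Finset.mem_singleton.1 hy'
      obtain rfl := Finset.mem_singleton.1 hg
      exact h)
  simpa using this

/-- Orders of elements of `W m`. -/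
lemma Cov.orders [FiniteDimensional (RatFunc k) N] [IsGalois (RatFunc k) N]
    (c : Cov (k := k) z D) (hD : D ≠ 0) {y : k} (pl : Place k z y) (m : ℕ) :
    ∃ S : Finset ℕ, S ⊆ Finset.range (Module.finrank (RatFunc k) N * m + 1) ∧
      Module.finrank k (W k z D m) ≤ S.card ∧
      ∀ i ∈ S, ∃ P ∈ Wp k d D m, PowerSeries.X ^ i ∣ pl.E 1 P ∧ ¬ PowerSeries.X ^ (i + 1) ∣ pl.E 1 P := by
  classical
  set T := Finset.range (Module.finrank (RatFunc k) N * m + 1)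
  set S := T.filter (fun i => ∃ P ∈ Wp k d D m, PowerSeries.X ^ i ∣ pl.E 1 P ∧
    ¬ PowerSeries.X ^ (i + 1) ∣ pl.E 1 P) with hS
  refine ⟨S, Finset.filter_subset _ _, ?_, fun i hi => (Finset.mem_filter.1 hi).2⟩
  have := Wp_fd (k := k) (d := d) hD m
  let A : Wp k d D m →ₗ[k] (S → k) := LinearMap.pi (fun i : S =>
    (PowerSeries.coeff (R := k) (i : ℕ)).comp ((pl.E 1).toLinearMap.comp (Wp k d D m).subtype))
  let B : Wp k d D m →ₗ[k] N := (evz k z).toLinearMap.comp (Wp k d D m).subtype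
  have hker : LinearMap.ker A ≤ LinearMap.ker B := by
    intro P hP
    rw [LinearMap.mem_ker] at hP ⊢
    by_contra hne
    have hne' : evz k z (P : MvPolynomial (Option (Fin d)) k) ≠ 0 := hne
    have hE0 : pl.E 1 P ≠ 0 := fun h => hne' ((pl.E_zero_iff _ _).1 h)
    obtain ⟨i, hi⟩ : ∃ i : ℕ, (pl.E 1 (P : MvPolynomial (Option (Fin d)) k)).order = (i : ℕ∞) :=
      ⟨_, (PowerSeries.coe_toNat_order hE0).symm⟩
    have h1 : PowerSeries.X ^ i ∣ pl.E 1 P := PowerSeries.X_pow_dvd_iff.2 fun m' hm' =>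
      PowerSeries.coeff_of_lt_order m' (by rw [hi]; exact_mod_cast hm')
    have h2 : PowerSeries.coeff i (pl.E 1 P) ≠ 0 := (PowerSeries.order_eq_nat.1 hi).1
    have h3 : ¬ PowerSeries.X ^ (i + 1) ∣ pl.E 1 P := fun h =>
      h2 (PowerSeries.X_pow_dvd_iff.1 h i (Nat.lt_succ_self i))
    have h4 : i ∈ S := by
      rw [hS, Finset.mem_filter]
      exact ⟨Finset.mem_range.2 (Nat.lt_succ_of_le (c.order_le pl P.2 hne' h1)), P, P.2, h1, h3⟩
    have := congrFun hP ⟨i, h4⟩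
    exact h2 this
  have hr : LinearMap.range B = W k z D m := by
    simp only [B, LinearMap.range_comp, Submodule.range_subtype]; rfl
  have h1 := LinearMap.finrank_range_add_finrank_ker A
  have h2 := LinearMap.finrank_range_add_finrank_ker B
  have h3 := Submodule.finrank_mono hker
  have h4 : Module.finrank k (LinearMap.range A) ≤ S.card := by
    refine (Submodule.finrank_le _).trans ?_
    simp
  rw [hr] at h2
  omega

end Eps
end PRU
end

section
open Polynomial
set_option linter.unusedSectionVars false
namespace PRU

/-- Independence of power series with distinct orders over `Q`-th powers. -/
lemma ps_sum_ne {k : Type*} [Field k] {ι : Type*} [Fintype ι] (u v : ι → PowerSeries k) (o : ι → ℕ)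
    (ho : Function.Injective o) (hv : ∀ j, PowerSeries.X ^ (o j) ∣ v j)
    (hv2 : ∀ j, ¬ PowerSeries.X ^ (o j + 1) ∣ v j) (Q : ℕ)
    (hu : ∀ j, u j ≠ 0 → ¬ PowerSeries.X ^ Q ∣ u j) (hne : ∃ j, u j ≠ 0) :
    ∑ j, u j * v j ^ Q ≠ 0 := by
  classical
  obtain ⟨j0, hj0, hmin⟩ := Finset.exists_min_image (Finset.univ.filter fun j => u j ≠ 0) o
    (by obtain ⟨j, hj⟩ := hne; exact ⟨j, by simpa using hj⟩)
  have hj0' : u j0 ≠ 0 := by simpa using hj0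
  intro h0
  rw [← Finset.add_sum_erase _ _ (Finset.mem_univ j0)] at h0
  have hd : PowerSeries.X ^ ((o j0 + 1) * Q) ∣ ∑ j ∈ Finset.univ.erase j0, u j * v j ^ Q := by
    refine Finset.dvd_sum fun j hj => ?_
    by_cases huj : u j = 0
    · rw [huj, zero_mul]; exact dvd_zero _
    · have h1 : o j0 ≤ o j := hmin j (by simpa using huj)
      have h2 : o j0 ≠ o j := fun h => (Finset.ne_of_mem_erase hj) (ho h).symm
      have h3 : o j0 + 1 ≤ o j := by omega
      rw [pow_mul]
      exact Dvd.dvd.mul_left (pow_dvd_pow_of_dvd ((pow_dvd_pow _ h3).trans (hv j)) Q) _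
  have hd2 : PowerSeries.X ^ ((o j0 + 1) * Q) ∣ u j0 * v j0 ^ Q := by
    rw [eq_neg_of_add_eq_zero_left h0]
    exact (dvd_neg).2 hd
  obtain ⟨w, hw⟩ := hv j0
  have hw0 : ¬ PowerSeries.X ∣ w := by
    rintro ⟨w', hw'⟩
    exact hv2 j0 ⟨w', by rw [hw, hw', pow_succ, mul_assoc]⟩
  have hX : Prime (PowerSeries.X : PowerSeries k) := PowerSeries.X_prime
  have h4 : PowerSeries.X ^ Q ∣ u j0 * w ^ Q := by
    have : u j0 * v j0 ^ Q = PowerSeries.X ^ (o j0 * Q) * (u j0 * w ^ Q) := by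
      rw [hw, mul_pow, ← pow_mul]; ring
    rw [this, add_mul, one_mul, pow_add] at hd2
    exact (mul_dvd_mul_iff_left (pow_ne_zero _ hX.ne_zero)).1 hd2
  refine hu j0 hj0' ?_
  exact hX.pow_dvd_of_dvd_mul_right Q (fun h => hw0 (hX.dvd_of_dvd_pow h)) h4

section Up
variable {k : Type*} [Field k] {N : Type*} [Field N] [Algebra k N] [Algebra k[X] N]
  [Algebra (RatFunc k) N] [IsScalarTower k k[X] N] [IsScalarTower k[X] (RatFunc k) N] {d : ℕ}
  {z : Fin d → N} {D : ℕ} [FiniteDimensional (RatFunc k) N] [IsGalois (RatFunc k) N]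

lemma Cov.dim_upper (c : Cov (k := k) z D) (hD : D ≠ 0) {y : k} (pl : Place k z y) (m : ℕ) :
    Module.finrank k (W k z D m) ≤ Module.finrank (RatFunc k) N * m + 1 := by
  obtain ⟨S, hS, h1, -⟩ := c.orders hD pl m
  exact h1.trans ((Finset.card_le_card hS).trans (by simp))

lemma Cov.exists_t (c : Cov (k := k) z D) (hD : D ≠ 0) {y : k} (pl : Place k z y) (J K : ℕ)
    (hK : K ≤ Module.finrank (RatFunc k) N * (J - D * d * d)) :
    ∃ (t : Fin K → MvPolynomial (Option (Fin d)) k) (o : Fin K → ℕ), Function.Injective o ∧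
      (∀ j, t j ∈ Wp k d D J) ∧ ∀ j, PowerSeries.X ^ (o j) ∣ pl.E 1 (t j) ∧
        ¬ PowerSeries.X ^ (o j + 1) ∣ pl.E 1 (t j) := by
  obtain ⟨S, -, h1, h2⟩ := c.orders hD pl J
  obtain ⟨S', hS', hc⟩ := Finset.exists_subset_card_eq (hK.trans ((c.dim_lower hD J).trans h1))
  let e := S'.equivFinOfCardEq hc
  choose t ht ht2 using h2
  exact ⟨fun j => t (e.symm j) (hS' (e.symm j).2), fun j => (e.symm j : ℕ),
    fun a b h => e.symm.injective (Subtype.ext h), fun j => ht _ _, fun j => ht2 _ _⟩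

lemma Cov.sum_ne (c : Cov (k := k) z D) {y : k} (pl : Place k z y) {K A Q : ℕ}
    {t s : Fin K → MvPolynomial (Option (Fin d)) k} {o : Fin K → ℕ} (ho : Function.Injective o)
    (ht : ∀ j, PowerSeries.X ^ (o j) ∣ pl.E 1 (t j) ∧ ¬ PowerSeries.X ^ (o j + 1) ∣ pl.E 1 (t j))
    (hs : ∀ j, s j ∈ Wp k d D A) (hs0 : ∃ j, evz k z (s j) ≠ 0)
    (hQ : Module.finrank (RatFunc k) N * A < Q) :
    evz k z (∑ j, s j * t j ^ Q) ≠ 0 := by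
  rw [Ne, ← pl.E_zero_iff 1, map_sum]
  simp only [map_mul, map_pow]
  refine ps_sum_ne _ _ o ho (fun j => (ht j).1) (fun j => (ht j).2) Q ?_ ?_
  · intro j hj h
    have := c.order_le pl (hs j) (fun h => hj ((pl.E_zero_iff _ _).2 h)) h
    omega
  · obtain ⟨j, hj⟩ := hs0
    exact ⟨j, fun h => hj ((pl.E_zero_iff _ _).1 h)⟩

/-- Twisting of polynomials. -/
noncomputable def tw (π : Fin d → Fin d) (F : k →+* k) (P : MvPolynomial (Option (Fin d)) k) :
    MvPolynomial (Option (Fin d)) k :=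
  MvPolynomial.rename (Option.map π) (MvPolynomial.map F P)

lemma tw_mem (π : Fin d → Fin d) (F : k →+* k) {m : ℕ} {P : MvPolynomial (Option (Fin d)) k}
    (hP : P ∈ Wp k d D m) : tw π F P ∈ Wp k d D m := by
  refine Wp_map ((MvPolynomial.rename (Option.map π)).toRingHom.comp
    (MvPolynomial.map F)).toAddMonoidHom (Wp k d D m).toAddSubmonoid (fun s c hs => ?_) hP
  simp only [RingHom.toAddMonoidHom_eq_coe, AddMonoidHom.coe_coe, RingHom.comp_apply,
    MvPolynomial.map_monomial, AlgHom.toRingHom_eq_coe, RingHom.coe_coe,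
    MvPolynomial.rename_monomial]
  refine monomial_mem_Wp (le_trans (le_of_eq ?_) hs) _
  rw [Finsupp.weight_apply, Finsupp.weight_apply, Finsupp.sum_mapDomain_index]
  · refine Finsupp.sum_congr fun o _ => ?_
    cases o <;> rfl
  · simp
  · intros; simp [add_mul]

/-- The set of points of type `π`. -/
def Place.Pt {y : k} (pl : Place k z y) (q : ℕ) (π : Fin d → Fin d) (g : N ≃ₐ[RatFunc k] N) : Prop :=
  ∀ j, PowerSeries.constantCoeff (pl.E g (MvPolynomial.X (some j))) ^ q =
    PowerSeries.constantCoeff (pl.E g (MvPolynomial.X (some (π j))))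

lemma Place.Pt.tw {y : k} {pl : Place k z y} {q : ℕ} {π : Fin d → Fin d} {g : N ≃ₐ[RatFunc k] N}
    (h : pl.Pt q π g) (F : k →+* k) (hF : ∀ a, F a = a ^ q) (hy : y ^ q = y)
    (P : MvPolynomial (Option (Fin d)) k) :
    PowerSeries.constantCoeff (pl.E g P) ^ q =
      PowerSeries.constantCoeff (pl.E g (PRU.tw π F P)) := by
  have hE : ∀ a : k, pl.E g (MvPolynomial.C a) = PowerSeries.C a := fun a =>
    (pl.E g).commutes a
  have key : F.comp ((PowerSeries.constantCoeff (R := k)).comp (pl.E g).toRingHom) =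
      ((PowerSeries.constantCoeff (R := k)).comp (pl.E g).toRingHom).comp
        ((MvPolynomial.rename (Option.map π)).toRingHom.comp (MvPolynomial.map F)) := by
    refine MvPolynomial.ringHom_ext (fun a => ?_) (fun o => ?_)
    · simp [hE]
    · cases o with
      | none =>
        simp only [RingHom.comp_apply, AlgHom.toRingHom_eq_coe, RingHom.coe_coe, hF,
          MvPolynomial.map_X, MvPolynomial.rename_X, Option.map_none, pl.E_X, expd_const, eval_X, hy]
      | some j =>
        simp only [RingHom.comp_apply, AlgHom.toRingHom_eq_coe, RingHom.coe_coe, hF,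
          MvPolynomial.map_X, MvPolynomial.rename_X, Option.map_some]
        exact h j
  have := RingHom.congr_fun key P
  rw [← hF]
  exact this

/-- Solving linear equations: given a test map into finite dimensional spaces. -/
lemma exists_basis_lift (hD : D ≠ 0) (A : ℕ) :
    ∃ e : Fin (Module.finrank k (W k z D A)) → MvPolynomial (Option (Fin d)) k,
      (∀ i, e i ∈ Wp k d D A) ∧ LinearIndependent k (fun i => evz k z (e i)) := by
  have := W_fd (z := z) (k := k) hD A
  let b := Module.finBasis k (W k z D A)
  have h : ∀ i, ∃ P ∈ Wp k d D A, evz k z P = b i := fun i => mem_W.1 (b i).2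
  choose e he hb using h
  refine ⟨e, he, ?_⟩
  simp only [hb]
  exact b.linearIndependent.map' (W k z D A).subtype (Submodule.ker_subtype _)

end Up
end PRU
end

section
open Polynomial
set_option linter.unusedSectionVars false
namespace PRU

section Up
variable {k : Type*} [Field k] {N : Type*} [Field N] [Algebra k N] [Algebra k[X] N]
  [Algebra (RatFunc k) N] [IsScalarTower k k[X] N] [IsScalarTower k[X] (RatFunc k) N] {d : ℕ}
  {z : Fin d → N} {D : ℕ} [FiniteDimensional (RatFunc k) N] [IsGalois (RatFunc k) N]

lemma Cov.upper_small [IsAlgClosed k] (c : Cov (k := k) z D) (hD : D ≠ 0) (p : ℕ) [Fact p.Prime] [CharP k p]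
    (r μ Q J A : ℕ) (hq : p ^ r = p ^ μ * Q)
    (hQ : Module.finrank (RatFunc k) N * A < Q)
    (hJ : p ^ μ + 1 ≤ Module.finrank (RatFunc k) N * (J - D * d * d))
    (hA : Module.finrank (RatFunc k) N * (p ^ μ * A + J) + 1 <
      (p ^ μ + 1) * (Module.finrank (RatFunc k) N * (A - D * d * d)))
    (π : Fin d → Fin d)
    (Y : Finset k) (hY : ∀ y ∈ Y, y ^ p ^ r = y) (pl : ∀ y ∈ Y, Place k z y)
    (S : k → Finset (N ≃ₐ[RatFunc k] N)) (hS : ∀ y (hy : y ∈ Y), ∀ g ∈ S y, (pl y hy).Pt (p ^ r) π g) :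
    ∑ y ∈ Y, (S y).card ≤ Module.finrank (RatFunc k) N * (A + Q * J) := by
  classical
  rcases Y.eq_empty_or_nonempty with rfl | ⟨y0, hy0⟩
  · simp
  have : ExpChar k p := ExpChar.prime Fact.out
  set M := p ^ μ with hM
  have hM0 : M ≠ 0 := pow_ne_zero _ (Nat.Prime.ne_zero Fact.out)
  obtain ⟨t, o, ho, htm, hto⟩ := c.exists_t hD (pl y0 hy0) J (M + 1) hJ
  obtain ⟨e, he, heli⟩ := exists_basis_lift (k := k) (z := z) hD A
  set F : k →+* k := iterateFrobenius k p r with hF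
  have hFa : ∀ a, F a = a ^ p ^ r := fun a => iterateFrobenius_def p r a
  have hmem : ∀ ji : Fin (M + 1) × Fin (Module.finrank k (W k z D A)),
      evz k z (e ji.2 ^ M * tw π F (t ji.1)) ∈ W k z D (M * A + J) := fun ji =>
    mem_W.2 ⟨_, mul_mem_Wp (pow_mem_Wp (he _) M) (tw_mem π F (htm _)), rfl⟩
  have := W_fd (z := z) (k := k) hD (M * A + J)
  have hnli : ¬ LinearIndependent k (fun ji => (⟨_, hmem ji⟩ : W k z D (M * A + J))) := by
    intro h
    have h1 := h.fintype_card_le_finrank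
    have h2 := c.dim_upper hD (pl y0 hy0) (M * A + J)
    have h3 := c.dim_lower hD A
    simp only [Fintype.card_prod, Fintype.card_fin] at h1
    have h4 := Nat.mul_le_mul_left (M + 1) h3
    omega
  obtain ⟨β, hβ, ⟨j1, i1⟩, hβ1⟩ := Fintype.not_linearIndependent_iff.1 hnli
  have hroot : ∀ ji, ∃ a : k, a ^ M = β ji := fun ji =>
    IsAlgClosed.exists_pow_nat_eq _ (Nat.pos_of_ne_zero hM0)
  choose α hα using hroot
  set s : Fin (M + 1) → MvPolynomial (Option (Fin d)) k := fun j => ∑ i, α (j, i) • e i with hs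
  have hsm : ∀ j, s j ∈ Wp k d D A := fun j =>
    Submodule.sum_mem _ fun i _ => Submodule.smul_mem _ _ (he i)
  have hs0 : ∃ j, evz k z (s j) ≠ 0 := by
    refine ⟨j1, fun h => ?_⟩
    simp only [hs, map_sum, map_smul] at h
    have := Fintype.linearIndependent_iff.1 heli _ h i1
    apply hβ1
    rw [← hα, this, zero_pow hM0]
  have hrel : evz k z (∑ j, s j ^ M * tw π F (t j)) = 0 := by
    have h1 := congrArg Subtype.val hβ
    rw [Submodule.coe_sum, Fintype.sum_prod_type] at h1
    rw [map_sum]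
    refine Eq.trans (Finset.sum_congr rfl fun j _ => ?_) h1
    have hfr : s j ^ M = ∑ i, (α (j, i) • e i) ^ M := sum_pow_char_pow p μ _ _
    rw [hfr, Finset.sum_mul, map_sum]
    refine Finset.sum_congr rfl fun i _ => ?_
    rw [_root_.smul_pow, smul_mul_assoc, map_smul, hα]
    rfl
  have hh := c.sum_ne (pl y0 hy0) ho hto hsm hs0 hQ
  have hhm : (∑ j, s j * t j ^ Q) ∈ Wp k d D (A + Q * J) :=
    Submodule.sum_mem _ fun j _ => mul_mem_Wp (hsm j) (pow_mem_Wp (htm j) Q)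
  have := c.zeros Y pl S (M := 1) hhm hh (by
    intro y hy g hg
    rw [pow_one, PowerSeries.X_dvd_iff]
    have h1 : PowerSeries.constantCoeff ((pl y hy).E g (∑ j, s j ^ M * tw π F (t j))) = 0 := by
      rw [((pl y hy).E_zero_iff g _).2 hrel, map_zero]
    have h2 : PowerSeries.constantCoeff ((pl y hy).E g (∑ j, s j * t j ^ Q)) ^ M = 0 := by
      rw [← h1]
      simp only [map_sum, map_mul, map_pow]
      refine (sum_pow_char_pow p μ _ _).trans (Finset.sum_congr rfl fun j _ => ?_)
      rw [← hM, mul_pow, ← pow_mul, mul_comm Q, ← hq, (hS y hy g hg).tw F hFa (hY y hy)]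
    exact pow_eq_zero_iff hM0 |>.1 h2)
  simpa using this

/-- Derivative of coefficients. -/
noncomputable def fyL (G : k[X][X]) : k[X][X] := G.sum fun i a => monomial i (derivative a)

lemma fyL_coeff (G : k[X][X]) (i : ℕ) : (fyL G).coeff i = derivative (G.coeff i) := by
  rw [fyL, Polynomial.sum, finsetSum_coeff]
  simp only [coeff_monomial]
  rw [Finset.sum_ite_eq']
  split_ifs with h
  · rfl
  · rw [notMem_support_iff.1 h, derivative_zero]

lemma expd_derivative (y0 : k) (P : k[X]) :
    PowerSeries.derivative k (expd y0 P) = expd y0 (derivative P) := by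
  rw [expd_eq, expd_eq, PowerSeries.derivative_coe]
  congr 1
  simp [taylor_apply, derivative_comp]

lemma deriv_eval₂ (y0 : k) (u : PowerSeries k) (G : k[X][X]) :
    PowerSeries.derivative k (G.eval₂ (expd y0) u) = (fyL G).eval₂ (expd y0) u +
      (derivative G).eval₂ (expd y0) u * PowerSeries.derivative k u := by
  induction G using Polynomial.induction_on' with
  | add P Q hP hQ =>
    have : fyL (P + Q) = fyL P + fyL Q := by
      ext1 i; simp [fyL_coeff]
    rw [this]
    simp only [eval₂_add, map_add, hP, hQ]
    ring
  | monomial i a =>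
    have : fyL (monomial i a) = monomial i (derivative a) := by
      ext1 j; simp only [fyL_coeff, coeff_monomial]; split_ifs <;> simp
    rw [this, derivative_monomial]
    simp only [eval₂_monomial, Derivation.leibniz, Derivation.leibniz_pow, expd_derivative,
      smul_eq_mul, map_mul, map_natCast, nsmul_eq_mul]
    ring

/-- Insertion of the variables. -/
noncomputable def ins (j : Fin d) (G : k[X][X]) : MvPolynomial (Option (Fin d)) k :=
  G.eval₂ (aeval (MvPolynomial.X none : MvPolynomial (Option (Fin d)) k)).toRingHom
    (MvPolynomial.X (some j))

lemma aeval_mem_Wp (P : k[X]) {m : ℕ} (h : P.natDegree ≤ m) :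
    aeval (MvPolynomial.X none : MvPolynomial (Option (Fin d)) k) P ∈ Wp k d D m := by
  rw [aeval_eq_sum_range]
  refine Submodule.sum_mem _ fun i hi => Submodule.smul_mem _ _ ?_
  refine Wp_mono ?_ (pow_mem_Wp Xnone_mem_Wp i)
  have := Finset.mem_range.1 hi
  omega

lemma ins_mem_Wp (j : Fin d) (G : k[X][X]) {a b : ℕ} (ha : ∀ i, (G.coeff i).natDegree ≤ a)
    (hb : G.natDegree ≤ b) : ins j G ∈ Wp k d D (a + b * D) := by
  rw [ins, eval₂_eq_sum_range]
  refine Submodule.sum_mem _ fun i hi => mul_mem_Wp (aeval_mem_Wp _ (ha i)) ?_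
  refine Wp_mono ?_ (pow_mem_Wp (Xsome_mem_Wp j) i)
  have := Finset.mem_range.1 hi
  exact Nat.mul_le_mul_right _ (by omega)

lemma Place.E_aeval {y : k} (pl : Place k z y) (g) (P : k[X]) :
    pl.E g (aeval (MvPolynomial.X none) P) = expd y P := by
  refine pl.E_poly g _ P ?_
  rw [← aeval_algHom_apply]
  simp only [evz, MvPolynomial.aeval_X, Option.elim_none]
  induction P using Polynomial.induction_on' with
  | add P Q hP hQ => simp only [map_add, hP, hQ]
  | monomial i a =>
    rw [aeval_monomial, ← C_mul_X_pow_eq_monomial, map_mul, map_pow,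
      IsScalarTower.algebraMap_apply k k[X] N]
    rfl

lemma Place.E_ins {y : k} (pl : Place k z y) (g) (j : Fin d) (G : k[X][X]) :
    pl.E g (ins j G) = G.eval₂ (expd y) (pl.E g (MvPolynomial.X (some j))) := by
  rw [ins, ← AlgHom.coe_toRingHom, hom_eval₂]
  congr 1
  refine RingHom.ext fun P => ?_
  exact pl.E_aeval g P

lemma Cov.E_root (c : Cov (k := k) z D) {y : k} (pl : Place k z y) (g) (j : Fin d) :
    c.f.eval₂ (expd y) (pl.E g (MvPolynomial.X (some j))) = 0 := by
  rw [← pl.E_ins, pl.E_zero_iff, ins, ← AlgHom.coe_toRingHom, hom_eval₂, ← c.eval_z j]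
  have : ((evz k z : MvPolynomial (Option (Fin d)) k →ₐ[k] N) : MvPolynomial (Option (Fin d)) k →+* N) (MvPolynomial.X (some j)) = z j := by simp [evz]
  rw [this]
  congr 1
  ext1
  · refine RingHom.ext fun a => ?_
    simp only [RingHom.comp_apply, AlgHom.toRingHom_eq_coe, RingHom.coe_coe, aeval_C,
      AlgHom.commutes]
    rw [IsScalarTower.algebraMap_apply k k[X] N]; rfl
  · simp [evz]

/-- The derivation lifting `δ d/dy`. -/
noncomputable def Cov.der (c : Cov (k := k) z D) :
    Derivation k (MvPolynomial (Option (Fin d)) k) (MvPolynomial (Option (Fin d)) k) :=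
  MvPolynomial.mkDerivation k (fun o => o.elim (aeval (MvPolynomial.X none) c.δ)
    (fun j => - (ins j c.b * ins j (fyL c.f))))

lemma Cov.E_der (c : Cov (k := k) z D) {y : k} (pl : Place k z y) (g)
    (P : MvPolynomial (Option (Fin d)) k) :
    pl.E g (c.der P) = expd y c.δ * PowerSeries.derivative k (pl.E g P) := by
  induction P using MvPolynomial.induction_on with
  | C a =>
    have h1 : c.der (MvPolynomial.C a) = 0 := Derivation.map_algebraMap c.der a
    have h2 : pl.E g (MvPolynomial.C a) = algebraMap k _ a := (pl.E g).commutes a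
    rw [h1, h2, Derivation.map_algebraMap, map_zero, mul_zero]
  | add P Q hP hQ => simp only [map_add, hP, hQ]; ring
  | mul_X P o hP =>
    have key : pl.E g (c.der (MvPolynomial.X o)) =
        expd y c.δ * PowerSeries.derivative k (pl.E g (MvPolynomial.X o)) := by
      rw [Cov.der, MvPolynomial.mkDerivation_X]
      cases o with
      | none =>
        rw [Option.elim_none, pl.E_aeval, pl.E_X, expd_derivative, derivative_X, map_one, mul_one]
      | some j =>
        set u := pl.E g (MvPolynomial.X (some j)) with hu
        have h0 : c.f.eval₂ (expd y) u = 0 := c.E_root pl g j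
        have h1 := deriv_eval₂ y u c.f
        have h2 := congrArg (Polynomial.eval₂ (expd y) u) c.bez
        rw [eval₂_add, eval₂_mul, eval₂_mul, eval₂_C, h0, mul_zero, zero_add] at h2
        rw [h0, map_zero] at h1
        rw [Option.elim_some, map_neg, map_mul, pl.E_ins, pl.E_ins, ← hu, ← h2]
        linear_combination (eval₂ (expd y) u c.b) * h1
    rw [Derivation.leibniz, map_mul, Derivation.leibniz, map_add]
    simp only [smul_eq_mul, map_mul, hP, key]
    ring

lemma Cov.der_mem (c : Cov (k := k) z D) {m : ℕ} {P : MvPolynomial (Option (Fin d)) k}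
    (hP : P ∈ Wp k d D m) : c.der P ∈ Wp k d D (m + ((D + D * D) + (D + d * D))) := by
  have hv : ∀ o : Option (Fin d), c.der (MvPolynomial.X o) ∈ Wp k d D ((D + D * D) + (D + d * D)) := by
    intro o
    rw [Cov.der, MvPolynomial.mkDerivation_X]
    cases o with
    | none => exact Wp_mono (by omega) (aeval_mem_Wp c.δ c.hδd)
    | some j =>
      refine Submodule.neg_mem _ (mul_mem_Wp (ins_mem_Wp j _ c.hbd c.hbn) (ins_mem_Wp j _ ?_ ?_))
      · intro i
        rw [fyL_coeff]
        rcases lt_trichotomy i c.f.natDegree with h | h | h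
        · exact (natDegree_derivative_le _).trans ((Nat.sub_le _ _).trans (c.hfd i))
        · rw [h, c.monic.coeff_natDegree]; simp
        · rw [coeff_eq_zero_of_natDegree_lt h]; simp
      · rw [natDegree_le_iff_coeff_eq_zero]
        intro i hi
        rw [fyL_coeff, coeff_eq_zero_of_natDegree_lt (by rw [c.natDegree]; exact hi), derivative_zero]
  refine Wp_map c.der.toLinearMap.toAddMonoidHom
    (Wp k d D (m + ((D + D * D) + (D + d * D)))).toAddSubmonoid (fun s a hs => ?_) hP
  change c.der (MvPolynomial.monomial s a) ∈ Wp k d D (m + ((D + D * D) + (D + d * D)))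
  unfold Cov.der at hv ⊢
  rw [MvPolynomial.mkDerivation_monomial]
  refine Submodule.smul_mem _ _ (Submodule.sum_mem _ fun o ho => ?_)
  have h1 := hv o
  rw [MvPolynomial.mkDerivation_X] at h1
  refine mul_mem_Wp (monomial_mem_Wp ?_ _) h1
  have := Finsupp.weight_sub_single_add (w := wtf d D) (Finsupp.mem_support_iff.1 ho)
  omega

end Up
end PRU
end

section
open Polynomial
set_option linter.unusedSectionVars false
namespace PRU

/-- The operator `a d/dT` on power series. -/
noncomputable def theta {k : Type*} [Field k] (a : PowerSeries k) : PowerSeries k →ₗ[k] PowerSeries k :=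
  (LinearMap.mulLeft k a).comp (PowerSeries.derivative k).toLinearMap

lemma theta_apply {k : Type*} [Field k] (a u : PowerSeries k) :
    theta a u = a * PowerSeries.derivative k u := rfl

lemma theta_dvd {k : Type*} [Field k] {p : ℕ} [Fact p.Prime] [CharP k p] (a : PowerSeries k)
    (ha : PowerSeries.constantCoeff a ≠ 0) (e : ℕ) (he : e < p) (u : PowerSeries k)
    (h1 : PowerSeries.X ^ e ∣ u) (h2 : PowerSeries.constantCoeff ((theta a ^ e) u) = 0) :
    PowerSeries.X ^ (e + 1) ∣ u := by
  induction e generalizing u with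
  | zero =>
    rw [zero_add, pow_one, PowerSeries.X_dvd_iff]
    simpa using h2
  | succ e ih =>
    have h3 : PowerSeries.X ^ e ∣ theta a u := by
      rw [theta_apply]
      refine Dvd.dvd.mul_left ?_ _
      rw [PowerSeries.X_pow_dvd_iff] at h1 ⊢
      intro m hm
      rw [PowerSeries.coeff_derivative, h1 (m + 1) (by omega), zero_mul]
    have h4 := ih (by omega) (theta a u) h3 (by
      rw [pow_succ] at h2; exact h2)
    have hu : IsUnit a := PowerSeries.isUnit_iff_constantCoeff.2 (isUnit_iff_ne_zero.2 ha)
    rw [theta_apply, hu.dvd_mul_left] at h4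
    rw [PowerSeries.X_pow_dvd_iff] at h1 h4 ⊢
    intro m hm
    rcases Nat.lt_succ_iff_lt_or_eq.1 hm with h | rfl
    · exact h1 m h
    · have h5 := h4 e (Nat.lt_succ_self e)
      rw [PowerSeries.coeff_derivative] at h5
      rcases mul_eq_zero.1 h5 with h | h
      · exact h
      · exfalso
        have h6 : ((e + 1 : ℕ) : k) = 0 := by exact_mod_cast h
        rw [CharP.cast_eq_zero_iff k p] at h6
        exact absurd (Nat.le_of_dvd (Nat.succ_pos e) h6) (by omega)

lemma theta_dvd_all {k : Type*} [Field k] {p : ℕ} [Fact p.Prime] [CharP k p] (a : PowerSeries k)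
    (ha : PowerSeries.constantCoeff a ≠ 0) (M : ℕ) (he : M ≤ p) (u : PowerSeries k)
    (h2 : ∀ l < M, PowerSeries.constantCoeff ((theta a ^ l) u) = 0) :
    PowerSeries.X ^ M ∣ u := by
  induction M with
  | zero => simp
  | succ M ih =>
    exact theta_dvd a ha M (by omega) u (ih (by omega) fun l hl => h2 l (by omega))
      (h2 M (Nat.lt_succ_self M))

lemma theta_pow_mul {k : Type*} [Field k] (a w : PowerSeries k)
    (hw : PowerSeries.derivative k w = 0) (l : ℕ) (u : PowerSeries k) :
    (theta a ^ l) (u * w) = (theta a ^ l) u * w := by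
  induction l generalizing u with
  | zero => simp
  | succ l ih =>
    rw [pow_succ, Module.End.mul_apply, Module.End.mul_apply, ← ih]
    congr 1
    rw [theta_apply, theta_apply, Derivation.leibniz, hw]
    simp only [smul_eq_mul]
    ring

section Up
variable {k : Type*} [Field k] {N : Type*} [Field N] [Algebra k N] [Algebra k[X] N]
  [Algebra (RatFunc k) N] [IsScalarTower k k[X] N] [IsScalarTower k[X] (RatFunc k) N] {d : ℕ}
  {z : Fin d → N} {D : ℕ} [FiniteDimensional (RatFunc k) N] [IsGalois (RatFunc k) N]

lemma Cov.E_der_pow (c : Cov (k := k) z D) {y : k} (pl : Place k z y) (g) (l : ℕ)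
    (P : MvPolynomial (Option (Fin d)) k) :
    pl.E g ((c.der.toLinearMap ^ l) P) = (theta (expd y c.δ) ^ l) (pl.E g P) := by
  induction l generalizing P with
  | zero => simp
  | succ l ih =>
    rw [pow_succ, Module.End.mul_apply, ih, pow_succ, Module.End.mul_apply]
    congr 1
    exact c.E_der pl g P

lemma Cov.der_pow_mem (c : Cov (k := k) z D) {m : ℕ} (l : ℕ) {P : MvPolynomial (Option (Fin d)) k}
    (hP : P ∈ Wp k d D m) :
    (c.der.toLinearMap ^ l) P ∈ Wp k d D (m + l * ((D + D * D) + (D + d * D))) := by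
  induction l with
  | zero => simpa using hP
  | succ l ih =>
    rw [pow_succ', Module.End.mul_apply, Nat.succ_mul, ← add_assoc]
    exact c.der_mem ih

lemma Cov.upper_large (c : Cov (k := k) z D) (hD : D ≠ 0) (p : ℕ) [Fact p.Prime] [CharP k p]
    (r M J A : ℕ) (hr : r ≠ 0) (hMp : M ≤ p)
    (hQ : Module.finrank (RatFunc k) N * A < p ^ r)
    (hJ : M + 1 ≤ Module.finrank (RatFunc k) N * (J - D * d * d))
    (hA : M * (Module.finrank (RatFunc k) N * (A + M * ((D + D * D) + (D + d * D)) + J) + 1) <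
      (M + 1) * (Module.finrank (RatFunc k) N * (A - D * d * d)))
    (π : Fin d → Fin d)
    (Y : Finset k) (hY : ∀ y ∈ Y, y ^ p ^ r = y) (hYδ : ∀ y ∈ Y, c.δ.eval y ≠ 0)
    (pl : ∀ y ∈ Y, Place k z y)
    (S : k → Finset (N ≃ₐ[RatFunc k] N)) (hS : ∀ y (hy : y ∈ Y), ∀ g ∈ S y, (pl y hy).Pt (p ^ r) π g) :
    M * ∑ y ∈ Y, (S y).card ≤ Module.finrank (RatFunc k) N * (A + p ^ r * J) := by
  classical
  rcases Y.eq_empty_or_nonempty with rfl | ⟨y0, hy0⟩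
  · simp
  have : ExpChar k p := ExpChar.prime Fact.out
  set c1 := (D + D * D) + (D + d * D) with hc1
  obtain ⟨t, o, ho, htm, hto⟩ := c.exists_t hD (pl y0 hy0) J (M + 1) hJ
  obtain ⟨e, he, heli⟩ := exists_basis_lift (k := k) (z := z) hD A
  set F : k →+* k := iterateFrobenius k p r with hF
  have hFa : ∀ a, F a = a ^ p ^ r := fun a => iterateFrobenius_def p r a
  have hmem : ∀ (ji : Fin (M + 1) × Fin (Module.finrank k (W k z D A))) (l : Fin M),
      evz k z ((c.der.toLinearMap ^ (l : ℕ)) (e ji.2) * tw π F (t ji.1)) ∈ W k z D (A + M * c1 + J) :=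
    fun ji l => mem_W.2 ⟨_, Wp_mono (by
      have := Nat.mul_le_mul_right c1 l.2.le
      rw [← hc1]; omega) (mul_mem_Wp (c.der_pow_mem l (he _)) (tw_mem π F (htm _))), rfl⟩
  have := W_fd (z := z) (k := k) hD (A + M * c1 + J)
  have hnli : ¬ LinearIndependent k
      (fun ji => (fun l => ⟨_, hmem ji l⟩ : Fin M → W k z D (A + M * c1 + J))) := by
    intro h
    have h1 := h.fintype_card_le_finrank
    have h2 := c.dim_upper hD (pl y0 hy0) (A + M * c1 + J)
    have h3 := c.dim_lower hD A
    rw [Module.finrank_pi_fintype] at h1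
    simp only [Fintype.card_prod, Fintype.card_fin, Finset.sum_const, Finset.card_univ,
      smul_eq_mul] at h1
    have h4 := Nat.mul_le_mul_left (M + 1) h3
    have h5 := Nat.mul_le_mul_left M h2
    omega
  obtain ⟨α, hα, ⟨j1, i1⟩, hα1⟩ := Fintype.not_linearIndependent_iff.1 hnli
  set s : Fin (M + 1) → MvPolynomial (Option (Fin d)) k := fun j => ∑ i, α (j, i) • e i with hs
  have hsm : ∀ j, s j ∈ Wp k d D A := fun j =>
    Submodule.sum_mem _ fun i _ => Submodule.smul_mem _ _ (he i)
  have hs0 : ∃ j, evz k z (s j) ≠ 0 := by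
    refine ⟨j1, fun h => ?_⟩
    simp only [hs, map_sum, map_smul] at h
    exact hα1 (Fintype.linearIndependent_iff.1 heli _ h i1)
  have hrel : ∀ l < M, evz k z (∑ j, (c.der.toLinearMap ^ l) (s j) * tw π F (t j)) = 0 := by
    intro l hl
    have h1 := congrArg Subtype.val (congrFun hα ⟨l, hl⟩)
    rw [Finset.sum_apply, Submodule.coe_sum, Fintype.sum_prod_type] at h1
    rw [map_sum]
    refine Eq.trans (Finset.sum_congr rfl fun j _ => ?_) h1
    rw [hs, map_sum, Finset.sum_mul, map_sum]
    refine Finset.sum_congr rfl fun i _ => ?_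
    rw [map_smul, smul_mul_assoc, map_smul]
    rfl
  have hh := c.sum_ne (pl y0 hy0) ho hto hsm hs0 hQ
  have hhm : (∑ j, s j * t j ^ (p ^ r)) ∈ Wp k d D (A + p ^ r * J) :=
    Submodule.sum_mem _ fun j _ => mul_mem_Wp (hsm j) (pow_mem_Wp (htm j) _)
  refine c.zeros Y pl S hhm hh fun y hy g hg => ?_
  refine theta_dvd_all (p := p) (expd y c.δ) (by rw [expd_const]; exact hYδ y hy) M hMp _ fun l hl => ?_
  have h1 : PowerSeries.constantCoeff ((pl y hy).E g
      (∑ j, (c.der.toLinearMap ^ l) (s j) * tw π F (t j))) = 0 := by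
    rw [((pl y hy).E_zero_iff g _).2 (hrel l hl), map_zero]
  rw [← h1]
  simp only [map_sum, map_mul, map_pow]
  refine Finset.sum_congr rfl fun j _ => ?_
  rw [theta_pow_mul, map_mul, map_pow, (hS y hy g hg).tw F hFa (hY y hy), c.E_der_pow]
  rw [Derivation.leibniz_pow, ← Nat.cast_smul_eq_nsmul k, Nat.cast_pow, CharP.cast_eq_zero,
    zero_pow hr, zero_smul]

end Up
end PRU
end

section
open Polynomial
set_option linter.unusedSectionVars false
namespace PRU

/-- Constants of the Stepanov argument. -/
def Jf (d D n M : ℕ) : ℕ := D * d * d + M / n + 1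
def Af (d D n M : ℕ) : ℕ := D * d * d * (M + 1) +
  M * (((D + D * D) + (D + d * D)) * M + Jf d D n M + 1) + Jf d D n M + 2

lemma Jf_cond (d D n M : ℕ) (hn : 0 < n) : M + 1 ≤ n * (Jf d D n M - D * d * d) := by
  have h : Jf d D n M - D * d * d = M / n + 1 := by
    unfold Jf; generalize M / n = x; omega
  rw [h]
  exact Nat.lt_mul_div_succ M hn

lemma Af_sub (d D n M : ℕ) : ∃ B, Af d D n M = D * d * d + B ∧
    B = D * d * d * M + M * (((D + D * D) + (D + d * D)) * M + Jf d D n M + 1) + Jf d D n M + 2 :=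
  ⟨_, by unfold Af; ring, rfl⟩

lemma Af_cond1 (d D n M : ℕ) (hn : 0 < n) :
    M * (n * (Af d D n M + M * ((D + D * D) + (D + d * D)) + Jf d D n M) + 1) <
      (M + 1) * (n * (Af d D n M - D * d * d)) := by
  obtain ⟨B, hB, hB2⟩ := Af_sub d D n M
  rw [hB, Nat.add_sub_cancel_left]
  generalize Jf d D n M = J at *
  generalize ((D + D * D) + (D + d * D)) = c1 at *
  generalize D * d * d = c0 at *
  have h1 : n * B = n * (c0 * M + M * (c1 * M + J)) + n * M + n * (J + 2) := by rw [hB2]; ring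
  have h2 : M ≤ n * M := Nat.le_mul_of_pos_left _ hn
  have h3 : 0 < n * (J + 2) := by positivity
  nlinarith

lemma Af_cond2 (d D n M : ℕ) (hn : 0 < n) :
    n * (M * Af d D n M + Jf d D n M) + 1 < (M + 1) * (n * (Af d D n M - D * d * d)) := by
  obtain ⟨B, hB, hB2⟩ := Af_sub d D n M
  rw [hB, Nat.add_sub_cancel_left]
  generalize Jf d D n M = J at *
  generalize ((D + D * D) + (D + d * D)) = c1 at *
  generalize D * d * d = c0 at *
  have h1 : n * B = n * (c0 * M) + n * (M * (c1 * M + J + 1)) + n * J + 2 * n := by rw [hB2]; ring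
  have h3 : 0 ≤ n * (M * (c1 * M + J + 1)) := Nat.zero_le _
  nlinarith

section Up
variable {k : Type*} [Field k] {N : Type*} [Field N] [Algebra k N] [Algebra k[X] N]
  [Algebra (RatFunc k) N] [IsScalarTower k k[X] N] [IsScalarTower k[X] (RatFunc k) N] {d : ℕ}
  {z : Fin d → N} {D : ℕ} [FiniteDimensional (RatFunc k) N] [IsGalois (RatFunc k) N]

lemma Cov.upper [IsAlgClosed k] (c : Cov (k := k) z D) (hD : D ≠ 0) (p : ℕ) [Fact p.Prime] [CharP k p]
    (r M0 : ℕ) (hr : r ≠ 0) (hM0 : M0 ≠ 0)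
    (hq : ∀ M ≤ M0 * M0, M * (Module.finrank (RatFunc k) N *
      Af d D (Module.finrank (RatFunc k) N) M) < p ^ r) :
    ∃ M, M0 ≤ M ∧ M ≤ M0 * M0 ∧ ∀ (π : Fin d → Fin d)
    (Y : Finset k) (_ : ∀ y ∈ Y, y ^ p ^ r = y) (_ : ∀ y ∈ Y, c.δ.eval y ≠ 0)
    (pl : ∀ y ∈ Y, Place k z y)
    (S : k → Finset (N ≃ₐ[RatFunc k] N))
    (_ : ∀ y (hy : y ∈ Y), ∀ g ∈ S y, (pl y hy).Pt (p ^ r) π g),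
    M * ∑ y ∈ Y, (S y).card ≤ Module.finrank (RatFunc k) N *
      (M * Af d D (Module.finrank (RatFunc k) N) M +
        p ^ r * Jf d D (Module.finrank (RatFunc k) N) M) := by
  set n := Module.finrank (RatFunc k) N with hn
  have hn0 : 0 < n := Module.finrank_pos
  have hp : 2 ≤ p := Nat.Prime.two_le Fact.out
  by_cases hpM : M0 ≤ p
  · refine ⟨M0, le_rfl, Nat.le_mul_of_pos_left _ (Nat.pos_of_ne_zero hM0), ?_⟩
    intro π Y hY hYδ pl S hS
    have h1 := hq M0 (Nat.le_mul_of_pos_left _ (Nat.pos_of_ne_zero hM0))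
    have h2 : n * Af d D n M0 ≤ M0 * (n * Af d D n M0) :=
      Nat.le_mul_of_pos_left _ (Nat.pos_of_ne_zero hM0)
    refine (c.upper_large hD p r M0 (Jf d D n M0) (Af d D n M0) hr hpM (lt_of_le_of_lt h2 h1)
      (Jf_cond d D n M0 hn0) (Af_cond1 d D n M0 hn0) π Y hY hYδ pl S hS).trans ?_
    refine Nat.mul_le_mul_left _ (Nat.add_le_add_right ?_ _)
    exact Nat.le_mul_of_pos_left _ (Nat.pos_of_ne_zero hM0)
  · push Not at hpM
    obtain ⟨μ, h1, h2⟩ : ∃ μ, M0 ≤ p ^ μ ∧ p ^ μ ≤ M0 * M0 := by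
      have hex : ∃ μ, M0 ≤ p ^ μ := ⟨M0, (Nat.lt_pow_self hp).le⟩
      classical
      refine ⟨Nat.find hex, Nat.find_spec hex, ?_⟩
      rcases hμ : Nat.find hex with _ | e
      · rw [pow_zero]
        exact Nat.one_le_iff_ne_zero.2 (mul_ne_zero hM0 hM0)
      · have := Nat.find_min hex (m := e) (by omega)
        rw [pow_succ]
        exact Nat.mul_le_mul (by omega) hpM.le
    refine ⟨p ^ μ, h1, h2, ?_⟩
    intro π Y hY hYδ pl S hS
    set M := p ^ μ with hM
    have h3 := hq M h2
    have hA0 : 0 < n * Af d D n M := Nat.mul_pos hn0 (by unfold Af; omega)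
    have hMr : M < p ^ r := lt_of_le_of_lt (Nat.le_mul_of_pos_right _ hA0) h3
    have hμr : μ ≤ r := ((Nat.pow_lt_pow_iff_right hp).1 hMr).le
    have hQ : p ^ r = M * p ^ (r - μ) := by rw [hM, ← pow_add]; congr 1; omega
    have h4 := c.upper_small hD p r μ (p ^ (r - μ)) (Jf d D n M) (Af d D n M) hQ
      (by rw [hQ] at h3; exact lt_of_mul_lt_mul_left h3 (Nat.zero_le _))
      (Jf_cond d D n M hn0) (Af_cond2 d D n M hn0) π Y hY pl S hS
    refine (Nat.mul_le_mul_left M h4).trans (le_of_eq ?_)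
    rw [hQ]; ring

lemma Place.twist {y : k} (pl : Place k z y) (p r : ℕ) [Fact p.Prime] [CharP k p] (hy : y ^ p ^ r = y)
    (τ : N →+* N) (hτ : ∀ a, τ (algebraMap k N a) = algebraMap k N (a ^ p ^ r))
    (hτy : τ (algebraMap k[X] N X) = algebraMap k[X] N X) (g : N ≃ₐ[RatFunc k] N) :
    ∃ g' : N ≃ₐ[RatFunc k] N, ∀ j i, τ (g' (z j)) = z i →
      PowerSeries.constantCoeff (pl.E g (MvPolynomial.X (some j))) ^ p ^ r =
        PowerSeries.constantCoeff (pl.E g (MvPolynomial.X (some i))) := by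
  have : ExpChar k p := ExpChar.prime Fact.out
  set L := LaurentSeries k
  set F : k →+* k := iterateFrobenius k p r with hF
  have hFa : ∀ a, F a = a ^ p ^ r := fun a => iterateFrobenius_def p r a
  have hmapinj : Function.Injective (PowerSeries.map F) := by
    intro u v h
    ext m
    have := congrArg (PowerSeries.coeff m) h
    rw [PowerSeries.coeff_map, PowerSeries.coeff_map] at this
    exact F.injective this
  let Φ : L →+* L := IsFractionRing.map (A := PowerSeries k) (B := PowerSeries k) hmapinj
  have hΦ : ∀ u : PowerSeries k, Φ (algebraMap _ L u) = algebraMap _ L (PowerSeries.map F u) :=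
    fun u => IsLocalization.map_eq _ u
  have hεg : ∀ Q : k[X], pl.ε (g (algebraMap k[X] N Q)) = algebraMap _ L (expd y Q) := by
    intro Q
    rw [IsScalarTower.algebraMap_apply k[X] (RatFunc k) N, AlgEquiv.commutes,
      ← IsScalarTower.algebraMap_apply, pl.hε]
  let A1 : N →+* L := Φ.comp (pl.ε.comp (g : N →+* N))
  let A2 : N →+* L := (pl.ε.comp (g : N →+* N)).comp τ
  have hag : A1.comp (algebraMap (RatFunc k) N) = A2.comp (algebraMap (RatFunc k) N) := by
    apply IsLocalization.ringHom_ext (nonZeroDivisors k[X])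
    have e0 : ∀ Q, algebraMap (RatFunc k) N (algebraMap k[X] (RatFunc k) Q) = algebraMap k[X] N Q :=
      fun Q => (IsScalarTower.algebraMap_apply k[X] (RatFunc k) N Q).symm
    ext1
    · refine RingHom.ext fun a => ?_
      have e1 : algebraMap k[X] N (C a) = algebraMap k N a := by
        rw [IsScalarTower.algebraMap_apply k k[X] N]; rfl
      have e2 : algebraMap k[X] N (C (a ^ p ^ r)) = algebraMap k N (a ^ p ^ r) := by
        rw [IsScalarTower.algebraMap_apply k k[X] N]; rfl
      change Φ (pl.ε (g (algebraMap (RatFunc k) N (algebraMap k[X] (RatFunc k) (C a))))) =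
        pl.ε (g (τ (algebraMap (RatFunc k) N (algebraMap k[X] (RatFunc k) (C a)))))
      rw [e0, hεg, hΦ, e1, hτ, ← e2, hεg, expd_C, expd_C, PowerSeries.map_C, hFa]
    · change Φ (pl.ε (g (algebraMap (RatFunc k) N (algebraMap k[X] (RatFunc k) X)))) =
        pl.ε (g (τ (algebraMap (RatFunc k) N (algebraMap k[X] (RatFunc k) X))))
      rw [e0, hτy, hεg, hΦ, expd_X, map_add, PowerSeries.map_C, PowerSeries.map_X, hFa, hy]
  let alg1 : Algebra N L := A2.toAlgebra
  let alg2 : Algebra (RatFunc k) L := (A2.comp (algebraMap (RatFunc k) N)).toAlgebra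
  have tower : IsScalarTower (RatFunc k) N L := IsScalarTower.of_algebraMap_eq fun x => rfl
  let A1' : N →ₐ[RatFunc k] L := { A1 with commutes' := fun x => RingHom.congr_fun hag x }
  let g' := Normal.algHomEquivAut (RatFunc k) L N A1'
  have hg' : ∀ x, A1 x = A2 (g' x) := by
    intro x
    have h1 := (Normal.algHomEquivAut (RatFunc k) L N).symm_apply_apply A1'
    have h2 := DFunLike.congr_fun h1 x
    exact h2.symm
  refine ⟨g', fun j i hji => ?_⟩
  have h1 := hg' (z j)
  have e : ∀ j, z j = evz k z (MvPolynomial.X (some j)) := fun j => by simp [evz]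
  have h2 : A1 (z j) = algebraMap _ L (PowerSeries.map F (pl.E g (MvPolynomial.X (some j)))) := by
    rw [← hΦ, ← pl.hE, ← e]; rfl
  have h3 : A2 (g' (z j)) = algebraMap _ L (pl.E g (MvPolynomial.X (some i))) := by
    rw [← pl.hE, ← e, ← hji]; rfl
  rw [h2, h3] at h1
  have h4 := IsFractionRing.injective (PowerSeries k) L h1
  have h5 := congrArg (PowerSeries.constantCoeff (R := k)) h4
  rw [← h5, ← hFa, ← PowerSeries.coeff_zero_eq_constantCoeff_apply,
    ← PowerSeries.coeff_zero_eq_constantCoeff_apply, PowerSeries.coeff_map]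

lemma final_arith {n M q A J c0 D Y : ℕ} (hn : 0 < n) (hM : 2 * (n * n * (c0 + 1)) ≤ M) (hM0 : 0 < M)
    (hJ : n * J ≤ n * (c0 + 1) + M) (hY : q ≤ Y + D)
    (h : M * (n * Y) ≤ (n - 1) * (n * (M * A + q * J))) : q ≤ 2 * (n * (D + n * A)) := by
  obtain ⟨m, rfl⟩ : ∃ m, n = m + 1 := ⟨n - 1, by omega⟩
  rw [Nat.add_sub_cancel] at h
  have h1 : M * ((m + 1) * q) ≤ M * ((m + 1) * D) + m * ((m + 1) * (M * A + q * J)) := by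
    nlinarith [Nat.mul_le_mul_left (M * (m + 1)) hY]
  have h2 : m * q * ((m + 1) * J) ≤ m * q * ((m + 1) * (c0 + 1) + M) := Nat.mul_le_mul_left _ hJ
  have h3 : M * q ≤ M * ((m + 1) * D) + m * (m + 1) * M * A + m * q * ((m + 1) * (c0 + 1)) := by
    nlinarith
  have h4 : q * (2 * ((m + 1) * (m + 1) * (c0 + 1))) ≤ q * M := Nat.mul_le_mul_left _ hM
  have h5 : M * q ≤ M * (2 * ((m + 1) * (D + (m + 1) * A))) := by
    have : 0 ≤ q * ((m + 1) * (c0 + 1)) := Nat.zero_le _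
    have : 0 ≤ (m + 1) * M * A := Nat.zero_le _
    nlinarith
  exact le_of_mul_le_mul_left h5 hM0

lemma card_fixed (k : Type*) [Field k] [IsAlgClosed k] (p : ℕ) [Fact p.Prime] [CharP k p] (r : ℕ)
    (hr : r ≠ 0) : ∃ Y : Finset k, Y.card = p ^ r ∧ ∀ y ∈ Y, y ^ p ^ r = y := by
  classical
  have hp : 1 < p ^ r := Nat.one_lt_pow hr (Nat.Prime.one_lt Fact.out)
  refine ⟨(X ^ (p ^ r) - X : k[X]).roots.toFinset, ?_, fun y hy => ?_⟩
  · rw [Multiset.toFinset_card_of_nodup (nodup_roots (galois_poly_separable p (p ^ r)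
      (dvd_pow_self p hr))), splits_iff_card_roots.1 (IsAlgClosed.splits _),
      FiniteField.X_pow_card_sub_X_natDegree_eq k hp]
  · rw [Multiset.mem_toFinset, mem_roots (FiniteField.X_pow_card_sub_X_ne_zero k hp)] at hy
    simpa [sub_eq_zero] using hy

/-- Chebotarev, core version. -/
lemma Cov.cheb [IsAlgClosed k] (c : Cov (k := k) z D) (hD : D ≠ 0) (p : ℕ) [Fact p.Prime] [CharP k p]
    (r M0 : ℕ) (hr : r ≠ 0)
    (hM0 : M0 = 2 * (Module.finrank (RatFunc k) N * Module.finrank (RatFunc k) N * (D * d * d + 1)))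
    (hq : ∀ M ≤ M0 * M0, M * (Module.finrank (RatFunc k) N *
      Af d D (Module.finrank (RatFunc k) N) M) < p ^ r)
    (hq2 : ∀ M ≤ M0 * M0, 2 * (Module.finrank (RatFunc k) N * (D + Module.finrank (RatFunc k) N *
      Af d D (Module.finrank (RatFunc k) N) M)) < p ^ r)
    (τ : N →+* N) (hτ : ∀ a, τ (algebraMap k N a) = algebraMap k N (a ^ p ^ r))
    (hτy : τ (algebraMap k[X] N X) = algebraMap k[X] N X) (π : Fin d → Fin d)
    (hπ : ∀ j, τ (z j) = z (π j)) :
    ∃ (y0 : k) (ζ : Fin d → k), y0 ^ p ^ r = y0 ∧ c.δ.eval y0 ≠ 0 ∧ (∀ j, ζ j ^ p ^ r = ζ (π j)) ∧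
      ∀ P : MvPolynomial (Option (Fin d)) k, evz k z P = 0 →
        MvPolynomial.aeval (fun o => o.elim y0 ζ) P = 0 := by
  classical
  set n := Module.finrank (RatFunc k) N with hn
  have hn0 : 0 < n := Module.finrank_pos
  have hM00 : M0 ≠ 0 := by rw [hM0]; positivity
  obtain ⟨M, hM1, hM2, hup⟩ := c.upper hD p r M0 hr hM00 hq
  obtain ⟨Y0, hY0c, hY0⟩ := card_fixed k p r hr
  set Y := Y0.filter (fun y => c.δ.eval y ≠ 0) with hYdef
  have hY : ∀ y ∈ Y, y ^ p ^ r = y := fun y hy => hY0 y (Finset.mem_filter.1 hy).1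
  have hYδ : ∀ y ∈ Y, c.δ.eval y ≠ 0 := fun y hy => (Finset.mem_filter.1 hy).2
  have hYc : p ^ r ≤ Y.card + D := by
    rw [← hY0c, ← Finset.card_filter_add_card_filter_not (s := Y0) (fun y => c.δ.eval y ≠ 0)]
    refine Nat.add_le_add_left ?_ _
    refine le_trans (Finset.card_le_card (t := c.δ.roots.toFinset) fun y hy => ?_) ?_
    · rw [Multiset.mem_toFinset, mem_roots c.hδ]
      simpa using (Finset.mem_filter.1 hy).2
    · exact (Multiset.toFinset_card_le _).trans ((card_roots' _).trans c.hδd)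
  have hpl : ∀ y ∈ Y, Nonempty (Place k z y) := fun y hy => c.exists_place y (hYδ y hy)
  let pl : ∀ y ∈ Y, Place k z y := fun y hy => (hpl y hy).some
  choose ρ hρ using c.gal_z
  have hsucc : ∃ y, ∃ hy : y ∈ Y, ∃ g, (pl y hy).Pt (p ^ r) π g := by
    by_contra hcon
    push Not at hcon
    let S : (N ≃ₐ[RatFunc k] N) → k → Finset (N ≃ₐ[RatFunc k] N) := fun g' y =>
      if hy : y ∈ Y then Finset.univ.filter (fun g => (pl y hy).Pt (p ^ r) (fun j => π (ρ g' j)) g)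
      else ∅
    have hS : ∀ g' y (hy : y ∈ Y), ∀ g ∈ S g' y, (pl y hy).Pt (p ^ r) (fun j => π (ρ g' j)) g := by
      intro g' y hy g hg
      simp only [S, dif_pos hy, Finset.mem_filter, Finset.mem_univ, true_and] at hg
      exact hg
    have hcov : ∀ y ∈ Y, n ≤ ∑ g' ∈ Finset.univ.erase 1, (S g' y).card := by
      intro y hy
      refine le_trans (le_of_eq ?_) Finset.card_biUnion_le
      have : (Finset.univ.erase 1).biUnion (fun g' => S g' y) = Finset.univ := by
        refine Finset.eq_univ_iff_forall.2 fun g => ?_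
        obtain ⟨g', hg'⟩ := (pl y hy).twist p r (hY y hy) τ hτ hτy g
        have hPt : (pl y hy).Pt (p ^ r) (fun j => π (ρ g' j)) g := by
          intro j
          exact hg' j _ (by rw [hρ, hπ])
        rw [Finset.mem_biUnion]
        refine ⟨g', Finset.mem_erase.2 ⟨?_, Finset.mem_univ _⟩, ?_⟩
        · rintro rfl
          refine hcon y hy g fun j => hg' j _ ?_
          rw [AlgEquiv.one_apply, hπ]
        · simp only [S, dif_pos hy, Finset.mem_filter, Finset.mem_univ, true_and]
          exact hPt
      rw [this, Finset.card_univ, ← Nat.card_eq_fintype_card, IsGalois.card_aut_eq_finrank]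
    have h1 : M * (n * Y.card) ≤ (n - 1) * (n * (M * Af d D n M + p ^ r * Jf d D n M)) := by
      calc M * (n * Y.card) = M * ∑ y ∈ Y, n := by rw [Finset.sum_const, smul_eq_mul, mul_comm n]
        _ ≤ M * ∑ y ∈ Y, ∑ g' ∈ Finset.univ.erase 1, (S g' y).card :=
            Nat.mul_le_mul_left _ (Finset.sum_le_sum hcov)
        _ = ∑ g' ∈ Finset.univ.erase 1, M * ∑ y ∈ Y, (S g' y).card := by
            rw [Finset.sum_comm, Finset.mul_sum]
        _ ≤ ∑ g' ∈ Finset.univ.erase (1 : N ≃ₐ[RatFunc k] N),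
              n * (M * Af d D n M + p ^ r * Jf d D n M) :=
            Finset.sum_le_sum fun g' _ => hup _ Y hY hYδ pl (S g') (hS g')
        _ = _ := by
            rw [Finset.sum_const, smul_eq_mul, Finset.card_erase_of_mem (Finset.mem_univ _),
              Finset.card_univ, ← Nat.card_eq_fintype_card, IsGalois.card_aut_eq_finrank]
    have h2 := final_arith hn0 (hM0 ▸ hM1) (by omega) (c0 := D * d * d) (by
      unfold Jf
      have := Nat.mul_div_le M n
      nlinarith) hYc h1
    exact absurd (hq2 M hM2) (by omega)
  obtain ⟨y, hy, g, hg⟩ := hsucc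
  refine ⟨y, fun j => PowerSeries.constantCoeff ((pl y hy).E g (MvPolynomial.X (some j))),
    hY y hy, hYδ y hy, hg, fun P hP => ?_⟩
  have h1 : PowerSeries.constantCoeff ((pl y hy).E g P) = 0 := by
    rw [((pl y hy).E_zero_iff g P).2 hP, map_zero]
  rw [← h1]
  have key : (MvPolynomial.aeval (fun o : Option (Fin d) => o.elim y (fun j =>
      PowerSeries.constantCoeff ((pl y hy).E g (MvPolynomial.X (some j)))))).toRingHom =
      (PowerSeries.constantCoeff (R := k)).comp ((pl y hy).E g).toRingHom := by
    refine MvPolynomial.ringHom_ext (fun a => ?_) (fun o => ?_)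
    · have hE : (pl y hy).E g (MvPolynomial.C a) = PowerSeries.C a := ((pl y hy).E g).commutes a
      simp [hE]
    · cases o with
      | none => simp [(pl y hy).E_X, expd_X]
      | some j => simp
  exact RingHom.congr_fun key P

end Up
end PRU
end

section
open Polynomial
set_option linter.unusedSectionVars false
namespace PRU

/-- The threshold for `q`. -/
def q0n (d D n : ℕ) : ℕ :=
  ∑ M ∈ Finset.range ((2 * (n * n * (D * d * d + 1))) * (2 * (n * n * (D * d * d + 1))) + 1),
    (M * (n * Af d D n M) + 2 * (n * (D + n * Af d D n M)) + 1)

def q0 (d D : ℕ) : ℕ := ∑ n ∈ Finset.range (d ^ d + 1), q0n d D n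

lemma q0_spec (d D n M : ℕ) (hn : n ≤ d ^ d)
    (hM : M ≤ (2 * (n * n * (D * d * d + 1))) * (2 * (n * n * (D * d * d + 1)))) :
    M * (n * Af d D n M) + 2 * (n * (D + n * Af d D n M)) + 1 ≤ q0 d D := by
  have h1 : q0n d D n ≤ q0 d D :=
    Finset.single_le_sum (f := fun n => q0n d D n) (fun _ _ => Nat.zero_le _)
      (Finset.mem_range.2 (Nat.lt_succ_of_le hn))
  refine le_trans ?_ h1
  exact Finset.single_le_sum
    (f := fun M => M * (n * Af d D n M) + 2 * (n * (D + n * Af d D n M)) + 1)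
    (fun _ _ => Nat.zero_le _) (Finset.mem_range.2 (Nat.lt_succ_of_le hM))

/-- Chebotarev for covers of the line, in a big field. -/
lemma cheb {d D : ℕ} (hD : D ≠ 0) {k : Type*} [Field k] [IsAlgClosed k] (p : ℕ) [Fact p.Prime] [CharP k p]
    (r : ℕ) (hr : r ≠ 0) (hq : q0 d D ≤ p ^ r)
    {Ω : Type*} [Field Ω] [Algebra k Ω] [Algebra k[X] Ω]
    [Algebra (RatFunc k) Ω] [IsScalarTower k k[X] Ω] [IsScalarTower k[X] (RatFunc k) Ω]
    (z : Fin d → Ω) (f a b : k[X][X]) (δ : k[X])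
    (monic : f.Monic)
    (hfd : ∀ i, (f.coeff i).natDegree ≤ D)
    (hbd : ∀ i, (b.coeff i).natDegree ≤ D)
    (hbn : b.natDegree ≤ D)
    (hδd : δ.natDegree ≤ D)
    (hz : f.map (algebraMap k[X] Ω) = ∏ j, (X - C (z j)))
    (bez : a * f + b * derivative f = C δ)
    (hδ : δ ≠ 0)
    (τ : Ω →+* Ω) (hτ : ∀ a, τ (algebraMap k Ω a) = algebraMap k Ω (a ^ p ^ r))
    (hτy : τ (algebraMap k[X] Ω X) = algebraMap k[X] Ω X) (π : Fin d → Fin d)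
    (hπ : ∀ j, τ (z j) = z (π j)) :
    ∃ (y0 : k) (ζ : Fin d → k), y0 ^ p ^ r = y0 ∧ δ.eval y0 ≠ 0 ∧ (∀ j, ζ j ^ p ^ r = ζ (π j)) ∧
      ∀ P : MvPolynomial (Option (Fin d)) k, evz k z P = 0 →
        MvPolynomial.aeval (fun o => o.elim y0 ζ) P = 0 := by
  classical
  have : ExpChar k p := ExpChar.prime Fact.out
  have tow : IsScalarTower k (RatFunc k) Ω := IsScalarTower.of_algebraMap_eq fun x => by
    rw [IsScalarTower.algebraMap_apply k k[X] Ω, IsScalarTower.algebraMap_apply k[X] (RatFunc k) Ω,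
      ← IsScalarTower.algebraMap_apply k k[X] (RatFunc k)]
  let N := IntermediateField.adjoin (RatFunc k) (Set.range z)
  have t1 : IsScalarTower k[X] N Ω := IsScalarTower.of_algebraMap_eq fun _ => rfl
  have t2 : IsScalarTower k k[X] N := IsScalarTower.of_algebraMap_eq fun x =>
    Subtype.ext (IsScalarTower.algebraMap_apply k k[X] Ω x)
  let zN : Fin d → N := fun j => ⟨z j, IntermediateField.subset_adjoin _ _ ⟨j, rfl⟩⟩
  have hval : ∀ Q : k[X], ((algebraMap k[X] N Q : N) : Ω) = algebraMap k[X] Ω Q := fun Q => rfl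
  have hinj : Function.Injective (algebraMap N Ω) := (algebraMap N Ω).injective
  set FK : (RatFunc k)[X] := f.map (algebraMap k[X] (RatFunc k)) with hFK
  have hFKm : FK.Monic := monic.map _
  have hFKΩ : FK.map (algebraMap (RatFunc k) Ω) = ∏ j, (X - C (z j)) := by
    rw [hFK, map_map, ← IsScalarTower.algebraMap_eq, hz]
  have hroot : FK.rootSet Ω = Set.range z := by
    ext x
    rw [mem_rootSet, aeval_def, ← eval_map, hFKΩ, eval_prod, Finset.prod_eq_zero_iff]
    constructor
    · rintro ⟨-, j, -, hj⟩
      rw [eval_sub, eval_X, eval_C, sub_eq_zero] at hj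
      exact ⟨j, hj.symm⟩
    · rintro ⟨j, rfl⟩
      exact ⟨hFKm.ne_zero, j, Finset.mem_univ _, by simp⟩
  have hsplit : (FK.map (algebraMap (RatFunc k) Ω)).Splits := by
    rw [hFKΩ]
    exact Splits.prod fun j _ => Splits.X_sub_C _
  have hsf : IsSplittingField (RatFunc k) N FK := by
    have := IntermediateField.adjoin_rootSet_isSplittingField hsplit
    rw [hroot] at this
    exact this
  have hsep : FK.Separable := by
    have h1 := congrArg (Polynomial.map (algebraMap k[X] (RatFunc k))) bez
    rw [Polynomial.map_add, Polynomial.map_mul, Polynomial.map_mul, ← derivative_map,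
      Polynomial.map_C] at h1
    have h0 : algebraMap k[X] (RatFunc k) δ ≠ 0 := RatFunc.algebraMap_ne_zero hδ
    refine ⟨C (algebraMap k[X] (RatFunc k) δ)⁻¹ * a.map (algebraMap k[X] (RatFunc k)),
      C (algebraMap k[X] (RatFunc k) δ)⁻¹ * b.map (algebraMap k[X] (RatFunc k)), ?_⟩
    rw [mul_assoc, mul_assoc, ← mul_add, h1, ← C_mul, inv_mul_cancel₀ h0, C_1]
  have hgal : IsGalois (RatFunc k) N := IsGalois.of_separable_splitting_field hsep
  have hfin : FiniteDimensional (RatFunc k) N := IsSplittingField.finiteDimensional N FK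
  let c : Cov (k := k) zN D :=
    { f := f, a := a, b := b, δ := δ, monic := monic, hfd := hfd, hbd := hbd, hbn := hbn
      hδd := hδd, bez := bez, hδ := hδ
      hz := by
        apply Polynomial.map_injective _ hinj
        rw [map_map, ← IsScalarTower.algebraMap_eq k[X] N Ω, hz, Polynomial.map_prod]
        refine Finset.prod_congr rfl fun j _ => ?_
        rw [Polynomial.map_sub, map_X, map_C]; rfl
      gen := by
        apply IntermediateField.lift_injective N
        rw [IntermediateField.lift_adjoin, IntermediateField.lift_top, ← Set.range_comp]
        rfl }
  have hfr : Module.finrank (RatFunc k) N ≤ d ^ d := by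
    have h1 := finrank_range_le_card (R := RatFunc k)
      (fun α : Fin d → Fin d => ∏ j, zN j ^ (α j : ℕ))
    rw [Set.finrank, c.span_mon, finrank_top] at h1
    simpa using h1
  have hτN : ∀ x ∈ N, τ x ∈ N := by
    intro x hx
    induction hx using IntermediateField.adjoin_induction with
    | mem x hx =>
      obtain ⟨j, rfl⟩ := hx
      rw [hπ]
      exact (zN (π j)).2
    | algebraMap x =>
      have hpoly : ∀ Q : k[X], τ (algebraMap k[X] Ω Q) ∈ N := by
        intro Q
        induction Q using Polynomial.induction_on' with
        | add P Q hP hQ => rw [map_add, map_add]; exact N.add_mem hP hQ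
        | monomial i a =>
          rw [← C_mul_X_pow_eq_monomial, map_mul, map_mul, map_pow, map_pow, hτy]
          refine N.mul_mem ?_ (pow_mem (algebraMap k[X] N X).2 i)
          have e1 : algebraMap k[X] Ω (C a) = algebraMap k Ω a := by
            rw [IsScalarTower.algebraMap_apply k k[X] Ω]; rfl
          rw [e1, hτ]
          exact (algebraMap k N (a ^ p ^ r)).2
      rw [← RatFunc.num_div_denom x, map_div₀, map_div₀, ← IsScalarTower.algebraMap_apply,
        ← IsScalarTower.algebraMap_apply]
      exact N.div_mem (hpoly _) (hpoly _)
    | add x y _ _ hx hy => rw [map_add]; exact N.add_mem hx hy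
    | inv x _ hx => rw [map_inv₀]; exact N.inv_mem hx
    | mul x y _ _ hx hy => rw [map_mul]; exact N.mul_mem hx hy
  let τN : N →+* N := τ.restrict N N hτN
  obtain ⟨y0, ζ, h1, h2, h3, h4⟩ := c.cheb hD p r _ hr rfl
    (fun M hM => by have := q0_spec d D _ M hfr hM; omega)
    (fun M hM => by have := q0_spec d D _ M hfr hM; omega) τN
    (fun a => Subtype.ext (hτ a)) (Subtype.ext hτy) π (fun j => Subtype.ext (hπ j))
  refine ⟨y0, ζ, h1, h2, h3, fun P hP => h4 P ?_⟩
  apply hinj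
  rw [map_zero, ← hP]
  have key : (algebraMap N Ω).comp (evz k zN : MvPolynomial (Option (Fin d)) k →ₐ[k] N).toRingHom =
      (evz k z : MvPolynomial (Option (Fin d)) k →ₐ[k] Ω).toRingHom := by
    refine MvPolynomial.ringHom_ext (fun a => ?_) (fun o => ?_)
    · simp only [RingHom.comp_apply, AlgHom.toRingHom_eq_coe, RingHom.coe_coe, evz,
        MvPolynomial.aeval_C]
      rfl
    · simp only [RingHom.comp_apply, AlgHom.toRingHom_eq_coe, RingHom.coe_coe, evz,
        MvPolynomial.aeval_X]
      cases o <;> rfl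
  exact RingHom.congr_fun key P

end PRU
end

section
open Polynomial
set_option linter.unusedSectionVars false
namespace PRU

/-! ### Ultraproducts of rings -/
section UPsec
variable {I : Type} (U : Ultrafilter I)

/-- The ideal of families vanishing almost everywhere. -/
def upI (R : I → Type) [∀ i, CommRing (R i)] : Ideal (∀ i, R i) where
  carrier := {f | ∀ᶠ i in (U : Filter I), f i = 0}
  add_mem' := by
    intro a b ha hb
    filter_upwards [ha, hb] with i h1 h2
    simp [h1, h2]
  zero_mem' := Filter.Eventually.of_forall fun _ => rfl
  smul_mem' := by
    intro c a ha
    filter_upwards [ha] with i h1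
    simp [h1]

/-- The ultraproduct. -/
def UP (R : I → Type) [∀ i, CommRing (R i)] : Type := (∀ i, R i) ⧸ upI U R

namespace UP
variable {U}
variable {R S T : I → Type}

noncomputable instance [∀ i, CommRing (R i)] : CommRing (UP U R) :=
  inferInstanceAs (CommRing ((∀ i, R i) ⧸ upI U R))

section
variable [∀ i, CommRing (R i)] [∀ i, CommRing (S i)] [∀ i, CommRing (T i)]

/-- The quotient map. -/
noncomputable def mk : (∀ i, R i) →+* UP U R := Ideal.Quotient.mk (upI U R)

lemma mk_surj (x : UP U R) : ∃ f, mk f = x := Ideal.Quotient.mk_surjective x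

lemma mk_eq {f g : ∀ i, R i} : (mk f : UP U R) = mk g ↔ ∀ᶠ i in (U : Filter I), f i = g i := by
  have h1 : (mk f : UP U R) = mk g ↔ f - g ∈ upI U R := Ideal.Quotient.eq
  rw [h1]
  show (∀ᶠ i in (U : Filter I), f i - g i = 0) ↔ _
  simp only [sub_eq_zero]

lemma mk_eq_zero {f : ∀ i, R i} : (mk f : UP U R) = 0 ↔ ∀ᶠ i in (U : Filter I), f i = 0 := by
  rw [← map_zero mk, mk_eq]; rfl

/-- A representative. -/
noncomputable def rep (x : UP U R) : ∀ i, R i := (mk_surj x).choose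

@[simp] lemma mk_rep (x : UP U R) : mk (rep x) = x := (mk_surj x).choose_spec

lemma rep_mk (f : ∀ i, R i) : ∀ᶠ i in (U : Filter I), rep (mk f : UP U R) i = f i :=
  mk_eq.1 (mk_rep _)

/-- Functoriality. -/
noncomputable def map (h : ∀ i, R i →+* S i) : UP U R →+* UP U S :=
  Ideal.quotientMap (upI U S) (RingHom.pi fun i => (h i).comp (Pi.evalRingHom R i)) (by
    intro f hf
    rw [Ideal.mem_comap]
    have hf' : ∀ᶠ i in (U : Filter I), f i = 0 := hf
    show ∀ᶠ i in (U : Filter I), h i (f i) = 0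
    filter_upwards [hf'] with i hi
    rw [hi, map_zero])

@[simp] lemma map_mk (h : ∀ i, R i →+* S i) (f : ∀ i, R i) :
    map h (mk f : UP U R) = mk fun i => h i (f i) := by
  have h1 := Ideal.quotientMap_mk (J := upI U R) (I := upI U S)
    (f := RingHom.pi fun i => (h i).comp (Pi.evalRingHom R i)) (H := by
      intro f hf
      rw [Ideal.mem_comap]
      have hf' : ∀ᶠ i in (U : Filter I), f i = 0 := hf
      show ∀ᶠ i in (U : Filter I), h i (f i) = 0
      filter_upwards [hf'] with i hi
      rw [hi, map_zero]) (x := f)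
  exact h1

lemma map_map (h : ∀ i, R i →+* S i) (g : ∀ i, S i →+* T i) (x : UP U R) :
    map g (map h x) = map (fun i => (g i).comp (h i)) x := by
  obtain ⟨f, rfl⟩ := mk_surj x
  simp

lemma map_congr (h g : ∀ i, R i →+* S i) (e : ∀ i, h i = g i) : (map h : UP U R →+* UP U S) = map g := by
  obtain rfl : h = g := funext e
  rfl

lemma map_injective (h : ∀ i, R i →+* S i) (hh : ∀ i, Function.Injective (h i)) :
    Function.Injective (map h : UP U R →+* UP U S) := by
  rw [injective_iff_map_eq_zero]
  intro x hx
  obtain ⟨f, rfl⟩ := mk_surj x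
  rw [map_mk, mk_eq_zero] at hx
  rw [mk_eq_zero]
  filter_upwards [hx] with i hi
  exact (injective_iff_map_eq_zero _).1 (hh i) _ hi

lemma rep_map (h : ∀ i, R i →+* S i) (x : UP U R) :
    ∀ᶠ i in (U : Filter I), rep (map h x) i = h i (rep x i) := by
  apply mk_eq.1
  rw [mk_rep]
  conv_lhs => rw [← mk_rep x]
  rw [map_mk]

/-- Polynomials over an ultraproduct. -/
noncomputable def pol : (UP U R)[X] →+* UP U (fun i => (R i)[X]) :=
  eval₂RingHom (map fun _ => C) (mk fun _ => X)

@[simp] lemma pol_C (a : UP U R) : pol (C a) = map (fun i => (C : R i →+* (R i)[X])) a := by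
  simp [pol]

@[simp] lemma pol_X : pol (X : (UP U R)[X]) = mk fun _ => X := by simp [pol]

lemma pol_map_mk (P : (∀ i, R i)[X]) :
    pol (P.map (mk : _ →+* UP U R)) = mk fun i => P.map (Pi.evalRingHom R i) := by
  have : (pol.comp (mapRingHom (mk : _ →+* UP U R))) =
      (mk : _ →+* UP U (fun i => (R i)[X])).comp
        (RingHom.pi fun i => mapRingHom (Pi.evalRingHom R i)) := by
    refine Polynomial.ringHom_ext (fun a => ?_) ?_
    · simp only [RingHom.comp_apply, coe_mapRingHom, map_C, pol_C, map_mk]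
      congr 1
      funext i
      simp
    · simp only [RingHom.comp_apply, coe_mapRingHom, map_X, pol_X]
      congr 1
      funext i
      simp
  exact RingHom.congr_fun this P

lemma map_mk_surj (P : (UP U R)[X]) : ∃ Q : (∀ i, R i)[X], Q.map (mk : _ →+* UP U R) = P :=
  Polynomial.map_surjective _ (fun x => mk_surj x) P

lemma pol_injective : Function.Injective (pol : (UP U R)[X] →+* UP U (fun i => (R i)[X])) := by
  rw [injective_iff_map_eq_zero]
  intro x hx
  obtain ⟨Q, rfl⟩ := map_mk_surj x
  rw [pol_map_mk, mk_eq_zero] at hx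
  ext n
  rw [coeff_map, coeff_zero, mk_eq_zero]
  filter_upwards [hx] with i hi
  have := congrArg (fun P => coeff P n) hi
  simpa using this

/-- Naturality of `pol`. -/
lemma map_pol (h : ∀ i, R i →+* S i) (P : (UP U R)[X]) :
    map (fun i => mapRingHom (h i)) (pol P) = pol (P.map (map h)) := by
  have : ((map (U := U) (fun i => mapRingHom (h i))).comp pol) = pol.comp (mapRingHom (map h)) := by
    refine Polynomial.ringHom_ext (fun a => ?_) ?_
    · obtain ⟨f, rfl⟩ := mk_surj a
      simp
    · simp
  exact RingHom.congr_fun this P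

/-- Evaluation and `pol`. -/
lemma map_pol_eval₂ (h : ∀ i, R i →+* S i) (s : ∀ i, S i) (P : (UP U R)[X]) :
    map (fun i => eval₂RingHom (h i) (s i)) (pol P) = P.eval₂ (map h) (mk s) := by
  have : ((map (U := U) (fun i => eval₂RingHom (h i) (s i))).comp pol) =
      eval₂RingHom (map h) (mk s) := by
    refine Polynomial.ringHom_ext (fun a => ?_) ?_
    · obtain ⟨f, rfl⟩ := mk_surj a
      simp
    · simp
  exact RingHom.congr_fun this P

end

section fields
variable [∀ i, Field (R i)]

instance upI_max : (upI U R).IsMaximal := by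
  rw [Ideal.isMaximal_iff]
  constructor
  · intro h
    have h1 : ∀ᶠ i in (U : Filter I), (1 : R i) = 0 := h
    have h2 : ∀ᶠ i in (U : Filter I), False := by
      filter_upwards [h1] with i hi
      exact one_ne_zero hi
    exact h2.exists.elim fun _ h => h
  · intro J f hJ hf hfJ
    have h1 : ¬ ∀ᶠ i in (U : Filter I), f i = 0 := hf
    rw [← Ultrafilter.eventually_not] at h1
    have h2 : f * (fun i => (f i)⁻¹) - 1 ∈ upI U R := by
      show ∀ᶠ i in (U : Filter I), f i * (f i)⁻¹ - 1 = 0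
      filter_upwards [h1] with i hi
      rw [mul_inv_cancel₀ hi, sub_self]
    have h3 := J.sub_mem (J.mul_mem_right (fun i => (f i)⁻¹) hfJ) (hJ h2)
    simpa using h3

lemma isField : IsField (UP U R) :=
  (Ideal.Quotient.maximal_ideal_iff_isField_quotient (upI U R)).1 upI_max

open Classical in
noncomputable instance : Field (UP U R) where
  __ := (inferInstance : CommRing (UP U R))
  inv x := if h : x = 0 then 0 else (isField.mul_inv_cancel h).choose
  exists_pair_ne := isField.exists_pair_ne
  mul_inv_cancel x hx := by
    show x * (if h : x = 0 then 0 else (isField.mul_inv_cancel h).choose) = 1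
    rw [dif_neg hx]
    exact (isField.mul_inv_cancel hx).choose_spec
  inv_zero := dif_pos rfl
  nnqsmul := _
  nnqsmul_def := fun _ _ => rfl
  qsmul := _
  qsmul_def := fun _ _ => rfl

instance [∀ i, IsAlgClosed (R i)] : IsAlgClosed (UP U R) := by
  refine IsAlgClosed.of_exists_root _ fun p hm hirr => ?_
  have hlift : p ∈ lifts (mk : _ →+* UP U R) := by
    obtain ⟨Q, hQ⟩ := map_mk_surj p
    rw [mem_lifts]
    exact ⟨Q, hQ⟩
  obtain ⟨Q, hQ, hdeg, hQm⟩ := lifts_and_natDegree_eq_and_monic hlift hm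
  have hroot : ∀ i, ∃ x : R i, (Q.map (Pi.evalRingHom R i)).eval x = 0 := by
    intro i
    have h1 : (Q.map (Pi.evalRingHom R i)).degree ≠ 0 := by
      have h2 : (Q.map (Pi.evalRingHom R i)).natDegree ≠ 0 := by
        rw [hQm.natDegree_map, hdeg]
        exact hirr.natDegree_pos.ne'
      intro h3
      exact h2 (natDegree_eq_of_degree_eq_some h3)
    exact IsAlgClosed.exists_root _ h1
  choose x hx using hroot
  refine ⟨mk x, ?_⟩
  rw [← hQ, eval_map, eval₂_at_apply, mk_eq_zero]
  refine Filter.Eventually.of_forall fun i => ?_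
  have h := hx i
  rw [eval_map] at h
  have h2 := eval₂_at_apply (p := Q) (Pi.evalRingHom R i) x
  exact h2.symm.trans h

end fields
end UP
end UPsec
end PRU
end

section
open Polynomial
set_option linter.unusedSectionVars false
namespace PRU

/-- Restriction of an endomorphism to a normal subextension. -/
lemma restr {K A L : Type*} [Field K] [Field A] [Field L] [Algebra K A] [Normal K A] (j : A →+* L)
    (φ : L →+* L) (h : ∀ x, φ (j (algebraMap K A x)) = j (algebraMap K A x)) :
    ∃ σ : A ≃ₐ[K] A, ∀ a, j (σ a) = φ (j a) := by
  let _ : Algebra A L := j.toAlgebra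
  let _ : Algebra K L := (j.comp (algebraMap K A)).toAlgebra
  have : IsScalarTower K A L := IsScalarTower.of_algebraMap_eq fun _ => rfl
  let ψ : L →ₐ[K] L := { φ with commutes' := h }
  let s := ψ.restrictNormal A
  refine ⟨AlgEquiv.ofBijective s (Algebra.IsAlgebraic.algHom_bijective s), fun a => ?_⟩
  exact ψ.restrictNormal_commutes A a

/-- Roots of polynomials over an algebraically closed field. -/
lemma splitRt {A L : Type*} [Field A] [IsAlgClosed A] [Field L] (j : A →+* L) (g : A[X]) (hg : g ≠ 0)
    (w : L) (hw : g.eval₂ j w = 0) : ∃ a, j a = w ∧ g.eval a = 0 := by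
  have hs := (IsAlgClosed.splits g).eq_prod_roots
  rw [hs, eval₂_mul, eval₂_C, mul_eq_zero] at hw
  rcases hw with hw | hw
  · rw [map_eq_zero, leadingCoeff_eq_zero] at hw
    exact absurd hw hg
  · rw [← coe_eval₂RingHom, map_multiset_prod, Multiset.prod_eq_zero_iff, Multiset.mem_map] at hw
    obtain ⟨q, hq, hq0⟩ := hw
    obtain ⟨a, ha, rfl⟩ := Multiset.mem_map.1 hq
    refine ⟨a, ?_, (mem_roots hg).1 ha⟩
    simp only [coe_eval₂RingHom, eval₂_sub, eval₂_X, eval₂_C, sub_eq_zero] at hq0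
    exact hq0.symm

/-- A separable element fixed by all automorphisms lies in the base. -/
lemma sepFixed {K A : Type*} [Field K] [Field A] [Algebra K A] [Normal K A] (x : A)
    (hs : IsSeparable K x) (hf : ∀ s : A ≃ₐ[K] A, s x = x) : ∃ y, algebraMap K A y = x := by
  have hi : IsIntegral K x := Algebra.IsIntegral.isIntegral x
  have h1 : ((minpoly K x).map (algebraMap K A)).roots = {x} := by
    have hnd : ((minpoly K x).map (algebraMap K A)).roots.Nodup := nodup_roots (Polynomial.Separable.map hs)
    have hall : ∀ a ∈ ((minpoly K x).map (algebraMap K A)).roots, a = x := by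
      intro a ha
      rw [mem_roots (map_ne_zero (minpoly.ne_zero hi)), IsRoot, eval_map_algebraMap] at ha
      obtain ⟨s, hs⟩ := minpoly.exists_algEquiv_of_root (Algebra.IsAlgebraic.isAlgebraic x) ha
      have h9 := hf s.symm
      rw [← hs, AlgEquiv.symm_apply_apply] at h9
      rw [h9, hs]
    have hmem : x ∈ ((minpoly K x).map (algebraMap K A)).roots := by
      rw [mem_roots (map_ne_zero (minpoly.ne_zero hi)), IsRoot, eval_map_algebraMap]
      exact minpoly.aeval K x
    rw [Multiset.Nodup.ext hnd (Multiset.nodup_singleton x)]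
    intro a
    rw [Multiset.mem_singleton]
    exact ⟨hall a, fun h => h ▸ hmem⟩
  have h2 : (minpoly K x).natDegree = 1 := by
    rw [← natDegree_map (algebraMap K A), (Normal.splits inferInstance x).natDegree_eq_card_roots, h1]
    rfl
  have h3 := minpoly.mem_range_of_degree_eq_one K x
    ((degree_eq_iff_natDegree_eq_of_pos one_pos).2 h2)
  exact h3

lemma exists_coprime_pow {G : Type*} [Group G] [Finite G] (a b : G) (h1 : b ∈ Subgroup.zpowers a)
    (h2 : a ∈ Subgroup.zpowers b) (M : ℕ) (hM : M ≠ 0) : ∃ u : ℕ, u.Coprime M ∧ a ^ u = b := by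
  rw [← mem_powers_iff_mem_zpowers] at h1
  obtain ⟨v, rfl⟩ := h1
  have hn : orderOf a ≠ 0 := (orderOf_pos a).ne'
  have hv : v.Coprime (orderOf a) := by
    rw [Nat.Coprime, Nat.gcd_comm]
    have h3 : orderOf (a ^ v) = orderOf a := by
      apply le_antisymm
      · exact Nat.le_of_dvd (orderOf_pos a) (orderOf_pow_dvd v)
      · have := Subgroup.zpowers_le.2 h2
        have h4 := Subgroup.card_le_of_le this
        rwa [Nat.card_zpowers, Nat.card_zpowers] at h4
    rw [orderOf_pow] at h3
    have h5 := Nat.gcd_dvd_left (orderOf a) v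
    have h6 := Nat.div_mul_cancel h5
    rw [h3] at h6
    exact Nat.eq_of_mul_eq_mul_left (orderOf_pos a) (by rw [h6, mul_one])
  have : NeZero (orderOf a * M) := ⟨mul_ne_zero hn hM⟩
  have hsurj := ZMod.unitsMap_surjective (Dvd.intro M rfl : orderOf a ∣ orderOf a * M)
  obtain ⟨w, hw⟩ := hsurj (ZMod.unitOfCoprime v hv)
  refine ⟨(w : ZMod (orderOf a * M)).val, ?_, ?_⟩
  · have := ZMod.val_coe_unit_coprime w
    exact Nat.Coprime.coprime_mul_left_right this
  · rw [pow_eq_pow_iff_modEq, ← ZMod.natCast_eq_natCast_iff]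
    have h7 := congrArg (fun t : (ZMod (orderOf a))ˣ => (t : ZMod (orderOf a))) hw
    simp only [ZMod.unitsMap_val, ZMod.coe_unitOfCoprime] at h7
    rw [← h7, ZMod.natCast_val]

/-- Two automorphisms with trivial constants generate the same thing. -/
lemma art {E A : Type*} [Field E] [Field A] [Algebra E A] [IsAlgClosed A] (s t : A ≃ₐ[E] A)
    (hs : ∀ e : A, IsIntegral E e → s e = e → ∃ c, algebraMap E A c = e)
    (ht : ∀ e : A, IsIntegral E e → t e = e → ∃ c, algebraMap E A c = e)
    (T : Finset A) (hT : ∀ x ∈ T, IsIntegral E x) (M : ℕ) (hM : M ≠ 0) :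
    ∃ u : ℕ, u.Coprime M ∧ ∀ x ∈ T, (s ^ u) x = t x := by
  classical
  let P : E[X] := ∏ x ∈ T, minpoly E x
  have hP : (P.map (algebraMap E A)).Splits := IsAlgClosed.splits _
  let N := IntermediateField.adjoin E (P.rootSet A)
  have hsf : IsSplittingField E N P := IntermediateField.adjoin_rootSet_isSplittingField hP
  have hnorm : Normal E N := Normal.of_isSplittingField P
  have hfd : FiniteDimensional E N := IsSplittingField.finiteDimensional N P
  let s' : N ≃ₐ[E] N := s.restrictNormal N
  let t' : N ≃ₐ[E] N := t.restrictNormal N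
  have hs' : ∀ x : N, ((s' x : N) : A) = s x := fun x => s.restrictNormal_commutes N x
  have ht' : ∀ x : N, ((t' x : N) : A) = t x := fun x => t.restrictNormal_commutes N x
  have key : ∀ (r : A ≃ₐ[E] A) (r' : N ≃ₐ[E] N), (∀ x : N, ((r' x : N) : A) = r x) →
      (∀ e : A, IsIntegral E e → r e = e → ∃ c, algebraMap E A c = e) →
      Subgroup.zpowers r' = ⊤ := by
    intro r r' hr hc
    have h0 : ∀ x : N, r' x = x → x ∈ (⊥ : IntermediateField E N) := by
      intro x hx
      have h1 := hr x
      rw [hx] at h1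
      have hi : IsIntegral E x := Algebra.IsIntegral.isIntegral x
      obtain ⟨c, hc⟩ := hc x (hi.map N.val) h1.symm
      rw [IntermediateField.mem_bot]
      exact ⟨c, Subtype.ext hc⟩
    have h1 : IntermediateField.fixedField (Subgroup.zpowers r') = ⊥ := by
      rw [eq_bot_iff]
      intro x hx
      exact h0 x (hx ⟨r', Subgroup.mem_zpowers r'⟩)
    rw [← IntermediateField.fixingSubgroup_fixedField (Subgroup.zpowers r'), h1,
      IntermediateField.fixingSubgroup_bot]
  obtain ⟨u, hu, hu2⟩ := exists_coprime_pow s' t' (by rw [key s s' hs' hs]; trivial)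
    (by rw [key t t' ht' ht]; trivial) M hM
  refine ⟨u, hu, fun x hx => ?_⟩
  have hxN : x ∈ N := by
    apply IntermediateField.subset_adjoin
    have hP0 : P ≠ 0 := Finset.prod_ne_zero_iff.2 fun y hy => minpoly.ne_zero (hT y hy)
    rw [mem_rootSet]
    refine ⟨hP0, ?_⟩
    rw [map_prod]
    exact Finset.prod_eq_zero hx (minpoly.aeval E x)
  have hpow : ∀ (n : ℕ) (y : N), (((s' ^ n) y : N) : A) = (s ^ n) y := by
    intro n
    induction n with
    | zero => intro y; rfl
    | succ n ih =>
      intro y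
      rw [pow_succ, pow_succ, AlgEquiv.mul_apply, AlgEquiv.mul_apply, ih, hs']
  have := hpow u ⟨x, hxN⟩
  rw [hu2, ht'] at this
  exact this.symm

end PRU
end

section
open Polynomial
set_option linter.unusedSectionVars false
namespace PRU

lemma bezClear {R K : Type*} [CommRing R] [IsDomain R] [Field K] [Algebra R K] [IsFractionRing R K]
    (f : R[X]) (hf : (f.map (algebraMap R K)).Separable) :
    ∃ (a b : R[X]) (δ : R), a * f + b * derivative f = C δ ∧ δ ≠ 0 := by
  obtain ⟨a0, b0, h0⟩ := hf
  obtain ⟨s, hs, h1⟩ := IsLocalization.integerNormalization_spec (nonZeroDivisors R) a0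
  obtain ⟨t, ht, h2⟩ := IsLocalization.integerNormalization_spec (nonZeroDivisors R) b0
  refine ⟨C t * IsLocalization.integerNormalization (nonZeroDivisors R) a0,
    C s * IsLocalization.integerNormalization (nonZeroDivisors R) b0, s * t, ?_,
    mul_ne_zero (nonZeroDivisors.ne_zero hs) (nonZeroDivisors.ne_zero ht)⟩
  apply Polynomial.map_injective (algebraMap R K) (IsFractionRing.injective R K)
  rw [Polynomial.map_add, Polynomial.map_mul, Polynomial.map_mul, Polynomial.map_mul,
    Polynomial.map_mul, h1, h2, ← derivative_map]
  rw [Polynomial.map_C, Polynomial.map_C, Polynomial.map_C, map_mul, C_mul,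
    algebra_compatible_smul K s, algebra_compatible_smul K t, smul_eq_C_mul, smul_eq_C_mul]
  linear_combination C (algebraMap R K s) * C (algebraMap R K t) * h0

lemma cover {R K A : Type*} [CommRing R] [IsDomain R] [IsIntegrallyClosed R] [Field K] [Algebra R K]
    [IsFractionRing R K] [Field A] [IsAlgClosed A] [Algebra R A] [Algebra K A] [IsScalarTower R K A]
    (Zs : Finset A) (hi : ∀ x ∈ Zs, IsIntegral R x) (hs : ∀ x ∈ Zs, IsSeparable K x) :
    ∃ (d : ℕ) (z : Fin d → A) (f a b : R[X]) (δ : R), Function.Injective z ∧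
      f.map (algebraMap R A) = ∏ j, (X - C (z j)) ∧ (∀ x ∈ Zs, ∃ j, z j = x) ∧
      a * f + b * derivative f = C δ ∧ δ ≠ 0 := by
  classical
  have : Module.IsTorsionFree R A := by
    have h1 : Function.Injective (algebraMap R A) := by
      rw [IsScalarTower.algebraMap_eq R K A]
      exact (algebraMap K A).injective.comp (IsFractionRing.injective R K)
    exact Module.isTorsionFree_iff_algebraMap_injective.mpr h1
  let S : Finset R[X] := Zs.image (minpoly R)
  let f : R[X] := ∏ m ∈ S, m
  have hSm : ∀ m ∈ S, m.Monic ∧ Irreducible (m.map (algebraMap R K)) ∧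
      (m.map (algebraMap R K)).Separable := by
    intro m hm
    obtain ⟨x, hx, rfl⟩ := Finset.mem_image.1 hm
    have hxi := hi x hx
    have e := minpoly.isIntegrallyClosed_eq_field_fractions' K hxi
    refine ⟨minpoly.monic hxi, ?_, ?_⟩
    · rw [← e]; exact minpoly.irreducible hxi.tower_top
    · rw [← e]; exact hs x hx
  have hmonic : f.Monic := monic_prod_of_monic _ _ fun m hm => (hSm m hm).1
  have hsep : (f.map (algebraMap R K)).Separable := by
    rw [Polynomial.map_prod]
    refine separable_prod' (fun m hm m' hm' hne => ?_) fun m hm => (hSm m hm).2.2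
    refine (EuclideanDomain.dvd_or_coprime _ _ (hSm m hm).2.1).resolve_left fun hd => hne ?_
    have h1 : m.map (algebraMap R K) = m'.map (algebraMap R K) :=
      eq_of_monic_of_associated ((hSm m hm).1.map _) ((hSm m' hm').1.map _)
        ((hSm m hm).2.1.associated_of_dvd (hSm m' hm').2.1 hd)
    exact Polynomial.map_injective _ (IsFractionRing.injective R K) h1
  obtain ⟨a, b, δ, h1, h2⟩ := bezClear f hsep
  have hfA : f.map (algebraMap R A) = (f.map (algebraMap R K)).map (algebraMap K A) := by
    rw [map_map, ← IsScalarTower.algebraMap_eq]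
  have hsepA : (f.map (algebraMap R A)).Separable := by rw [hfA]; exact hsep.map
  set T := (f.map (algebraMap R A)).roots.toFinset with hT
  let e := T.equivFin
  refine ⟨T.card, fun j => (e.symm j : A), f, a, b, δ, ?_, ?_, ?_, h1, h2⟩
  · exact Subtype.val_injective.comp e.symm.injective
  · have h3 := (IsAlgClosed.splits (f.map (algebraMap R A))).eq_prod_roots
    rw [(hmonic.map _).leadingCoeff, C_1, one_mul] at h3
    rw [h3, e.symm.prod_comp (fun x : T => (X - C (x : A))), Finset.prod_coe_sort T (fun x => X - C x)]
    rw [hT, Finset.prod_multiset_map_count]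
    refine Finset.prod_congr rfl fun x hx => ?_
    rw [Multiset.count_eq_one_of_mem (nodup_roots hsepA) (Multiset.mem_toFinset.1 hx), pow_one]
  · intro x hx
    have hxT : x ∈ T := by
      rw [hT, Multiset.mem_toFinset, mem_roots (hmonic.map _).ne_zero, IsRoot, eval_map]
      rw [← coe_eval₂RingHom, map_prod]
      refine Finset.prod_eq_zero (Finset.mem_image_of_mem _ hx) ?_
      exact minpoly.aeval R x
    exact ⟨e ⟨x, hxT⟩, by simp⟩

end PRU
end

section
open Polynomial
set_option linter.unusedSectionVars false
namespace PRU

/-- Chebotarev, stated with specialisations of factorisations. -/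
lemma chebSpec {d D : ℕ} (hD : D ≠ 0) {k : Type*} [Field k] [IsAlgClosed k] (p : ℕ) [Fact p.Prime]
    [CharP k p] (r : ℕ) (hr : r ≠ 0) (hq : q0 d D ≤ p ^ r)
    {Ω : Type*} [Field Ω] [Algebra k Ω] [Algebra k[X] Ω]
    [Algebra (RatFunc k) Ω] [IsScalarTower k k[X] Ω] [IsScalarTower k[X] (RatFunc k) Ω]
    (z : Fin d → Ω) (f a b : k[X][X]) (δ : k[X])
    (hfd : ∀ i, (f.coeff i).natDegree ≤ D)
    (hbd : ∀ i, (b.coeff i).natDegree ≤ D)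
    (hbn : b.natDegree ≤ D)
    (hδd : δ.natDegree ≤ D)
    (hz : f.map (algebraMap k[X] Ω) = ∏ j, (X - C (z j)))
    (bez : a * f + b * derivative f = C δ)
    (hδ : δ ≠ 0)
    (τ : Ω →+* Ω) (hτ : ∀ a, τ (algebraMap k Ω a) = algebraMap k Ω (a ^ p ^ r))
    (hτy : τ (algebraMap k[X] Ω X) = algebraMap k[X] Ω X) (π : Fin d → Fin d)
    (hπ : ∀ j, τ (z j) = z (π j)) :
    ∃ (y0 : k) (ζ : Fin d → k), y0 ^ p ^ r = y0 ∧ δ.eval y0 ≠ 0 ∧ (∀ j, ζ j ^ p ^ r = ζ (π j)) ∧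
      Function.Injective ζ ∧
      ∀ (h : k[X][X]) (l : k[X]) (m : Multiset (Fin d)), h.map (algebraMap k[X] Ω) =
          C (algebraMap k[X] Ω l) * (m.map fun j => X - C (z j)).prod →
        h.map (evalRingHom y0) = C (l.eval y0) * (m.map fun j => X - C (ζ j)).prod := by
  have hinj : Function.Injective (algebraMap k[X] Ω) := by
    rw [IsScalarTower.algebraMap_eq k[X] (RatFunc k) Ω]
    exact (algebraMap (RatFunc k) Ω).injective.comp (IsFractionRing.injective k[X] (RatFunc k))
  have monic : f.Monic := by
    apply monic_of_injective hinj
    rw [hz]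
    exact monic_prod_of_monic _ _ fun j _ => monic_X_sub_C _
  obtain ⟨y0, ζ, h1, h2, h3, h4⟩ := cheb hD p r hr hq z f a b δ monic hfd hbd hbn hδd hz bez hδ τ hτ
    hτy π hπ
  have spec : ∀ (h : k[X][X]) (l : k[X]) (m : Multiset (Fin d)), h.map (algebraMap k[X] Ω) =
          C (algebraMap k[X] Ω l) * (m.map fun j => X - C (z j)).prod →
        h.map (evalRingHom y0) = C (l.eval y0) * (m.map fun j => X - C (ζ j)).prod := by
    intro h l m hh
    let ι : k[X] →+* MvPolynomial (Option (Fin d)) k :=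
      (aeval (MvPolynomial.X none : MvPolynomial (Option (Fin d)) k)).toRingHom
    let e1 : MvPolynomial (Option (Fin d)) k →+* Ω := (evz k z).toRingHom
    let e0 : MvPolynomial (Option (Fin d)) k →+* k :=
      (MvPolynomial.aeval (R := k) (fun o : Option (Fin d) => o.elim y0 ζ)).toRingHom
    have hι1 : e1.comp ι = algebraMap k[X] Ω := by
      refine Polynomial.ringHom_ext (fun a => ?_) ?_
      · simp only [e1, ι, RingHom.comp_apply, AlgHom.toRingHom_eq_coe, RingHom.coe_coe, aeval_C,
          AlgHom.commutes]
        rw [IsScalarTower.algebraMap_apply k k[X] Ω]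
        rfl
      · simp only [e1, ι, RingHom.comp_apply, AlgHom.toRingHom_eq_coe, RingHom.coe_coe, aeval_X, evz,
          MvPolynomial.aeval_X]
        rfl
    have hι0 : e0.comp ι = evalRingHom y0 := by
      refine Polynomial.ringHom_ext (fun a => ?_) ?_
      · simp [e0, ι]
      · simp [e0, ι]
    have hX1 : ∀ j, e1 (MvPolynomial.X (some j)) = z j := by
      intro j
      simp only [e1, AlgHom.toRingHom_eq_coe, RingHom.coe_coe, evz, MvPolynomial.aeval_X]
      rfl
    have hX0 : ∀ j, e0 (MvPolynomial.X (some j)) = ζ j := by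
      intro j
      simp [e0]
    set H : (MvPolynomial (Option (Fin d)) k)[X] :=
      h.map ι - C (ι l) * (m.map fun j => X - C (MvPolynomial.X (some j))).prod with hH
    have hm : ∀ {B : Type _} [CommRing B] (e : MvPolynomial (Option (Fin d)) k →+* B) (w : Fin d → B),
        (∀ j, e (MvPolynomial.X (some j)) = w j) →
        H.map e = h.map (e.comp ι) - C ((e.comp ι) l) * (m.map fun j => X - C (w j)).prod := by
      intro B _ e w hw
      rw [hH, Polynomial.map_sub, Polynomial.map_mul, map_C, map_map, Polynomial.map_multiset_prod,
        Multiset.map_map]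
      congr 3
      refine Multiset.map_congr rfl fun j _ => ?_
      simp [hw]
    have hz1 : H.map e1 = 0 := by
      rw [hm e1 z hX1, hι1, hh, sub_self]
    have hz0 : H.map e0 = 0 := by
      ext n
      rw [coeff_map, coeff_zero]
      refine h4 _ ?_
      have := congrArg (fun P => coeff P n) hz1
      rw [coeff_map, coeff_zero] at this
      exact this
    have hfin : H.map e0 = h.map (e0.comp ι) - C ((e0.comp ι) l) * (m.map fun j => X - C (ζ j)).prod := by
      rw [hH, Polynomial.map_sub, Polynomial.map_mul, map_C, map_map, Polynomial.map_multiset_prod,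
        Multiset.map_map]
      congr 3
      refine Multiset.map_congr rfl fun j _ => ?_
      simp [hX0]
    rw [hz0, hι0, eq_comm, sub_eq_zero] at hfin
    exact hfin
  refine ⟨y0, ζ, h1, h2, h3, ?_, spec⟩
  have hf0 := spec f 1 Finset.univ.val (by rw [hz, map_one, C_1, one_mul]; rfl)
  rw [eval_one, C_1, one_mul] at hf0
  have hf1 : f.map (evalRingHom y0) = ∏ j, (X - C (ζ j)) := hf0
  rw [← separable_prod_X_sub_C_iff, ← hf1]
  have hb := congrArg (Polynomial.map (evalRingHom y0)) bez
  rw [Polynomial.map_add, Polynomial.map_mul, Polynomial.map_mul, ← derivative_map, map_C] at hb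
  refine ⟨C (δ.eval y0)⁻¹ * a.map (evalRingHom y0), C (δ.eval y0)⁻¹ * b.map (evalRingHom y0), ?_⟩
  rw [mul_assoc, mul_assoc, ← mul_add, hb, coe_evalRingHom, ← C_mul, inv_mul_cancel₀ h2, C_1]

end PRU
end

section
open Polynomial
set_option linter.unusedSectionVars false
namespace PRU

section side
variable {E A : Type} [Field E] [Field A] [Algebra E A] [Algebra E[X] A] [Algebra (RatFunc E) A]
  [IsScalarTower E E[X] A] [IsScalarTower E[X] (RatFunc E) A] [IsAlgClosure (RatFunc E) A]

/-- The action of an endomorphism `φ` of `L` on the closure of `E(y)`. -/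
lemma side1 {L : Type} [Field L] [IsAlgClosed L] (φ : L →+* L) (ε : E →+* L)
    (hfix : ∀ e, φ (ε e) = ε e)
    (hrel : ∀ a : L, φ a = a → (∃ P : E[X], P.Monic ∧ P.eval₂ ε a = 0) → ∃ e, ε e = a)
    (b : L) (hb : φ b = b) (htr : ∀ P : E[X], P.eval₂ ε b = 0 → P = 0) :
    ∃ (j : A →+* L) (s : A ≃ₐ[RatFunc E] A), (∀ c : E[X], j (algebraMap E[X] A c) = c.eval₂ ε b) ∧
      (∀ a, j (s a) = φ (j a)) ∧
      (∀ e : A, IsIntegral E e → s e = e → ∃ c, algebraMap E A c = e) := by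
  have hcl : IsAlgClosed A := IsAlgClosure.isAlgClosed (RatFunc E)
  have halg : Algebra.IsAlgebraic (RatFunc E) A := IsAlgClosure.isAlgebraic
  have hψ : Function.Injective (eval₂RingHom ε b) := by
    rw [injective_iff_map_eq_zero]
    exact htr
  let _ : Algebra (RatFunc E) L := (IsFractionRing.lift (K := RatFunc E) hψ).toAlgebra
  let j : A →ₐ[RatFunc E] L := IsAlgClosed.lift
  have hj : ∀ c : E[X], j (algebraMap E[X] A c) = c.eval₂ ε b := by
    intro c
    rw [IsScalarTower.algebraMap_apply E[X] (RatFunc E) A, j.commutes]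
    exact IsFractionRing.lift_algebraMap hψ c
  have hjE : ∀ c : E, j (algebraMap E A c) = ε c := by
    intro c
    rw [IsScalarTower.algebraMap_apply E E[X] A, hj]
    simp
  have hφ : ∀ c : E[X], φ (c.eval₂ ε b) = c.eval₂ ε b := by
    intro c
    rw [hom_eval₂, hb]
    congr 1
    ext e
    exact hfix e
  have hφ2 : ∀ x, φ (j (algebraMap (RatFunc E) A x)) = j (algebraMap (RatFunc E) A x) := by
    intro x
    rw [← RatFunc.num_div_denom x, map_div₀, map_div₀, map_div₀,
      ← IsScalarTower.algebraMap_apply, ← IsScalarTower.algebraMap_apply, hj, hj, hφ, hφ]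
  have : Normal (RatFunc E) A := IsAlgClosure.normal (RatFunc E) A
  obtain ⟨s, hs⟩ := restr (K := RatFunc E) j.toRingHom φ hφ2
  refine ⟨j.toRingHom, s, hj, hs, fun e he hse => ?_⟩
  have h1 : φ (j e) = j e := by
    have := hs e
    rw [hse] at this
    exact this.symm
  have hjc : j.toRingHom.comp (algebraMap E A) = ε := by
    ext c; exact hjE c
  obtain ⟨P, hP, hP0⟩ := he
  obtain ⟨c, hc⟩ := hrel (j e) h1 ⟨P, hP, by
    have := congrArg j.toRingHom hP0
    rw [hom_eval₂, hjc, map_zero] at this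
    exact this⟩
  exact ⟨c, j.toRingHom.injective ((hjE c).trans hc)⟩

lemma side1_root {L : Type} [Field L] (φ : L →+* L) (ε : E →+* L) (b : L)
    (j : A →+* L) (s : A ≃ₐ[RatFunc E] A) (hj : ∀ c : E[X], j (algebraMap E[X] A c) = c.eval₂ ε b)
    (hs : ∀ a, j (s a) = φ (j a)) (g : E[X][X]) (hg : g ≠ 0) :
    (∃ w : L, φ w = w ∧ g.eval₂ (eval₂RingHom ε b) w = 0) ↔
      ∃ w : A, s w = w ∧ g.eval₂ (algebraMap E[X] A) w = 0 := by
  have hcl : IsAlgClosed A := IsAlgClosure.isAlgClosed (RatFunc E)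
  have hjc : j.comp (algebraMap E[X] A) = eval₂RingHom ε b := by
    refine RingHom.ext fun c => ?_
    exact hj c
  have hinj : Function.Injective (algebraMap E[X] A) := by
    rw [IsScalarTower.algebraMap_eq E[X] (RatFunc E) A]
    exact (algebraMap (RatFunc E) A).injective.comp (IsFractionRing.injective E[X] (RatFunc E))
  constructor
  · rintro ⟨w, hw, hw0⟩
    rw [← hjc, ← eval₂_map] at hw0
    obtain ⟨a, rfl, ha⟩ := splitRt j _ ((Polynomial.map_ne_zero_iff hinj).2 hg) w hw0
    refine ⟨a, j.injective ((hs a).trans hw), ?_⟩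
    rwa [eval_map] at ha
  · rintro ⟨w, hw, hw0⟩
    refine ⟨j w, by rw [← hs, hw], ?_⟩
    rw [← hjc, ← hom_eval₂, hw0, map_zero]

/-- elements of `L` algebraic over `E` come from `A` -/
lemma int_lift {L : Type} [Field L] (ε : E →+* L) (j : A →+* L)
    (hj : ∀ c : E, j (algebraMap E A c) = ε c) (a : L) (P : E[X]) (hP : P.Monic) (h : P.eval₂ ε a = 0) :
    ∃ e : A, j e = a ∧ IsIntegral E e := by
  have hcl : IsAlgClosed A := IsAlgClosure.isAlgClosed (RatFunc E)
  have hjc : j.comp (algebraMap E A) = ε := by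
    ext c; exact hj c
  rw [← hjc, ← eval₂_map] at h
  obtain ⟨e, rfl, he⟩ := splitRt j _ (hP.map (algebraMap E A)).ne_zero a h
  exact ⟨e, rfl, P, hP, by rwa [eval_map] at he⟩

end side

lemma extHom {K A L : Type*} [Field K] [Field A] [Field L] [Algebra K A] [Algebra.IsAlgebraic K A]
    [IsAlgClosed L] (f : K →+* L) : ∃ w : A →+* L, w.comp (algebraMap K A) = f := by
  let _ : Algebra K L := f.toAlgebra
  let j : A →ₐ[K] L := IsAlgClosed.lift
  exact ⟨j.toRingHom, RingHom.ext fun x => j.commutes x⟩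

/-- Lifting an endomorphism of `k`. -/
lemma frobLift {k Ω : Type*} [Field k] [Field Ω] [Algebra k[X] Ω] [Algebra (RatFunc k) Ω]
    [IsScalarTower k[X] (RatFunc k) Ω] [IsAlgClosure (RatFunc k) Ω] (φ : k →+* k) :
    ∃ w : Ω →+* Ω, ∀ c : k[X], w (algebraMap k[X] Ω c) = algebraMap k[X] Ω (c.map φ) := by
  have hcl : IsAlgClosed Ω := IsAlgClosure.isAlgClosed (RatFunc k)
  have halg : Algebra.IsAlgebraic (RatFunc k) Ω := IsAlgClosure.isAlgebraic
  have hinj : Function.Injective (algebraMap k[X] Ω) := by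
    rw [IsScalarTower.algebraMap_eq k[X] (RatFunc k) Ω]
    exact (algebraMap (RatFunc k) Ω).injective.comp (IsFractionRing.injective k[X] (RatFunc k))
  have hψ : Function.Injective ((algebraMap k[X] Ω).comp (mapRingHom φ)) :=
    hinj.comp (Polynomial.map_injective φ φ.injective)
  let f : RatFunc k →+* Ω := IsFractionRing.lift (K := RatFunc k) hψ
  have hf : ∀ c : k[X], f (algebraMap k[X] (RatFunc k) c) = algebraMap k[X] Ω (c.map φ) :=
    fun c => IsFractionRing.lift_algebraMap hψ c
  obtain ⟨w, hw⟩ : ∃ w : Ω →+* Ω, w.comp (algebraMap (RatFunc k) Ω) = f :=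
    extHom f
  refine ⟨w, fun c => ?_⟩
  rw [IsScalarTower.algebraMap_apply k[X] (RatFunc k) Ω, ← hf, ← hw]
  rfl

end PRU
end

section
open Polynomial
set_option linter.unusedSectionVars false
namespace PRU

section S2
variable {I : Type} {U : Ultrafilter I} {k Ω : I → Type} [∀ i, Field (k i)]
  [∀ i, Field (Ω i)] [∀ i, Algebra (k i) (Ω i)] [∀ i, Algebra (k i)[X] (Ω i)]
  [∀ i, Algebra (RatFunc (k i)) (Ω i)] [∀ i, IsScalarTower (k i) (k i)[X] (Ω i)]
  [∀ i, IsScalarTower (k i)[X] (RatFunc (k i)) (Ω i)]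
  {E A : Type} [Field E] [Field A] [Algebra E A] [Algebra E[X] A] [Algebra (RatFunc E) A]
  [IsScalarTower E E[X] A] [IsScalarTower E[X] (RatFunc E) A] [IsAlgClosure (RatFunc E) A]

variable (U k Ω) in
/-- constants -/
noncomputable def etaK : UP U k →+* UP U Ω := UP.map fun i => algebraMap (k i) (Ω i)

variable (U k Ω) in
/-- the generic point -/
noncomputable def yst : UP U Ω := UP.mk fun i => algebraMap (k i)[X] (Ω i) X

/-- families of polynomials -/
noncomputable def Lam1 (ε : E →+* UP U k) : E[X] →+* UP U (fun i => (k i)[X]) :=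
  UP.pol.comp (mapRingHom ε)

/-- families of polynomials in two variables -/
noncomputable def Lam2 (ε : E →+* UP U k) : E[X][X] →+* UP U (fun i => (k i)[X][X]) :=
  UP.pol.comp (mapRingHom (Lam1 ε))

lemma algMap_eq_eval₂ (i : I) : algebraMap (k i)[X] (Ω i) =
    eval₂RingHom (algebraMap (k i) (Ω i)) (algebraMap (k i)[X] (Ω i) X) := by
  refine Polynomial.ringHom_ext (fun a => ?_) ?_
  · rw [IsScalarTower.algebraMap_eq (k i) (k i)[X] (Ω i)]
    simp
  · simp

lemma eta_pol (Q : (UP U k)[X]) :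
    UP.map (fun i => algebraMap (k i)[X] (Ω i)) (UP.pol Q) = Q.eval₂ (etaK U k Ω) (yst U k Ω) := by
  rw [UP.map_congr _ _ (fun i => algMap_eq_eval₂ (k := k) (Ω := Ω) i)]
  exact UP.map_pol_eval₂ _ _ _

lemma eta_Lam1 (ε : E →+* UP U k) (c : E[X]) :
    UP.map (fun i => algebraMap (k i)[X] (Ω i)) (Lam1 ε c) =
      c.eval₂ ((etaK U k Ω).comp ε) (yst U k Ω) := by
  rw [Lam1, RingHom.comp_apply, eta_pol, coe_mapRingHom, eval₂_map]

lemma eta_inj (i : I) : Function.Injective (algebraMap (k i)[X] (Ω i)) := by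
  rw [IsScalarTower.algebraMap_eq (k i)[X] (RatFunc (k i)) (Ω i)]
  exact (algebraMap (RatFunc (k i)) (Ω i)).injective.comp
    (IsFractionRing.injective (k i)[X] (RatFunc (k i)))

lemma yst_inj : Function.Injective (eval₂RingHom (etaK U k Ω) (yst U k Ω)) := by
  have : ⇑(eval₂RingHom (etaK U k Ω) (yst U k Ω)) =
      (UP.map (fun i => algebraMap (k i)[X] (Ω i))) ∘ UP.pol := by
    funext Q
    exact (eta_pol Q).symm
  rw [this]
  exact (UP.map_injective _ fun i => eta_inj i).comp UP.pol_injective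

lemma Lam1_inj (ε : E →+* UP U k) : Function.Injective (Lam1 ε) :=
  UP.pol_injective.comp (Polynomial.map_injective ε ε.injective)

lemma Lam1_C (ε : E →+* UP U k) (e : E) (t : ∀ i, k i) (ht : UP.mk t = ε e) :
    Lam1 ε (C e) = UP.mk fun i => C (t i) := by
  simp [Lam1, ← ht]

lemma Lam1_X (ε : E →+* UP U k) : Lam1 ε X = UP.mk fun _ => X := by
  simp [Lam1]

lemma Lam2_C (ε : E →+* UP U k) (e : E[X]) (t : ∀ i, (k i)[X]) (ht : UP.mk t = Lam1 ε e) :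
    Lam2 ε (C e) = UP.mk fun i => C (t i) := by
  simp [Lam2, ← ht]

lemma Lam2_X (ε : E →+* UP U k) : Lam2 ε X = UP.mk fun _ => X := by
  simp [Lam2]

lemma Lam1_bd (ε : E →+* UP U k) (c : E[X]) : ∃ (D : ℕ) (t : ∀ i, (k i)[X]), UP.mk t = Lam1 ε c ∧
    ∀ i, (t i).natDegree ≤ D := by
  induction c using Polynomial.induction_on' with
  | add P Q hP hQ =>
    obtain ⟨D, t, h1, h2⟩ := hP
    obtain ⟨D', t', h1', h2'⟩ := hQ
    refine ⟨D + D', t + t', by rw [map_add, map_add, h1, h1'], fun i => ?_⟩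
    refine (natDegree_add_le _ _).trans (max_le ((h2 i).trans (by omega)) ((h2' i).trans (by omega)))
  | monomial n e =>
    obtain ⟨t, ht⟩ := UP.mk_surj (ε e)
    refine ⟨n, fun i => C (t i) * X ^ n, ?_, fun i => natDegree_C_mul_X_pow_le _ _⟩
    rw [← C_mul_X_pow_eq_monomial, map_mul, map_pow, Lam1_C ε e t ht, Lam1_X, ← map_pow, ← map_mul]
    rfl

lemma Lam2_bd (ε : E →+* UP U k) (c : E[X][X]) : ∃ (D : ℕ) (t : ∀ i, (k i)[X][X]),
    UP.mk t = Lam2 ε c ∧ (∀ i, (t i).natDegree ≤ D ∧ ∀ n, ((t i).coeff n).natDegree ≤ D) ∧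
    UP.mk (fun i => derivative (t i)) = Lam2 ε (derivative c) := by
  induction c using Polynomial.induction_on' with
  | add P Q hP hQ =>
    obtain ⟨D, t, h1, h2, h3⟩ := hP
    obtain ⟨D', t', h1', h2', h3'⟩ := hQ
    refine ⟨D + D', t + t', by rw [map_add, map_add, h1, h1'], fun i => ⟨?_, fun n => ?_⟩, ?_⟩
    · exact (natDegree_add_le _ _).trans
        (max_le ((h2 i).1.trans (by omega)) ((h2' i).1.trans (by omega)))
    · rw [Pi.add_apply, coeff_add]
      exact (natDegree_add_le _ _).trans
        (max_le (((h2 i).2 n).trans (by omega)) (((h2' i).2 n).trans (by omega)))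
    · rw [derivative_add, map_add, ← h3, ← h3', ← map_add]
      congr 1
      funext i
      simp
  | monomial n e =>
    obtain ⟨D, t, ht, hD⟩ := Lam1_bd ε e
    refine ⟨n + D, fun i => C (t i) * X ^ n, ?_, fun i => ⟨?_, fun m => ?_⟩, ?_⟩
    · rw [← C_mul_X_pow_eq_monomial, map_mul, map_pow, Lam2_C ε e t ht, Lam2_X, ← map_pow, ← map_mul]
      rfl
    · exact (natDegree_C_mul_X_pow_le _ _).trans (by omega)
    · rw [coeff_C_mul_X_pow]
      split_ifs
      · exact (hD i).trans (by omega)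
      · simp
    · rw [← C_mul_X_pow_eq_monomial, derivative_C_mul_X_pow, map_mul, map_pow,
        Lam2_C ε (e * n) (fun i => t i * n) (by
          rw [map_mul, ← ht, map_natCast, ← map_natCast (UP.mk (U := U) (R := fun i => (k i)[X])) n,
            ← map_mul]; rfl), Lam2_X, ← map_pow, ← map_mul]
      congr 1
      funext i
      exact derivative_C_mul_X_pow _ _

lemma Lam1_rep_bd (ε : E →+* UP U k) (c : E[X]) :
    ∃ D : ℕ, ∀ᶠ i in (U : Filter I), (UP.rep (Lam1 ε c) i).natDegree ≤ D := by
  obtain ⟨D, t, h1, h2⟩ := Lam1_bd ε c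
  refine ⟨D, ?_⟩
  have h := UP.rep_mk (U := U) t
  rw [h1] at h
  filter_upwards [h] with i hi
  rw [hi]; exact h2 i

lemma Lam2_rep_bd (ε : E →+* UP U k) (c : E[X][X]) :
    ∃ D : ℕ, ∀ᶠ i in (U : Filter I), (UP.rep (Lam2 ε c) i).natDegree ≤ D ∧
      ∀ n, ((UP.rep (Lam2 ε c) i).coeff n).natDegree ≤ D := by
  obtain ⟨D, t, h1, h2, -⟩ := Lam2_bd ε c
  refine ⟨D, ?_⟩
  have h := UP.rep_mk (U := U) t
  rw [h1] at h
  filter_upwards [h] with i hi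
  rw [hi]; exact h2 i

lemma Lam2_rep_der (ε : E →+* UP U k) (c : E[X][X]) : ∀ᶠ i in (U : Filter I),
    derivative (UP.rep (Lam2 ε c) i) = UP.rep (Lam2 ε (derivative c)) i := by
  obtain ⟨D, t, h1, -, h2⟩ := Lam2_bd ε c
  have h := UP.rep_mk (U := U) t
  have h' := UP.rep_mk (U := U) (fun i => derivative (t i))
  rw [h1] at h
  rw [h2] at h'
  filter_upwards [h, h'] with i hi hi'
  rw [hi, hi']

/-- transfer of factorisations -/
lemma fact_transfer (ε : E →+* UP U k) (j : A →+* UP U Ω)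
    (hj : ∀ c : E[X], j (algebraMap E[X] A c) = c.eval₂ ((etaK U k Ω).comp ε) (yst U k Ω))
    {d : ℕ} (z : Fin d → A) (h : E[X][X]) (l : E[X]) (m : Multiset (Fin d))
    (hh : h.map (algebraMap E[X] A) = C (algebraMap E[X] A l) * (m.map fun j => X - C (z j)).prod) :
    ∀ᶠ i in (U : Filter I), (UP.rep (Lam2 ε h) i).map (algebraMap (k i)[X] (Ω i)) =
      C (algebraMap (k i)[X] (Ω i) (UP.rep (Lam1 ε l) i)) *
        (m.map fun a => X - C (UP.rep (j (z a)) i)).prod := by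
  have e1 : (UP.map (fun i => algebraMap (k i)[X] (Ω i))).comp (Lam1 ε) =
      j.comp (algebraMap E[X] A) := by
    refine RingHom.ext fun c => ?_
    rw [RingHom.comp_apply, eta_Lam1, RingHom.comp_apply, hj]
  apply UP.mk_eq.1
  have e2 : (UP.mk (fun i => (UP.rep (Lam2 ε h) i).map (algebraMap (k i)[X] (Ω i))) :
      UP U fun i => (Ω i)[X]) =
      UP.map (fun i => mapRingHom (algebraMap (k i)[X] (Ω i))) (Lam2 ε h) := by
    conv_rhs => rw [← UP.mk_rep (Lam2 ε h)]
    rw [UP.map_mk]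
    rfl
  rw [e2, Lam2, RingHom.comp_apply, UP.map_pol, coe_mapRingHom, Polynomial.map_map, e1,
    ← Polynomial.map_map, hh, Polynomial.map_mul, Polynomial.map_multiset_prod, map_C, map_mul,
    map_multiset_prod, Multiset.map_map, Multiset.map_map, hj, ← eta_Lam1 (Ω := Ω) ε, UP.pol_C]
  have e3 : (fun i => C (algebraMap (k i)[X] (Ω i) (UP.rep (Lam1 ε l) i)) *
        (m.map fun a => X - C (UP.rep (j (z a)) i)).prod) =
      (fun i => C (algebraMap (k i)[X] (Ω i) (UP.rep (Lam1 ε l) i))) *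
        (m.map fun a => (fun i => X - C (UP.rep (j (z a)) i) : ∀ i, (Ω i)[X])).prod := by
    funext i
    rw [Pi.mul_apply]
    congr 1
    have := map_multiset_prod (Pi.evalRingHom (fun i => (Ω i)[X]) i)
      (m.map fun a => (fun i => X - C (UP.rep (j (z a)) i) : ∀ i, (Ω i)[X]))
    rw [Multiset.map_map] at this
    exact this.symm
  rw [e3, map_mul, map_multiset_prod, Multiset.map_map]
  congr 1
  · conv_lhs => rw [← UP.mk_rep (Lam1 ε l)]
    rw [UP.map_mk, UP.map_mk]
  · congr 1
    refine Multiset.map_congr rfl fun a _ => ?_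
    simp only [Function.comp_apply, Polynomial.map_sub, map_X, map_C, map_sub, UP.pol_X, UP.pol_C]
    conv_lhs => rw [← UP.mk_rep (j (z a))]
    rw [UP.map_mk, ← map_sub]
    rfl

end S2
end PRU
end

section
open Polynomial
set_option linter.unusedSectionVars false
namespace PRU

/-- Homomorphisms permute the roots. -/
lemma permOf {R A : Type*} [CommRing R] [Field A] (η : R →+* A) (s : A →+* A)
    (hs : ∀ c, s (η c) = η c) {d : ℕ} (z : Fin d → A) (hz : Function.Injective z) (f : R[X])
    (hf : f.map η = ∏ j, (X - C (z j))) :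
    ∃ π : Equiv.Perm (Fin d), ∀ j, s (z j) = z (π j) := by
  have h1 : ∀ x : A, f.eval₂ η x = 0 ↔ ∃ j, z j = x := by
    intro x
    rw [← eval_map, hf, eval_prod, Finset.prod_eq_zero_iff]
    simp [sub_eq_zero, eq_comm]
  have h2 : ∀ j, ∃ j', z j' = s (z j) := by
    intro j
    rw [← h1]
    have h3 := (h1 (z j)).2 ⟨j, rfl⟩
    have h4 := hom_eval₂ f η s (z j)
    rw [h3, map_zero] at h4
    have h5 : s.comp η = η := RingHom.ext hs
    rw [h5] at h4
    exact h4.symm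
  choose π hπ using h2
  have hinj : Function.Injective π := by
    intro a b hab
    apply hz
    apply s.injective
    rw [← hπ, ← hπ, hab]
  exact ⟨Equiv.ofBijective π (Finite.injective_iff_bijective.1 hinj), fun j => (hπ j).symm⟩

lemma sep_aeval {K A : Type*} [Field K] [Field A] [Algebra K A] {d : ℕ} (z : Fin d → A)
    (hz : ∀ j, IsSeparable K (z j)) (P : MvPolynomial (Fin d) ℤ) :
    IsSeparable K (MvPolynomial.aeval z P) := by
  rw [← mem_separableClosure_iff]
  induction P using MvPolynomial.induction_on with
  | C a => 
    rw [MvPolynomial.aeval_C]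
    simp
  | add p q hp hq => 
    rw [map_add]
    exact add_mem hp hq
  | mul_X p j hp => 
    rw [map_mul, MvPolynomial.aeval_X]
    exact mul_mem hp (mem_separableClosure_iff.2 (hz j))

lemma aeval_mem_W {d : ℕ} (D : ℕ) (P : MvPolynomial (Fin d) ℤ) : ∃ m : ℕ, ∀ (k Ω : Type)
    [Field k] [Field Ω] [Algebra k Ω] [Algebra k[X] Ω] [IsScalarTower k k[X] Ω]
    (z : Fin d → Ω), MvPolynomial.aeval z P ∈ W k z D m := by
  induction P using MvPolynomial.induction_on with
  | C a =>
    refine ⟨0, fun k Ω _ _ _ _ _ z => ?_⟩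
    rw [MvPolynomial.aeval_C]
    refine mem_W.2 ⟨MvPolynomial.C (a : k), C_mem_Wp _ _, ?_⟩
    simp
  | add p q hp hq =>
    obtain ⟨m, hm⟩ := hp
    obtain ⟨m', hm'⟩ := hq
    refine ⟨m + m', fun k Ω _ _ _ _ _ z => ?_⟩
    rw [map_add]
    exact add_mem (W_mono (by omega) (hm k Ω z)) (W_mono (by omega) (hm' k Ω z))
  | mul_X p j hp =>
    obtain ⟨m, hm⟩ := hp
    refine ⟨m + D, fun k Ω _ _ _ _ _ z => ?_⟩
    rw [map_mul, MvPolynomial.aeval_X]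
    refine mul_mem_W (hm k Ω z) (mem_W.2 ⟨MvPolynomial.X (some j), Xsome_mem_Wp j, ?_⟩)
    simp [evz]

/-- invariants are polynomials -/
lemma inv_level {d : ℕ} (D : ℕ) (P : MvPolynomial (Fin d) ℤ) : ∃ m : ℕ, ∀ (k Ω : Type)
    [Field k] [Field Ω] [Algebra k Ω] [Algebra k[X] Ω] [IsScalarTower k k[X] Ω]
    [Algebra (RatFunc k) Ω] [IsScalarTower k[X] (RatFunc k) Ω] [IsAlgClosure (RatFunc k) Ω]
    (z : Fin d → Ω) (_ : Function.Injective z) (f : k[X][X])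
    (_ : f.map (algebraMap k[X] Ω) = ∏ j, (X - C (z j)))
    (_ : ∀ i, (f.coeff i).natDegree ≤ D)
    (_ : ∀ s : Ω ≃ₐ[RatFunc k] Ω, s (MvPolynomial.aeval z P) = MvPolynomial.aeval z P),
    ∃ Q : k[X], algebraMap k[X] Ω Q = MvPolynomial.aeval z P ∧ Q.natDegree ≤ m := by
  obtain ⟨m, hm⟩ := aeval_mem_W D P
  refine ⟨m, fun k Ω _ _ _ _ _ _ _ _ z hzi f hf hfd hP => ?_⟩
  have hinj : Function.Injective (algebraMap k[X] Ω) := by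
    rw [IsScalarTower.algebraMap_eq k[X] (RatFunc k) Ω]
    exact (algebraMap (RatFunc k) Ω).injective.comp (IsFractionRing.injective k[X] (RatFunc k))
  have := IsAlgClosure.normal (RatFunc k) Ω
  have hfm : f.Monic := by
    apply monic_of_injective hinj
    rw [hf]
    exact monic_prod_X_sub_C _ _
  have hz : ∀ j, f.eval₂ (algebraMap k[X] Ω) (z j) = 0 := by
    intro j
    rw [← eval_map, hf, eval_prod, Finset.prod_eq_zero (Finset.mem_univ j)]
    simp
  have hsep : ∀ j, IsSeparable (RatFunc k) (z j) := by
    intro j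
    have h1 : (f.map (algebraMap k[X] (RatFunc k))).Separable := by
      rw [← separable_map (algebraMap (RatFunc k) Ω), Polynomial.map_map,
        ← IsScalarTower.algebraMap_eq, hf, separable_prod_X_sub_C_iff]
      exact hzi
    refine h1.of_dvd (minpoly.dvd _ _ ?_)
    rw [aeval_def, eval₂_map, ← IsScalarTower.algebraMap_eq, hz]
  obtain ⟨x, hx⟩ := sepFixed (K := RatFunc k) _ (sep_aeval z hsep P) hP
  exact Linfty hfm (fun i _ => hfd i) hz (hm k Ω z) x hx

lemma int_coeff {R S : Type*} [CommRing R] [CommRing S] (ε : R →+* S) (Q : S[X]) (B : R[X][X])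
    (hB : B.Monic) (h : B.eval₂ (mapRingHom ε) Q = 0) (n : ℕ) :
    ∃ B : R[X], B.Monic ∧ B.eval₂ ε (Q.coeff n) = 0 := by
  let _ : Algebra R S := ε.toAlgebra
  let _ : Algebra R[X] S[X] := Polynomial.algebra R S
  have h4 : IsIntegral R[X] Q := ⟨B, hB, h⟩
  exact Polynomial.isIntegral_iff_isIntegral_coeff.1 h4 n

section S2
variable {I : Type} {U : Ultrafilter I} {k Ω : I → Type} [∀ i, Field (k i)]
  [∀ i, Field (Ω i)] [∀ i, Algebra (k i) (Ω i)] [∀ i, Algebra (k i)[X] (Ω i)]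
  [∀ i, Algebra (RatFunc (k i)) (Ω i)] [∀ i, IsScalarTower (k i) (k i)[X] (Ω i)]
  [∀ i, IsScalarTower (k i)[X] (RatFunc (k i)) (Ω i)]
  {E A : Type} [Field E] [Field A] [Algebra E A] [Algebra E[X] A] [Algebra (RatFunc E) A]
  [IsScalarTower E E[X] A] [IsScalarTower E[X] (RatFunc E) A] [IsAlgClosure (RatFunc E) A]

lemma pol_of_bdd (Q : ∀ i, (k i)[X]) (m : ℕ) (h : ∀ᶠ i in (U : Filter I), (Q i).natDegree ≤ m) :
    ∃ P : (UP U k)[X], UP.pol P = UP.mk Q := by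
  refine ⟨(∑ n ∈ Finset.range (m + 1), C (fun i => (Q i).coeff n : ∀ i, k i) * X ^ n).map UP.mk, ?_⟩
  rw [UP.pol_map_mk, UP.mk_eq]
  filter_upwards [h] with i hi
  rw [Polynomial.map_sum]
  conv_rhs => rw [(Q i).as_sum_range_C_mul_X_pow' (Nat.lt_succ_of_le hi)]
  refine Finset.sum_congr rfl fun n _ => ?_
  simp

lemma rep_inj {B : Type*} [Finite B] (z : B → UP U Ω) (hz : Function.Injective z) :
    ∀ᶠ i in (U : Filter I), Function.Injective fun a => UP.rep (z a) i := by
  have h : ∀ a b : B, ∀ᶠ i in (U : Filter I), UP.rep (z a) i = UP.rep (z b) i → a = b := by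
    intro a b
    by_cases hab : a = b
    · exact Filter.Eventually.of_forall fun i _ => hab
    · have h1 : ¬ ∀ᶠ i in (U : Filter I), UP.rep (z a) i = UP.rep (z b) i := by
        rw [← UP.mk_eq, UP.mk_rep, UP.mk_rep]
        exact fun h => hab (hz h)
      rw [← Ultrafilter.eventually_not] at h1
      filter_upwards [h1] with i hi h2
      exact absurd h2 hi
  have h2 := Filter.eventually_all.2 fun a => Filter.eventually_all.2 (h a)
  filter_upwards [h2] with i hi a b hab
  exact hi a b hab

lemma aeval_mk {d : ℕ} (z : Fin d → UP U Ω) (P : MvPolynomial (Fin d) ℤ) :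
    MvPolynomial.aeval z P = UP.mk fun i => MvPolynomial.aeval (fun a => UP.rep (z a) i) P := by
  induction P using MvPolynomial.induction_on with
  | C a =>
    simp only [MvPolynomial.aeval_C, algebraMap_int_eq, Int.coe_castRingHom]
    exact (map_intCast (UP.mk (U := U) (R := Ω)) a).symm
  | add p q hp hq =>
    simp only [map_add]
    rw [hp, hq, ← map_add]
    rfl
  | mul_X p j hp =>
    simp only [map_mul, MvPolynomial.aeval_X]
    conv_lhs => rw [hp, ← UP.mk_rep (z j), ← map_mul]
    rfl

lemma f_transfer (ε : E →+* UP U k) (j : A →+* UP U Ω)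
    (hj : ∀ c : E[X], j (algebraMap E[X] A c) = c.eval₂ ((etaK U k Ω).comp ε) (yst U k Ω))
    {d : ℕ} (z : Fin d → A) (f : E[X][X])
    (hf : f.map (algebraMap E[X] A) = ∏ j, (X - C (z j))) :
    ∀ᶠ i in (U : Filter I), (UP.rep (Lam2 ε f) i).map (algebraMap (k i)[X] (Ω i)) =
      ∏ a, (X - C (UP.rep (j (z a)) i)) := by
  have h1 := fact_transfer ε j hj z f 1 Finset.univ.val (by rw [hf, map_one, map_one, one_mul]; rfl)
  have h2 := UP.rep_mk (U := U) (1 : ∀ i, (k i)[X])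
  rw [map_one] at h2
  filter_upwards [h1, h2] with i hi hi2
  rw [hi, map_one, hi2, Pi.one_apply, map_one, map_one, one_mul]
  rfl

/-- Invariants of the geometric group are determined by constants. -/
lemma inv_const [∀ i, IsAlgClosure (RatFunc (k i)) (Ω i)] (ε : E →+* UP U k) (j : A →+* UP U Ω)
    (hj : ∀ c : E[X], j (algebraMap E[X] A c) = c.eval₂ ((etaK U k Ω).comp ε) (yst U k Ω))
    {d : ℕ} (z : Fin d → A) (hz : Function.Injective z) (f : E[X][X])
    (hf : f.map (algebraMap E[X] A) = ∏ j, (X - C (z j))) (P : MvPolynomial (Fin d) ℤ)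
    (hP : ∀ᶠ i in (U : Filter I), ∀ s : Ω i ≃ₐ[RatFunc (k i)] Ω i,
      s (MvPolynomial.aeval (fun a => UP.rep (j (z a)) i) P) =
        MvPolynomial.aeval (fun a => UP.rep (j (z a)) i) P) :
    ∃ T : Finset A, (∀ x ∈ T, IsIntegral E x) ∧ ∀ γ : A ≃ₐ[RatFunc E] A, (∀ x ∈ T, γ x = x) →
      γ (MvPolynomial.aeval z P) = MvPolynomial.aeval z P := by
  have hjz : Function.Injective fun a => j (z a) := j.injective.comp hz
  obtain ⟨D, hD⟩ := Lam2_rep_bd ε f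
  obtain ⟨m, hm⟩ := inv_level D P
  have h1 : ∀ᶠ i in (U : Filter I), ∃ Q : (k i)[X], algebraMap (k i)[X] (Ω i) Q =
      MvPolynomial.aeval (fun a => UP.rep (j (z a)) i) P ∧ Q.natDegree ≤ m := by
    filter_upwards [rep_inj _ hjz, f_transfer ε j hj z f hf, hD, hP] with i h1 h2 h3 h4
    exact hm (k i) (Ω i) _ h1 _ h2 h3.2 h4
  classical
  let Q : ∀ i, (k i)[X] := fun i => if h : ∃ Q : (k i)[X], algebraMap (k i)[X] (Ω i) Q =
      MvPolynomial.aeval (fun a => UP.rep (j (z a)) i) P ∧ Q.natDegree ≤ m then h.choose else 0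
  have h2 : ∀ᶠ i in (U : Filter I), algebraMap (k i)[X] (Ω i) (Q i) =
      MvPolynomial.aeval (fun a => UP.rep (j (z a)) i) P ∧ (Q i).natDegree ≤ m := by
    filter_upwards [h1] with i hi
    simp only [Q, dif_pos hi]
    exact hi.choose_spec
  obtain ⟨R, hR⟩ := pol_of_bdd Q m (h2.mono fun i h => h.2)
  -- the equation over the ultraproduct
  have h3 : j (MvPolynomial.aeval z P) = R.eval₂ (etaK U k Ω) (yst U k Ω) := by
    rw [← eta_pol, hR, UP.map_mk]
    have : j (MvPolynomial.aeval z P) = MvPolynomial.aeval (fun a => j (z a)) P := by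
      have := MvPolynomial.map_aeval (R := ℤ) z j P
      rw [this, MvPolynomial.aeval_def, MvPolynomial.coe_eval₂Hom]
      congr 1
      exact RingHom.ext_int _ _
    rw [this, aeval_mk, UP.mk_eq]
    exact h2.mono fun i h => h.1.symm
  have hinj : Function.Injective (algebraMap E[X] A) := by
    rw [IsScalarTower.algebraMap_eq E[X] (RatFunc E) A]
    exact (algebraMap (RatFunc E) A).injective.comp (IsFractionRing.injective E[X] (RatFunc E))
  have hinteg : IsIntegral E[X] (MvPolynomial.aeval z P) := by
    have hfm : f.Monic := by
      apply monic_of_injective hinj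
      rw [hf]
      exact monic_prod_X_sub_C _ _
    have hzi : ∀ a, IsIntegral E[X] (z a) := fun a => ⟨f, hfm, by
      rw [← eval_map, hf, eval_prod, Finset.prod_eq_zero (Finset.mem_univ a)]
      simp⟩
    clear hP hm h1 h2 h3 Q hR
    induction P using MvPolynomial.induction_on with
    | C a =>
      rw [MvPolynomial.aeval_C]
      simpa using isIntegral_algebraMap (R := E[X]) (A := A) (x := (a : E[X]))
    | add p q hp hq =>
      rw [map_add]
      exact hp.add hq
    | mul_X p b hp =>
      rw [map_mul, MvPolynomial.aeval_X]
      exact hp.mul (hzi b)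
  have hq : ∀ n, ∃ B : E[X], B.Monic ∧ B.eval₂ ε (R.coeff n) = 0 := by
    obtain ⟨B, hB, hB2⟩ := hinteg
    refine int_coeff ε R B hB ?_
    apply yst_inj (U := U) (k := k) (Ω := Ω)
    have h5 := congrArg j hB2
    rw [hom_eval₂, map_zero, h3] at h5
    rw [map_zero, hom_eval₂, ← h5]
    congr 1
    refine RingHom.ext fun c => ?_
    rw [RingHom.comp_apply, RingHom.comp_apply, hj, coe_mapRingHom, coe_eval₂RingHom, eval₂_map]
  have hjE : ∀ c : E, j (algebraMap E A c) = ((etaK U k Ω).comp ε) c := by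
    intro c
    rw [IsScalarTower.algebraMap_apply E E[X] A, hj]
    simp
  have hl : ∀ n, ∃ e : A, j e = etaK U k Ω (R.coeff n) ∧ IsIntegral E e := by
    intro n
    obtain ⟨B, hB, hB2⟩ := hq n
    refine int_lift ((etaK U k Ω).comp ε) j hjE _ B hB ?_
    rw [← hom_eval₂, hB2, map_zero]
  choose e he hei using hl
  refine ⟨(Finset.range (R.natDegree + 1)).image e, ?_, ?_⟩
  · intro x hx
    obtain ⟨n, -, rfl⟩ := Finset.mem_image.1 hx
    exact hei n
  · intro γ hγ
    have h6 : MvPolynomial.aeval z P =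
        ∑ n ∈ Finset.range (R.natDegree + 1), e n * algebraMap E[X] A X ^ n := by
      apply j.injective
      rw [h3, eval₂_eq_sum_range, map_sum]
      refine Finset.sum_congr rfl fun n _ => ?_
      rw [map_mul, map_pow, hj, he]
      simp
    rw [h6, map_sum]
    refine Finset.sum_congr rfl fun n hn => ?_
    rw [map_mul, map_pow, hγ _ (Finset.mem_image_of_mem e hn),
      IsScalarTower.algebraMap_apply E[X] (RatFunc E) A, AlgEquiv.commutes]
end S2
end PRU
end

section
open Polynomial
set_option linter.unusedSectionVars false
namespace PRU

/-- The resolvent. -/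
noncomputable def PhiG {d : ℕ} (G : Finset (Equiv.Perm (Fin d))) : (MvPolynomial (Fin d) ℤ)[X][X] :=
  ∏ π ∈ G, (X - C (∑ a : Fin d, C (MvPolynomial.X (π a)) * X ^ (a : ℕ)))

lemma PhiG_map {d : ℕ} (G : Finset (Equiv.Perm (Fin d))) {B : Type*} [CommRing B]
    (e : MvPolynomial (Fin d) ℤ →+* B) : (PhiG G).map (mapRingHom e) =
    ∏ π ∈ G, (X - C (∑ a : Fin d, C (e (MvPolynomial.X (π a))) * X ^ (a : ℕ))) := by
  simp [PhiG, Polynomial.map_prod, Polynomial.map_sum]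

lemma PhiG_rename {d : ℕ} (G : Finset (Equiv.Perm (Fin d))) (g : Equiv.Perm (Fin d))
    (hg : ∀ π ∈ G, g * π ∈ G) (a b : ℕ) :
    MvPolynomial.rename g (((PhiG G).coeff a).coeff b) = ((PhiG G).coeff a).coeff b := by
  have h : (PhiG G).map (mapRingHom (MvPolynomial.rename (R := ℤ) g).toRingHom) = PhiG G := by
    rw [PhiG_map, PhiG]
    classical
    have hG : G.image (g * ·) = G := Finset.eq_of_subset_of_card_le
      (fun x hx => by
        obtain ⟨y, hy, rfl⟩ := Finset.mem_image.1 hx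
        exact hg y hy) (by rw [Finset.card_image_of_injective _ (mul_right_injective g)])
    conv_rhs => rw [← hG, Finset.prod_image (fun x _ y _ h => mul_right_injective g h)]
    refine Finset.prod_congr rfl fun π _ => ?_
    simp
  have h2 := congrArg (fun Q => (Q.coeff a).coeff b) h
  simpa [coeff_map] using h2

lemma PhiG_mem {d : ℕ} (G : Finset (Equiv.Perm (Fin d))) (h1 : 1 ∈ G) {A : Type*} [Field A]
    (z : Fin d → A) (hz : Function.Injective z) (γ : A →+* A) (c : Equiv.Perm (Fin d))
    (hc : ∀ j, γ (z j) = z (c j))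
    (hfix : ∀ a b, γ (MvPolynomial.aeval z (((PhiG G).coeff a).coeff b)) =
      MvPolynomial.aeval z (((PhiG G).coeff a).coeff b)) : c ∈ G := by
  have h2 : (PhiG G).map (mapRingHom (γ.comp (MvPolynomial.aeval (R := ℤ) z).toRingHom)) =
      (PhiG G).map (mapRingHom (MvPolynomial.aeval (R := ℤ) z).toRingHom) := by
    ext a b
    simpa [coeff_map] using hfix a b
  rw [PhiG_map, PhiG_map] at h2
  have h3 := congrArg (eval (∑ a : Fin d, C (z (c a)) * X ^ (a : ℕ))) h2
  rw [eval_prod, Finset.prod_eq_zero h1 (by rw [eval_sub, eval_X, eval_C, sub_eq_zero]; simp [hc]), eval_prod] at h3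
  obtain ⟨π, hπ, h4⟩ := Finset.prod_eq_zero_iff.1 h3.symm
  have h5 : c = π := by
    refine Equiv.ext fun a => hz ?_
    simp only [eval_sub, eval_X, eval_C, sub_eq_zero] at h4
    have h6 := congrArg (fun Q => Q.coeff (a : ℕ)) h4
    have h7 : ∀ v : Fin d → A, (∑ x : Fin d, C (v x) * X ^ (x : ℕ)).coeff (a : ℕ) = v a := by
      intro v
      rw [finsetSum_coeff, Finset.sum_eq_single a]
      · simp
      · intro b _ hb
        rw [coeff_C_mul_X_pow, if_neg]
        exact fun h => hb (Fin.ext h.symm)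
      · simp
    rw [h7 (fun x => z (c x)), h7] at h6
    simpa using h6
  rw [h5]
  exact hπ

section S2
variable {I : Type} {U : Ultrafilter I} {k Ω : I → Type} [∀ i, Field (k i)]
  [∀ i, Field (Ω i)] [∀ i, Algebra (k i) (Ω i)] [∀ i, Algebra (k i)[X] (Ω i)]
  [∀ i, Algebra (RatFunc (k i)) (Ω i)] [∀ i, IsScalarTower (k i) (k i)[X] (Ω i)]
  [∀ i, IsScalarTower (k i)[X] (RatFunc (k i)) (Ω i)]
  {E A : Type} [Field E] [Field A] [Algebra E A] [Algebra E[X] A] [Algebra (RatFunc E) A]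
  [IsScalarTower E E[X] A] [IsScalarTower E[X] (RatFunc E) A] [IsAlgClosure (RatFunc E) A]

lemma side2 [∀ i, IsAlgClosed (k i)] [∀ i, IsAlgClosure (RatFunc (k i)) (Ω i)]
    (F : ∀ i, k i →+* k i) (ε : E →+* UP U k) (hfix : ∀ e, UP.map F (ε e) = ε e)
    (hrel : ∀ a : UP U k, UP.map F a = a → (∃ P : E[X], P.Monic ∧ P.eval₂ ε a = 0) → ∃ e, ε e = a) :
    ∃ (w : ∀ i, Ω i →+* Ω i) (j : A →+* UP U Ω) (s : A ≃ₐ[RatFunc E] A),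
      (∀ i a, w i (algebraMap (k i) (Ω i) a) = algebraMap (k i) (Ω i) (F i a)) ∧
      (∀ i, w i (algebraMap (k i)[X] (Ω i) X) = algebraMap (k i)[X] (Ω i) X) ∧
      (∀ c : E[X], j (algebraMap E[X] A c) = c.eval₂ ((etaK U k Ω).comp ε) (yst U k Ω)) ∧
      (∀ a, j (s a) = UP.map w (j a)) ∧
      (∀ e : A, IsIntegral E e → s e = e → ∃ c, algebraMap E A c = e) := by
  have h1 : ∀ i, ∃ w : Ω i →+* Ω i, ∀ c : (k i)[X],
      w (algebraMap (k i)[X] (Ω i) c) = algebraMap (k i)[X] (Ω i) (c.map (F i)) := fun i =>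
    frobLift (F i)
  choose w hw using h1
  have hwk : ∀ i a, w i (algebraMap (k i) (Ω i) a) = algebraMap (k i) (Ω i) (F i a) := by
    intro i a
    rw [IsScalarTower.algebraMap_apply (k i) (k i)[X] (Ω i), Polynomial.algebraMap_apply, hw,
      IsScalarTower.algebraMap_apply (k i) (k i)[X] (Ω i), Polynomial.algebraMap_apply]
    simp
  have hwX : ∀ i, w i (algebraMap (k i)[X] (Ω i) X) = algebraMap (k i)[X] (Ω i) X := by
    intro i
    rw [hw, map_X]
  have hac : ∀ i, IsAlgClosed (Ω i) := fun i => IsAlgClosure.isAlgClosed (RatFunc (k i))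
  have hwe : ∀ x : UP U k, UP.map w (etaK U k Ω x) = etaK U k Ω (UP.map F x) := by
    intro x
    rw [etaK, UP.map_map, UP.map_map]
    refine congrArg (fun g : UP U k →+* UP U Ω => g x) (UP.map_congr _ _ fun i => ?_)
    exact RingHom.ext (hwk i)
  obtain ⟨j, s, hj, hs, hc⟩ := side1 (A := A) (UP.map w) ((etaK U k Ω).comp ε)
    (fun e => by rw [RingHom.comp_apply, hwe, hfix])
    (by
      rintro a ha ⟨P, hP, hP2⟩
      obtain ⟨c, rfl, hc⟩ := splitRt (etaK U k Ω) (P.map ε) ((hP.map ε).ne_zero) a (by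
        rw [eval₂_map]; exact hP2)
      rw [hwe] at ha
      obtain ⟨e, he⟩ := hrel c ((etaK U k Ω).injective ha) ⟨P, hP, by rw [← eval_map]; exact hc⟩
      exact ⟨e, by rw [RingHom.comp_apply, he]⟩)
    (yst U k Ω) (by rw [yst, UP.map_mk]; simp only [hwX])
    (by
      intro P hP
      rw [← eval₂_map] at hP
      have := yst_inj (U := U) (k := k) (Ω := Ω) (a₁ := P.map ε) (a₂ := 0) (by
        rw [map_zero]; exact hP)
      exact (Polynomial.map_eq_zero ε).1 this)
  exact ⟨w, j, s, hwk, hwX, hj, hs, hc⟩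

/-- The arithmetic Chebotarev statement in families. -/
lemma core [∀ i, IsAlgClosed (k i)] (Ω : I → Type) [∀ i, Field (Ω i)] [∀ i, Algebra (k i) (Ω i)]
    [∀ i, Algebra (k i)[X] (Ω i)]
    [∀ i, Algebra (RatFunc (k i)) (Ω i)] [∀ i, IsScalarTower (k i) (k i)[X] (Ω i)]
    [∀ i, IsScalarTower (k i)[X] (RatFunc (k i)) (Ω i)]
    [∀ i, IsAlgClosure (RatFunc (k i)) (Ω i)]
    (p r : I → ℕ) [∀ i, Fact (p i).Prime] [∀ i, CharP (k i) (p i)] (hr : ∀ i, r i ≠ 0)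
    (hq : ∀ N, ∀ᶠ i in (U : Filter I), N ≤ p i ^ r i)
    (F : ∀ i, k i →+* k i) (hF : ∀ i a, F i a = a ^ p i ^ r i) (ε : E →+* UP U k)
    (hfix : ∀ e, UP.map F (ε e) = ε e)
    (hrel : ∀ a : UP U k, UP.map F a = a → (∃ P : E[X], P.Monic ∧ P.eval₂ ε a = 0) → ∃ e, ε e = a)
    (s1 : A ≃ₐ[RatFunc E] A) (hs1 : ∀ e : A, IsIntegral E e → s1 e = e → ∃ c, algebraMap E A c = e)
    {d : ℕ} (z : Fin d → A) (hz : Function.Injective z) (f a b : E[X][X]) (δ : E[X])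
    (hf : f.map (algebraMap E[X] A) = ∏ j, (X - C (z j)))
    (bez : a * f + b * derivative f = C δ) (hδ : δ ≠ 0) (M : ℕ) (hM : M ≠ 0) :
    ∃ (u : ℕ) (π : Equiv.Perm (Fin d)), u.Coprime M ∧ (∀ j, (s1 ^ u) (z j) = z (π j)) ∧
    ∃ (y0 : ∀ i, k i) (ζ : ∀ i, Fin d → k i), (∀ᶠ i in (U : Filter I), y0 i ^ p i ^ r i = y0 i ∧
      (UP.rep (Lam1 ε δ) i).eval (y0 i) ≠ 0 ∧ (∀ j, ζ i j ^ p i ^ r i = ζ i (π j)) ∧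
      Function.Injective (ζ i)) ∧
    ∀ (h : E[X][X]) (l : E[X]) (m : Multiset (Fin d)), h.map (algebraMap E[X] A) =
      C (algebraMap E[X] A l) * (m.map fun j => X - C (z j)).prod →
      ∀ᶠ i in (U : Filter I), (UP.rep (Lam2 ε h) i).map (evalRingHom (y0 i)) =
        C ((UP.rep (Lam1 ε l) i).eval (y0 i)) * (m.map fun j => X - C (ζ i j)).prod := by
  classical
  have hA : IsAlgClosed A := IsAlgClosure.isAlgClosed (RatFunc E)
  have hT0 : IsScalarTower E (RatFunc E) A := by
    refine IsScalarTower.of_algebraMap_eq fun e => ?_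
    rw [IsScalarTower.algebraMap_apply E E[X] A, IsScalarTower.algebraMap_apply E[X] (RatFunc E) A,
      IsScalarTower.algebraMap_apply E E[X] (RatFunc E)]
  obtain ⟨w, j, s2, hwk, hwX, hj, hs2, hc2⟩ := side2 (A := A) (Ω := Ω) F ε hfix hrel
  -- the geometric group
  let Gi : I → Finset (Equiv.Perm (Fin d)) := fun i => Finset.univ.filter fun π =>
    ∃ s : Ω i ≃ₐ[RatFunc (k i)] Ω i, ∀ a, s (UP.rep (j (z a)) i) = UP.rep (j (z (π a))) i
  obtain ⟨G, hG⟩ : ∃ G, ∀ᶠ i in (U : Filter I), Gi i = G := by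
    obtain ⟨G, hG⟩ := Ultrafilter.eq_pure_of_finite (U.map Gi)
    refine ⟨G, ?_⟩
    have : ∀ᶠ x in ((U.map Gi : Ultrafilter _) : Filter (Finset (Equiv.Perm (Fin d)))), x = G := by
      rw [hG]; simp
    exact this
  have hft := f_transfer ε j hj z f hf
  have hzi := rep_inj _ (j.injective.comp hz)
  have hGm : ∀ᶠ i in (U : Filter I), ∀ π, π ∈ G ↔
      ∃ s : Ω i ≃ₐ[RatFunc (k i)] Ω i, ∀ a, s (UP.rep (j (z a)) i) = UP.rep (j (z (π a))) i := by
    filter_upwards [hG] with i hi π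
    rw [← hi]; simp [Gi]
  obtain ⟨i0, hi0⟩ := hGm.exists
  have h1G : 1 ∈ G := (hi0 1).2 ⟨1, fun a => rfl⟩
  have hmG : ∀ g ∈ G, ∀ π ∈ G, g * π ∈ G := by
    intro g hg π hπ
    obtain ⟨s, hs⟩ := (hi0 g).1 hg
    obtain ⟨t, ht⟩ := (hi0 π).1 hπ
    exact (hi0 _).2 ⟨s * t, fun a => by rw [AlgEquiv.mul_apply, ht, hs]; rfl⟩
  have hT : ∀ a b, ∃ T : Finset A, (∀ x ∈ T, IsIntegral E x) ∧ ∀ γ : A ≃ₐ[RatFunc E] A,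
      (∀ x ∈ T, γ x = x) → γ (MvPolynomial.aeval z (((PhiG G).coeff a).coeff b)) =
        MvPolynomial.aeval z (((PhiG G).coeff a).coeff b) := by
    intro a b
    refine inv_const ε j hj z hz f hf _ ?_
    filter_upwards [hGm, hft, hzi] with i hi hi2 hi3 s
    obtain ⟨π, hπ⟩ := permOf (algebraMap (k i)[X] (Ω i)) (s : Ω i →+* Ω i) (fun c => by
      rw [IsScalarTower.algebraMap_apply (k i)[X] (RatFunc (k i)) (Ω i)]
      exact s.commutes _) _ hi3 _ hi2
    have hπG : π ∈ G := (hi π).2 ⟨s, hπ⟩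
    have h2 := PhiG_rename G π (hmG π hπG) a b
    conv_rhs => rw [← h2, MvPolynomial.aeval_rename]
    have := MvPolynomial.map_aeval (R := ℤ) (fun a => UP.rep (j (z a)) i) (s : Ω i →+* Ω i)
      (((PhiG G).coeff a).coeff b)
    refine this.trans ?_
    rw [MvPolynomial.aeval_def, MvPolynomial.coe_eval₂Hom]
    congr 1
    · exact RingHom.ext_int _ _
    · funext x
      exact hπ x
  choose T hTi hTf using hT
  let T0 : Finset A := (PhiG G).support.biUnion fun a => ((PhiG G).coeff a).support.biUnion fun b => T a b
  obtain ⟨u, hu, huT⟩ := art (s1.restrictScalars E) (s2.restrictScalars E) hs1 hc2 T0 (by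
    intro x hx
    simp only [T0, Finset.mem_biUnion] at hx
    obtain ⟨a, -, b, -, hx⟩ := hx
    exact hTi a b x hx) M hM
  have hpow : ∀ (n : ℕ) x, ((s1.restrictScalars E) ^ n) x = (s1 ^ n) x := by
    intro n
    induction n with
    | zero => intro x; rfl
    | succ n ih =>
      intro x
      rw [pow_succ, pow_succ, AlgEquiv.mul_apply, AlgEquiv.mul_apply, ih]
      rfl
  have halg : ∀ (s : A ≃ₐ[RatFunc E] A) (c : E[X]), (s : A →+* A) (algebraMap E[X] A c) =
      algebraMap E[X] A c := by
    intro s c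
    rw [IsScalarTower.algebraMap_apply E[X] (RatFunc E) A]
    exact s.commutes _
  obtain ⟨π, hπ⟩ := permOf (algebraMap E[X] A) ((s1 ^ u : A ≃ₐ[RatFunc E] A) : A →+* A)
    (halg _) z hz f hf
  have hπ' : ∀ a, (s1 ^ u) (z a) = z (π a) := hπ
  let γ : A ≃ₐ[RatFunc E] A := s2⁻¹ * s1 ^ u
  obtain ⟨c, hc⟩ := permOf (algebraMap E[X] A) (γ : A →+* A) (halg _) z hz f hf
  have hγT : ∀ x ∈ T0, γ x = x := by
    intro x hx
    have h1 := huT x hx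
    rw [hpow] at h1
    change s2⁻¹ ((s1 ^ u) x) = x
    rw [h1]
    exact s2.symm_apply_apply x
  have hcG : c ∈ G := by
    refine PhiG_mem G h1G z hz (γ : A →+* A) c hc fun a b => ?_
    by_cases h0 : ((PhiG G).coeff a).coeff b = 0
    · rw [h0]; simp
    · refine hTf a b γ fun x hx => hγT x ?_
      simp only [T0, Finset.mem_biUnion]
      refine ⟨a, ?_, b, ?_, hx⟩
      · rw [mem_support_iff]
        intro h; rw [h] at h0; simp at h0
      · rwa [mem_support_iff]
  have hs12 : ∀ a, z (π a) = s2 (z (c a)) := by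
    intro a
    rw [← hπ']
    have : γ (z a) = z (c a) := hc a
    rw [← this]
    exact (s2.apply_symm_apply _).symm
  have hlev : ∀ᶠ i in (U : Filter I), ∀ a, UP.rep (j (z (π a))) i = w i (UP.rep (j (z (c a))) i) := by
    refine Filter.eventually_all.2 fun a => ?_
    rw [hs12, hs2]
    exact UP.rep_map w _
  obtain ⟨D1, hD1⟩ := Lam2_rep_bd ε f
  obtain ⟨D2, hD2⟩ := Lam2_rep_bd ε b
  obtain ⟨D3, hD3⟩ := Lam1_rep_bd ε δ
  let D := D1 + D2 + D3 + 1
  have hδ0 : ∀ᶠ i in (U : Filter I), UP.rep (Lam1 ε δ) i ≠ 0 := by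
    have : Lam1 ε δ ≠ 0 := fun h => hδ (Lam1_inj ε (by rw [h, map_zero]))
    rw [← UP.mk_rep (Lam1 ε δ), Ne, UP.mk_eq_zero] at this
    exact Ultrafilter.eventually_not.2 this
  have hbez : ∀ᶠ i in (U : Filter I), UP.rep (Lam2 ε a) i * UP.rep (Lam2 ε f) i +
      UP.rep (Lam2 ε b) i * UP.rep (Lam2 ε (derivative f)) i = C (UP.rep (Lam1 ε δ) i) := by
    apply UP.mk_eq.1
    have h1 : (UP.mk (fun i => UP.rep (Lam2 ε a) i * UP.rep (Lam2 ε f) i +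
      UP.rep (Lam2 ε b) i * UP.rep (Lam2 ε (derivative f)) i) : UP U fun i => (k i)[X][X]) =
      UP.mk (UP.rep (Lam2 ε a) * UP.rep (Lam2 ε f) +
      UP.rep (Lam2 ε b) * UP.rep (Lam2 ε (derivative f))) := rfl
    rw [h1, map_add, map_mul, map_mul, UP.mk_rep, UP.mk_rep, UP.mk_rep, UP.mk_rep, ← map_mul,
      ← map_mul, ← map_add, bez]
    exact Lam2_C ε δ _ (UP.mk_rep _)
  have hmain : ∀ᶠ i in (U : Filter I), ∃ (y0 : k i) (ζ : Fin d → k i), y0 ^ p i ^ r i = y0 ∧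
      (UP.rep (Lam1 ε δ) i).eval y0 ≠ 0 ∧ (∀ j, ζ j ^ p i ^ r i = ζ (π j)) ∧
      Function.Injective ζ ∧
      ∀ (h : (k i)[X][X]) (l : (k i)[X]) (m : Multiset (Fin d)), h.map (algebraMap (k i)[X] (Ω i)) =
          C (algebraMap (k i)[X] (Ω i) l) * (m.map fun a => X - C (UP.rep (j (z a)) i)).prod →
        h.map (evalRingHom y0) = C (l.eval y0) * (m.map fun j => X - C (ζ j)).prod := by
    filter_upwards [hGm, hft, hlev, hD1, hD2, hD3, hδ0, hbez, Lam2_rep_der ε f, hq (q0 d D)]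
      with i g1 g2 g3 g4 g5 g6 g7 g8 g9 g10
    obtain ⟨t, ht⟩ := (g1 c).1 hcG
    refine chebSpec (D := D) (by omega) (p i) (r i) (hr i) g10 (fun a => UP.rep (j (z a)) i)
      (UP.rep (Lam2 ε f) i) (UP.rep (Lam2 ε a) i) (UP.rep (Lam2 ε b) i) (UP.rep (Lam1 ε δ) i)
      (fun n => (g4.2 n).trans (by omega)) (fun n => (g5.2 n).trans (by omega))
      (g5.1.trans (by omega)) (g6.trans (by omega)) g2 (by rw [g9]; exact g8) g7
      ((w i).comp (t : Ω i →+* Ω i)) ?_ ?_ π ?_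
    · intro a
      have h1 : t (algebraMap (k i) (Ω i) a) = algebraMap (k i) (Ω i) a := by
        rw [IsScalarTower.algebraMap_apply (k i) (k i)[X] (Ω i),
          IsScalarTower.algebraMap_apply (k i)[X] (RatFunc (k i)) (Ω i)]
        exact t.commutes _
      change w i (t _) = _
      rw [h1, hwk, hF]
    · have h1 : t (algebraMap (k i)[X] (Ω i) X) = algebraMap (k i)[X] (Ω i) X := by
        rw [IsScalarTower.algebraMap_apply (k i)[X] (RatFunc (k i)) (Ω i)]
        exact t.commutes _
      change w i (t _) = _
      rw [h1, hwX]
    · intro a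
      change w i (t _) = _
      rw [ht, ← g3]
  let y0 : ∀ i, k i := fun i => if h : _ then (h : ∃ (y0 : k i) (ζ : Fin d → k i), y0 ^ p i ^ r i = y0 ∧
      (UP.rep (Lam1 ε δ) i).eval y0 ≠ 0 ∧ (∀ j, ζ j ^ p i ^ r i = ζ (π j)) ∧
      Function.Injective ζ ∧
      ∀ (h : (k i)[X][X]) (l : (k i)[X]) (m : Multiset (Fin d)), h.map (algebraMap (k i)[X] (Ω i)) =
          C (algebraMap (k i)[X] (Ω i) l) * (m.map fun a => X - C (UP.rep (j (z a)) i)).prod →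
        h.map (evalRingHom y0) = C (l.eval y0) * (m.map fun j => X - C (ζ j)).prod).choose else 0
  have hmain2 : ∀ i, ∃ (ζ : Fin d → k i), (∃ (y0 : k i) (ζ : Fin d → k i), y0 ^ p i ^ r i = y0 ∧
      (UP.rep (Lam1 ε δ) i).eval y0 ≠ 0 ∧ (∀ j, ζ j ^ p i ^ r i = ζ (π j)) ∧
      Function.Injective ζ ∧
      ∀ (h : (k i)[X][X]) (l : (k i)[X]) (m : Multiset (Fin d)), h.map (algebraMap (k i)[X] (Ω i)) =
          C (algebraMap (k i)[X] (Ω i) l) * (m.map fun a => X - C (UP.rep (j (z a)) i)).prod →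
        h.map (evalRingHom y0) = C (l.eval y0) * (m.map fun j => X - C (ζ j)).prod) →
      y0 i ^ p i ^ r i = y0 i ∧
      (UP.rep (Lam1 ε δ) i).eval (y0 i) ≠ 0 ∧ (∀ j, ζ j ^ p i ^ r i = ζ (π j)) ∧
      Function.Injective ζ ∧
      ∀ (h : (k i)[X][X]) (l : (k i)[X]) (m : Multiset (Fin d)), h.map (algebraMap (k i)[X] (Ω i)) =
          C (algebraMap (k i)[X] (Ω i) l) * (m.map fun a => X - C (UP.rep (j (z a)) i)).prod →
        h.map (evalRingHom (y0 i)) = C (l.eval (y0 i)) * (m.map fun j => X - C (ζ j)).prod := by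
    intro i
    by_cases h : (∃ (y0 : k i) (ζ : Fin d → k i), y0 ^ p i ^ r i = y0 ∧
      (UP.rep (Lam1 ε δ) i).eval y0 ≠ 0 ∧ (∀ j, ζ j ^ p i ^ r i = ζ (π j)) ∧
      Function.Injective ζ ∧
      ∀ (h : (k i)[X][X]) (l : (k i)[X]) (m : Multiset (Fin d)), h.map (algebraMap (k i)[X] (Ω i)) =
          C (algebraMap (k i)[X] (Ω i) l) * (m.map fun a => X - C (UP.rep (j (z a)) i)).prod →
        h.map (evalRingHom y0) = C (l.eval y0) * (m.map fun j => X - C (ζ j)).prod)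
    · obtain ⟨ζ, hζ⟩ := h.choose_spec
      refine ⟨ζ, fun _ => ?_⟩
      simp only [y0, dif_pos h]
      exact hζ
    · exact ⟨fun _ => 0, fun h' => absurd h' h⟩
  choose ζ hζ using hmain2
  refine ⟨u, π, hu, hπ', y0, ζ, ?_, ?_⟩
  · filter_upwards [hmain] with i hi
    have := hζ i hi
    exact ⟨this.1, this.2.1, this.2.2.1, this.2.2.2.1⟩
  · intro h l m hh
    filter_upwards [hmain, fact_transfer ε j hj z h l m hh] with i hi hi2
    exact (hζ i hi).2.2.2.2 _ _ _ hi2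

end S2
end PRU
end

section
open Polynomial
set_option linter.unusedSectionVars false
namespace PRU

/-- The polynomial whose roots are `(c w)^(q^n)`. -/
noncomputable def Hg {R : Type*} [CommRing R] (q n : ℕ) [ExpChar R q] (c : R) (g : R[X]) : R[X] :=
  scaleRoots (g.map (iterateFrobenius R q n)) (c ^ q ^ n)

lemma Hg_iff {R L : Type*} [CommRing R] [Field L] (q n : ℕ) [ExpChar R q] [ExpChar L q] (c : R)
    (g : R[X]) (e : R →+* L) (hc : e c ≠ 0) (w : L) :
    (Hg q n c g).eval₂ e ((e c * w) ^ q ^ n) = 0 ↔ g.eval₂ e w = 0 := by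
  rw [Hg, mul_pow, ← map_pow, scaleRoots_eval₂_mul, eval₂_map]
  have h1 : e.comp (iterateFrobenius R q n) = (iterateFrobenius L q n).comp e := by
    refine RingHom.ext fun x => ?_
    simp [iterateFrobenius_def]
  have h2 : w ^ q ^ n = iterateFrobenius L q n w := (iterateFrobenius_def q n w).symm
  rw [h1, h2, ← hom_eval₂, mul_eq_zero]
  constructor
  · rintro (h | h)
    · rw [map_pow] at h
      exact absurd (eq_zero_of_pow_eq_zero h) (pow_ne_zero _ hc)
    · exact (iterateFrobenius_inj L q n) (by rw [h, map_zero])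
  · intro h
    right
    rw [h, map_zero]

lemma Hg_lead {R : Type*} [CommRing R] [IsDomain R] (q n : ℕ) [ExpChar R q] (c : R)
    (g : R[X]) : (Hg q n c g).leadingCoeff = g.leadingCoeff ^ q ^ n := by
  rw [Hg, leadingCoeff_scaleRoots, leadingCoeff_map_of_injective (iterateFrobenius_inj R q n),
    iterateFrobenius_def]

lemma fac_root {R L : Type*} [CommRing R] [Field L] (e : R →+* L) (h : R[X]) (l : L) (hl : l ≠ 0)
    {ι : Type*} (m : Multiset ι) (z : ι → L)
    (hh : h.map e = C l * (m.map fun j => X - C (z j)).prod) (x : L) :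
    h.eval₂ e x = 0 ↔ ∃ j ∈ m, z j = x := by
  rw [← eval_map, hh, eval_mul, eval_C, mul_eq_zero, or_iff_right hl, eval_multiset_prod,
    Multiset.prod_eq_zero_iff, Multiset.map_map, Multiset.mem_map]
  simp [sub_eq_zero, eq_comm]

lemma unif_sep {K A : Type*} [Field K] [Field A] [Algebra K A] [Algebra.IsAlgebraic K A] (q : ℕ)
    [ExpChar K q] (W : Finset A) : ∃ n : ℕ, ∀ x ∈ W, IsSeparable K (x ^ q ^ n) := by
  have : ExpChar (separableClosure K A) q :=
    expChar_of_injective_algebraMap (algebraMap K (separableClosure K A)).injective q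
  have h1 : ∀ x : A, ∃ n : ℕ, x ^ q ^ n ∈ separableClosure K A := by
    intro x
    obtain ⟨n, y, hy⟩ := IsPurelyInseparable.pow_mem (separableClosure K A) q x
    refine ⟨n, ?_⟩
    rw [← hy]
    exact y.2
  choose n hn using h1
  refine ⟨W.sup n, fun x hx => ?_⟩
  rw [← mem_separableClosure_iff]
  obtain ⟨m, hm⟩ := Nat.exists_eq_add_of_le (Finset.le_sup (f := n) hx)
  rw [hm, pow_add, pow_mul]
  exact pow_mem (hn x) _

lemma perm_fix {d : ℕ} (ρ : Equiv.Perm (Fin d)) (u : ℕ) (hu : u.Coprime d.factorial) (j : Fin d) :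
    (ρ ^ u) j = j ↔ ρ j = j := by
  constructor
  · intro h
    have h1 : ρ ^ d.factorial = 1 := by
      have := pow_card_eq_one' (x := ρ)
      rwa [Nat.card_eq_fintype_card, Fintype.card_perm, Fintype.card_fin] at this
    have h2 : u.Coprime (orderOf ρ) := hu.coprime_dvd_right (orderOf_dvd_of_pow_eq_one h1)
    obtain ⟨m, hm⟩ := exists_pow_eq_self_of_coprime h2
    rw [← hm]
    exact pow_mem (S := MulAction.stabilizer (Equiv.Perm (Fin d)) j)
      (MulAction.mem_stabilizer_iff.2 h) m
  · intro h
    exact pow_mem (S := MulAction.stabilizer (Equiv.Perm (Fin d)) j) (MulAction.mem_stabilizer_iff.2 h) u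

section S2
variable {I : Type} {U : Ultrafilter I} {k Ω : I → Type} [∀ i, Field (k i)]
  {E A : Type} [Field E] [Field A] [Algebra E A] [Algebra E[X] A] [Algebra (RatFunc E) A]
  [IsScalarTower E E[X] A] [IsScalarTower E[X] (RatFunc E) A] [IsAlgClosure (RatFunc E) A]

lemma ev_Lam1 (ε : E →+* UP U k) (y0 : ∀ i, k i) (c : E[X]) :
    UP.map (fun i => evalRingHom (y0 i)) (Lam1 ε c) = c.eval₂ ε (UP.mk y0) := by
  have h := UP.map_pol_eval₂ (U := U) (fun i => RingHom.id (k i)) y0 (c.map ε)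
  rw [eval₂_map] at h
  have h2 : (UP.map (U := U) fun i => RingHom.id (k i)) = RingHom.id _ := by
    refine RingHom.ext fun x => ?_
    obtain ⟨x, rfl⟩ := UP.mk_surj x
    simp
  rw [h2, RingHom.id_comp] at h
  exact h

lemma ev_Lam2 (ε : E →+* UP U k) (y0 : ∀ i, k i) (h : E[X][X]) :
    (UP.mk fun i => (UP.rep (Lam2 ε h) i).map (evalRingHom (y0 i)) : UP U fun i => (k i)[X]) =
      UP.pol (h.map (eval₂RingHom ε (UP.mk y0))) := by
  have e2 : (UP.mk (fun i => (UP.rep (Lam2 ε h) i).map (evalRingHom (y0 i))) :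
      UP U fun i => (k i)[X]) =
      UP.map (fun i => mapRingHom (evalRingHom (y0 i))) (Lam2 ε h) := by
    conv_rhs => rw [← UP.mk_rep (Lam2 ε h)]
    rw [UP.map_mk]
    rfl
  rw [e2, Lam2, RingHom.comp_apply, UP.map_pol, coe_mapRingHom, Polynomial.map_map]
  congr 2
  exact RingHom.ext fun c => ev_Lam1 ε y0 c

/-- `core` inside the ultraproduct. -/
lemma coreUP [∀ i, IsAlgClosed (k i)]
    (p r : I → ℕ) [∀ i, Fact (p i).Prime] [∀ i, CharP (k i) (p i)] (hr : ∀ i, r i ≠ 0)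
    (hq : ∀ N, ∀ᶠ i in (U : Filter I), N ≤ p i ^ r i)
    (F : ∀ i, k i →+* k i) (hF : ∀ i a, F i a = a ^ p i ^ r i) (ε : E →+* UP U k)
    (hfix : ∀ e, UP.map F (ε e) = ε e)
    (hrel : ∀ a : UP U k, UP.map F a = a → (∃ P : E[X], P.Monic ∧ P.eval₂ ε a = 0) → ∃ e, ε e = a)
    (s1 : A ≃ₐ[RatFunc E] A) (hs1 : ∀ e : A, IsIntegral E e → s1 e = e → ∃ c, algebraMap E A c = e)
    {d : ℕ} (z : Fin d → A) (hz : Function.Injective z) (f a b : E[X][X]) (δ : E[X])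
    (hf : f.map (algebraMap E[X] A) = ∏ j, (X - C (z j)))
    (bez : a * f + b * derivative f = C δ) (hδ : δ ≠ 0) (M : ℕ) (hM : M ≠ 0) :
    ∃ (u : ℕ) (π : Equiv.Perm (Fin d)), u.Coprime M ∧ (∀ j, (s1 ^ u) (z j) = z (π j)) ∧
    ∃ (y : UP U k) (ζ : Fin d → UP U k), UP.map F y = y ∧ δ.eval₂ ε y ≠ 0 ∧
      (∀ j, UP.map F (ζ j) = ζ (π j)) ∧ Function.Injective ζ ∧
    ∀ (h : E[X][X]) (l : E[X]) (m : Multiset (Fin d)), h.map (algebraMap E[X] A) =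
      C (algebraMap E[X] A l) * (m.map fun j => X - C (z j)).prod →
      h.map (eval₂RingHom ε y) = C (l.eval₂ ε y) * (m.map fun j => X - C (ζ j)).prod := by
  obtain ⟨u, π, hu, hπ, y0, ζ, h1, h2⟩ := core (fun i => AlgebraicClosure (RatFunc (k i))) p r hr hq F
    hF ε hfix hrel s1 hs1 z hz f a b δ hf bez hδ M hM
  refine ⟨u, π, hu, hπ, UP.mk y0, fun j => UP.mk fun i => ζ i j, ?_, ?_, ?_, ?_, ?_⟩
  · rw [UP.map_mk, UP.mk_eq]
    filter_upwards [h1] with i hi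
    rw [hF, hi.1]
  · rw [← ev_Lam1, ← UP.mk_rep (Lam1 ε δ), UP.map_mk, Ne, UP.mk_eq_zero]
    apply Ultrafilter.eventually_not.1
    filter_upwards [h1] with i hi
    exact hi.2.1
  · intro j
    rw [UP.map_mk, UP.mk_eq]
    filter_upwards [h1] with i hi
    rw [hF, hi.2.2.1]
  · intro a b hab
    obtain ⟨i, hi, hi2⟩ := (h1.and (UP.mk_eq.1 hab)).exists
    exact hi.2.2.2 hi2
  · intro h l m hh
    apply UP.pol_injective
    rw [← ev_Lam2, map_mul, UP.pol_C, ← ev_Lam1, map_multiset_prod, Multiset.map_map]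
    rw [UP.mk_eq.2 (h2 h l m hh)]
    have e3 : (fun i => C ((UP.rep (Lam1 ε l) i).eval (y0 i)) *
          (m.map fun a => X - C (ζ i a)).prod) =
        (fun i => C ((UP.rep (Lam1 ε l) i).eval (y0 i))) *
          (m.map fun a => (fun i => X - C (ζ i a) : ∀ i, (k i)[X])).prod := by
      funext i
      rw [Pi.mul_apply]
      congr 1
      have := map_multiset_prod (Pi.evalRingHom (fun i => (k i)[X]) i)
        (m.map fun a => (fun i => X - C (ζ i a) : ∀ i, (k i)[X]))
      rw [Multiset.map_map] at this
      exact this.symm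
    rw [e3, map_mul, map_multiset_prod, Multiset.map_map]
    congr 1
    · conv_rhs => rw [← UP.mk_rep (Lam1 ε l)]
      rw [UP.map_mk, UP.map_mk]
      rfl
    · congr 1
      refine Multiset.map_congr rfl fun a _ => ?_
      simp only [Function.comp_apply, map_sub, UP.pol_X, UP.pol_C]
      rw [UP.map_mk, ← map_sub]
      rfl

lemma S2 [∀ i, IsAlgClosed (k i)]
    (p r : I → ℕ) [∀ i, Fact (p i).Prime] [∀ i, CharP (k i) (p i)] (hr : ∀ i, r i ≠ 0)
    (hq : ∀ N, ∀ᶠ i in (U : Filter I), N ≤ p i ^ r i)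
    (F : ∀ i, k i →+* k i) (hF : ∀ i a, F i a = a ^ p i ^ r i) (ε : E →+* UP U k)
    (hfix : ∀ e, UP.map F (ε e) = ε e)
    (hrel : ∀ a : UP U k, UP.map F a = a → (∃ P : E[X], P.Monic ∧ P.eval₂ ε a = 0) → ∃ e, ε e = a)
    (s1 : A ≃ₐ[RatFunc E] A) (hs1 : ∀ e : A, IsIntegral E e → s1 e = e → ∃ c, algebraMap E A c = e)
    (S : Finset E[X][X]) (hS : ∀ g ∈ S, g ≠ 0) :
    ∃ y : UP U k, UP.map F y = y ∧ ∀ g ∈ S,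
      ((∃ w : UP U k, UP.map F w = w ∧ g.eval₂ (eval₂RingHom ε y) w = 0) ↔
        ∃ w : A, s1 w = w ∧ g.eval₂ (algebraMap E[X] A) w = 0) := by
  classical
  obtain ⟨q, hqE⟩ := ExpChar.exists E
  have hinj : Function.Injective (algebraMap E[X] A) := by
    rw [IsScalarTower.algebraMap_eq E[X] (RatFunc E) A]
    exact (algebraMap (RatFunc E) A).injective.comp (IsFractionRing.injective E[X] (RatFunc E))
  have hA : IsAlgClosed A := IsAlgClosure.isAlgClosed (RatFunc E)
  have hAalg : Algebra.IsAlgebraic (RatFunc E) A := IsAlgClosure.isAlgebraic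
  have : ExpChar (UP U k) q := expChar_of_injective_ringHom ε.injective q
  have : ExpChar E[X] q := expChar_of_injective_ringHom (f := (C : E →+* E[X])) C_injective q
  have : ExpChar (RatFunc E) q :=
    expChar_of_injective_ringHom (IsFractionRing.injective E[X] (RatFunc E)) q
  have : ExpChar A q := expChar_of_injective_ringHom hinj q
  have hq0 : ∀ n, q ^ n ≠ 0 := fun n => pow_ne_zero _ (expChar_pos E q).ne'
  let c : E[X] := ∏ g ∈ S, g.leadingCoeff
  have hc : c ≠ 0 := Finset.prod_ne_zero_iff.2 fun g hg => leadingCoeff_ne_zero.2 (hS g hg)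
  have hcA : algebraMap E[X] A c ≠ 0 := fun h => hc (hinj (by rw [h, map_zero]))
  let W : Finset A := S.biUnion fun g =>
    (g.map (algebraMap E[X] A)).roots.toFinset.image fun w => algebraMap E[X] A c * w
  obtain ⟨n, hn⟩ := unif_sep (K := RatFunc E) q W
  have hWi : ∀ x ∈ W, IsIntegral E[X] x := by
    intro x hx
    simp only [W, Finset.mem_biUnion, Finset.mem_image, Multiset.mem_toFinset] at hx
    obtain ⟨g, hg, w, hw, rfl⟩ := hx
    have h1 : aeval w g = 0 := by
      rw [aeval_def, ← eval_map]
      exact (mem_roots'.1 hw).2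
    have h2 := isIntegral_leadingCoeff_smul g w h1
    have h3 : c = (∏ g ∈ S.erase g, g.leadingCoeff) * g.leadingCoeff :=
      (Finset.prod_erase_mul S _ hg).symm
    rw [h3, map_mul, mul_assoc, ← Algebra.smul_def g.leadingCoeff]
    exact isIntegral_algebraMap.mul h2
  obtain ⟨d, z, f, a, b, δ, hz, hf, hcov, bez, hδ⟩ := cover (R := E[X]) (K := RatFunc E)
    (W.image fun x => x ^ q ^ n)
    (by
      intro x hx
      obtain ⟨y, hy, rfl⟩ := Finset.mem_image.1 hx
      exact (hWi y hy).pow _)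
    (by
      intro x hx
      obtain ⟨y, hy, rfl⟩ := Finset.mem_image.1 hx
      exact hn y hy)
  obtain ⟨u, π, hu, hπ, y, ζ, hy, hyδ, hζ, hζi, hfac⟩ := coreUP p r hr hq F hF ε hfix hrel s1 hs1 z hz
    f (C c * a) (C c * b) (c * δ) hf (by rw [map_mul, ← bez]; ring) (mul_ne_zero hc hδ)
    d.factorial d.factorial_ne_zero
  refine ⟨y, hy, fun g hg => ?_⟩
  set e : E[X] →+* UP U k := eval₂RingHom ε y with he
  have hec : e c ≠ 0 := by
    intro h
    apply hyδ
    rw [eval₂_mul]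
    have : c.eval₂ ε y = 0 := h
    rw [this, zero_mul]
  have heF : ∀ c : E[X], UP.map F (e c) = e c := by
    intro c
    rw [he, coe_eval₂RingHom, hom_eval₂, hy]
    congr 1
    exact RingHom.ext hfix
  -- permutation of `s1`
  have halg : ∀ (s : A ≃ₐ[RatFunc E] A) (c : E[X]), s (algebraMap E[X] A c) =
      algebraMap E[X] A c := by
    intro s c
    rw [IsScalarTower.algebraMap_apply E[X] (RatFunc E) A]
    exact s.commutes _
  obtain ⟨ρ, hρ⟩ := permOf (algebraMap E[X] A) (s1 : A →+* A) (halg s1) z hz f hf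
  have hρu : ρ ^ u = π := by
    refine Equiv.ext fun j => hz ?_
    rw [← hπ]
    have : ∀ (n : ℕ) j, (s1 ^ n) (z j) = z ((ρ ^ n) j) := by
      intro n
      induction n with
      | zero => intro j; rfl
      | succ n ih =>
        intro j
        have : s1 (z j) = z (ρ j) := hρ j
        rw [pow_succ, pow_succ, AlgEquiv.mul_apply, this, ih]
        rfl
    rw [this]
  have hfixj : ∀ j, π j = j ↔ s1 (z j) = z j := by
    intro j
    have : s1 (z j) = z (ρ j) := hρ j
    rw [this, hz.eq_iff, ← hρu, perm_fix ρ u hu]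
  -- the polynomial with roots `(c w)^P`
  let H := Hg q n c g
  have hroot : ∀ x ∈ (H.map (algebraMap E[X] A)).roots, ∃ w, g.eval₂ (algebraMap E[X] A) w = 0 ∧
      x = (algebraMap E[X] A c * w) ^ q ^ n := by
    intro x hx
    obtain ⟨w, hw⟩ := IsAlgClosed.exists_pow_nat_eq x (Nat.pos_of_ne_zero (hq0 n))
    have hw2 : x = (algebraMap E[X] A c * ((algebraMap E[X] A c)⁻¹ * w)) ^ q ^ n := by
      rw [mul_inv_cancel_left₀ hcA, hw]
    refine ⟨_, ?_, hw2⟩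
    rw [← Hg_iff q n c g (algebraMap E[X] A) hcA, ← hw2, ← eval_map]
    exact (mem_roots'.1 hx).2
  have hrz : ∀ x ∈ (H.map (algebraMap E[X] A)).roots, ∃ j, z j = x := by
    intro x hx
    obtain ⟨w, hw, rfl⟩ := hroot x hx
    apply hcov
    refine Finset.mem_image_of_mem _ ?_
    simp only [W, Finset.mem_biUnion, Finset.mem_image, Multiset.mem_toFinset]
    refine ⟨g, hg, w, mem_roots'.2 ⟨?_, ?_⟩, rfl⟩
    · exact fun h => hS g hg (Polynomial.map_injective _ hinj (by rw [h, Polynomial.map_zero]))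
    · rw [IsRoot, eval_map, hw]
  obtain ⟨m, hm⟩ : ∃ m : Multiset (Fin d), m.map z = (H.map (algebraMap E[X] A)).roots := by
    generalize (H.map (algebraMap E[X] A)).roots = M at hrz
    clear hroot
    induction M using Multiset.induction_on with
    | empty => exact ⟨0, rfl⟩
    | cons x M ih =>
      obtain ⟨m, hm⟩ := ih fun x hx => hrz x (Multiset.mem_cons_of_mem hx)
      obtain ⟨j, hj⟩ := hrz x (Multiset.mem_cons_self _ _)
      exact ⟨j ::ₘ m, by rw [Multiset.map_cons, hm, hj]⟩
  have hHA : H.map (algebraMap E[X] A) =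
      C (algebraMap E[X] A H.leadingCoeff) * (m.map fun j => X - C (z j)).prod := by
    have h1 := (IsAlgClosed.splits (H.map (algebraMap E[X] A))).eq_prod_roots
    rw [leadingCoeff_map_of_injective hinj, ← hm, Multiset.map_map] at h1
    exact h1
  have hHL := hfac H H.leadingCoeff m hHA
  have hlead : e g.leadingCoeff ≠ 0 := by
    intro h
    apply hec
    have h3 : c = (∏ g ∈ S.erase g, g.leadingCoeff) * g.leadingCoeff :=
      (Finset.prod_erase_mul S _ hg).symm
    rw [h3, map_mul, h, mul_zero]
  have hHl : H.leadingCoeff = g.leadingCoeff ^ q ^ n := Hg_lead q n c g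
  have evA := fac_root _ _ _ (by
    rw [hHl, map_pow]
    exact pow_ne_zero _ fun h => hS g hg (leadingCoeff_eq_zero.1 (hinj (by rw [h, map_zero])))) _ _ hHA
  have evL := fac_root _ _ _ (by
    rw [hHl]
    change e _ ≠ 0
    rw [map_pow]
    exact pow_ne_zero _ hlead) _ _ hHL
  constructor
  · rintro ⟨w, hw, hgw⟩
    rw [← Hg_iff q n c g e hec, evL] at hgw
    obtain ⟨j, hjm, hj⟩ := hgw
    have h1 : π j = j := by
      apply hζi
      rw [← hζ, hj, map_pow, map_mul, hw, heF]
    obtain ⟨w', hw', hzw⟩ := hroot (z j) (by rw [← hm]; exact Multiset.mem_map_of_mem z hjm)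
    refine ⟨w', ?_, hw'⟩
    have h2 := (hfixj j).1 h1
    rw [hzw, map_pow, map_mul, halg] at h2
    have h3 := iterateFrobenius_inj A q n (a₁ := algebraMap E[X] A c * s1 w')
      (a₂ := algebraMap E[X] A c * w') (by rw [iterateFrobenius_def, iterateFrobenius_def, h2])
    exact mul_left_cancel₀ hcA h3
  · rintro ⟨w, hw, hgw⟩
    rw [← Hg_iff q n c g _ hcA, evA] at hgw
    obtain ⟨j, hjm, hj⟩ := hgw
    have h1 : π j = j := by
      rw [hfixj, hj, map_pow, map_mul, halg, hw]
    obtain ⟨v, hv⟩ := IsAlgClosed.exists_pow_nat_eq (ζ j) (Nat.pos_of_ne_zero (hq0 n))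
    have hv2 : ζ j = (e c * ((e c)⁻¹ * v)) ^ q ^ n := by
      rw [mul_inv_cancel_left₀ hec, hv]
    refine ⟨(e c)⁻¹ * v, ?_, ?_⟩
    · have h2 := hζ j
      rw [h1, hv2, map_pow, map_mul, heF] at h2
      have h3 := iterateFrobenius_inj (UP U k) q n (a₁ := e c * UP.map F ((e c)⁻¹ * v))
        (a₂ := e c * ((e c)⁻¹ * v)) (by
        rw [iterateFrobenius_def, iterateFrobenius_def]; exact h2)
      exact mul_left_cancel₀ hec h3
    · rw [← Hg_iff q n c g e hec, ← hv2, evL]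
      exact ⟨j, hjm, rfl⟩

end S2
end PRU
end

section
open Polynomial
set_option linter.unusedSectionVars false
namespace PRU

/-! ### Quantifier elimination -/

lemma iso_dom {R K1 K2 : Type} [CommRing R] [IsDomain R] [Field K1] [Field K2] (ξ1 : R →+* K1)
    (ξ2 : R →+* K2) (h1 : Function.Injective ξ1) (h2 : Function.Injective ξ2)
    (hroot : ∀ f : R[X], (∃ z, f.eval₂ ξ1 z = 0) ↔ (∃ z, f.eval₂ ξ2 z = 0)) :
    ∃ (E : Type) (_ : Field E) (ξ : R →+* E) (ε1 : E →+* K1) (ε2 : E →+* K2),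
      ε1.comp ξ = ξ1 ∧ ε2.comp ξ = ξ2 ∧
      (∀ a : K1, (∃ P : E[X], P ≠ 0 ∧ P.eval₂ ε1 a = 0) → ∃ e, ε1 e = a) ∧
      (∀ a : K2, (∃ P : E[X], P ≠ 0 ∧ P.eval₂ ε2 a = 0) → ∃ e, ε2 e = a) := by
  let k0 := FractionRing R
  let _ : Algebra k0 K1 := (IsFractionRing.lift (K := k0) h1).toAlgebra
  let _ : Algebra k0 K2 := (IsFractionRing.lift (K := k0) h2).toAlgebra
  have a1 : (algebraMap k0 K1).comp (algebraMap R k0) = ξ1 :=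
    RingHom.ext fun r => IsFractionRing.lift_algebraMap (K := k0) h1 r
  have a2 : (algebraMap k0 K2).comp (algebraMap R k0) = ξ2 :=
    RingHom.ext fun r => IsFractionRing.lift_algebraMap (K := k0) h2 r
  have key : ∀ (K : Type) [Field K] [Algebra k0 K] (ξ : R →+* K)
      (_ : (algebraMap k0 K).comp (algebraMap R k0) = ξ) (p : k0[X]) (hp : p ≠ 0),
      (∃ x : algebraicClosure k0 K, aeval x p = 0) ↔
        ∃ z : K, (IsLocalization.integerNormalization (nonZeroDivisors R) p).eval₂ ξ z = 0 := by
    intro K _ _ ξ hξ p hp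
    obtain ⟨b, hbm, hb⟩ := IsLocalization.integerNormalization_spec (nonZeroDivisors R) p
    have hz : ∀ z : K, (IsLocalization.integerNormalization (nonZeroDivisors R) p).eval₂ ξ z = 0 ↔
        aeval z p = 0 := by
      intro z
      rw [← hξ, ← eval₂_map, hb, Algebra.smul_def, IsScalarTower.algebraMap_apply R k0 k0[X],
        Polynomial.algebraMap_eq, eval₂_mul, eval₂_C, mul_eq_zero, aeval_def, or_iff_right]
      rw [map_eq_zero, IsFractionRing.to_map_eq_zero_iff]
      exact nonZeroDivisors.ne_zero hbm
    simp only [hz]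
    constructor
    · rintro ⟨x, hx⟩
      refine ⟨x, ?_⟩
      have := congrArg (algebraMap (algebraicClosure k0 K) K) hx
      rwa [map_zero, ← aeval_algebraMap_apply] at this
    · rintro ⟨z, hz⟩
      refine ⟨⟨z, mem_algebraicClosure_iff.2 ⟨p, hp, hz⟩⟩, ?_⟩
      apply (algebraMap (algebraicClosure k0 K) K).injective
      rw [map_zero, ← aeval_algebraMap_apply]
      exact hz
  obtain ⟨τ⟩ := Field.nonempty_algEquiv_of_aeval_eq_zero_eq (F := k0)
    (E := algebraicClosure k0 K1) (K := algebraicClosure k0 K2) (by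
      ext p
      by_cases hp : p = 0
      · subst hp
        exact ⟨fun _ => ⟨0, map_zero _⟩, fun _ => ⟨0, map_zero _⟩⟩
      · show (∃ x, _) ↔ (∃ x, _)
        rw [key K1 ξ1 a1 p hp, key K2 ξ2 a2 p hp, hroot])
  have fin : ∀ (K : Type) [Field K] [Algebra k0 K] (a : K),
      (∃ P : (algebraicClosure k0 K)[X], P ≠ 0 ∧ P.eval₂ (algebraMap _ K) a = 0) →
        a ∈ algebraicClosure k0 K := by
    intro K _ _ a ha
    have : IsAlgebraic (algebraicClosure k0 K) a := ha
    rw [mem_algebraicClosure_iff]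
    exact this.restrictScalars k0
  refine ⟨algebraicClosure k0 K1, inferInstance, (algebraMap k0 _).comp (algebraMap R k0),
    algebraMap _ K1, (algebraMap (algebraicClosure k0 K2) K2).comp (τ : _ →+* _), ?_, ?_, ?_, ?_⟩
  · rw [← a1]; rfl
  · rw [← a2]
    refine RingHom.ext fun r => ?_
    simp only [RingHom.comp_apply, RingHom.coe_coe, AlgEquiv.commutes]
    rfl
  · intro a ha
    exact ⟨⟨a, fin K1 a ha⟩, rfl⟩
  · rintro a ⟨P, hP, hPa⟩
    have : a ∈ algebraicClosure k0 K2 := fin K2 a ⟨P.map (τ : _ →+* _),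
      (Polynomial.map_ne_zero_iff τ.injective).2 hP, by rwa [eval₂_map]⟩
    refine ⟨τ.symm ⟨a, this⟩, ?_⟩
    simp

lemma isoLemma {R K1 K2 : Type} [CommRing R] [Field K1] [Field K2] (ξ1 : R →+* K1)
    (ξ2 : R →+* K2)
    (hroot : ∀ f : R[X], (∃ z, f.eval₂ ξ1 z = 0) ↔ (∃ z, f.eval₂ ξ2 z = 0)) :
    ∃ (E : Type) (_ : Field E) (ξ : R →+* E) (ε1 : E →+* K1) (ε2 : E →+* K2),
      ε1.comp ξ = ξ1 ∧ ε2.comp ξ = ξ2 ∧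
      (∀ a : K1, (∃ P : E[X], P ≠ 0 ∧ P.eval₂ ε1 a = 0) → ∃ e, ε1 e = a) ∧
      (∀ a : K2, (∃ P : E[X], P ≠ 0 ∧ P.eval₂ ε2 a = 0) → ∃ e, ε2 e = a) := by
  have hk : ∀ r, ξ1 r = 0 ↔ ξ2 r = 0 := fun r => by
    have := hroot (C r)
    simpa using this
  have : (RingHom.ker ξ1).IsPrime := RingHom.ker_isPrime ξ1
  let Q := R ⧸ RingHom.ker ξ1
  let m : R →+* Q := Ideal.Quotient.mk _
  let η1 : Q →+* K1 := Ideal.Quotient.lift _ ξ1 fun a ha => ha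
  let η2 : Q →+* K2 := Ideal.Quotient.lift _ ξ2 fun a ha => (hk a).1 ha
  have e1 : η1.comp m = ξ1 := RingHom.ext fun r => rfl
  have e2 : η2.comp m = ξ2 := RingHom.ext fun r => rfl
  have ms : Function.Surjective m := Ideal.Quotient.mk_surjective
  have i1 : Function.Injective η1 := (injective_iff_map_eq_zero _).2 fun a ha => by
    obtain ⟨r, rfl⟩ := ms a
    exact Ideal.Quotient.eq_zero_iff_mem.2 ha
  have i2 : Function.Injective η2 := (injective_iff_map_eq_zero _).2 fun a ha => by
    obtain ⟨r, rfl⟩ := ms a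
    exact Ideal.Quotient.eq_zero_iff_mem.2 ((hk r).2 ha)
  obtain ⟨E, fE, ξ, ε1, ε2, h1, h2, h3, h4⟩ := iso_dom η1 η2 i1 i2 (fun f => by
    obtain ⟨f, rfl⟩ := Polynomial.map_surjective m ms f
    simp only [eval₂_map, e1, e2, hroot])
  refine ⟨E, fE, ξ.comp m, ε1, ε2, ?_, ?_, h3, h4⟩
  · rw [← RingHom.comp_assoc, h1, e1]
  · rw [← RingHom.comp_assoc, h2, e2]

lemma frob_fix (F : Type) [Field F] [Fintype F] (a : AlgebraicClosure F)
    (ha : a ^ Fintype.card F = a) : ∃ b : F, algebraMap F (AlgebraicClosure F) b = a := by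
  have hne : (X ^ Fintype.card F - X : F[X]) ≠ 0 := FiniteField.X_pow_card_sub_X_ne_zero F Fintype.one_lt_card
  have hsp := Polynomial.splits_X_pow_nat_card_sub_X (K := F)
  rw [Nat.card_eq_fintype_card] at hsp
  have hw : (X ^ Fintype.card F - X : F[X]).eval₂ (algebraMap F (AlgebraicClosure F)) a = 0 := by
    simp [ha]
  rw [hsp.eq_prod_roots, eval₂_mul, eval₂_C, mul_eq_zero] at hw
  rcases hw with hw | hw
  · rw [map_eq_zero, leadingCoeff_eq_zero] at hw
    exact absurd hw hne
  · rw [← coe_eval₂RingHom, map_multiset_prod, Multiset.prod_eq_zero_iff, Multiset.mem_map] at hw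
    obtain ⟨q, hq, hq0⟩ := hw
    obtain ⟨b, -, rfl⟩ := Multiset.mem_map.1 hq
    rw [coe_eval₂RingHom, eval₂_sub, eval₂_X, eval₂_C, sub_eq_zero] at hq0
    exact ⟨b, hq0.symm⟩

section qeUPsec
variable {I : Type} {U : Ultrafilter I}

/-- Frobenius on the algebraic closure. -/
noncomputable def frA (F : Type) [Field F] [Fintype F] : AlgebraicClosure F →+* AlgebraicClosure F :=
  (FiniteField.frobeniusAlgHom F (AlgebraicClosure F) : _ →+* _)

lemma frA_apply (F : Type) [Field F] [Fintype F] (a : AlgebraicClosure F) :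
    frA F a = a ^ Fintype.card F := rfl

variable (F F' : I → Type) [∀ i, Field (F i)] [∀ i, Fintype (F i)] [∀ i, Field (F' i)]
  [∀ i, Fintype (F' i)]

variable (U) in
/-- The embedding of the ultraproduct of finite fields in that of their closures. -/
noncomputable def iotaUP : UP U F →+* UP U (fun i => AlgebraicClosure (F i)) :=
  UP.map fun i => algebraMap (F i) (AlgebraicClosure (F i))

variable (U) in
/-- The ultra-Frobenius. -/
noncomputable def phiUP : UP U (fun i => AlgebraicClosure (F i)) →+* UP U (fun i => AlgebraicClosure (F i)) :=
  UP.map fun i => frA (F i)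

lemma phiUP_iota (a : UP U F) : phiUP U F (iotaUP U F a) = iotaUP U F a := by
  rw [phiUP, iotaUP, UP.map_map]
  congr 1
  apply UP.map_congr
  intro i
  refine RingHom.ext fun x => ?_
  rw [RingHom.comp_apply, frA_apply, ← map_pow, FiniteField.pow_card]

lemma phiUP_fix (a : UP U (fun i => AlgebraicClosure (F i))) (h : phiUP U F a = a) :
    ∃ b, iotaUP U F b = a := by
  obtain ⟨f, rfl⟩ := UP.mk_surj a
  rw [phiUP, UP.map_mk, UP.mk_eq] at h
  have : ∀ i, ∃ b : F i, frA (F i) (f i) = f i → algebraMap (F i) (AlgebraicClosure (F i)) b = f i := by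
    intro i
    by_cases hi : frA (F i) (f i) = f i
    · obtain ⟨b, hb⟩ := frob_fix (F i) (f i) hi
      exact ⟨b, fun _ => hb⟩
    · exact ⟨0, fun h => absurd h hi⟩
  choose b hb using this
  refine ⟨UP.mk b, ?_⟩
  rw [iotaUP, UP.map_mk, UP.mk_eq]
  filter_upwards [h] with i hi using hb i hi

lemma root_transfer {R E : Type} [CommRing R] [Field E] (ξ : R →+* E) (ε : E →+* UP U F) (b : UP U F)
    (f : R[X][X]) :
    (∃ w : UP U F, f.eval₂ (eval₂RingHom (ε.comp ξ) b) w = 0) ↔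
      ∃ w, phiUP U F w = w ∧ (f.map (mapRingHom ξ)).eval₂
        (eval₂RingHom ((iotaUP U F).comp ε) (iotaUP U F b)) w = 0 := by
  have hc : (eval₂RingHom ((iotaUP U F).comp ε) (iotaUP U F b)).comp (mapRingHom ξ) =
      (iotaUP U F).comp (eval₂RingHom (ε.comp ξ) b) := by
    refine Polynomial.ringHom_ext (fun a => ?_) ?_ <;> simp
  have hinj : Function.Injective (iotaUP U F) := (iotaUP U F).injective
  simp only [eval₂_map, hc]
  constructor
  · rintro ⟨w, hw⟩
    refine ⟨iotaUP U F w, phiUP_iota F w, ?_⟩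
    rw [← hom_eval₂, hw, map_zero]
  · rintro ⟨w, hw, hw2⟩
    obtain ⟨v, rfl⟩ := phiUP_fix F w hw
    refine ⟨v, hinj ?_⟩
    rw [hom_eval₂, hw2, map_zero]

lemma hrel_UP {E : Type} [Field E] (ε : E →+* UP U F)
    (h : ∀ a : UP U F, (∃ P : E[X], P ≠ 0 ∧ P.eval₂ ε a = 0) → ∃ e, ε e = a)
    (a : UP U (fun i => AlgebraicClosure (F i))) (ha : phiUP U F a = a)
    (hP : ∃ P : E[X], P.Monic ∧ P.eval₂ ((iotaUP U F).comp ε) a = 0) :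
    ∃ e, ((iotaUP U F).comp ε) e = a := by
  obtain ⟨v, rfl⟩ := phiUP_fix F a ha
  obtain ⟨P, hPm, hP⟩ := hP
  rw [← hom_eval₂, map_eq_zero] at hP
  obtain ⟨e, rfl⟩ := h v ⟨P, hPm.ne_zero, hP⟩
  exact ⟨e, rfl⟩

lemma qeUP (hq : ∀ N, ∀ᶠ i in (U : Filter I), N ≤ Fintype.card (F' i)) {R : Type} [CommRing R]
    (ξ1 : R →+* UP U F) (ξ2 : R →+* UP U F')
    (hroot : ∀ f : R[X], (∃ z, f.eval₂ ξ1 z = 0) ↔ (∃ z, f.eval₂ ξ2 z = 0)) (b : UP U F)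
    (S : Finset R[X][X]) :
    ∃ b' : UP U F', ∀ f ∈ S, (∃ w, f.eval₂ (eval₂RingHom ξ1 b) w = 0) ↔
      ∃ w, f.eval₂ (eval₂RingHom ξ2 b') w = 0 := by
  classical
  obtain ⟨E, fE, ξ, ε1, ε2, rfl, rfl, h3, h4⟩ := isoLemma ξ1 ξ2 hroot
  by_cases hb : ∃ P : E[X], P ≠ 0 ∧ P.eval₂ ε1 b = 0
  · obtain ⟨e, rfl⟩ := h3 b hb
    refine ⟨ε2 e, fun f _ => ?_⟩
    have hc : ∀ {K : Type} [Field K] (ε : E →+* K), eval₂RingHom (ε.comp ξ) (ε e) =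
        ε.comp (eval₂RingHom ξ e) := by
      intro K _ ε
      refine Polynomial.ringHom_ext (fun a => ?_) ?_ <;> simp
    rw [hc, hc]
    let g : E[X] := f.map (eval₂RingHom ξ e)
    have hg : ∀ {K : Type} [Field K] (ε : E →+* K) (w : K),
        f.eval₂ (ε.comp (eval₂RingHom ξ e)) w = g.eval₂ ε w := by
      intro K _ ε w
      rw [eval₂_map]
    simp only [hg]
    by_cases g0 : g = 0
    · simp [g0]
    constructor
    · rintro ⟨w, hw⟩
      obtain ⟨v, rfl⟩ := h3 w ⟨g, g0, hw⟩
      rw [eval₂_at_apply, map_eq_zero] at hw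
      exact ⟨ε2 v, by rw [eval₂_at_apply, hw, map_zero]⟩
    · rintro ⟨w, hw⟩
      obtain ⟨v, rfl⟩ := h4 w ⟨g, g0, hw⟩
      rw [eval₂_at_apply, map_eq_zero] at hw
      exact ⟨ε1 v, by rw [eval₂_at_apply, hw, map_zero]⟩
  · have htr : ∀ P : E[X], P.eval₂ ((iotaUP U F).comp ε1) (iotaUP U F b) = 0 → P = 0 := by
      intro P hP
      rw [← hom_eval₂, map_eq_zero] at hP
      by_contra hP0
      exact hb ⟨P, hP0, hP⟩
    obtain ⟨j, s, hj, hs, hfs⟩ := side1 (A := AlgebraicClosure (RatFunc E)) (phiUP U F)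
      ((iotaUP U F).comp ε1) (fun e => phiUP_iota F _) (hrel_UP F ε1 h3) (iotaUP U F b)
      (phiUP_iota F b) htr
    have hd : ∀ i, ∃ p r : ℕ, p.Prime ∧ r ≠ 0 ∧ CharP (AlgebraicClosure (F' i)) p ∧
        Fintype.card (F' i) = p ^ r := by
      intro i
      obtain ⟨p, hp, n, hpp, hn⟩ := FiniteField.card' (F' i)
      exact ⟨p, n, hpp, n.ne_zero, charP_of_injective_algebraMap
        (algebraMap (F' i) (AlgebraicClosure (F' i))).injective p, hn⟩
    choose p r hp hr hchar hcard using hd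
    have : ∀ i, Fact (p i).Prime := fun i => ⟨hp i⟩
    obtain ⟨y, hy, hyS⟩ := S2 (A := AlgebraicClosure (RatFunc E)) (U := U) p r hr
      (fun N => by simpa only [hcard] using hq N) (fun i => frA (F' i))
      (fun i a => by rw [frA_apply, hcard]) ((iotaUP U F').comp ε2) (fun e => phiUP_iota F' _)
      (hrel_UP F' ε2 h4) s hfs ((S.image fun f => f.map (mapRingHom ξ)).erase 0)
      (fun g hg => (Finset.mem_erase.1 hg).1)
    obtain ⟨b', rfl⟩ := phiUP_fix F' y hy
    refine ⟨b', fun f hf => ?_⟩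
    rw [root_transfer, root_transfer]
    by_cases g0 : f.map (mapRingHom ξ) = 0
    · rw [g0]
      simp only [eval₂_zero, and_true]
      exact ⟨fun _ => ⟨0, map_zero _⟩, fun _ => ⟨0, map_zero _⟩⟩
    · rw [side1_root (phiUP U F) ((iotaUP U F).comp ε1) (iotaUP U F b) j s hj hs _ g0]
      exact (hyS _ (Finset.mem_erase.2 ⟨g0, Finset.mem_image_of_mem _ hf⟩)).symm

end qeUPsec

end PRU
end

section
open Polynomial
set_option linter.unusedSectionVars false
namespace PRU

section qesec
variable {σ τ : Type}

lemma hasRt_option {K : Type} [Field K] (x : σ → K) (b : K) (f : (MvPolynomial (Option σ) ℤ)[X]) :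
    HasRt (fun o : Option σ => o.elim b x) f ↔
      ∃ w, (f.map ((MvPolynomial.optionEquivLeft ℤ σ : _ →+* _))).eval₂
        (eval₂RingHom (MvPolynomial.aeval x : MvPolynomial σ ℤ →ₐ[ℤ] K).toRingHom b) w = 0 := by
  have hc : (eval₂RingHom (MvPolynomial.aeval x : MvPolynomial σ ℤ →ₐ[ℤ] K).toRingHom b).comp
      (MvPolynomial.optionEquivLeft ℤ σ : _ →+* _) =
      (MvPolynomial.aeval (fun o : Option σ => o.elim b x) : _ →ₐ[ℤ] K).toRingHom := by
    refine MvPolynomial.ringHom_ext (fun r => ?_) (fun o => ?_)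
    · simp
    · cases o <;> simp [MvPolynomial.optionEquivLeft_X_none, MvPolynomial.optionEquivLeft_X_some]
  simp only [eval₂_map, hc]
  rfl

lemma hasRt_los {I : Type} {U : Ultrafilter I} (F : I → Type) [∀ i, Field (F i)] (x : ∀ i, σ → F i)
    (f : (MvPolynomial σ ℤ)[X]) :
    HasRt (fun s => (UP.mk fun i => x i s : UP U F)) f ↔ ∀ᶠ i in (U : Filter I), HasRt (x i) f := by
  let η : MvPolynomial σ ℤ →+* (∀ i, F i) :=
    RingHom.pi fun i => (MvPolynomial.aeval (x i) : MvPolynomial σ ℤ →ₐ[ℤ] F i).toRingHom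
  have h1 : (MvPolynomial.aeval (fun s => (UP.mk fun i => x i s : UP U F)) :
      MvPolynomial σ ℤ →ₐ[ℤ] UP U F).toRingHom = UP.mk.comp η := by
    refine MvPolynomial.ringHom_ext (fun r => ?_) (fun o => ?_)
    · simp
    · simp only [AlgHom.toRingHom_eq_coe, RingHom.coe_coe, MvPolynomial.aeval_X, RingHom.comp_apply]
      congr 1
      funext i
      simp [η]
  have h2 : ∀ z : ∀ i, F i, f.eval₂ (UP.mk.comp η) (UP.mk z : UP U F) =
      UP.mk fun i => f.eval₂ (MvPolynomial.aeval (x i) : MvPolynomial σ ℤ →ₐ[ℤ] F i).toRingHom (z i) := by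
    intro z
    rw [← hom_eval₂]
    congr 1
    funext i
    exact hom_eval₂ f η (Pi.evalRingHom F i) z
  unfold HasRt
  rw [h1]
  constructor
  · rintro ⟨z, hz⟩
    obtain ⟨z, rfl⟩ := UP.mk_surj z
    rw [h2, UP.mk_eq_zero] at hz
    filter_upwards [hz] with i hi using ⟨z i, hi⟩
  · intro h
    have : ∀ i, ∃ z : F i, HasRt (x i) f →
        f.eval₂ (MvPolynomial.aeval (x i) : MvPolynomial σ ℤ →ₐ[ℤ] F i).toRingHom z = 0 := by
      intro i
      by_cases hi : HasRt (x i) f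
      · obtain ⟨z, hz⟩ := hi
        exact ⟨z, fun _ => hz⟩
      · exact ⟨0, fun h => absurd h hi⟩
    choose z hz using this
    refine ⟨UP.mk z, ?_⟩
    rw [h2, UP.mk_eq_zero]
    filter_upwards [h] with i hi using hz i hi

lemma ult_iff {I : Type} {U : Ultrafilter I} {p q : I → Prop}
    (h : (∀ᶠ i in (U : Filter I), p i) ↔ ∀ᶠ i in (U : Filter I), q i) :
    ∀ᶠ i in (U : Filter I), (p i ↔ q i) := by
  by_cases hp : ∀ᶠ i in (U : Filter I), p i
  · filter_upwards [hp, h.1 hp] with i h1 h2 using iff_of_true h1 h2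
  · have hq := fun hq => hp (h.2 hq)
    rw [← Ultrafilter.eventually_not] at hp
    have hq' := Ultrafilter.eventually_not.2 hq
    filter_upwards [hp, hq'] with i h1 h2 using iff_of_false h1 h2

/-- Quantifier elimination. -/
theorem DeltaDef.ex {X : (F : FF) → (Option σ → F) → Prop} (hX : DeltaDef X) :
    DeltaDef (fun F (x : σ → F) => ∃ b : F, X F (fun o => o.elim b x)) := by
  classical
  obtain ⟨q0, S, hS⟩ := hX
  by_contra hcon
  have key : ∀ i : ℕ × Finset (MvPolynomial σ ℤ)[X], ∃ (F F' : FF) (x : σ → F) (x' : σ → F'),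
      i.1 ≤ Fintype.card F ∧ i.1 ≤ Fintype.card F' ∧ (∀ f ∈ i.2, HasRt x f ↔ HasRt x' f) ∧
      (∃ b : F, X F (fun o => o.elim b x)) ∧ ¬ (∃ b : F', X F' (fun o => o.elim b x')) := by
    intro i
    by_contra hi
    push Not at hi
    refine hcon ⟨i.1, i.2, fun F F' x x' h1 h2 h3 => ⟨fun h => ?_, fun h => ?_⟩⟩
    · exact hi F F' x x' h1 h2 h3 h
    · exact hi F' F x' x h2 h1 (fun f hf => (h3 f hf).symm) h
  choose F F' x x' hF hF' hT hb hno using key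
  choose b hb using hb
  let U : Ultrafilter (ℕ × Finset (MvPolynomial σ ℤ)[X]) := Ultrafilter.of Filter.atTop
  have hU : (U : Filter (ℕ × Finset (MvPolynomial σ ℤ)[X])) ≤ Filter.atTop := Ultrafilter.of_le _
  have hcardF' : ∀ N, ∀ᶠ i in (U : Filter _), N ≤ Fintype.card (F' i) := fun N =>
    hU ((Filter.eventually_ge_atTop ((N, ∅) : ℕ × Finset (MvPolynomial σ ℤ)[X])).mono
      fun i hi => (hi.1 : N ≤ i.1).trans (hF' i))
  have hcardF : ∀ N, ∀ᶠ i in (U : Filter _), N ≤ Fintype.card (F i) := fun N =>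
    hU ((Filter.eventually_ge_atTop ((N, ∅) : ℕ × Finset (MvPolynomial σ ℤ)[X])).mono
      fun i hi => (hi.1 : N ≤ i.1).trans (hF i))
  have hag : ∀ f, ∀ᶠ i in (U : Filter _), (HasRt (x i) f ↔ HasRt (x' i) f) := fun f =>
    hU ((Filter.eventually_ge_atTop ((0, {f}) : ℕ × Finset (MvPolynomial σ ℤ)[X])).mono
      fun i hi => hT i f ((hi.2 : {f} ⊆ i.2) (Finset.mem_singleton_self f)))
  let K := fun i => (F i).carrier
  let K' := fun i => (F' i).carrier
  let xU : σ → UP U K := fun s => UP.mk fun i => x i s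
  let xU' : σ → UP U K' := fun s => UP.mk fun i => x' i s
  have hroot : ∀ f, HasRt xU f ↔ HasRt xU' f := by
    intro f
    rw [hasRt_los K x f, hasRt_los K' x' f]
    exact Filter.eventually_congr (hag f)
  obtain ⟨bb, hbb⟩ := qeUP (U := U) K K' hcardF' (MvPolynomial.aeval xU).toRingHom
    (MvPolynomial.aeval xU').toRingHom hroot (UP.mk b)
    (S.image fun f => f.map ((MvPolynomial.optionEquivLeft ℤ σ : MvPolynomial (Option σ) ℤ →+* (MvPolynomial σ ℤ)[X])))
  obtain ⟨b', rfl⟩ := UP.mk_surj bb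
  have hfin : ∀ f ∈ S, ∀ᶠ i in (U : Filter _),
      (HasRt (fun o : Option σ => o.elim (b i) (x i)) f ↔ HasRt (fun o : Option σ => o.elim (b' i) (x' i)) f) := by
    intro f hf
    apply ult_iff
    have e1 := hasRt_los (U := U) K (fun i (o : Option σ) => o.elim (b i) (x i)) f
    have e2 := hasRt_los (U := U) K' (fun i (o : Option σ) => o.elim (b' i) (x' i)) f
    rw [← e1, ← e2]
    have t1 : (fun o : Option σ => (UP.mk fun i => o.elim (b i) (x i) : UP U K)) =
        fun o => o.elim (UP.mk b) xU := by
      funext o; cases o <;> rfl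
    have t2 : (fun o : Option σ => (UP.mk fun i => o.elim (b' i) (x' i) : UP U K')) =
        fun o => o.elim (UP.mk b') xU' := by
      funext o; cases o <;> rfl
    rw [t1, t2, hasRt_option, hasRt_option]
    exact hbb _ (Finset.mem_image_of_mem _ hf)
  have hall := (Filter.eventually_all_finset S).2 hfin
  obtain ⟨i, hi, h1, h2⟩ := (hall.and ((hcardF q0).and (hcardF' q0))).exists
  exact hno i ⟨b' i, (hS _ _ _ _ h1 h2 hi).1 (hb i)⟩

lemma DeltaDef.not {X : (F : FF) → (σ → F) → Prop} (hX : DeltaDef X) :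
    DeltaDef (fun F x => ¬ X F x) := by
  obtain ⟨q, S, h⟩ := hX
  exact ⟨q, S, fun F F' x x' h1 h2 h3 => not_congr (h F F' x x' h1 h2 h3)⟩

lemma DeltaDef.imp {X Y : (F : FF) → (σ → F) → Prop} (hX : DeltaDef X) (hY : DeltaDef Y) :
    DeltaDef (fun F x => X F x → Y F x) := by
  classical
  obtain ⟨q, S, h⟩ := hX
  obtain ⟨q', S', h'⟩ := hY
  refine ⟨max q q', S ∪ S', fun F F' x x' h1 h2 h3 => imp_congr ?_ ?_⟩
  · exact h F F' x x' (le_of_max_le_left h1) (le_of_max_le_left h2)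
      fun f hf => h3 f (Finset.mem_union_left _ hf)
  · exact h' F F' x x' (le_of_max_le_right h1) (le_of_max_le_right h2)
      fun f hf => h3 f (Finset.mem_union_right _ hf)

lemma DeltaDef.reindex {X : (F : FF) → (τ → F) → Prop} (hX : DeltaDef X) (e : τ → σ) :
    DeltaDef (fun F x => X F (x ∘ e)) := by
  classical
  obtain ⟨q, S, h⟩ := hX
  refine ⟨q, S.image fun f => f.map (MvPolynomial.rename e : _ →ₐ[ℤ] _).toRingHom,
    fun F F' x x' h1 h2 h3 => h F F' _ _ h1 h2 fun f hf => ?_⟩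
  have := h3 _ (Finset.mem_image_of_mem _ hf)
  have hc : ∀ {K : Type} [Field K] (x : σ → K),
      (MvPolynomial.aeval x : _ →ₐ[ℤ] K).toRingHom.comp (MvPolynomial.rename e : _ →ₐ[ℤ] _).toRingHom =
        (MvPolynomial.aeval (x ∘ e) : _ →ₐ[ℤ] K).toRingHom := by
    intro K _ x
    refine MvPolynomial.ringHom_ext (fun r => ?_) (fun o => ?_) <;> simp
  unfold HasRt at this ⊢
  simpa only [eval₂_map, hc] using this

lemma DeltaDef.eqn (P : MvPolynomial σ ℤ) : DeltaDef (fun F x => MvPolynomial.aeval x P = (0 : F)) := by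
  refine ⟨0, {C P}, fun F F' x x' _ _ h => ?_⟩
  have := h (C P) (Finset.mem_singleton_self _)
  simpa [HasRt] using this

end qesec

section glue
open FirstOrder

lemma term_pol {α : Type} (t : Language.ring.Term α) : ∃ P : MvPolynomial α ℤ, ∀ (F : FF) (x : α → F),
    (letI := Ring.compatibleRingOfRing F; t.realize x) = MvPolynomial.aeval x P := by
  induction t with
  | var a => exact ⟨MvPolynomial.X a, fun F x => by simp⟩
  | @func l f ts ih =>
    choose P hP using ih
    cases f with
    | add =>
      refine ⟨P 0 + P 1, fun F x => ?_⟩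
      rw [map_add, ← hP, ← hP]; rfl
    | mul =>
      refine ⟨P 0 * P 1, fun F x => ?_⟩
      rw [map_mul, ← hP, ← hP]; rfl
    | neg =>
      refine ⟨- P 0, fun F x => ?_⟩
      rw [map_neg, ← hP]; rfl
    | zero => exact ⟨0, fun F x => by rw [map_zero]; rfl⟩
    | one => exact ⟨1, fun F x => by rw [map_one]; rfl⟩

lemma formula_delta {k n : ℕ} (φ : Language.ring.BoundedFormula (Fin k) n) :
    DeltaDef (σ := Fin k ⊕ Fin n) (fun F z => letI := Ring.compatibleRingOfRing F;
      φ.Realize (z ∘ Sum.inl) (z ∘ Sum.inr)) := by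
  induction φ with
  | falsum => exact ⟨0, ∅, fun F F' x x' _ _ _ => Iff.rfl⟩
  | equal t₁ t₂ =>
    obtain ⟨P, hP⟩ := term_pol t₁
    obtain ⟨Q, hQ⟩ := term_pol t₂
    have h := DeltaDef.eqn (P - Q)
    convert h using 3 with F x
    rw [map_sub, sub_eq_zero, ← hP, ← hQ]
    simp only [Language.BoundedFormula.Realize, Sum.elim_comp_inl_inr]
  | rel R => exact R.elim
  | imp f g hf hg => exact hf.imp hg
  | @all n f ih =>
    have h := ((ih.reindex (σ := Option (Fin k ⊕ Fin n)) (Sum.elim (fun a => some (Sum.inl a))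
      (Fin.snoc (α := fun _ => Option (Fin k ⊕ Fin n)) (fun a => some (Sum.inr a)) none))).not.ex).not
    convert h using 3 with F x
    simp only [Language.BoundedFormula.Realize, not_exists, not_not]
    refine forall_congr' fun a => ?_
    apply iff_of_eq
    congr 1
    funext j
    refine Fin.lastCases ?_ (fun j => ?_) j
    · simp
    · simp

end glue

end PRU
end

end

open FirstOrder PowerSeries

/-- Uniformity in `p`: the Poincaré series of a ring-language formula `φ` over the fields
`GaloisField p m` is rational, with numerator and denominator degrees bounded
independently of the prime `p`. -/
theorem poincare_series_rational_uniform (k : ℕ) (φ : Language.ring.Formula (Fin k)) :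
    ∃ B : ℕ, ∀ (p : ℕ) [Fact p.Prime],
      ∃ a b : Polynomial ℚ, b ≠ 0 ∧ a.natDegree ≤ B ∧ b.natDegree ≤ B ∧
        (b : PowerSeries ℚ) *
          PowerSeries.mk (fun m => if m = 0 then 0 else
            (ringFormulaCount φ (GaloisField p m) : ℚ)) = (a : PowerSeries ℚ) := by
  have h := PRU.DeltaDef.reindex (PRU.formula_delta φ) (Sum.elim id Fin.elim0 : Fin k ⊕ Fin 0 → Fin k)
  obtain ⟨B, hB⟩ := PRU.delta_rec h
  refine ⟨B + 1, fun p hp => ?_⟩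
  refine (hB p).congr_of_lt fun m hm => ?_
  rw [if_neg (by omega)]
  congr 1
  unfold ringFormulaCount
  refine Nat.card_congr (Equiv.subtypeEquivRight fun x => ?_)
  unfold Language.Formula.Realize
  apply iff_of_eq
  congr 1
  exact Subsingleton.elim _ _
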